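/- Fix A ≥ 1, 0 ≤ α < β ≤ 1 and δ > 0. There exists x₀ such that for every x ≥ x₀ and every positive integer B₀ the following holds: there exist real numbers A′ and c′ with 1 ≤ c′ ≤ 5 and |A′ − c′A| ≤ δA, and a probability distribution μ on the finite set V × W, where V := ∏_{s ∈ 𝒮} ℤ/sℤ and W := ∏_{p ∈ 𝒫} ℤ/pℤ, such that with μ-probability at least 1 − δ the pair (a, n) = ((a_s)_{s∈𝒮}, (n_p)_{p∈𝒫}) satisfies |#(𝒬 ∩ S(a) ∩ S(n) ∩ (αy, βy]) − A′(β−α)·x/log x| ≤ δ·A′·(β−α)·x/log x. -/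

import Mathlib

namespace RandomSieve

section PrimeNumberTheorem
open Real Finset MeasureTheory Filter Topology Asymptotics

/-- The triangle function `max (T - |t|) 0`. -/
noncomputable def triangle (T t : ℝ) : ℝ := max (T - |t|) 0

lemma triangle_continuous (T : ℝ) : Continuous (triangle T) := by
  unfold triangle; fun_prop

lemma triangle_nonneg (T t : ℝ) : 0 ≤ triangle T t := le_max_right _ _

lemma triangle_eq_zero {T t : ℝ} (h : T ≤ |t|) : triangle T t = 0 :=
  max_eq_right (by linarith)

lemma triangle_hasCompactSupport (T : ℝ) : HasCompactSupport (triangle T) := by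
  refine HasCompactSupport.intro (isCompact_Icc (a := -T) (b := T)) fun t ht => ?_
  refine triangle_eq_zero ?_
  by_contra! h
  rw [abs_lt] at h
  exact ht ⟨h.1.le, h.2.le⟩

lemma triangle_integrable (T : ℝ) : Integrable (triangle T) :=
  (triangle_continuous T).integrable_of_hasCompactSupport (triangle_hasCompactSupport T)

/-- The Fejér kernel. -/
noncomputable def fejer (T w : ℝ) : ℝ := if w = 0 then T ^ 2 else 2 * (1 - cos (T * w)) / w ^ 2

lemma fejer_nonneg (T w : ℝ) : 0 ≤ fejer T w := by
  unfold fejer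
  split_ifs
  · positivity
  · have := cos_le_one (T * w)
    exact div_nonneg (by linarith) (by positivity)

lemma fejer_le {T w : ℝ} (hw : w ≠ 0) : fejer T w ≤ 4 / w ^ 2 := by
  rw [fejer, if_neg hw]
  have := neg_one_le_cos (T * w)
  gcongr; linarith

lemma fejer_le_sq (T w : ℝ) : fejer T w ≤ T ^ 2 := by
  unfold fejer
  split_ifs with hw
  · exact le_rfl
  · rw [div_le_iff₀ (by positivity)]
    have := one_sub_sq_div_two_le_cos (x := T * w)
    nlinarith

lemma le_fejer {T w : ℝ} (hT : 0 < T) (hw : |w| ≤ 1 / T) : 2 / 5 * T ^ 2 ≤ fejer T w := by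
  unfold fejer
  split_ifs with h0
  · nlinarith [sq_nonneg T]
  · have hw2 : 0 < w ^ 2 := by positivity
    rw [le_div_iff₀ hw2]
    have h1 : |T * w| ≤ 1 := by
      rw [abs_mul, abs_of_pos hT]
      calc T * |w| ≤ T * (1 / T) := by gcongr
        _ = 1 := by field_simp
    have h2 := cos_le_one_sub_mul_cos_sq (x := T * w) (h1.trans (by linarith [pi_gt_three]))
    have h3 : (1 / 5 : ℝ) ≤ 2 / π ^ 2 := by
      rw [div_le_div_iff₀ (by norm_num) (by positivity)]
      nlinarith [pi_lt_d2, pi_pos]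
    nlinarith [mul_le_mul_of_nonneg_right h3 (sq_nonneg (T * w))]

lemma integral_triangle_exp_half (T w : ℝ) (hw : w ≠ 0) :
    ∫ t in (0 : ℝ)..T, ((T - t : ℝ) : ℂ) * Complex.exp (Complex.I * t * w)
      = Complex.exp (Complex.I * T * w) / (Complex.I * w) ^ 2 - T / (Complex.I * w)
        - 1 / (Complex.I * w) ^ 2 := by
  have hw' : (w : ℂ) ≠ 0 := by exact_mod_cast hw
  have hIw : Complex.I * (w : ℂ) ≠ 0 := mul_ne_zero Complex.I_ne_zero (by exact_mod_cast hw)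
  have hd : ∀ t : ℝ, HasDerivAt (fun t : ℝ => ((T - t : ℝ) : ℂ) * Complex.exp (Complex.I * t * w)
      / (Complex.I * w) + Complex.exp (Complex.I * t * w) / (Complex.I * w) ^ 2)
      (((T - t : ℝ) : ℂ) * Complex.exp (Complex.I * t * w)) t := fun t => by
    have h1 : HasDerivAt (fun t : ℝ => Complex.exp (Complex.I * t * w))
        (Complex.exp (Complex.I * t * w) * (Complex.I * w)) t := by
      have : HasDerivAt (fun t : ℝ => Complex.I * (t : ℂ) * w) (Complex.I * w) t := by
        simpa using ((Complex.ofRealCLM.hasDerivAt (x := t)).const_mul Complex.I).mul_const (w : ℂ)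
      exact this.cexp
    have h2 : HasDerivAt (fun t : ℝ => ((T - t : ℝ) : ℂ)) (-1) t := by
      simpa using ((hasDerivAt_id t).const_sub T).ofReal_comp
    have h3 := ((h2.mul h1).div_const (Complex.I * w)).add (h1.div_const ((Complex.I * w) ^ 2))
    refine h3.congr_deriv ?_
    field_simp; ring
  rw [intervalIntegral.integral_eq_sub_of_hasDerivAt (fun t _ => hd t)
    (Continuous.intervalIntegrable (by fun_prop) _ _)]
  simp only [sub_self, Complex.ofReal_zero, sub_zero]
  simp
  ring

lemma integral_triangle_exp {T : ℝ} (hT : 0 < T) (w : ℝ) :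
    ∫ t : ℝ, (triangle T t : ℂ) * Complex.exp (Complex.I * t * w) = fejer T w := by
  have h0 : ∫ t : ℝ, (triangle T t : ℂ) * Complex.exp (Complex.I * t * w)
      = ∫ t in (-T)..T, (triangle T t : ℂ) * Complex.exp (Complex.I * t * w) := by
    rw [intervalIntegral.integral_of_le (by linarith)]
    symm
    refine setIntegral_eq_integral_of_forall_compl_eq_zero fun t ht => ?_
    rw [triangle_eq_zero, Complex.ofReal_zero, zero_mul]
    by_contra! h
    rw [abs_lt] at h
    exact ht ⟨h.1, h.2.le⟩
  have hc : Continuous fun t : ℝ => (triangle T t : ℂ) * Complex.exp (Complex.I * t * w) := by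
    have := triangle_continuous T
    fun_prop
  have h1 : ∫ t in (0 : ℝ)..T, (triangle T t : ℂ) * Complex.exp (Complex.I * t * w)
      = ∫ t in (0 : ℝ)..T, ((T - t : ℝ) : ℂ) * Complex.exp (Complex.I * t * w) := by
    refine intervalIntegral.integral_congr fun t ht => ?_
    rw [Set.uIcc_of_le hT.le] at ht
    simp only [triangle]
    rw [abs_of_nonneg ht.1, max_eq_left (by linarith [ht.2])]
  have h2 : ∫ t in (-T)..0, (triangle T t : ℂ) * Complex.exp (Complex.I * t * w)
      = ∫ t in (0 : ℝ)..T, ((T - t : ℝ) : ℂ) * Complex.exp (Complex.I * t * (-w : ℝ)) := by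
    have := intervalIntegral.integral_comp_neg (a := 0) (b := T)
      (fun t : ℝ => (triangle T t : ℂ) * Complex.exp (Complex.I * t * w))
    rw [neg_zero] at this
    rw [← this]
    refine intervalIntegral.integral_congr fun t ht => ?_
    rw [Set.uIcc_of_le hT.le] at ht
    simp only [triangle]
    rw [abs_neg, abs_of_nonneg ht.1, max_eq_left (by linarith [ht.2])]
    congr 2
    push_cast; ring
  rw [h0, ← intervalIntegral.integral_add_adjacent_intervals (b := 0)
    (hc.intervalIntegrable _ _) (hc.intervalIntegrable _ _), h1, h2]
  rcases eq_or_ne w 0 with rfl | hw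
  · simp only [neg_zero, Complex.ofReal_zero, mul_zero, Complex.exp_zero, mul_one]
    rw [intervalIntegral.integral_ofReal]
    have : ∫ x in (0:ℝ)..T, (T - x) = T ^ 2 / 2 := by
      rw [intervalIntegral.integral_sub (by simp) (by simp), integral_id,
        intervalIntegral.integral_const, smul_eq_mul]; ring
    rw [this, fejer, if_pos rfl]; push_cast; ring
  · rw [integral_triangle_exp_half T w hw, integral_triangle_exp_half T (-w) (neg_ne_zero.mpr hw),
      fejer, if_neg hw]
    have e1 : Complex.exp (Complex.I * T * w) + Complex.exp (Complex.I * T * (-w : ℝ))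
        = 2 * Complex.cos (T * w) := by
      rw [Complex.cos]
      have : Complex.I * T * (-w : ℝ) = -(T * w) * Complex.I := by push_cast; ring
      rw [this]
      have : Complex.I * T * w = (T * w) * Complex.I := by ring
      rw [this]; ring
    have hw' : (w : ℂ) ≠ 0 := by exact_mod_cast hw
    have e2 : (Complex.I * (w : ℂ)) ^ 2 = -(w : ℂ) ^ 2 := by rw [mul_pow, Complex.I_sq]; ring
    have e3 : (Complex.I * ((-w : ℝ) : ℂ)) ^ 2 = -(w : ℂ) ^ 2 := by
      rw [mul_pow, Complex.I_sq]; push_cast; ring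
    rw [e2, e3]
    have e4 : (T : ℂ) / (Complex.I * ((-w : ℝ) : ℂ)) = - (T / (Complex.I * w)) := by
      push_cast; rw [mul_neg, div_neg]
    rw [e4]
    push_cast
    calc _ = (Complex.exp (Complex.I * T * w) + Complex.exp (Complex.I * T * (-w : ℝ))) / (-(w:ℂ)^2)
          + 2 / (w : ℂ) ^ 2 := by push_cast; ring
      _ = _ := by rw [e1]; ring

lemma fejer_integrable {T : ℝ} (_hT : 0 < T) : Integrable (fejer T) := by
  have hm : AEStronglyMeasurable (fejer T) := by
    have : Measurable (fejer T) := by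
      unfold fejer
      refine Measurable.ite (measurableSet_singleton 0) measurable_const (by fun_prop)
    exact this.aestronglyMeasurable
  have hb : Integrable (fun w : ℝ => (T ^ 2 + 4) * 2 * (1 + w ^ 2)⁻¹) :=
    integrable_inv_one_add_sq.const_mul _
  refine hb.mono' hm (Eventually.of_forall fun w => ?_)
  rw [norm_eq_abs, abs_of_nonneg (fejer_nonneg T w), ← div_eq_mul_inv, le_div_iff₀ (by positivity)]
  have h1 := fejer_le_sq T w
  have h2 : fejer T w * w ^ 2 ≤ 4 := by
    rcases eq_or_ne w 0 with rfl | hw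
    · simp
    · have := fejer_le (T := T) hw
      rwa [le_div_iff₀ (by positivity)] at this
  nlinarith [fejer_nonneg T w]

lemma fejer_measurable (T : ℝ) : Measurable (fejer T) := by
  unfold fejer
  exact Measurable.ite (measurableSet_singleton 0) measurable_const (by fun_prop)

section WienerIkehara

variable {h : ℝ → ℝ} {M : ℝ} {G : ℂ → ℂ}

lemma integral_mul_fejer_eq (hm : Measurable h) (hM : ∀ u, |h u| ≤ M)
    (hG : ∀ s : ℂ, 0 < s.re → ∫ u in Set.Ioi (0 : ℝ), (h u : ℂ) * Complex.exp (-(s * u)) = G s)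
    {T : ℝ} (hT : 0 < T) (v : ℝ) {ε : ℝ} (hε : 0 < ε) :
    ((∫ u in Set.Ioi (0 : ℝ), h u * exp (-(ε * u)) * fejer T (v - u) : ℝ) : ℂ)
      = ∫ t : ℝ, (triangle T t : ℂ) * Complex.exp (Complex.I * t * v) * G (ε + Complex.I * t) := by
  have h1 : ((∫ u in Set.Ioi (0 : ℝ), h u * exp (-(ε * u)) * fejer T (v - u) : ℝ) : ℂ)
      = ∫ u in Set.Ioi (0 : ℝ), ∫ t : ℝ, (h u : ℂ) * Complex.exp (-(ε * u)) *
          ((triangle T t : ℂ) * Complex.exp (Complex.I * t * (v - u : ℝ))) := by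
    rw [← integral_complex_ofReal]
    refine integral_congr_ae (Eventually.of_forall fun u => ?_)
    simp only
    rw [integral_const_mul, integral_triangle_exp hT]
    push_cast; ring
  rw [h1, integral_integral_swap]
  · refine integral_congr_ae (Eventually.of_forall fun t => ?_)
    simp only
    rw [← hG _ (by simpa using hε), ← integral_const_mul]
    refine integral_congr_ae (Eventually.of_forall fun u => ?_)
    simp only
    have : Complex.exp (-((ε + Complex.I * t) * u)) * Complex.exp (Complex.I * t * v)
        = Complex.exp (-(ε * u)) * Complex.exp (Complex.I * t * (v - u : ℝ)) := by
      rw [← Complex.exp_add, ← Complex.exp_add]; congr 1; push_cast; ring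
    linear_combination (-(h u : ℂ) * (triangle T t)) * this
  · have hi1 : Integrable (fun u : ℝ => M * exp (-(ε * u))) (volume.restrict (Set.Ioi 0)) := by
      have := (integrableOn_exp_mul_Ioi (a := -ε) (by linarith) 0).const_mul M
      refine this.congr (Eventually.of_forall fun u => by simp)
    have hi := hi1.mul_prod (triangle_integrable T)
    refine hi.mono' ?_ (Eventually.of_forall fun p => ?_)
    · have := triangle_continuous T
      refine Measurable.aestronglyMeasurable ?_
      have hm' : Measurable fun p : ℝ × ℝ => ((h p.1 : ℝ) : ℂ) :=
        Complex.measurable_ofReal.comp (hm.comp measurable_fst)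
      have hc : Continuous fun p : ℝ × ℝ => Complex.exp (-(ε * p.1)) *
          ((triangle T p.2 : ℂ) * Complex.exp (Complex.I * p.2 * (v - p.1 : ℝ))) := by fun_prop
      convert hm'.mul hc.measurable using 1
      ext p; simp [Function.uncurry, mul_assoc]
    · simp only [Function.uncurry]
      have e1 : ‖Complex.exp (Complex.I * p.2 * (v - p.1 : ℝ))‖ = 1 := by
        rw [show Complex.I * p.2 * ((v - p.1 : ℝ) : ℂ) = ((p.2 * (v - p.1) : ℝ) : ℂ) * Complex.I by
          push_cast; ring]
        exact Complex.norm_exp_ofReal_mul_I _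
      have e2 : ‖Complex.exp (-(ε * p.1 : ℂ))‖ = exp (-(ε * p.1)) := by
        rw [Complex.norm_exp]; simp
      rw [norm_mul, norm_mul, norm_mul, e1, e2, mul_one, Complex.norm_real, Complex.norm_real,
        norm_eq_abs, norm_eq_abs, abs_of_nonneg (triangle_nonneg T p.2)]
      gcongr
      · exact triangle_nonneg _ _
      · exact hM _

lemma integral_mul_fejer_eq_boundary (hm : Measurable h) (hM : ∀ u, |h u| ≤ M)
    (hG : ∀ s : ℂ, 0 < s.re → ∫ u in Set.Ioi (0 : ℝ), (h u : ℂ) * Complex.exp (-(s * u)) = G s)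
    (hc : ContinuousOn G {s | 0 ≤ s.re}) {T : ℝ} (hT : 0 < T) (v : ℝ) :
    ((∫ u in Set.Ioi (0 : ℝ), h u * fejer T (v - u) : ℝ) : ℂ)
      = ∫ t : ℝ, (triangle T t : ℂ) * Complex.exp (Complex.I * t * v) * G (Complex.I * t) := by
  have hMn : 0 ≤ M := (abs_nonneg _).trans (hM 0)
  have hseq : Tendsto (fun n : ℕ => 1 / ((n : ℝ) + 1)) atTop (𝓝 0) :=
    tendsto_one_div_add_atTop_nhds_zero_nat
  have hpos : ∀ n : ℕ, 0 < 1 / ((n : ℝ) + 1) := fun n => by positivity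
  have L : Tendsto (fun n : ℕ => ∫ u in Set.Ioi (0 : ℝ),
      h u * exp (-(1 / ((n : ℝ) + 1) * u)) * fejer T (v - u)) atTop
      (𝓝 (∫ u in Set.Ioi (0 : ℝ), h u * fejer T (v - u))) := by
    have hfi : Integrable (fun u => fejer T (v - u)) := (fejer_integrable hT).comp_sub_left v
    refine tendsto_integral_of_dominated_convergence (fun u => M * fejer T (v - u)) (fun n => ?_)
      (hfi.const_mul M).integrableOn (fun n => ?_) ?_
    · refine Measurable.aestronglyMeasurable ?_
      have := fejer_measurable T
      exact (hm.mul (by fun_prop)).mul (this.comp (by fun_prop))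
    · refine (ae_restrict_iff' measurableSet_Ioi).mpr (Eventually.of_forall fun u hu => ?_)
      rw [norm_mul, norm_mul, norm_eq_abs, norm_eq_abs, norm_eq_abs,
        abs_of_nonneg (fejer_nonneg _ _), abs_of_pos (exp_pos _)]
      have h1 : exp (-(1 / ((n : ℝ) + 1) * u)) ≤ 1 := by
        rw [exp_le_one_iff]
        have := mul_nonneg (hpos n).le (le_of_lt (Set.mem_Ioi.mp hu))
        linarith
      have := fejer_nonneg T (v - u)
      calc |h u| * exp (-(1 / ((n : ℝ) + 1) * u)) * fejer T (v - u)
          ≤ M * 1 * fejer T (v - u) := by gcongr; exact hM u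
        _ = _ := by ring
    · refine Eventually.of_forall fun u => ?_
      have : Tendsto (fun n : ℕ => h u * exp (-(1 / ((n : ℝ) + 1) * u)) * fejer T (v - u))
          atTop (𝓝 (h u * exp (-(0 * u)) * fejer T (v - u))) :=
        ((continuous_exp.tendsto _).comp ((hseq.mul_const u).neg)).const_mul (h u) |>.mul_const _
      simpa using this
  have Rr : Tendsto (fun n : ℕ => ∫ t : ℝ, (triangle T t : ℂ) * Complex.exp (Complex.I * t * v) *
      G ((1 / ((n : ℝ) + 1) : ℝ) + Complex.I * t)) atTop
      (𝓝 (∫ t : ℝ, (triangle T t : ℂ) * Complex.exp (Complex.I * t * v) * G (Complex.I * t))) := by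
    obtain ⟨K, hK⟩ : ∃ K, ∀ s ∈ (Set.Icc (0 : ℝ) 1 ×ℂ Set.Icc (-T) T), ‖G s‖ ≤ K := by
      have hcomp : IsCompact (Set.Icc (0 : ℝ) 1 ×ℂ Set.Icc (-T) T) :=
        isCompact_Icc.reProdIm isCompact_Icc
      refine hcomp.exists_bound_of_continuousOn (hc.mono fun s hs => ?_)
      exact (Complex.mem_reProdIm.mp hs).1.1
    refine tendsto_integral_of_dominated_convergence (fun t => triangle T t * K) (fun n => ?_)
      ((triangle_integrable T).mul_const K) (fun n => Eventually.of_forall fun t => ?_)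
      (Eventually.of_forall fun t => ?_)
    · have := triangle_continuous T
      refine Continuous.aestronglyMeasurable ?_
      refine Continuous.mul (by fun_prop) ?_
      refine hc.comp_continuous (by fun_prop) fun t => ?_
      have := (hpos n).le
      simp only [Set.mem_ofPred_eq, Complex.add_re, Complex.ofReal_re, Complex.mul_re, Complex.I_re,
        Complex.I_im, Complex.ofReal_im]
      linarith
    · rw [norm_mul, norm_mul, Complex.norm_real, norm_eq_abs,
        abs_of_nonneg (triangle_nonneg _ _)]
      have e1 : ‖Complex.exp (Complex.I * t * v)‖ = 1 := by
        rw [show Complex.I * t * (v : ℂ) = ((t * v : ℝ) : ℂ) * Complex.I by push_cast; ring]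
        exact Complex.norm_exp_ofReal_mul_I _
      rw [e1, mul_one]
      rcases le_or_gt T |t| with h0 | h0
      · rw [triangle_eq_zero h0]; simp
      · refine mul_le_mul_of_nonneg_left (hK _ ?_) (triangle_nonneg _ _)
        rw [abs_lt] at h0
        rw [Complex.mem_reProdIm]
        have : 1 / ((n : ℝ) + 1) ≤ 1 := by
          rw [div_le_one (by positivity)]; linarith [Nat.cast_nonneg (α := ℝ) n]
        have h3 := (hpos n).le
        simp only [Complex.add_re, Complex.ofReal_re, Complex.mul_re, Complex.I_re, Complex.I_im,
          Complex.ofReal_im, Complex.add_im, Complex.mul_im, Set.mem_Icc]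
        refine ⟨⟨by linarith, by linarith⟩, by linarith [h0.1], by linarith [h0.2]⟩
    · refine Tendsto.const_mul _ ?_
      have hcw : ContinuousWithinAt G {s | 0 ≤ s.re} (Complex.I * t) := hc _ (by simp)
      refine hcw.tendsto.comp (tendsto_nhdsWithin_iff.mpr ⟨?_, Eventually.of_forall fun n => ?_⟩)
      · have : Tendsto (fun n : ℕ => ((1 / ((n : ℝ) + 1) : ℝ) : ℂ) + Complex.I * t) atTop
            (𝓝 (((0 : ℝ) : ℂ) + Complex.I * t)) :=
          ((Complex.continuous_ofReal.tendsto _).comp hseq).add_const _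
        simpa using this
      · have := (hpos n).le
        simp only [Set.mem_ofPred_eq, Complex.add_re, Complex.ofReal_re, Complex.mul_re, Complex.I_re,
          Complex.I_im, Complex.ofReal_im]
        linarith
  have L' := (Complex.continuous_ofReal.tendsto _).comp L
  refine tendsto_nhds_unique L' (Rr.congr fun n => ?_)
  exact (integral_mul_fejer_eq hm hM hG hT v (hpos n)).symm

lemma tendsto_integral_mul_fejer (hm : Measurable h) (hM : ∀ u, |h u| ≤ M)
    (hG : ∀ s : ℂ, 0 < s.re → ∫ u in Set.Ioi (0 : ℝ), (h u : ℂ) * Complex.exp (-(s * u)) = G s)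
    (hc : ContinuousOn G {s | 0 ≤ s.re}) {T : ℝ} (hT : 0 < T) :
    Tendsto (fun v : ℝ => ∫ u in Set.Ioi (0 : ℝ), h u * fejer T (v - u)) atTop (𝓝 0) := by
  have h1 := (Real.tendsto_integral_exp_smul_cocompact
    (fun t : ℝ => (triangle T t : ℂ) * G (Complex.I * t))).mono_left atTop_le_cocompact
  have hs : Tendsto (fun v : ℝ => -(v / (2 * π))) atTop atBot :=
    tendsto_neg_atTop_atBot.comp (tendsto_id.atTop_div_const (by positivity))
  have h1 := ((Real.tendsto_integral_exp_smul_cocompact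
    (fun t : ℝ => (triangle T t : ℂ) * G (Complex.I * t))).mono_left atBot_le_cocompact).comp hs
  rw [← Complex.ofReal_zero] at h1
  have h2 : Tendsto (fun v : ℝ => ((∫ u in Set.Ioi (0 : ℝ), h u * fejer T (v - u) : ℝ) : ℂ)) atTop
      (𝓝 ((0 : ℝ) : ℂ)) := by
    refine h1.congr fun v => ?_
    rw [integral_mul_fejer_eq_boundary hm hM hG hc hT v]
    refine integral_congr_ae (Eventually.of_forall fun t => ?_)
    simp only [Circle.smul_def, fourierChar_apply, smul_eq_mul]
    have : (2 * π * -(t * -(v / (2 * π))) : ℝ) = t * v := by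
      have := pi_pos; field_simp
    rw [this]
    have : ((t * v : ℝ) : ℂ) * Complex.I = Complex.I * t * v := by push_cast; ring
    rw [this]; ring
  have h3 := (Complex.continuous_re.tendsto _).comp h2
  simpa [Function.comp_def] using h3

/-- A bounded function whose Laplace transform extends continuously to the imaginary axis cannot stay
above a positive constant on long intervals far out. -/
lemma eventually_exists_lt (hm : Measurable h) (hM : ∀ u, |h u| ≤ M)
    (hG : ∀ s : ℂ, 0 < s.re → ∫ u in Set.Ioi (0 : ℝ), (h u : ℂ) * Complex.exp (-(s * u)) = G s)
    (hc : ContinuousOn G {s | 0 ≤ s.re}) {lam r : ℝ} (hl : 0 < lam) (hr : 0 < r) :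
    ∀ᶠ v : ℝ in atTop, ∃ u ∈ Set.Icc (v - r) (v + r), h u < lam := by
  have hMn : 0 ≤ M := (abs_nonneg _).trans (hM 0)
  set K := 4 * M * (1 + 1 / r ^ 2) with hK
  have hK0 : 0 ≤ K := by positivity
  set T := (K * π + 1) / (4 / 5 * lam) + 1 / r with hT
  have hTr : 1 / r ≤ T := by
    have := pi_pos
    rw [hT]; have : 0 ≤ (K * π + 1) / (4 / 5 * lam) := by positivity
    linarith
  have hT0 : 0 < T := lt_of_lt_of_le (by positivity) hTr
  have hTr' : 1 / T ≤ r := by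
    rw [div_le_iff₀ hT0]; rw [div_le_iff₀ hr] at hTr; linarith
  have hTl : K * π + 1 ≤ 4 / 5 * lam * T := by
    have : (K * π + 1) / (4 / 5 * lam) ≤ T := by
      rw [hT]; have : 0 < 1 / r := by positivity
      linarith
    rw [div_le_iff₀ (by positivity)] at this
    linarith
  have ev := (tendsto_integral_mul_fejer hm hM hG hc hT0).eventually_lt_const (zero_lt_one)
  filter_upwards [ev, eventually_gt_atTop (1 / T)] with v hv hvT
  by_contra! hcon
  have hfi : Integrable (fun u => fejer T (v - u)) := (fejer_integrable hT0).comp_sub_left v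
  have hci : Integrable (fun u : ℝ => (1 + (v - u) ^ 2)⁻¹) :=
    (integrable_inv_one_add_sq).comp_sub_left v
  have hint : Integrable (fun u => h u * fejer T (v - u)) :=
    hfi.bdd_mul (c := M) hm.aestronglyMeasurable (Eventually.of_forall fun u => hM u)
  have hind : Integrable ((Set.Icc (v - 1 / T) (v + 1 / T)).indicator
      fun _ : ℝ => lam * (2 / 5 * T ^ 2)) :=
    (integrable_indicator_iff measurableSet_Icc).mpr
      (integrableOn_const (by simp [volume_Icc]))
  have key : ∀ u : ℝ, (Set.Icc (v - 1 / T) (v + 1 / T)).indicator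
      (fun _ : ℝ => lam * (2 / 5 * T ^ 2)) u - K * (1 + (v - u) ^ 2)⁻¹ ≤ h u * fejer T (v - u) := by
    intro u
    have hf := fejer_nonneg T (v - u)
    have hcK : 0 ≤ K * (1 + (v - u) ^ 2)⁻¹ := by positivity
    by_cases h1 : u ∈ Set.Icc (v - 1 / T) (v + 1 / T)
    · rw [Set.indicator_of_mem h1]
      have h2 := hcon u ⟨by linarith [h1.1], by linarith [h1.2]⟩
      have h3 : 2 / 5 * T ^ 2 ≤ fejer T (v - u) :=
        le_fejer hT0 (abs_le.mpr ⟨by linarith [h1.2], by linarith [h1.1]⟩)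
      have : lam * (2 / 5 * T ^ 2) ≤ h u * fejer T (v - u) :=
        mul_le_mul h2 h3 (by positivity) (hl.le.trans h2)
      linarith
    · rw [Set.indicator_of_notMem h1]
      by_cases h2 : u ∈ Set.Icc (v - r) (v + r)
      · have := mul_nonneg (hl.le.trans (hcon u h2)) hf
        linarith
      · have h3 : r ^ 2 ≤ (v - u) ^ 2 := by
          rw [sq_le_sq, abs_of_pos hr]
          by_contra! h4
          rw [abs_lt] at h4
          exact h2 ⟨by linarith [h4.2], by linarith [h4.1]⟩
        have hw0 : v - u ≠ 0 := fun h0 => by rw [h0] at h3; nlinarith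
        have h4 := fejer_le (T := T) hw0
        have h5 : 4 / (v - u) ^ 2 ≤ 4 * (1 + 1 / r ^ 2) * (1 + (v - u) ^ 2)⁻¹ := by
          rw [← div_eq_mul_inv, div_le_div_iff₀ (by positivity) (by positivity)]
          have : (1 : ℝ) ≤ 1 / r ^ 2 * (v - u) ^ 2 := by
            rw [one_div_mul_eq_div, le_div_iff₀ (by positivity)]; linarith
          nlinarith
        have h6 := (abs_le.mp (hM u)).1
        have : M * fejer T (v - u) ≤ K * (1 + (v - u) ^ 2)⁻¹ := by
          calc _ ≤ M * (4 * (1 + 1 / r ^ 2) * (1 + (v - u) ^ 2)⁻¹) := by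
                gcongr; exact h4.trans h5
            _ = _ := by rw [hK]; ring
        nlinarith
  have hmono := setIntegral_mono (s := Set.Ioi 0) (hind.integrableOn.sub
    (hci.const_mul K).integrableOn) hint.integrableOn key
  rw [integral_sub' hind.integrableOn (hci.const_mul K).integrableOn, integral_const_mul] at hmono
  have e1 : ∫ u in Set.Ioi (0 : ℝ), (Set.Icc (v - 1 / T) (v + 1 / T)).indicator
      (fun _ : ℝ => lam * (2 / 5 * T ^ 2)) u = 4 / 5 * lam * T := by
    rw [setIntegral_indicator measurableSet_Icc, Set.inter_eq_self_of_subset_right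
      (fun u hu => Set.mem_Ioi.mpr (by linarith [hu.1])), setIntegral_const]
    rw [Measure.real, volume_Icc, ENNReal.toReal_ofReal
      (by have : 0 < 1 / T := by positivity
          linarith), smul_eq_mul]
    field_simp; ring
  have e2 : ∫ u in Set.Ioi (0 : ℝ), (1 + (v - u) ^ 2)⁻¹ ≤ π := by
    rw [← integral_univ_inv_one_add_sq]
    calc _ ≤ ∫ u : ℝ, (1 + (v - u) ^ 2)⁻¹ :=
          setIntegral_le_integral hci (Eventually.of_forall fun u => by
            simp only [Pi.zero_apply]; positivity)
      _ = _ := integral_sub_left_eq_self (fun u : ℝ => (1 + u ^ 2)⁻¹) volume v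
  rw [e1] at hmono
  have := mul_le_mul_of_nonneg_left e2 hK0
  linarith

end WienerIkehara

/-- The normalised error in the prime number theorem on a logarithmic scale. -/
noncomputable def psiErr (u : ℝ) : ℝ := Chebyshev.psi (exp u) * exp (-u) - 1

lemma psiErr_measurable : Measurable psiErr := by
  have : Measurable Chebyshev.psi := Chebyshev.psi_mono.measurable
  unfold psiErr
  exact ((this.comp measurable_exp).mul (by fun_prop)).sub measurable_const

lemma abs_psiErr_le (u : ℝ) : |psiErr u| ≤ log 4 + 5 := by
  have h1 := Chebyshev.psi_le_const_mul_self (exp_pos u).le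
  have h2 := Chebyshev.psi_nonneg (exp u)
  have h3 : Chebyshev.psi (exp u) * exp (-u) ≤ log 4 + 4 := by
    rw [exp_neg, ← div_eq_mul_inv, div_le_iff₀ (exp_pos u)]; exact h1
  have h4 : 0 ≤ Chebyshev.psi (exp u) * exp (-u) := by positivity
  have h5 : 0 ≤ log 4 := log_nonneg (by norm_num)
  unfold psiErr
  rw [abs_le]; constructor <;> linarith

/-- The continuous extension of the Laplace transform of `psiErr`. -/
noncomputable def psiErrLaplace (s : ℂ) : ℂ :=
  (ArithmeticFunction.vonMangoldt.LFunctionResidueClassAux (1 : ZMod 1) (1 + s) - 1) / (1 + s)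

lemma psiErrLaplace_continuousOn : ContinuousOn psiErrLaplace {s | 0 ≤ s.re} := by
  unfold psiErrLaplace
  refine ContinuousOn.div ?_ (by fun_prop) fun s hs => ?_
  · refine ContinuousOn.sub ?_ continuousOn_const
    refine (ArithmeticFunction.vonMangoldt.continuousOn_LFunctionResidueClassAux
      (1 : ZMod 1)).comp (by fun_prop) fun s hs => ?_
    have : 0 ≤ s.re := hs
    simpa using this
  · intro h
    have h1 := congrArg Complex.re h
    have : 0 ≤ s.re := hs
    simp at h1; linarith

lemma LSeries_vonMangoldt_eq_integral {s : ℂ} (hs : 0 < s.re) :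
    LSeries (fun n => (ArithmeticFunction.vonMangoldt n : ℂ)) (1 + s)
      = (1 + s) * ∫ u in Set.Ioi (0 : ℝ),
        ((Chebyshev.psi (exp u) * exp (-u) : ℝ) : ℂ) * Complex.exp (-(s * u)) := by
  have hpsi : ∀ t : ℝ, ∑ k ∈ Icc 1 ⌊t⌋₊, (ArithmeticFunction.vonMangoldt k : ℂ)
      = (Chebyshev.psi t : ℂ) := by
    intro t
    rw [Chebyshev.psi, ← Icc_add_one_left_eq_Ioc]; push_cast; rfl
  have h1 := LSeries_eq_mul_integral_of_nonneg (fun n => ArithmeticFunction.vonMangoldt n)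
    (r := 1) (s := 1 + s) zero_le_one (by simpa using hs) ?_
    (fun n => ArithmeticFunction.vonMangoldt_nonneg)
  · rw [h1]
    congr 1
    have himg : Set.Ioi (1 : ℝ) = exp '' Set.Ioi 0 := by
      ext t
      constructor
      · intro ht
        have ht1 : (1 : ℝ) < t := ht
        exact ⟨log t, log_pos ht1, exp_log (by linarith)⟩
      · rintro ⟨u, hu, rfl⟩
        exact one_lt_exp_iff.mpr hu
    rw [himg, integral_image_eq_integral_abs_deriv_smul measurableSet_Ioi
      (fun u _ => (hasDerivAt_exp u).hasDerivWithinAt) exp_injective.injOn]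
    refine integral_congr_ae (Eventually.of_forall fun u => ?_)
    simp only [hpsi]
    rw [abs_of_pos (exp_pos u), Complex.real_smul]
    have e1 : ((exp u : ℝ) : ℂ) ^ (-(1 + s + 1)) = Complex.exp (-((1 + s + 1) * u)) := by
      rw [Complex.cpow_def_of_ne_zero (by exact_mod_cast (exp_pos u).ne'),
        ← Complex.ofReal_log (exp_pos u).le, log_exp]
      congr 1; ring
    rw [e1]
    push_cast
    have : Complex.exp u * Complex.exp (-((1 + s + 1) * u))
        = Complex.exp (-u) * Complex.exp (-(s * u)) := by
      rw [← Complex.exp_add, ← Complex.exp_add]; congr 1; ring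
    linear_combination (Chebyshev.psi (exp u) : ℂ) * this
  · refine Asymptotics.IsBigO.of_bound (log 4 + 4) (Eventually.of_forall fun n => ?_)
    have : ∑ k ∈ Icc 1 n, ArithmeticFunction.vonMangoldt k = Chebyshev.psi n := by
      rw [Chebyshev.psi, ← Icc_add_one_left_eq_Ioc, Nat.floor_natCast]; rfl
    rw [this, norm_of_nonneg (Chebyshev.psi_nonneg _), rpow_one,
      norm_of_nonneg (Nat.cast_nonneg n)]
    exact Chebyshev.psi_le_const_mul_self (Nat.cast_nonneg n)

lemma integrable_psi_exp {s : ℂ} (hs : 0 < s.re) {f : ℝ → ℝ} (hm : Measurable f) {M : ℝ}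
    (hM : ∀ u, |f u| ≤ M) : IntegrableOn (fun u : ℝ => (f u : ℂ) * Complex.exp (-(s * u)))
      (Set.Ioi 0) := by
  have hi1 : Integrable (fun u : ℝ => Complex.exp (-s * u)) (volume.restrict (Set.Ioi 0)) :=
    integrableOn_exp_mul_complex_Ioi (by simpa using hs) 0
  have hi2 : Integrable (fun u : ℝ => Complex.exp (-(s * u))) (volume.restrict (Set.Ioi 0)) := by
    simpa [neg_mul] using hi1
  refine hi2.bdd_mul (c := M) (Complex.measurable_ofReal.comp hm).aestronglyMeasurable
    (Eventually.of_forall fun u => ?_)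
  simpa using hM u

lemma integral_psiErr {s : ℂ} (hs : 0 < s.re) :
    ∫ u in Set.Ioi (0 : ℝ), (psiErr u : ℂ) * Complex.exp (-(s * u)) = psiErrLaplace s := by
  have hs0 : s ≠ 0 := fun h => by rw [h] at hs; simp at hs
  have hs1 : 1 + s ≠ 0 := fun h => by
    have h1 := congrArg Complex.re h
    simp at h1; linarith
  have h1 := LSeries_vonMangoldt_eq_integral hs
  have h2 := ArithmeticFunction.vonMangoldt.eqOn_LFunctionResidueClassAux (q := 1) (a := 1)
    isUnit_one (x := 1 + s) (by simpa using hs)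
  simp only [Nat.totient_one, Nat.cast_one, inv_one, add_sub_cancel_left] at h2
  have h3 : LSeries (fun n => ((ArithmeticFunction.vonMangoldt.residueClass (1 : ZMod 1) n : ℝ) : ℂ))
      (1 + s) = LSeries (fun n => (ArithmeticFunction.vonMangoldt n : ℂ)) (1 + s) := by
    congr 1
    ext n
    congr 1
    rw [ArithmeticFunction.vonMangoldt.residueClass, Set.indicator_of_mem]
    exact Subsingleton.elim _ _
  rw [h3, h1] at h2
  have hfm : Measurable fun u => Chebyshev.psi (exp u) * exp (-u) := by
    have := psiErr_measurable.add_const 1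
    simpa [psiErr] using this
  have hfb : ∀ u, |Chebyshev.psi (exp u) * exp (-u)| ≤ log 4 + 6 := by
    intro u
    have := abs_psiErr_le u
    unfold psiErr at this
    rw [abs_le] at this ⊢
    constructor <;> linarith [this.1, this.2]
  have h4 : ∫ u in Set.Ioi (0 : ℝ), (psiErr u : ℂ) * Complex.exp (-(s * u))
      = (∫ u in Set.Ioi (0 : ℝ),
        ((Chebyshev.psi (exp u) * exp (-u) : ℝ) : ℂ) * Complex.exp (-(s * u)))
        - 1 / s := by
    have e : (∫ u in Set.Ioi (0 : ℝ), ((1 : ℝ) : ℂ) * Complex.exp (-(s * u))) = 1 / s := by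
      have := integral_exp_mul_complex_Ioi (a := -s) (by simpa using hs) 0
      simp only [Complex.ofReal_one, one_mul, ← neg_mul]
      rw [this]; simp
    rw [← e, ← integral_sub (integrable_psi_exp hs hfm hfb)
      (integrable_psi_exp hs (f := fun _ => 1) measurable_const (M := 1) (by simp))]
    refine integral_congr_ae (Eventually.of_forall fun u => ?_)
    simp only [psiErr]
    push_cast; ring
  rw [h4, psiErrLaplace, h2]
  field_simp
  ring

lemma psi_isEquivalent : Tendsto (fun x => Chebyshev.psi x / x) atTop (𝓝 1) := by
  have key : ∀ lam : ℝ, 0 < lam → lam < 1 → ∀ᶠ v : ℝ in atTop, |psiErr v| < lam := by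
    intro lam h0 h1
    have up := fun (r : ℝ) (hr : 0 < r) => eventually_exists_lt psiErr_measurable abs_psiErr_le
      (fun s hs => integral_psiErr hs) psiErrLaplace_continuousOn (lam := lam / 2) (r := r)
      (by linarith) hr
    have dn := fun (r : ℝ) (hr : 0 < r) => eventually_exists_lt (h := fun u => -psiErr u)
      psiErr_measurable.neg (fun u => by rw [abs_neg]; exact abs_psiErr_le u)
      (G := fun s => -psiErrLaplace s) (fun s hs => by
        rw [← integral_psiErr hs, ← integral_neg]; simp) psiErrLaplace_continuousOn.neg
      (lam := lam / 2) (r := r) (by linarith) hr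
    obtain ⟨r, hr, hr1, hr2⟩ : ∃ r : ℝ, 0 < r ∧ 1 + lam / 2 ≤ (1 + lam) * exp (-(2 * r)) ∧
        (1 - lam) * exp (2 * r) ≤ 1 - lam / 2 := by
      have c1 : Tendsto (fun r : ℝ => (1 + lam) * exp (-(2 * r))) (𝓝[>] 0)
          (𝓝 ((1 + lam) * exp (-(2 * 0)))) :=
        (Continuous.tendsto (by fun_prop) 0).mono_left nhdsWithin_le_nhds
      have c2 : Tendsto (fun r : ℝ => (1 - lam) * exp (2 * r)) (𝓝[>] 0)
          (𝓝 ((1 - lam) * exp (2 * 0))) :=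
        (Continuous.tendsto (by fun_prop) 0).mono_left nhdsWithin_le_nhds
      have e1 := c1.eventually_const_le (u := 1 + lam / 2) (by simp; linarith)
      have e2 := c2.eventually_le_const (u := 1 - lam / 2) (by simp; linarith)
      obtain ⟨r, hr⟩ := (e1.and (e2.and self_mem_nhdsWithin)).exists
      exact ⟨r, hr.2.2, hr.1, hr.2.1⟩
    have e1 := (tendsto_atTop_add_const_right atTop r tendsto_id).eventually (up r hr)
    have e2 := (tendsto_atTop_add_const_right atTop (-r) tendsto_id).eventually (dn r hr)
    filter_upwards [e1, e2] with v ⟨u, hu, hul⟩ ⟨u', hu', hul'⟩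
    simp only [id] at hu hu'
    rw [abs_lt]
    have ev := exp_pos v
    constructor
    · by_contra! hc
      unfold psiErr at hc hul'
      have m : Chebyshev.psi (exp u') ≤ Chebyshev.psi (exp v) :=
        Chebyshev.psi_mono (exp_le_exp.mpr (by linarith [hu'.2]))
      have h2 : Chebyshev.psi (exp v) ≤ (1 - lam) * exp v := by
        rw [exp_neg, ← div_eq_mul_inv] at hc
        have : Chebyshev.psi (exp v) / exp v ≤ 1 - lam := by linarith
        rwa [div_le_iff₀ ev] at this
      have h3 : Chebyshev.psi (exp u') * exp (-u') ≤ (1 - lam) * exp (2 * r) := by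
        calc _ ≤ (1 - lam) * exp v * exp (-u') := by gcongr; linarith
          _ = (1 - lam) * exp (v - u') := by
            rw [mul_assoc, ← exp_add, ← sub_eq_add_neg]
          _ ≤ _ := by
            refine mul_le_mul_of_nonneg_left (exp_le_exp.mpr (by linarith [hu'.1])) (by linarith)
      linarith
    · by_contra! hc
      unfold psiErr at hc hul
      have m : Chebyshev.psi (exp v) ≤ Chebyshev.psi (exp u) :=
        Chebyshev.psi_mono (exp_le_exp.mpr (by linarith [hu.1]))
      have h2 : (1 + lam) * exp v ≤ Chebyshev.psi (exp v) := by
        rw [exp_neg, ← div_eq_mul_inv] at hc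
        have : 1 + lam ≤ Chebyshev.psi (exp v) / exp v := by linarith
        rwa [le_div_iff₀ ev] at this
      have h3 : (1 + lam) * exp (-(2 * r)) ≤ Chebyshev.psi (exp u) * exp (-u) := by
        calc _ ≤ (1 + lam) * exp (v - u) := by
              refine mul_le_mul_of_nonneg_left (exp_le_exp.mpr (by linarith [hu.2])) (by linarith)
          _ = (1 + lam) * exp v * exp (-u) := by
            rw [mul_assoc, ← exp_add, ← sub_eq_add_neg]
          _ ≤ _ := by gcongr; linarith
      linarith
  have lim : Tendsto psiErr atTop (𝓝 0) := by
    rw [Metric.tendsto_nhds]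
    intro ε hε
    filter_upwards [key (min (ε / 2) (1 / 2)) (by positivity)
      (lt_of_le_of_lt (min_le_right _ _) (by norm_num))] with v hv
    rw [dist_eq, sub_zero]
    exact (hv.trans_le (min_le_left _ _)).trans (by linarith)
  have := (lim.comp tendsto_log_atTop).add_const 1
  rw [zero_add] at this
  refine this.congr' ?_
  filter_upwards [eventually_gt_atTop 0] with x hx
  simp [psiErr, exp_log hx, exp_neg, div_eq_mul_inv]

lemma tendsto_theta_div : Tendsto (fun x => Chebyshev.theta x / x) atTop (𝓝 1) := by
  obtain ⟨C, hC⟩ := Chebyshev.psi_sub_theta_le_mul_sqrt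
  have h1 : Tendsto (fun x : ℝ => (Chebyshev.psi x - Chebyshev.theta x) / x) atTop (𝓝 0) := by
    have h2 : Tendsto (fun x : ℝ => |C| * x ^ (-(1 / 2) : ℝ)) atTop (𝓝 0) := by
      simpa using (tendsto_rpow_neg_atTop (y := 1 / 2) (by norm_num)).const_mul |C|
    refine squeeze_zero' ?_ ?_ h2
    · filter_upwards [eventually_gt_atTop 0] with x hx
      exact div_nonneg (sub_nonneg.mpr (Chebyshev.theta_le_psi x)) hx.le
    · filter_upwards [eventually_gt_atTop 0] with x hx
      rw [div_le_iff₀ hx, mul_assoc, ← rpow_add_one hx.ne']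
      refine (hC x).trans ?_
      rw [sqrt_eq_rpow, show (-(1 / 2) + 1 : ℝ) = 1 / 2 by norm_num]
      gcongr
      exact le_abs_self C
  have := psi_isEquivalent.sub h1
  rw [sub_zero] at this
  refine this.congr fun x => ?_
  rw [← sub_div]; ring

lemma tendsto_primeCounting :
    Tendsto (fun x : ℝ => (Nat.primeCounting ⌊x⌋₊ : ℝ) * log x / x) atTop (𝓝 1) := by
  obtain ⟨C, hC⟩ := Chebyshev.primeCounting_sub_theta_div_log_isBigO.bound
  have hlog := tendsto_log_atTop
  have h1 : Tendsto (fun x : ℝ => ((Nat.primeCounting ⌊x⌋₊ : ℝ) - Chebyshev.theta x / log x) *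
      log x / x) atTop (𝓝 0) := by
    have h2 : Tendsto (fun x : ℝ => C / log x) atTop (𝓝 0) := hlog.const_div_atTop C
    refine squeeze_zero_norm' ?_ h2
    filter_upwards [hC, eventually_gt_atTop 1] with x hx hx1
    have hl := log_pos hx1
    have hx0 : 0 < x := by linarith
    rw [norm_div, norm_mul, norm_of_nonneg hl.le, norm_of_nonneg hx0.le]
    rw [norm_of_nonneg (by positivity : 0 ≤ x / log x ^ 2)] at hx
    calc _ ≤ C * (x / log x ^ 2) * log x / x := by gcongr
      _ = _ := by field_simp
  have := h1.add tendsto_theta_div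
  rw [zero_add] at this
  refine this.congr' ?_
  filter_upwards [eventually_gt_atTop 1] with x hx1
  have hl := log_pos hx1
  field_simp; ring

lemma tendsto_primeCounting_mul {b : ℝ} (hb : 0 ≤ b) :
    Tendsto (fun x : ℝ => (Nat.primeCounting ⌊b * x⌋₊ : ℝ) * log x / x) atTop (𝓝 b) := by
  rcases hb.eq_or_lt with rfl | hb
  · simp
  have h1 := tendsto_primeCounting.comp (tendsto_id.const_mul_atTop hb)
  have h2 : Tendsto (fun x : ℝ => log x / log (b * x)) atTop (𝓝 1) := by
    have h3 : Tendsto (fun x : ℝ => log b / log x) atTop (𝓝 0) :=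
      tendsto_log_atTop.const_div_atTop _
    have h4 : Tendsto (fun x : ℝ => (log b / log x + 1)⁻¹) atTop (𝓝 (0 + 1)⁻¹) :=
      (h3.add_const 1).inv₀ (by norm_num)
    rw [zero_add, inv_one] at h4
    refine h4.congr' ?_
    filter_upwards [eventually_gt_atTop 1] with x hx
    have := log_pos hx
    rw [log_mul hb.ne' (by linarith), ← inv_div (_ + _), add_div,
      div_self this.ne']
  have h5 := (h1.mul h2).const_mul b
  simp only [mul_one] at h5
  refine h5.congr' ?_
  filter_upwards [eventually_gt_atTop 1, eventually_gt_atTop (1 / b)] with x hx hx2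
  have := log_pos hx
  have hbx : 1 < b * x := by rw [div_lt_iff₀ hb] at hx2; linarith
  have := log_pos hbx
  simp only [Function.comp, id]
  field_simp

/-- The number of primes in `(u, v]`. -/
noncomputable def primeCount (u v : ℝ) : ℕ :=
  ((Icc 1 ⌊v⌋₊).filter fun p : ℕ => p.Prime ∧ u < (p : ℝ)).card

lemma mem_Icc_floor {v : ℝ} (hv : 0 ≤ v) {p : ℕ} :
    p ∈ Icc 1 ⌊v⌋₊ ↔ 1 ≤ p ∧ (p : ℝ) ≤ v := by
  rw [mem_Icc, Nat.le_floor_iff hv]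

lemma primeCounting_eq_card (n : ℕ) :
    Nat.primeCounting n = ((Icc 1 n).filter Nat.Prime).card := by
  rw [Nat.primeCounting, Nat.primeCounting', Nat.count_eq_card_filter_range]
  congr 1
  ext p
  simp only [mem_filter, mem_range, mem_Icc]
  constructor
  · rintro ⟨h1, h2⟩; exact ⟨⟨h2.one_lt.le, by omega⟩, h2⟩
  · rintro ⟨h1, h2⟩; exact ⟨by omega, h2⟩

lemma primeCount_eq {u v : ℝ} (hu : 0 ≤ u) (huv : u ≤ v) :
    (primeCount u v : ℝ) = Nat.primeCounting ⌊v⌋₊ - Nat.primeCounting ⌊u⌋₊ := by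
  rw [primeCounting_eq_card, primeCounting_eq_card, primeCount, eq_sub_iff_add_eq]
  norm_cast
  rw [← card_union_of_disjoint]
  · congr 1
    ext p
    simp only [mem_union, mem_filter, mem_Icc_floor hu, mem_Icc_floor (hu.trans huv)]
    constructor
    · rintro (⟨h1, h2, h3⟩ | ⟨⟨h1, h2⟩, h3⟩)
      · exact ⟨h1, h2⟩
      · exact ⟨⟨h1, h2.trans huv⟩, h3⟩
    · rintro ⟨⟨h1, h2⟩, h3⟩
      by_cases h : u < p
      · exact Or.inl ⟨⟨h1, h2⟩, h3, h⟩
      · exact Or.inr ⟨⟨h1, not_lt.mp h⟩, h3⟩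
  · rw [disjoint_left]
    simp only [mem_filter, mem_Icc_floor hu]
    rintro p ⟨-, -, h1⟩ ⟨⟨-, h2⟩, -⟩
    linarith

lemma tendsto_primeCount {a b : ℝ} (ha : 0 ≤ a) (hab : a ≤ b) :
    Tendsto (fun x : ℝ => (primeCount (a * x) (b * x) : ℝ) * log x / x) atTop (𝓝 (b - a)) := by
  refine ((tendsto_primeCounting_mul (ha.trans hab)).sub (tendsto_primeCounting_mul ha)).congr' ?_
  filter_upwards [eventually_ge_atTop 0] with x hx
  rw [primeCount_eq (by positivity) (by gcongr)]
  ring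

end PrimeNumberTheorem

section Mertens
open Finset Filter Topology MeasureTheory

open ArithmeticFunction in
lemma exists_sum_vonMangoldt_div :
    ∃ C : ℝ, ∀ n : ℕ, 1 ≤ n → |∑ k ∈ Ioc 0 n, vonMangoldt k / k - Real.log n| ≤ C := by
  refine ⟨Real.log 4 + 5, fun n hn => ?_⟩
  have hn0 : (0 : ℝ) < n := by exact_mod_cast hn
  have h1 : Real.log n.factorial = ∑ k ∈ Ioc 0 n, vonMangoldt k * ((n / k : ℕ) : ℝ) := by
    have h2 := sum_Ioc_mul_zeta_eq_sum (R := ℝ) vonMangoldt n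
    rw [vonMangoldt_mul_zeta] at h2
    rw [← h2]
    simp only [ArithmeticFunction.log_apply]
    clear h2 hn hn0
    induction n with
    | zero => simp
    | succ m ih =>
      rw [Nat.factorial_succ, Nat.cast_mul, Real.log_mul (by positivity) (by positivity), ih,
        sum_Ioc_succ_top (Nat.zero_le m)]
      push_cast; ring
  have h3 : Real.log n.factorial ≤ n * Real.log n := by
    have : (n.factorial : ℝ) ≤ (n : ℝ) ^ n := by exact_mod_cast Nat.factorial_le_pow n
    have := Real.log_le_log (by positivity) this
    rwa [Real.log_pow] at this
  have h4 : n * Real.log n - n ≤ Real.log n.factorial := by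
    have h5 := Stirling.le_log_factorial_stirling (n := n) (by omega)
    have h6 := Real.log_natCast_nonneg n
    have : 0 ≤ Real.log (2 * Real.pi) := Real.log_nonneg (by linarith [Real.pi_gt_three])
    linarith
  have h7 : Real.log n.factorial ≤ n * ∑ k ∈ Ioc 0 n, vonMangoldt k / k := by
    rw [h1, mul_sum]
    refine sum_le_sum fun k hk => ?_
    have : ((n / k : ℕ) : ℝ) ≤ n / k := Nat.cast_div_le
    calc vonMangoldt k * ((n / k : ℕ) : ℝ) ≤ vonMangoldt k * (n / k) := by gcongr
      _ = _ := by ring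
  have h8 : n * ∑ k ∈ Ioc 0 n, vonMangoldt k / k ≤ Real.log n.factorial + Chebyshev.psi n := by
    rw [h1, mul_sum, Chebyshev.psi, Nat.floor_natCast, ← sum_add_distrib]
    refine sum_le_sum fun k hk => ?_
    have hk0 : (0 : ℝ) < k := by exact_mod_cast (mem_Ioc.mp hk).1
    have : (n : ℝ) / k ≤ ((n / k : ℕ) : ℝ) + 1 := by
      rw [← Nat.floor_div_eq_div (K := ℝ)]
      exact (Nat.lt_floor_add_one _).le
    calc n * (vonMangoldt k / k) = vonMangoldt k * (n / k) := by ring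
      _ ≤ vonMangoldt k * (((n / k : ℕ) : ℝ) + 1) := by gcongr
      _ = _ := by ring
  have h9 := Chebyshev.psi_le_const_mul_self (Nat.cast_nonneg (α := ℝ) n)
  set S := ∑ k ∈ Ioc 0 n, vonMangoldt k / k
  have hl4 : 0 ≤ Real.log 4 := Real.log_nonneg (by norm_num)
  rw [abs_le]
  constructor
  · by_contra! hc
    nlinarith
  · by_contra! hc
    nlinarith

open ArithmeticFunction in
/-- Mertens' first theorem. -/
lemma exists_sum_log_div_prime : ∃ C : ℝ, 0 ≤ C ∧ ∀ x : ℝ, 1 ≤ x →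
    |∑ k ∈ Icc 0 ⌊x⌋₊, (if k.Prime then Real.log k / k else 0) - Real.log x| ≤ C := by
  obtain ⟨C, hC⟩ := exists_sum_vonMangoldt_div
  have hsum := vonMangoldt.summable_residueClass_non_primes_div (1 : ZMod 1)
  have hrc : ∀ n, vonMangoldt.residueClass (1 : ZMod 1) n = vonMangoldt n := fun n => by
    rw [vonMangoldt.residueClass, Set.indicator_of_mem]
    exact Subsingleton.elim _ _
  simp only [hrc] at hsum
  set K := ∑' n : ℕ, (if n.Prime then 0 else vonMangoldt n) / (n : ℝ)
  have hC0 : 0 ≤ C := (abs_nonneg _).trans (hC 1 le_rfl)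
  have hK0 : 0 ≤ K := tsum_nonneg fun n => by
    split_ifs
    · simp
    · exact div_nonneg vonMangoldt_nonneg (Nat.cast_nonneg n)
  refine ⟨C + K + 1, by linarith, fun x hx => ?_⟩
  set n := ⌊x⌋₊ with hn
  have hn1 : 1 ≤ n := Nat.one_le_floor_iff x |>.mpr hx
  have hnx : (n : ℝ) ≤ x := Nat.floor_le (by linarith)
  have hnx' : x < n + 1 := Nat.lt_floor_add_one x
  have hn0 : (1 : ℝ) ≤ n := by exact_mod_cast hn1
  have e1 : ∑ k ∈ Icc 0 n, (if k.Prime then Real.log k / k else 0)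
      = ∑ k ∈ Ioc 0 n, vonMangoldt k / k
        - ∑ k ∈ Ioc 0 n, (if k.Prime then 0 else vonMangoldt k) / (k : ℝ) := by
    rw [← sum_sub_distrib, ← add_sum_Ioc_eq_sum_Icc (Nat.zero_le n)]
    simp only [Nat.not_prime_zero, if_false, zero_add]
    refine sum_congr rfl fun k _ => ?_
    split_ifs with hk
    · rw [vonMangoldt_apply_prime hk]; simp
    · simp
  have e2 : ∑ k ∈ Ioc 0 n, (if k.Prime then 0 else vonMangoldt k) / (k : ℝ) ≤ K :=
    hsum.sum_le_tsum _ fun k _ => by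
      split_ifs
      · simp
      · exact div_nonneg vonMangoldt_nonneg (Nat.cast_nonneg k)
  have e3 : 0 ≤ ∑ k ∈ Ioc 0 n, (if k.Prime then 0 else vonMangoldt k) / (k : ℝ) :=
    sum_nonneg fun k _ => by
      split_ifs
      · simp
      · exact div_nonneg vonMangoldt_nonneg (Nat.cast_nonneg k)
  have e4 := abs_le.mp (hC n hn1)
  have e5 : Real.log n ≤ Real.log x := Real.log_le_log (by linarith) hnx
  have e6 : Real.log x ≤ Real.log n + 1 := by
    have : Real.log x ≤ Real.log (n * 2) := Real.log_le_log (by linarith) (by linarith)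
    rw [Real.log_mul (by linarith) (by norm_num)] at this
    linarith [Real.log_two_lt_d9]
  rw [e1, abs_le]
  constructor <;> linarith [e4.1, e4.2]

/-- Mertens' second theorem, as an estimate for differences. -/
lemma exists_sum_inv_prime : ∃ C : ℝ, 0 ≤ C ∧ ∀ u v : ℝ, 2 ≤ u → u ≤ v →
    |∑ k ∈ Ioc ⌊u⌋₊ ⌊v⌋₊, (if k.Prime then 1 / (k : ℝ) else 0)
      - Real.log (Real.log v / Real.log u)| ≤ C / Real.log u := by
  obtain ⟨C, hC0, hC⟩ := exists_sum_log_div_prime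
  refine ⟨2 * C, by linarith, fun a b ha hab => ?_⟩
  have hl : ∀ t ∈ Set.Icc a b, 0 < Real.log t := fun t ht => Real.log_pos (by linarith [ht.1])
  have hla : 0 < Real.log a := hl a ⟨le_rfl, hab⟩
  have hlb : 0 < Real.log b := hl b ⟨hab, le_rfl⟩
  set c : ℕ → ℝ := fun k => if k.Prime then Real.log k / k else 0 with hc
  set S : ℝ → ℝ := fun t => ∑ k ∈ Icc 0 ⌊t⌋₊, c k with hS
  set w : ℝ → ℝ := fun t => 1 / (t * Real.log t ^ 2) with hw
  have hd : ∀ t ∈ Set.Icc a b, HasDerivAt (fun t => (Real.log t)⁻¹) (-w t) t := fun t ht => by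
    have h0 : t ≠ 0 := by linarith [ht.1]
    refine ((Real.hasDerivAt_log h0).inv (hl t ht).ne').congr_deriv ?_
    rw [hw]; field_simp
  have hwc : ContinuousOn w (Set.Icc a b) := by
    refine continuousOn_const.div (continuousOn_id.mul ((Real.continuousOn_log.mono ?_).pow 2)) ?_
    · intro t ht h0; rw [Set.mem_singleton_iff] at h0; linarith [ht.1]
    · intro t ht
      have := hl t ht
      have : 0 < t := by linarith [ht.1]
      positivity
  have hwi : IntegrableOn w (Set.Icc a b) := hwc.integrableOn_Icc
  have hdw : IntegrableOn (deriv fun t => (Real.log t)⁻¹) (Set.Icc a b) :=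
    hwi.neg.congr_fun (fun t ht => (hd t ht).deriv.symm) measurableSet_Icc
  have abel := sum_mul_eq_sub_sub_integral_mul c (f := fun t => (Real.log t)⁻¹) (a := a) (b := b)
    (by linarith) hab (fun t ht => (hd t ht).differentiableAt) hdw
  have hint : ∫ t in Set.Ioc a b, deriv (fun t => (Real.log t)⁻¹) t * ∑ k ∈ Icc 0 ⌊t⌋₊, c k
      = - ∫ t in Set.Ioc a b, w t * S t := by
    rw [← integral_neg]
    refine setIntegral_congr_fun measurableSet_Ioc fun t ht => ?_
    simp only [hS, (hd t ⟨ht.1.le, ht.2⟩).deriv]; ring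
  have hSi : IntegrableOn (fun t => w t * S t) (Set.Ioc a b) :=
    (integrableOn_mul_sum_Icc c (by linarith) hwi).mono_set Set.Ioc_subset_Icc_self
  have hF : ∀ K : ℝ, ∫ t in Set.Ioc a b, (w t * (Real.log t + K))
      = Real.log (Real.log b / Real.log a) + K * (1 / Real.log a - 1 / Real.log b) := fun K => by
    rw [← intervalIntegral.integral_of_le hab,
      intervalIntegral.integral_eq_sub_of_hasDerivAt
        (f := fun t => Real.log (Real.log t) - K * (Real.log t)⁻¹)]
    · rw [Real.log_div hlb.ne' hla.ne']; ring
    · intro t ht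
      rw [Set.uIcc_of_le hab] at ht
      have h0 : t ≠ 0 := by linarith [ht.1]
      have h1 := hl t ht
      refine (((Real.hasDerivAt_log h0).log h1.ne').sub ((hd t ht).const_mul K)).congr_deriv ?_
      rw [hw]; field_simp; ring
    · refine ContinuousOn.intervalIntegrable_of_Icc hab (hwc.mul
        ((Real.continuousOn_log.mono ?_).add continuousOn_const))
      intro t ht h0; rw [Set.mem_singleton_iff] at h0; linarith [ht.1]
  have hwK : ∀ K : ℝ, IntegrableOn (fun t => w t * (Real.log t + K)) (Set.Ioc a b) := fun K => by
    refine (ContinuousOn.integrableOn_Icc (hwc.mul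
        ((Real.continuousOn_log.mono ?_).add continuousOn_const))).mono_set Set.Ioc_subset_Icc_self
    intro t ht h0; rw [Set.mem_singleton_iff] at h0; linarith [ht.1]
  have hw0 : ∀ t ∈ Set.Ioc a b, 0 ≤ w t := fun t ht => by
    have : 0 < t := by linarith [ht.1]
    rw [hw]; positivity
  have hSb := fun t (ht : 1 ≤ t) => abs_le.mp (hC t ht)
  have up : ∫ t in Set.Ioc a b, w t * S t ≤ Real.log (Real.log b / Real.log a)
      + C * (1 / Real.log a - 1 / Real.log b) := by
    rw [← hF]
    refine setIntegral_mono_on hSi (hwK C) measurableSet_Ioc fun t ht => ?_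
    refine mul_le_mul_of_nonneg_left ?_ (hw0 t ht)
    have := (hSb t (by linarith [ht.1])).2
    simp only [hS, hc]; linarith
  have dn : Real.log (Real.log b / Real.log a) + (-C) * (1 / Real.log a - 1 / Real.log b)
      ≤ ∫ t in Set.Ioc a b, w t * S t := by
    rw [← hF]
    refine setIntegral_mono_on (hwK (-C)) hSi measurableSet_Ioc fun t ht => ?_
    refine mul_le_mul_of_nonneg_left ?_ (hw0 t ht)
    have := (hSb t (by linarith [ht.1])).1
    simp only [hS, hc]; linarith
  have hsum : ∑ k ∈ Ioc ⌊a⌋₊ ⌊b⌋₊, (if k.Prime then 1 / (k : ℝ) else 0)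
      = ∑ k ∈ Ioc ⌊a⌋₊ ⌊b⌋₊, (Real.log k)⁻¹ * c k := by
    refine sum_congr rfl fun k _ => ?_
    simp only [hc]
    split_ifs with hk
    · have : 0 < Real.log k := Real.log_pos (by exact_mod_cast hk.one_lt)
      field_simp
    · simp
  rw [hsum, abel, hint]
  have eb := hSb b (by linarith)
  have ea := hSb a (by linarith)
  have kb : |(Real.log b)⁻¹ * S b - 1| ≤ C / Real.log b := by
    rw [show (Real.log b)⁻¹ * S b - 1 = (S b - Real.log b) / Real.log b by field_simp, abs_div,
      abs_of_pos hlb]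
    gcongr; exact abs_le.mpr eb
  have ka : |(Real.log a)⁻¹ * S a - 1| ≤ C / Real.log a := by
    rw [show (Real.log a)⁻¹ * S a - 1 = (S a - Real.log a) / Real.log a by field_simp, abs_div,
      abs_of_pos hla]
    gcongr; exact abs_le.mpr ea
  rw [abs_le] at ka kb ⊢
  have x1 : C * (1 / Real.log a - 1 / Real.log b) = C / Real.log a - C / Real.log b := by ring
  have x2 : 2 * C / Real.log a = C / Real.log a + C / Real.log a := by ring
  rw [x1] at up
  rw [neg_mul, x1] at dn
  rw [x2]
  change -(_) ≤ (Real.log b)⁻¹ * S b - (Real.log a)⁻¹ * S a - -_ - _ ∧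
    (Real.log b)⁻¹ * S b - (Real.log a)⁻¹ * S a - -_ - _ ≤ _
  constructor <;> linarith [ka.1, ka.2, kb.1, kb.2]

end Mertens

open Real Finset

section Tensor
open Matrix
variable {ι κ J : Type*} [Fintype ι] [DecidableEq ι] [Fintype κ] [DecidableEq κ]
  [Fintype J] [DecidableEq J]

/-- The quadratic form of a tensor product of matrices. -/
noncomputable def tensorForm (A : ι → Matrix κ κ ℝ) (Z : (ι → κ) → ℝ) : ℝ :=
  ∑ C, ∑ C', Z C * Z C' * ∏ i, A i (C i) (C' i)

lemma posSemidef_hadamard {n : Type*} [Finite n] {A B : Matrix n n ℝ} (hA : A.PosSemidef)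
    (hB : B.PosSemidef) : (A ⊙ B).PosSemidef :=
  hA.hadamard hB

lemma posSemidef_prod {A B : ι → Matrix κ κ ℝ} (h₁ : ∀ i, (B i + A i).PosSemidef)
    (h₂ : ∀ i, (B i - A i).PosSemidef) (T : Finset ι) :
    (Matrix.of fun C C' : ι → κ =>
        ∏ i ∈ T, B i (C i) (C' i) + ∏ i ∈ T, A i (C i) (C' i)).PosSemidef ∧
      (Matrix.of fun C C' : ι → κ =>
        ∏ i ∈ T, B i (C i) (C' i) - ∏ i ∈ T, A i (C i) (C' i)).PosSemidef := by
  induction T using Finset.induction_on with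
  | empty =>
    have := Matrix.posSemidef_vecMulVec_self_star (fun _ : ι → κ => (1 : ℝ))
    constructor
    · convert this.add this using 1
      ext
      simp [Matrix.vecMulVec_apply]
    · convert Matrix.PosSemidef.zero (n := ι → κ) (R := ℝ) using 1
      ext
      simp
  | insert i T hi ih =>
    have e₁ := (h₁ i).submatrix (fun C : ι → κ => C i)
    have e₂ := (h₂ i).submatrix (fun C : ι → κ => C i)
    have half : (0 : ℝ) ≤ 1 / 2 := by norm_num
    constructor
    · convert ((posSemidef_hadamard e₁ ih.1).add (posSemidef_hadamard e₂ ih.2)).smul half using 1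
      ext
      simp [prod_insert hi]
      ring
    · convert ((posSemidef_hadamard e₁ ih.2).add (posSemidef_hadamard e₂ ih.1)).smul half using 1
      ext
      simp [prod_insert hi]
      ring

lemma abs_tensorForm_le {A B : ι → Matrix κ κ ℝ} (h₁ : ∀ i, (B i + A i).PosSemidef)
    (h₂ : ∀ i, (B i - A i).PosSemidef) (Z : (ι → κ) → ℝ) :
    |tensorForm A Z| ≤ tensorForm B Z := by
  obtain ⟨p₁, p₂⟩ := posSemidef_prod h₁ h₂ univ
  have q₁ := p₁.dotProduct_mulVec_nonneg Z
  have q₂ := p₂.dotProduct_mulVec_nonneg Z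
  simp only [dotProduct, mulVec, Matrix.of_apply, mul_sum, Pi.star_apply, star_trivial, add_mul,
    sub_mul, mul_add, mul_sub, ← mul_assoc, mul_right_comm _ _ (Z _), sum_add_distrib,
    sum_sub_distrib] at q₁ q₂
  unfold tensorForm
  exact abs_le.2 ⟨by linarith, by linarith⟩

lemma sum_sum_prod (h : ι → κ → κ → ℝ) :
    ∑ C : ι → κ, ∑ C' : ι → κ, ∏ i, h i (C i) (C' i) = ∏ i, ∑ a, ∑ b, h i a b := by
  simp_rw [prod_univ_sum, Fintype.piFinset_univ]

/-- Local values when no event occurs. -/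
def baseVec (r : ℝ) : Option J → ℝ
  | none => 1
  | some _ => r

/-- Local values when the event `s` occurs. -/
def eventVec (r : ℝ) (s : J) (a : Option J) : ℝ :=
  baseVec r a - if a = some s then 1 else 0

/-- Local coefficient matrices of the expansion of products of local functions. -/
noncomputable def coefMat (r : ℝ) : Option J → Matrix (Option J) (Option J) ℝ
  | none => vecMulVec (baseVec r) (baseVec r) + r • ∑ s : J,
      (vecMulVec (eventVec r s) (eventVec r s) - vecMulVec (baseVec r) (baseVec r))
  | some s => vecMulVec (eventVec r s) (eventVec r s) - vecMulVec (baseVec r) (baseVec r)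

/-- Local majorants of `coefMat`. -/
noncomputable def majMat (r : ℝ) : Option J → Matrix (Option J) (Option J) ℝ
  | none => Matrix.diagonal (baseVec r)
  | some s => vecMulVec (eventVec r s) (eventVec r s) + vecMulVec (baseVec r) (baseVec r)

/-- Local diagonal minorant of the Gram matrix. -/
noncomputable def minMat (r : ℝ) : Matrix (Option J) (Option J) ℝ :=
  Matrix.diagonal (baseVec (r * (1 - Fintype.card J * r)))

lemma coefMat_none_apply (r : ℝ) (a b : Option J) :
    coefMat r none a b = baseVec r a * baseVec r b
      + r * ∑ s, (eventVec r s a * eventVec r s b - baseVec r a * baseVec r b) := by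
  simp only [coefMat, Matrix.add_apply, Matrix.smul_apply, Matrix.sum_apply, Matrix.sub_apply,
    vecMulVec_apply, smul_eq_mul]

lemma coefMat_none_none (r : ℝ) : coefMat (J := J) r none none none = 1 := by
  simp [coefMat_none_apply, eventVec, baseVec, mul_sub, sum_sub_distrib]

lemma coefMat_none_some (r : ℝ) (j : J) : coefMat (J := J) r none none (some j) = 0 := by
  simp [coefMat_none_apply, eventVec, baseVec, mul_sub, sum_sub_distrib]

lemma coefMat_some_none (r : ℝ) (j : J) : coefMat (J := J) r none (some j) none = 0 := by
  simp [coefMat_none_apply, eventVec, baseVec, mul_sub, sum_sub_distrib]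

lemma coefMat_some_some (r : ℝ) (j j' : J) :
    coefMat (J := J) r none (some j) (some j') = (if j = j' then r else 0) - r ^ 2 := by
  have e (s : J) : eventVec r s (some j) * eventVec r s (some j')
      - baseVec r (some j) * baseVec r (some j')
      = -r * (if j = s then 1 else 0) - r * (if j' = s then 1 else 0)
        + if j = s then (if j = j' then 1 else 0) else 0 := by
    simp only [eventVec, baseVec, Option.some.injEq]
    grind
  simp_rw [coefMat_none_apply, e, sum_add_distrib, sum_sub_distrib, ← mul_sum]
  simp [baseVec]
  grind

lemma quad_option (M : Matrix (Option J) (Option J) ℝ) (X : Option J → ℝ)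
    (h₁ : ∀ j, M none (some j) = 0) (h₂ : ∀ j, M (some j) none = 0) :
    star X ⬝ᵥ M *ᵥ X = M none none * X none ^ 2
      + ∑ j, ∑ j', X (some j) * X (some j') * M (some j) (some j') := by
  simp only [dotProduct, mulVec, Pi.star_apply, star_trivial, Fintype.sum_option, h₁, h₂,
    mul_sum, zero_mul, sum_const_zero, mul_zero, zero_add, add_zero]
  congr 1
  · ring
  · exact sum_congr rfl fun C _ => sum_congr rfl fun C' _ => by ring

lemma coefMat_isHermitian (r : ℝ) : (coefMat (J := J) r none).IsHermitian := by
  ext a b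
  rcases a with _ | a <;> rcases b with _ | b <;>
    simp [coefMat_none_none, coefMat_none_some, coefMat_some_none, coefMat_some_some, eq_comm]

lemma coefMat_sub_minMat (r : ℝ) :
    (coefMat (J := J) r none - minMat r).PosSemidef := by
  refine Matrix.PosSemidef.of_dotProduct_mulVec_nonneg
    ((coefMat_isHermitian r).sub (Matrix.isHermitian_diagonal _)) fun X => ?_
  rw [quad_option]
  · have key : ∑ j : J, ∑ j' : J, X (some j) * X (some j')
        * (coefMat (J := J) r none - minMat r : Matrix _ _ ℝ) (some j) (some j')
        = r ^ 2 * (Fintype.card J * ∑ j, X (some j) ^ 2 - (∑ j, X (some j)) ^ 2) := by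
      have e : ∀ j j' : J, X (some j) * X (some j')
          * (coefMat (J := J) r none - minMat r : Matrix _ _ ℝ) (some j) (some j')
          = (if j = j' then r ^ 2 * Fintype.card J * X (some j) ^ 2 else 0)
            - r ^ 2 * (X (some j) * X (some j')) := by
        intro j j'
        simp only [Matrix.sub_apply, coefMat_some_some, minMat, Matrix.diagonal_apply,
          Option.some.injEq, baseVec]
        grind
      simp_rw [e, sum_sub_distrib, pow_two (∑ j, X (some j)), sum_mul_sum, mul_sub, ← mul_assoc,
        mul_sum]
      simp [mul_assoc]
    rw [key]
    have := sq_sum_le_card_mul_sum_sq (s := (univ : Finset J)) (f := fun j => X (some j))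
    rw [card_univ] at this
    have e0 : (coefMat (J := J) r none - minMat r : Matrix _ _ ℝ) none none = 0 := by
      simp [coefMat_none_none, minMat, baseVec]
    rw [e0]
    have := mul_nonneg (sq_nonneg r) (sub_nonneg.2 this)
    linarith
  · intro j; simp [coefMat_none_some, minMat]
  · intro j; simp [coefMat_some_none, minMat]

lemma minMat_posSemidef {r : ℝ} (hr : 0 ≤ r) (hk : Fintype.card J * r ≤ 1) :
    (minMat (J := J) r).PosSemidef := by
  refine Matrix.PosSemidef.diagonal fun a => ?_
  rcases a with _ | a
  · simp [baseVec]
  · exact mul_nonneg hr (by linarith)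

lemma coefMat_posSemidef {r : ℝ} (hr : 0 ≤ r) (hk : Fintype.card J * r ≤ 1) :
    (coefMat (J := J) r none).PosSemidef := by
  simpa using (coefMat_sub_minMat (J := J) r).add (minMat_posSemidef hr hk)

lemma majMat_posSemidef {r : ℝ} (hr : 0 ≤ r) (o : Option J) :
    (majMat (J := J) r o).PosSemidef := by
  rcases o with _ | s
  · refine Matrix.PosSemidef.diagonal fun a => ?_
    rcases a with _ | a
    · simp [baseVec]
    · exact hr
  · exact (Matrix.posSemidef_vecMulVec_self_star (eventVec r s)).add
      (Matrix.posSemidef_vecMulVec_self_star (baseVec r))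

lemma majMat_add {r : ℝ} (hr : 0 ≤ r) (hk : Fintype.card J * r ≤ 1) (o : Option J) :
    (majMat (J := J) r o + coefMat r o).PosSemidef := by
  rcases o with _ | s
  · exact (majMat_posSemidef hr none).add (coefMat_posSemidef hr hk)
  · have := Matrix.posSemidef_vecMulVec_self_star (eventVec r s)
    convert this.add this using 1
    simp [majMat, coefMat]

lemma majMat_sub {r : ℝ} (o : Option J) :
    (majMat (J := J) r o - coefMat r o).PosSemidef := by
  rcases o with _ | s
  · convert Matrix.posSemidef_vecMulVec_self_star
      (fun a : Option J => (match a with | none => 0 | some _ => r : ℝ)) using 1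
    ext a b
    rcases a with _ | a <;> rcases b with _ | b <;>
      simp [majMat, coefMat_none_none, coefMat_none_some, coefMat_some_none, coefMat_some_some,
        Matrix.vecMulVec_apply, baseVec, Matrix.diagonal_apply]
    ring
  · have := Matrix.posSemidef_vecMulVec_self_star (baseVec (J := J) r)
    convert this.add this using 1
    simp [majMat, coefMat]

lemma baseVec_mul (a b : ℝ) (o : Option J) : baseVec a o * baseVec b o = baseVec (a * b) o := by
  rcases o with _ | s <;> simp [baseVec]

lemma baseVec_nonneg {a : ℝ} (ha : 0 ≤ a) (o : Option J) : 0 ≤ baseVec a o := by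
  rcases o with _ | s
  exacts [zero_le_one, ha]

lemma sum_baseVec (a : ℝ) : ∑ o : Option J, baseVec a o = 1 + Fintype.card J * a := by
  simp [Fintype.sum_option, baseVec]

lemma sum_prod_baseVec (a : ι → ℝ) :
    ∑ t : ι → Option J, ∏ i, baseVec (a i) (t i) = ∏ i, (1 + Fintype.card J * a i) := by
  simp_rw [← sum_baseVec, prod_univ_sum, Fintype.piFinset_univ]

lemma tensorForm_diagonal (d : ι → κ → ℝ) (Z : (ι → κ) → ℝ) :
    tensorForm (fun i => Matrix.diagonal (d i)) Z = ∑ C, Z C ^ 2 * ∏ i, d i (C i) := by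
  refine sum_congr rfl fun C _ => ?_
  rw [sum_eq_single C]
  · simp [pow_two]
  · intro C' _ hne
    obtain ⟨i, hi⟩ := Function.ne_iff.1 hne
    rw [prod_eq_zero (mem_univ i), mul_zero]
    exact Matrix.diagonal_apply_ne' _ hi
  · simp

/-- The normalised square sum of the coefficients. -/
noncomputable def sqSum (r : ι → ℝ) (Z : (ι → Option J) → ℝ) : ℝ :=
  ∑ C, Z C ^ 2 * ∏ i, baseVec (r i) (C i)

/-- Coefficients of the square of the weight in terms of products of centred events. -/
noncomputable def sieveCoef (r : ι → ℝ) (Z : (ι → Option J) → ℝ) (t : ι → Option J) : ℝ :=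
  tensorForm (fun i => coefMat (r i) (t i)) Z

lemma sqSum_nonneg {r : ι → ℝ} (hr : ∀ i, 0 ≤ r i) (Z : (ι → Option J) → ℝ) :
    0 ≤ sqSum r Z :=
  sum_nonneg fun _ _ => mul_nonneg (sq_nonneg _)
    (prod_nonneg fun _ _ => baseVec_nonneg (hr _) _)

lemma sum_abs_majMat_some {r : ℝ} (hr : 0 ≤ r) (hr1 : r ≤ 1) (hk : Fintype.card J * r ≤ 1)
    (s : J) : ∑ a, ∑ b, |majMat r (some s) a b| ≤ 18 := by
  have hb : ∑ a : Option J, |baseVec r a| ≤ 2 := by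
    simp_rw [abs_of_nonneg (baseVec_nonneg hr _), sum_baseVec]
    linarith
  have he : ∑ a, |eventVec r s a| ≤ 3 := by
    have : ∀ a, |eventVec r s a| ≤ |baseVec r a| + if a = some s then 1 else 0 := fun a =>
      (abs_sub _ _).trans (add_le_add le_rfl (by split_ifs <;> simp))
    refine (sum_le_sum fun a _ => this a).trans ?_
    simp only [sum_add_distrib, sum_ite_eq', mem_univ, if_true]
    linarith
  have hb0 : 0 ≤ ∑ a : Option J, |baseVec r a| := by positivity
  have he0 : 0 ≤ ∑ a, |eventVec r s a| := by positivity
  calc ∑ a, ∑ b, |majMat r (some s) a b|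
      ≤ ∑ a, ∑ b, (|eventVec r s a| * |eventVec r s b| + |baseVec r a| * |baseVec r b|) := by
        simp_rw [← abs_mul]
        exact sum_le_sum fun a _ => sum_le_sum fun b _ => abs_add_le _ _
    _ = (∑ a, |eventVec r s a|) * (∑ a, |eventVec r s a|)
        + (∑ a : Option J, |baseVec r a|) * ∑ a : Option J, |baseVec r a| := by
        simp_rw [sum_add_distrib, sum_mul_sum]
    _ ≤ 18 := by nlinarith

/-- A map erasing the sites at which `t` is present. -/
def eraseAt (t C : ι → Option J) (i : ι) : Option J := if t i = none then C i else none

lemma le_sieveCoef_none {r : ι → ℝ} (hr : ∀ i, 0 ≤ r i) (hk : ∀ i, Fintype.card J * r i ≤ 1)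
    (Z : (ι → Option J) → ℝ) :
    ∑ C, Z C ^ 2 * ∏ i, baseVec (r i * (1 - Fintype.card J * r i)) (C i)
      ≤ sieveCoef r Z (fun _ => none) := by
  rw [← tensorForm_diagonal]
  exact (le_abs_self _).trans (abs_tensorForm_le
    (fun i => (coefMat_posSemidef (hr i) (hk i)).add (minMat_posSemidef (hr i) (hk i)))
    (fun i => coefMat_sub_minMat (r i)) Z)

section Bounds
variable {r : ι → ℝ} (hr : ∀ i, 0 ≤ r i) (hr1 : ∀ i, r i ≤ 1)
    (hk : ∀ i, Fintype.card J * r i ≤ 1) {Z : (ι → Option J) → ℝ} (hZ0 : ∀ C, 0 ≤ Z C)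
    (hZ : ∀ t C, Z C ≤ Z (eraseAt t C))
include hr hr1

lemma le_prod_of_sieveCoef_ne_zero {R : ℝ} (hR : 0 < R)
    (hsupp : ∀ C, Z C ≠ 0 → R⁻¹ ≤ ∏ i, baseVec (r i) (C i)) {t : ι → Option J}
    (ht : sieveCoef r Z t ≠ 0) : (R ^ 2)⁻¹ ≤ ∏ i, baseVec (r i) (t i) := by
  obtain ⟨C, -, hC⟩ := exists_ne_zero_of_sum_ne_zero ht
  obtain ⟨C', -, hC'⟩ := exists_ne_zero_of_sum_ne_zero hC
  obtain ⟨h, hprod⟩ := mul_ne_zero_iff.1 hC'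
  have e1 := hsupp C (left_ne_zero_of_mul h)
  have e2 := hsupp C' (right_ne_zero_of_mul h)
  have hb (i) (o : Option J) : 0 ≤ baseVec (r i) o := baseVec_nonneg (hr i) o
  have hb1 (i) (o : Option J) : baseVec (r i) o ≤ 1 := by
    rcases o with _ | s
    exacts [le_rfl, hr1 i]
  calc (R ^ 2)⁻¹ = R⁻¹ * R⁻¹ := by rw [pow_two, mul_inv]
    _ ≤ (∏ i, baseVec (r i) (C i)) * ∏ i, baseVec (r i) (C' i) :=
        mul_le_mul e1 e2 (by positivity) ((by positivity : 0 ≤ R⁻¹).trans e1)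
    _ = ∏ i, (baseVec (r i) (C i) * baseVec (r i) (C' i)) := prod_mul_distrib.symm
    _ ≤ ∏ i, baseVec (r i) (t i) := by
      refine prod_le_prod (fun i _ => mul_nonneg (hb i _) (hb i _)) fun i _ => ?_
      have hi := prod_ne_zero_iff.1 hprod i (mem_univ i)
      beta_reduce at hi
      rcases hti : t i with _ | s
      · exact mul_le_one₀ (hb1 i _) (hb i _) (hb1 i _)
      · rw [hti] at hi
        by_cases ha : C i = some s
        · rw [ha]
          exact mul_le_of_le_one_right (hb i _) (hb1 i _)
        · by_cases hc : C' i = some s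
          · rw [hc]
            exact mul_le_of_le_one_left (hb i _) (hb1 i _)
          · exact absurd (by simp [coefMat, vecMulVec_apply, eventVec, ha, hc]) hi

include hk hZ0 hZ

lemma tensorForm_majMat_le (t : ι → Option J) :
    tensorForm (fun i => majMat (r i) (t i)) Z ≤ (∏ i, baseVec 18 (t i)) * sqSum r Z := by
  have step1 : tensorForm (fun i => majMat (r i) (t i)) Z ≤
      ∑ C : ι → Option J, ∑ C' : ι → Option J,
      Z (eraseAt t C) ^ 2 * ∏ i, |majMat (r i) (t i) (C i) (C' i)| := by
    refine sum_le_sum fun C _ => sum_le_sum fun C' _ => ?_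
    rw [← abs_prod]
    by_cases hp : ∏ i, majMat (r i) (t i) (C i) (C' i) = 0
    · simp [hp]
    · have hCC : eraseAt t C' = eraseAt t C := by
        funext i
        unfold eraseAt
        split_ifs with hi
        · by_contra hne
          exact hp (prod_eq_zero (mem_univ i) (hi ▸ Matrix.diagonal_apply_ne' _ hne))
        · rfl
      have h2 := mul_le_mul (hZ t C) (hZ t C') (hZ0 _) ((hZ0 _).trans (hZ t C))
      rw [hCC, ← pow_two] at h2
      have := hZ0 C
      have := hZ0 C'
      refine (mul_le_mul_of_nonneg_left (le_abs_self _) (by positivity)).trans ?_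
      gcongr
  refine step1.trans ?_
  have step2 : ∀ C C' : ι → Option J, Z (eraseAt t C) ^ 2 * ∏ i, |majMat (r i) (t i) (C i) (C' i)|
      = ∑ D : ι → Option J, Z D ^ 2 * ∏ i, ((if D i = eraseAt t C i then 1 else 0) *
          |majMat (r i) (t i) (C i) (C' i)|) := by
    intro C C'
    rw [sum_eq_single (eraseAt t C)]
    · simp
    · intro D _ hne
      obtain ⟨i, hi⟩ := Function.ne_iff.1 hne
      rw [prod_eq_zero (mem_univ i) (by simp [hi]), mul_zero]
    · simp
  simp_rw [step2]
  rw [sum_congr rfl fun C _ => sum_comm, sum_comm, sqSum, mul_sum]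
  refine sum_le_sum fun D _ => ?_
  simp_rw [← mul_sum]
  refine (congrArg (Z D ^ 2 * ·) (sum_sum_prod fun i a b =>
    (if D i = if t i = none then a else none then 1 else 0) * |majMat (r i) (t i) a b|)).trans_le ?_
  rw [mul_left_comm, ← prod_mul_distrib]
  refine mul_le_mul_of_nonneg_left ?_ (sq_nonneg _)
  refine prod_le_prod (fun i _ => sum_nonneg fun a _ => sum_nonneg
    fun b _ => mul_nonneg (by split_ifs <;> norm_num) (abs_nonneg _)) fun i _ => ?_
  rcases hti : t i with _ | s
  · simp only [if_true, majMat]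
    rw [show baseVec (18 : ℝ) (none : Option J) = 1 from rfl, one_mul, sum_eq_single (D i)]
    · simp only [if_true, one_mul]
      rw [sum_eq_single (D i)]
      · rw [Matrix.diagonal_apply_eq, abs_of_nonneg (baseVec_nonneg (hr i) _)]
      · intro b _ hb
        rw [Matrix.diagonal_apply_ne' _ hb, abs_zero]
      · simp
    · intro a _ ha
      simp [ha.symm]
    · simp
  · simp only [reduceCtorEq, if_false]
    rcases hD : D i with _ | s'
    · simpa [baseVec] using sum_abs_majMat_some (hr i) (hr1 i) (hk i) s
    · simpa [baseVec] using hr i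

lemma abs_sieveCoef_le (t : ι → Option J) :
    |sieveCoef r Z t| ≤ (∏ i, baseVec 18 (t i)) * sqSum r Z :=
  (abs_tensorForm_le (fun i => majMat_add (hr i) (hk i) (t i))
    (fun i => majMat_sub (t i)) Z).trans (tensorForm_majMat_le hr hr1 hk hZ0 hZ t)

lemma sieveCoef_none_le : sieveCoef r Z (fun _ => none) ≤ sqSum r Z := by
  simpa [baseVec] using (le_abs_self _).trans (abs_sieveCoef_le hr hr1 hk hZ0 hZ fun _ => none)

lemma sum_abs_sieveCoef_le {R : ℝ} (hR : 0 < R)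
    (hsupp : ∀ C, Z C ≠ 0 → R⁻¹ ≤ ∏ i, baseVec (r i) (C i)) {c : ℝ} (hc : 0 ≤ c) :
    ∑ t, |sieveCoef r Z t| * ∏ i, baseVec c (t i)
      ≤ sqSum r Z * (R ^ 2 * ∏ i, (1 + Fintype.card J * (18 * c * r i))) := by
  rw [← sum_prod_baseVec, mul_sum, mul_sum]
  refine sum_le_sum fun t _ => ?_
  have e : ∏ i, baseVec (18 * c * r i) (t i)
      = (∏ i, baseVec 18 (t i)) * (∏ i, baseVec c (t i)) * ∏ i, baseVec (r i) (t i) := by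
    simp_rw [← prod_mul_distrib, baseVec_mul]
  have n1 : 0 ≤ ∏ i, baseVec 18 (t i) :=
    prod_nonneg fun _ _ => baseVec_nonneg (by norm_num) _
  have n2 : 0 ≤ ∏ i, baseVec c (t i) := prod_nonneg fun _ _ => baseVec_nonneg hc _
  have n3 : 0 ≤ ∏ i, baseVec (r i) (t i) := prod_nonneg fun i _ => baseVec_nonneg (hr i) _
  have n4 := sqSum_nonneg hr Z
  by_cases ht : sieveCoef r Z t = 0
  · rw [ht, abs_zero, zero_mul, e]
    positivity
  · have h1 := abs_sieveCoef_le hr hr1 hk hZ0 hZ t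
    have h2 := le_prod_of_sieveCoef_ne_zero hr hr1 hR hsupp ht
    have h3 : 1 ≤ R ^ 2 * ∏ i, baseVec (r i) (t i) := by
      rwa [inv_le_iff_one_le_mul₀' (by positivity)] at h2
    rw [e]
    refine (mul_le_mul_of_nonneg_right h1 n2).trans
      ((le_mul_of_one_le_right (by positivity) h3).trans_eq (by ring))

end Bounds

/-- The local factor attached to a colour, given the indicators `e` of the events. -/
def localFactor (r : ℝ) (e : J → ℝ) : Option J → ℝ
  | none => 1
  | some j => r - e j

/-- The centred event indicator. -/
def centred (r : ℝ) (e : J → ℝ) : Option J → ℝ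
  | none => 1
  | some j => e j - r

lemma localFactor_mul {r : ℝ} {e : J → ℝ} (he : ∀ s s', e s * e s' = if s = s' then e s else 0)
    (a b : Option J) :
    localFactor r e a * localFactor r e b = ∑ o, coefMat r o a b * centred r e o := by
  have h1 : ∀ o, localFactor r e o = baseVec r o - ∑ s, (if o = some s then 1 else 0) * e s := by
    rintro (_ | s) <;> simp [localFactor, baseVec]
  have h2 : (∑ s, (if a = some s then 1 else 0) * e s) * ∑ s, (if b = some s then 1 else 0) * e s
      = ∑ s, (if a = some s then 1 else 0) * (if b = some s then 1 else 0) * e s := by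
    simp_rw [sum_mul_sum, mul_mul_mul_comm _ (e _), he, mul_ite, mul_zero, sum_ite_eq, mem_univ, if_true]
  have h3 : ∀ s, (eventVec r s a * eventVec r s b - baseVec r a * baseVec r b) * e s
      = (if a = some s then 1 else 0) * (if b = some s then 1 else 0) * e s
        - baseVec r b * ((if a = some s then 1 else 0) * e s)
        - baseVec r a * ((if b = some s then 1 else 0) * e s) := by
    intro s; unfold eventVec; ring
  have h4 : ∀ s, coefMat r (some s) a b
      = eventVec r s a * eventVec r s b - baseVec r a * baseVec r b := fun _ => rfl
  simp_rw [Fintype.sum_option, centred, mul_one, h4, mul_sub _ (e _)]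
  rw [sum_sub_distrib, ← sum_mul, coefMat_none_apply]
  generalize ∑ s, (eventVec r s a * eventVec r s b - baseVec r a * baseVec r b) = G
  simp_rw [h3, sum_sub_distrib, ← mul_sum, ← h2, h1]
  ring

/-- The sieve weight. -/
noncomputable def sieveSum (r : ι → ℝ) (Z : (ι → Option J) → ℝ) (e : ι → J → ℝ) : ℝ :=
  ∑ C, Z C * ∏ i, localFactor (r i) (e i) (C i)

lemma sieveSum_sq {r : ι → ℝ} (Z : (ι → Option J) → ℝ) {e : ι → J → ℝ}
    (he : ∀ i s s', e i s * e i s' = if s = s' then e i s else 0) :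
    sieveSum r Z e ^ 2 = ∑ t, sieveCoef r Z t * ∏ i, centred (r i) (e i) (t i) := by
  rw [pow_two, sieveSum, sum_mul_sum]
  simp_rw [sieveCoef, tensorForm, sum_mul]
  rw [sum_comm (s := (univ : Finset (ι → Option J))) (t := univ)
    (f := fun t C => ∑ C', Z C * Z C' * (∏ i, coefMat (r i) (t i) (C i) (C' i)) *
      ∏ i, centred (r i) (e i) (t i))]
  refine sum_congr rfl fun C _ => ?_
  rw [sum_comm]
  refine sum_congr rfl fun C' _ => ?_
  simp_rw [mul_assoc, ← mul_sum, ← prod_mul_distrib]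
  have := prod_univ_sum (fun _ : ι => (univ : Finset (Option J)))
    (fun i o => coefMat (r i) o (C i) (C' i) * centred (r i) (e i) o)
  rw [Fintype.piFinset_univ] at this
  rw [← this]
  simp_rw [← localFactor_mul (he _), prod_mul_distrib]
  ring

end Tensor

lemma abs_card_Ioc_modEq_sub_le {a b : ℤ} (hab : a ≤ b) (v : ℤ) {W : ℕ} (hW : 0 < W) :
    |(((Ioc a b).filter fun n => n ≡ v [ZMOD W]).card : ℝ) - ((b : ℝ) - a) / W| ≤ 1 := by
  have h := Int.Ioc_filter_modEq_card a b (by exact_mod_cast hW : (0 : ℤ) < W) v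
  have hab' : (a : ℚ) ≤ b := by exact_mod_cast hab
  rw [max_eq_left (sub_nonneg.2 (Int.floor_le_floor (by gcongr)))] at h
  have h' := congrArg (Int.cast (R := ℝ)) h
  push_cast at h'
  have key (c : ℤ) : (⌊(c - v : ℚ) / W⌋ : ℝ) ≤ ((c : ℝ) - v) / W ∧
      ((c : ℝ) - v) / W < (⌊(c - v : ℚ) / W⌋ : ℝ) + 1 :=
    ⟨by exact_mod_cast Int.floor_le ((c - v : ℚ) / W),
      by exact_mod_cast Int.lt_floor_add_one ((c - v : ℚ) / W)⟩
  have e : ((b : ℝ) - a) / W = ((b : ℝ) - v) / W - ((a : ℝ) - v) / W := by ring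
  rw [h', e, abs_le]
  constructor <;> linarith [key a, key b]

lemma exists_modEq_and {W m : ℕ} (h : Nat.Coprime W m) (v u : ℤ) :
    ∃ v' : ℤ, ∀ n : ℤ, (n ≡ v [ZMOD W] ∧ n ≡ u [ZMOD m]) ↔ n ≡ v' [ZMOD ((W * m : ℕ) : ℤ)] := by
  obtain ⟨a, b, hab⟩ := Nat.isCoprime_iff_coprime.2 h
  refine ⟨u * (a * W) + v * (b * m), fun n => ?_⟩
  have hc : (W : ℤ).natAbs.Coprime (m : ℤ).natAbs := by simpa using h
  rw [Nat.cast_mul, ← Int.modEq_and_modEq_iff_modEq_mul hc]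
  have e1 : u * (a * W) + v * (b * m) ≡ v [ZMOD W] :=
    Int.modEq_iff_dvd.2 ⟨v * a - u * a, by linear_combination (-v) * hab⟩
  have e2 : u * (a * W) + v * (b * m) ≡ u [ZMOD m] :=
    Int.modEq_iff_dvd.2 ⟨u * b - v * b, by linear_combination (-u) * hab⟩
  exact and_congr ⟨(·.trans e1.symm), (·.trans e1)⟩ ⟨(·.trans e2.symm), (·.trans e2)⟩

/-- The average of an `m`-periodic function. -/
noncomputable def avg (m : ℕ) (F : ℤ → ℝ) : ℝ := (∑ u ∈ range m, F u) / m

lemma sum_filter_eq_sum_range {m : ℕ} (hm : 0 < m) {F : ℤ → ℝ}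
    (hF : ∀ u v : ℤ, u ≡ v [ZMOD m] → F u = F v) (A : Finset ℤ) (G : ℤ → ℝ) :
    ∑ n ∈ A, F n * G n = ∑ u ∈ range m, F u * ∑ n ∈ A with n ≡ u [ZMOD m], G n := by
  have hm' : (0 : ℤ) < m := by exact_mod_cast hm
  simp_rw [mul_sum, sum_filter]
  rw [sum_comm]
  refine sum_congr rfl fun n _ => ?_
  rw [sum_eq_single (n % m).toNat]
  · have e : (((n % m).toNat : ℕ) : ℤ) = n % m := Int.toNat_of_nonneg (Int.emod_nonneg _ hm'.ne')
    have e2 : n ≡ (((n % m).toNat : ℕ) : ℤ) [ZMOD m] := by rw [e]; exact (Int.mod_modEq n m).symm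
    rw [if_pos e2, hF _ _ e2]
  · intro u hu hne
    refine if_neg fun h => hne ?_
    rw [h, Int.emod_eq_of_lt (by positivity) (by exact_mod_cast mem_range.1 hu), Int.toNat_natCast]
  · intro h
    have := Int.emod_nonneg n hm'.ne'
    have := Int.emod_lt_of_pos n hm'
    grind

/-- Counting with products of periodic functions to coprime moduli. -/
lemma abs_sum_prod_periodic_sub_le {ι : Type*} [DecidableEq ι] {ℓ : ι → ℕ} (hℓ : ∀ i, 0 < ℓ i)
    (hcop : ∀ i j, i ≠ j → Nat.Coprime (ℓ i) (ℓ j)) {F : ι → ℤ → ℝ}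
    (hF : ∀ i, ∀ u v : ℤ, u ≡ v [ZMOD ℓ i] → F i u = F i v) {a b : ℤ} (hab : a ≤ b)
    (T : Finset ι) : ∀ {W : ℕ}, 0 < W → (∀ i ∈ T, Nat.Coprime W (ℓ i)) → ∀ v : ℤ,
    |∑ n ∈ Ioc a b with n ≡ v [ZMOD W], ∏ i ∈ T, F i n
        - ((b : ℝ) - a) / W * ∏ i ∈ T, avg (ℓ i) (F i)|
      ≤ ∏ i ∈ T, ∑ u ∈ range (ℓ i), |F i u| := by
  induction T using Finset.induction_on with
  | empty =>
    intro W hW _ v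
    simpa using abs_card_Ioc_modEq_sub_le hab v hW
  | insert i T hi ih =>
    intro W hW hc v
    have hci := hc i (mem_insert_self _ _)
    choose v' hv' using fun u : ℕ => exists_modEq_and hci v (u : ℤ)
    have hW' : 0 < W * ℓ i := Nat.mul_pos hW (hℓ i)
    have hc' : ∀ j ∈ T, Nat.Coprime (W * ℓ i) (ℓ j) := fun j hj =>
      Nat.Coprime.mul_left (hc j (mem_insert_of_mem hj))
        (hcop i j (fun h => hi (h ▸ hj)))
    have e1 : ∑ n ∈ Ioc a b with n ≡ v [ZMOD W], ∏ j ∈ insert i T, F j n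
        = ∑ u ∈ range (ℓ i), F i u *
          ∑ n ∈ Ioc a b with n ≡ v' u [ZMOD ((W * ℓ i : ℕ) : ℤ)], ∏ j ∈ T, F j n := by
      simp_rw [prod_insert hi]
      rw [sum_filter_eq_sum_range (hℓ i) (hF i)]
      refine sum_congr rfl fun u _ => ?_
      rw [filter_filter]
      simp_rw [hv' u]
    have e2 : ((b : ℝ) - a) / W * ∏ j ∈ insert i T, avg (ℓ j) (F j)
        = ∑ u ∈ range (ℓ i), F i u *
          (((b : ℝ) - a) / (W * ℓ i : ℕ) * ∏ j ∈ T, avg (ℓ j) (F j)) := by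
      rw [prod_insert hi, ← sum_mul]
      unfold avg
      push_cast
      field_simp
    rw [e1, e2, ← sum_sub_distrib, prod_insert hi, sum_mul]
    refine (abs_sum_le_sum_abs _ _).trans (sum_le_sum fun u _ => ?_)
    rw [← mul_sub, abs_mul]
    exact mul_le_mul_of_nonneg_left (ih hW' hc' (v' u)) (abs_nonneg _)

section TupleWeights
variable {ι J : Type*} [Fintype ι] [DecidableEq ι] [Fintype J] [DecidableEq J]

/-- Indicator of the event `m ∣ n + c`. -/
def ev (m : ℕ) (c n : ℤ) : ℝ := if (m : ℤ) ∣ n + c then 1 else 0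

lemma ev_periodic {m : ℕ} (c : ℤ) {u v : ℤ} (h : u ≡ v [ZMOD m]) : ev m c u = ev m c v := by
  unfold ev
  have : (m : ℤ) ∣ u + c ↔ (m : ℤ) ∣ v + c := by
    rw [← Int.modEq_zero_iff_dvd, ← Int.modEq_zero_iff_dvd]
    exact ⟨fun h' => ((h.add_right c).symm).trans h', fun h' => (h.add_right c).trans h'⟩
  simp only [this]

lemma sum_ev {m : ℕ} (hm : 0 < m) (c : ℤ) : ∑ u ∈ range m, ev m c (u : ℤ) = 1 := by
  have hm' : (0 : ℤ) < m := by exact_mod_cast hm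
  have e : ∀ u : ℤ, ev m c u = ev m c u * (fun _ => 1) u := fun u => by simp
  have e3 : (((-c % m).toNat : ℕ) : ℤ) = -c % m := Int.toNat_of_nonneg (Int.emod_nonneg _ hm'.ne')
  rw [sum_eq_single (-c % m).toNat]
  · unfold ev
    rw [if_pos]
    rw [e3, ← Int.modEq_zero_iff_dvd]
    have := (Int.mod_modEq (-c) m).add_right c
    simpa using this
  · intro u hu hne
    unfold ev
    rw [if_neg]
    intro h
    apply hne
    have h1 : -c ≡ u [ZMOD m] := by
      rw [Int.modEq_iff_dvd]; simpa using h
    have h2 : -c % m = (u : ℤ) := by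
      rw [h1]; exact Int.emod_eq_of_lt (by positivity) (by exact_mod_cast mem_range.1 hu)
    rw [h2]; simp
  · intro h
    exfalso
    apply h
    rw [mem_range, Int.toNat_lt (Int.emod_nonneg _ hm'.ne')]
    exact Int.emod_lt_of_pos _ hm'

lemma ev_mul_ev (m : ℕ) (c c' n : ℤ) :
    ev m c n * ev m c' n = (if (m : ℤ) ∣ c - c' then 1 else 0) * ev m c n := by
  unfold ev
  by_cases h : (m : ℤ) ∣ n + c
  · have : (m : ℤ) ∣ n + c' ↔ (m : ℤ) ∣ c - c' := by
      rw [show n + c' = (n + c) - (c - c') by ring]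
      exact ⟨fun h' => (dvd_sub_right h).1 h', fun h' => dvd_sub h h'⟩
    simp [h, this]
  · simp [h]

lemma ev_nonneg (m : ℕ) (c n : ℤ) : 0 ≤ ev m c n := by unfold ev; split_ifs <;> norm_num

lemma ev_le_one (m : ℕ) (c n : ℤ) : ev m c n ≤ 1 := by unfold ev; split_ifs <;> norm_num

/-- The local centred function at the prime `m` for the linear forms `n + sh s * p`. -/
noncomputable def loc (m : ℕ) (sh : J → ℤ) (p n : ℤ) (o : Option J) : ℝ :=
  centred (1 / (m : ℝ)) (fun s => ev m (sh s * p) n) o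

/-- Local correlation. -/
noncomputable def theta (m : ℕ) (sh : J → ℤ) (p p' : ℤ) : Option J → Option J → ℝ
  | none, none => 1
  | some s, some s' => (if (m : ℤ) ∣ sh s * p - sh s' * p' then 1 / (m : ℝ) else 0)
      - 1 / (m : ℝ) ^ 2
  | _, _ => 0

lemma loc_periodic (m : ℕ) (sh : J → ℤ) (p : ℤ) (o : Option J) {u v : ℤ}
    (h : u ≡ v [ZMOD m]) : loc m sh p u o = loc m sh p v o := by
  rcases o with _ | s
  · rfl
  · simp [loc, centred, ev_periodic _ h]

lemma avg_loc {m : ℕ} (hm : 0 < m) (sh : J → ℤ) (p p' : ℤ) (o o' : Option J) :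
    avg m (fun n => loc m sh p n o * loc m sh p' n o') = theta m sh p p' o o' := by
  have hm' : (m : ℝ) ≠ 0 := by positivity
  rcases o with _ | s <;> rcases o' with _ | s'
  · simp [avg, loc, centred, theta, hm']
  · simp [avg, loc, centred, theta, sum_ev hm, hm']
  · simp [avg, loc, centred, theta, sum_ev hm, hm']
  · have e : ∀ u : ℤ, (ev m (sh s * p) u - 1 / (m : ℝ)) * (ev m (sh s' * p') u - 1 / (m : ℝ))
        = (if (m : ℤ) ∣ sh s * p - sh s' * p' then 1 else 0) * ev m (sh s * p) u
          - 1 / (m : ℝ) * ev m (sh s * p) u - 1 / (m : ℝ) * ev m (sh s' * p') u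
          + 1 / (m : ℝ) ^ 2 := by
      intro u; rw [← ev_mul_ev]; ring
    simp only [avg, loc, centred, theta, e, sum_add_distrib, sum_sub_distrib,
      ← mul_sum, sum_ev hm, sum_const, card_range, nsmul_eq_mul]
    split_ifs <;> field_simp <;> ring

lemma abs_loc_le {m : ℕ} (hm : 0 < m) (sh : J → ℤ) (p n : ℤ) (o : Option J) :
    |loc m sh p n o| ≤ 1 := by
  have hm' : (1 : ℝ) ≤ m := by exact_mod_cast hm
  rcases o with _ | s
  · simp [loc, centred]
  · have h1 := ev_nonneg m (sh s * p) n
    have h2 := ev_le_one m (sh s * p) n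
    have h3 : 1 / (m : ℝ) ≤ 1 := by rw [div_le_one (by linarith)]; exact hm'
    have h4 : 0 ≤ 1 / (m : ℝ) := by positivity
    simp only [loc, centred]
    rw [abs_le]; constructor <;> linarith

lemma sum_abs_loc_le {m : ℕ} (hm : 0 < m) (sh : J → ℤ) (p : ℤ) (s : J) :
    ∑ u ∈ range m, |loc m sh p u (some s)| ≤ 2 := by
  have hm' : (m : ℝ) ≠ 0 := by positivity
  calc ∑ u ∈ range m, |loc m sh p u (some s)|
      ≤ ∑ u ∈ range m, (ev m (sh s * p) u + 1 / (m : ℝ)) := by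
        refine sum_le_sum fun u _ => ?_
        simp only [loc, centred]
        refine (abs_sub _ _).trans ?_
        rw [abs_of_nonneg (ev_nonneg _ _ _), abs_of_nonneg (by positivity)]
    _ = 2 := by
        rw [sum_add_distrib, sum_ev hm]
        simp [hm']; norm_num

lemma sum_abs_loc_mul_le {m : ℕ} (hm : 0 < m) (sh : J → ℤ) (p p' : ℤ) (o o' : Option J)
    (h : o ≠ none ∨ o' ≠ none) :
    ∑ u ∈ range m, |loc m sh p u o * loc m sh p' u o'| ≤ baseVec 2 o * baseVec 2 o' := by
  rcases o with _ | s
  · rcases o' with _ | s'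
    · simp at h
    · have := sum_abs_loc_le hm sh p' s'
      simpa [loc, centred, baseVec] using this
  · calc ∑ u ∈ range m, |loc m sh p u (some s) * loc m sh p' u o'|
        ≤ ∑ u ∈ range m, |loc m sh p u (some s)| := by
          refine sum_le_sum fun u _ => ?_
          rw [abs_mul]
          exact mul_le_of_le_one_right (abs_nonneg _) (abs_loc_le hm _ _ _ _)
      _ ≤ 2 := sum_abs_loc_le hm sh p s
      _ ≤ _ := by
          rcases o' with _ | s' <;> simp [baseVec]

/-- Product over the sites of the centred local functions. -/
noncomputable def psi (ℓ : ι → ℕ) (sh : J → ℤ) (p n : ℤ) (t : ι → Option J) : ℝ :=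
  ∏ i, loc (ℓ i) sh p n (t i)

lemma abs_sum_psi_mul_psi_sub_le {ℓ : ι → ℕ} (hℓ : ∀ i, (ℓ i).Prime)
    (hinj : Function.Injective ℓ) (sh : J → ℤ) (p p' : ℤ) {a b : ℤ} (hab : a ≤ b)
    {W : ℕ} (hW : 0 < W) (hWc : ∀ i, Nat.Coprime W (ℓ i)) (v : ℤ) (t t' : ι → Option J) :
    |∑ n ∈ Ioc a b with n ≡ v [ZMOD W], psi ℓ sh p n t * psi ℓ sh p' n t'
        - ((b : ℝ) - a) / W * ∏ i, theta (ℓ i) sh p p' (t i) (t' i)|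
      ≤ (∏ i, baseVec 2 (t i)) * ∏ i, baseVec 2 (t' i) := by
  have hpos : ∀ i, 0 < ℓ i := fun i => (hℓ i).pos
  set T : Finset ι := univ.filter fun i => t i ≠ none ∨ t' i ≠ none with hT
  have hout : ∀ i ∉ T, t i = none ∧ t' i = none := by
    intro i hi
    simp only [hT, mem_filter, mem_univ, true_and, not_or, not_not] at hi
    exact hi
  have key := abs_sum_prod_periodic_sub_le hpos
    (fun i j hij => (Nat.coprime_primes (hℓ i) (hℓ j)).2 fun h => hij (hinj h))
    (F := fun i n => loc (ℓ i) sh p n (t i) * loc (ℓ i) sh p' n (t' i))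
    (fun i u v h => by simp only [loc_periodic _ _ _ _ h]) hab T hW (fun i _ => hWc i) v
  have e1 : ∀ n : ℤ, ∏ i ∈ T, loc (ℓ i) sh p n (t i) * loc (ℓ i) sh p' n (t' i)
      = psi ℓ sh p n t * psi ℓ sh p' n t' := by
    intro n
    rw [psi, psi, ← prod_mul_distrib]
    refine prod_subset (subset_univ _) fun i _ hi => ?_
    rw [(hout i hi).1, (hout i hi).2]; simp [loc, centred]
  have e2 : ∏ i ∈ T, avg (ℓ i) (fun n => loc (ℓ i) sh p n (t i) * loc (ℓ i) sh p' n (t' i))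
      = ∏ i, theta (ℓ i) sh p p' (t i) (t' i) := by
    simp_rw [avg_loc (hpos _)]
    refine prod_subset (subset_univ _) fun i _ hi => ?_
    rw [(hout i hi).1, (hout i hi).2]; simp [theta]
  rw [e2] at key
  simp_rw [e1] at key
  refine key.trans ?_
  rw [← prod_mul_distrib]
  calc ∏ i ∈ T, ∑ u ∈ range (ℓ i), |loc (ℓ i) sh p u (t i) * loc (ℓ i) sh p' u (t' i)|
      ≤ ∏ i ∈ T, (baseVec 2 (t i) * baseVec 2 (t' i)) := by
        refine prod_le_prod (fun i _ => sum_nonneg fun _ _ => abs_nonneg _)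
          fun i hi => ?_
        exact sum_abs_loc_mul_le (hpos i) sh p p' _ _ (mem_filter.1 hi).2
    _ = _ := prod_subset (subset_univ _) fun i _ hi => by
        rw [(hout i hi).1, (hout i hi).2]; simp [baseVec]

/-- Hypotheses on sieve coefficients. -/
structure Admissible (ℓ : ι → ℕ) (Z : (ι → Option J) → ℝ) (R : ℝ) : Prop where
  prime : ∀ i, (ℓ i).Prime
  inj : Function.Injective ℓ
  card_le : ∀ i, Fintype.card J ≤ ℓ i
  nonneg : ∀ C, 0 ≤ Z C
  anti : ∀ t C, Z C ≤ Z (eraseAt t C)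
  R_pos : 0 < R
  supp : ∀ C, Z C ≠ 0 → R⁻¹ ≤ ∏ i, baseVec (1 / (ℓ i : ℝ)) (C i)

/-- The weight attached to the linear forms `n + sh s * p`. -/
noncomputable def weight (ℓ : ι → ℕ) (Z : (ι → Option J) → ℝ) (sh : J → ℤ) (p n : ℤ) : ℝ :=
  sieveSum (fun i => 1 / (ℓ i : ℝ)) Z (fun i s => ev (ℓ i) (sh s * p) n)

/-- The expected square of the weight. -/
noncomputable def meanSq (ℓ : ι → ℕ) (Z : (ι → Option J) → ℝ) : ℝ :=
  sieveCoef (fun i => 1 / (ℓ i : ℝ)) Z (fun _ => none)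

/-- The normalised square sum. -/
noncomputable def normSq (ℓ : ι → ℕ) (Z : (ι → Option J) → ℝ) : ℝ :=
  sqSum (fun i => 1 / (ℓ i : ℝ)) Z

/-- The error factor. -/
noncomputable def errFactor (ℓ : ι → ℕ) (k : ℕ) (R : ℝ) : ℝ :=
  R ^ 2 * ∏ i, (1 + k * (18 * 2 * (1 / (ℓ i : ℝ))))

section
variable {ℓ : ι → ℕ} {Z : (ι → Option J) → ℝ} {R : ℝ}

lemma Admissible.inv_nonneg (_h : Admissible ℓ Z R) (i : ι) : 0 ≤ 1 / (ℓ i : ℝ) := by positivity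

lemma Admissible.inv_le_one (h : Admissible ℓ Z R) (i : ι) : 1 / (ℓ i : ℝ) ≤ 1 := by
  have : (1 : ℝ) ≤ ℓ i := by exact_mod_cast (h.prime i).one_lt.le
  rw [div_le_one (by linarith)]; exact this

lemma Admissible.card_mul_le (h : Admissible ℓ Z R) (i : ι) :
    Fintype.card J * (1 / (ℓ i : ℝ)) ≤ 1 := by
  have : (0 : ℝ) < ℓ i := by exact_mod_cast (h.prime i).pos
  rw [mul_one_div, div_le_one this]
  exact_mod_cast h.card_le i

lemma Admissible.normSq_nonneg (h : Admissible ℓ Z R) : 0 ≤ normSq ℓ Z :=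
  sqSum_nonneg h.inv_nonneg Z

lemma Admissible.meanSq_le (h : Admissible ℓ Z R) : meanSq ℓ Z ≤ normSq ℓ Z :=
  sieveCoef_none_le h.inv_nonneg h.inv_le_one h.card_mul_le h.nonneg h.anti

lemma Admissible.le_meanSq (h : Admissible ℓ Z R) :
    ∑ C, Z C ^ 2 * ∏ i, baseVec (1 / (ℓ i : ℝ) * (1 - Fintype.card J * (1 / (ℓ i : ℝ)))) (C i)
      ≤ meanSq ℓ Z :=
  le_sieveCoef_none h.inv_nonneg h.card_mul_le Z

lemma Admissible.sum_abs_le (h : Admissible ℓ Z R) :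
    ∑ t, |sieveCoef (fun i => 1 / (ℓ i : ℝ)) Z t| * ∏ i, baseVec 2 (t i)
      ≤ normSq ℓ Z * errFactor ℓ (Fintype.card J) R :=
  sum_abs_sieveCoef_le h.inv_nonneg h.inv_le_one h.card_mul_le h.nonneg h.anti h.R_pos h.supp
    (by norm_num)

lemma Admissible.weight_sq (_h : Admissible ℓ Z R) {sh : J → ℤ} {p : ℤ}
    (hsh : ∀ i s s', s ≠ s' → ¬ (ℓ i : ℤ) ∣ sh s * p - sh s' * p) (n : ℤ) :
    weight ℓ Z sh p n ^ 2
      = ∑ t, sieveCoef (fun i => 1 / (ℓ i : ℝ)) Z t * psi ℓ sh p n t := by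
  rw [weight, sieveSum_sq]
  · rfl
  · intro i s s'
    rw [ev_mul_ev]
    by_cases hs : s = s'
    · subst hs; simp
    · simp [hsh i s s' hs, hs]

lemma abs_psi_le (hℓ : ∀ i, 0 < ℓ i) (sh : J → ℤ) (p n : ℤ) (t : ι → Option J) :
    |psi ℓ sh p n t| ≤ 1 := by
  rw [psi, abs_prod]
  exact prod_le_one (fun _ _ => abs_nonneg _) fun i _ => abs_loc_le (hℓ i) _ _ _ _

lemma one_le_prod_baseVec_two (t : ι → Option J) : (1 : ℝ) ≤ ∏ i, baseVec 2 (t i) := by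
  refine prod_induction _ (fun x : ℝ => 1 ≤ x) (fun a b ha hb => ?_) le_rfl fun i _ => ?_
  · nlinarith
  · rcases t i with _ | s <;> simp [baseVec]

lemma Admissible.weight_sq_le (h : Admissible ℓ Z R) {sh : J → ℤ} {p : ℤ}
    (hsh : ∀ i s s', s ≠ s' → ¬ (ℓ i : ℤ) ∣ sh s * p - sh s' * p) (n : ℤ) :
    weight ℓ Z sh p n ^ 2 ≤ normSq ℓ Z * errFactor ℓ (Fintype.card J) R := by
  rw [h.weight_sq hsh]
  refine le_trans (sum_le_sum fun t _ => ?_) h.sum_abs_le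
  refine (le_abs_self _).trans ?_
  rw [abs_mul]
  exact mul_le_mul_of_nonneg_left ((abs_psi_le (fun i => (h.prime i).pos) _ _ _ _).trans
    (one_le_prod_baseVec_two t)) (abs_nonneg _)

lemma Admissible.abs_sum_weight_sq_sub_le (h : Admissible ℓ Z R) {sh : J → ℤ} {p : ℤ}
    (hsh : ∀ i s s', s ≠ s' → ¬ (ℓ i : ℤ) ∣ sh s * p - sh s' * p) {a b : ℤ} (hab : a ≤ b)
    {W : ℕ} (hW : 0 < W) (hWc : ∀ i, Nat.Coprime W (ℓ i)) (v : ℤ) :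
    |∑ n ∈ Ioc a b with n ≡ v [ZMOD W], weight ℓ Z sh p n ^ 2
        - ((b : ℝ) - a) / W * meanSq ℓ Z| ≤ normSq ℓ Z * errFactor ℓ (Fintype.card J) R := by
  set g := sieveCoef (fun i => 1 / (ℓ i : ℝ)) Z with hg
  have e1 : ∑ n ∈ Ioc a b with n ≡ v [ZMOD W], weight ℓ Z sh p n ^ 2
      = ∑ t, g t * ∑ n ∈ Ioc a b with n ≡ v [ZMOD W], psi ℓ sh p n t * psi ℓ sh p n (fun _ => none) := by
    simp_rw [h.weight_sq hsh, mul_sum]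
    rw [sum_comm]
    refine sum_congr rfl fun t _ => sum_congr rfl fun n _ => ?_
    simp [psi, loc, centred, hg]
  have e2 : ((b : ℝ) - a) / W * meanSq ℓ Z
      = ∑ t, g t * (((b : ℝ) - a) / W * ∏ i, theta (ℓ i) sh p p (t i) none) := by
    rw [sum_eq_single (fun _ => none)]
    · simp [theta, meanSq, hg]; ring
    · intro t _ ht
      obtain ⟨i, hi⟩ := Function.ne_iff.1 ht
      rw [prod_eq_zero (mem_univ i)]
      · simp
      · rcases hti : t i with _ | s
        · exact absurd hti hi
        · rfl
    · simp
  rw [e1, e2, ← sum_sub_distrib]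
  refine (abs_sum_le_sum_abs _ _).trans (le_trans (sum_le_sum fun t _ => ?_)
    h.sum_abs_le)
  rw [← mul_sub, abs_mul]
  refine mul_le_mul_of_nonneg_left ?_ (abs_nonneg _)
  have := abs_sum_psi_mul_psi_sub_le h.prime h.inj sh p p hab hW hWc v t (fun _ => none)
  simpa [baseVec] using this

end

/-- Majorant of the local correlation. -/
noncomputable def thetaMaj (m : ℕ) (sh : J → ℤ) (p p' : ℤ) : Option J → Option J → ℝ
  | none, none => 1
  | some s, some s' => (if (m : ℤ) ∣ sh s * p - sh s' * p' then 1 / (m : ℝ) else 0)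
      + 1 / (m : ℝ) ^ 2
  | _, _ => 0

/-- A local weight supported on pairs that are both absent or both present. -/
def pairVec (c : ℝ) : Option J → Option J → ℝ
  | none, none => 1
  | some _, some _ => c
  | _, _ => 0

lemma pairVec_nonneg {c : ℝ} (hc : 0 ≤ c) (o o' : Option J) : 0 ≤ pairVec c o o' := by
  rcases o with _ | s <;> rcases o' with _ | s' <;> simp [pairVec, hc]

lemma prod_pairVec_nonneg {c : ι → ℝ} (hc : ∀ i, 0 ≤ c i) (t t' : ι → Option J) :
    0 ≤ ∏ i, pairVec (c i) (t i) (t' i) :=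
  prod_nonneg fun i _ => pairVec_nonneg (hc i) _ _

lemma abs_theta_le (m : ℕ) (sh : J → ℤ) (p p' : ℤ) (o o' : Option J) :
    |theta m sh p p' o o'| ≤ thetaMaj m sh p p' o o' := by
  rcases o with _ | s <;> rcases o' with _ | s' <;> simp only [theta, thetaMaj, abs_one, abs_zero,
    le_refl]
  exact (abs_sub _ _).trans (add_le_add (abs_of_nonneg (by positivity)).le
    (abs_of_nonneg (by positivity)).le)

lemma sum_ite_dvd_le {m : ℕ} (hm : m.Prime) {c d : ℤ} (hd : ¬ (m : ℤ) ∣ d) :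
    ∑ u ∈ range m, (if (m : ℤ) ∣ c - d * (u : ℤ) then 1 / (m : ℝ) else 0) ≤ 1 / (m : ℝ) := by
  rw [← sum_filter, sum_const, nsmul_eq_mul]
  refine mul_le_of_le_one_left (by positivity) ?_
  norm_cast
  refine card_le_one.2 fun u hu u' hu' => ?_
  rw [mem_filter, mem_range] at hu hu'
  have h := dvd_sub hu'.2 hu.2
  have h2 : (m : ℤ) ∣ d * ((u : ℤ) - u') := by grind
  have h3 := ((Nat.prime_iff_prime_int.1 hm).dvd_or_dvd h2).resolve_left hd
  exact (Nat.ModEq.eq_of_lt_of_lt (Int.natCast_modEq_iff.1 (Int.modEq_iff_dvd.2 h3)) hu'.1 hu.1).symm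

lemma thetaMaj_nonneg (m : ℕ) (sh : J → ℤ) (p p' : ℤ) (o o' : Option J) :
    0 ≤ thetaMaj m sh p p' o o' := (abs_nonneg _).trans (abs_theta_le m sh p p' o o')

lemma thetaMaj_periodic {m : ℕ} (sh : J → ℤ) (p : ℤ) (o o' : Option J) {u v : ℤ}
    (h : u ≡ v [ZMOD m]) : thetaMaj m sh p u o o' = thetaMaj m sh p v o o' := by
  rcases o with _ | s <;> rcases o' with _ | s' <;> simp only [thetaMaj]
  have h1 : sh s * p - sh s' * u ≡ sh s * p - sh s' * v [ZMOD m] :=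
    (Int.ModEq.refl _).sub ((Int.ModEq.refl _).mul h)
  simp only [h1.dvd_iff]

lemma sum_thetaMaj_le {m : ℕ} (hm : m.Prime) {sh : J → ℤ} (hsh : ∀ s, ¬ (m : ℤ) ∣ sh s) (p : ℤ)
    (s s' : J) : ∑ u ∈ range m, thetaMaj m sh p u (some s) (some s') ≤ 2 / (m : ℝ) := by
  have hm' : (m : ℝ) ≠ 0 := by exact_mod_cast hm.ne_zero
  simp only [thetaMaj, sum_add_distrib, sum_const, card_range, nsmul_eq_mul]
  have := sum_ite_dvd_le hm (c := sh s * p) (hsh s')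
  have e : (m : ℝ) * (1 / (m : ℝ) ^ 2) = 1 / m := by field_simp
  grind

lemma sum_prod_abs_theta_le {ℓ : ι → ℕ} (hℓ : ∀ i, (ℓ i).Prime) (hinj : Function.Injective ℓ)
    {sh : J → ℤ} (hsh : ∀ i s, ¬ (ℓ i : ℤ) ∣ sh s) {P' : Finset ℕ} {X W : ℕ} {p0 : ℤ}
    (hW : 0 < W) (hWc : ∀ i, Nat.Coprime W (ℓ i))
    (hP : ∀ p ∈ P', 0 < p ∧ p ≤ X ∧ (p : ℤ) ≡ p0 [ZMOD W]) {R : ℝ} (hR : 0 < R)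
    (hWR : W * R ^ 2 ≤ X) (p : ℤ) (t t' : ι → Option J)
    (ht : (R ^ 2)⁻¹ ≤ ∏ i, baseVec (1 / (ℓ i : ℝ)) (t i)) :
    ∑ p' ∈ P', ∏ i, |theta (ℓ i) sh p p' (t i) (t' i)|
      ≤ 2 * ((X : ℝ) / W) * ∏ i, pairVec (2 * (1 / (ℓ i : ℝ)) ^ 2) (t i) (t' i) := by
  have hW' : (0 : ℝ) < W := by exact_mod_cast hW
  have hℓ' : ∀ i, (0 : ℝ) < ℓ i := fun i => by exact_mod_cast (hℓ i).pos
  have hpv : 0 ≤ ∏ i, pairVec (2 * (1 / (ℓ i : ℝ)) ^ 2) (t i) (t' i) :=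
    prod_pairVec_nonneg (fun _ => by positivity) _ _
  by_cases hc : ∀ i, t i = none ↔ t' i = none
  swap
  · obtain ⟨i, hi⟩ := not_forall.1 hc
    rw [sum_eq_zero]
    · positivity
    · intro p' _
      refine prod_eq_zero (mem_univ i) ?_
      rcases h1 : t i with _ | s <;> rcases h2 : t' i with _ | s' <;> simp_all [theta]
  set T : Finset ι := univ.filter fun i => t i ≠ none with hT
  have hout : ∀ i ∉ T, t i = none ∧ t' i = none := by simp_all
  set F : ι → ℤ → ℝ := fun i n => thetaMaj (ℓ i) sh p n (t i) (t' i) with hF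
  have hF0 : ∀ i n, 0 ≤ F i n := fun i n => thetaMaj_nonneg _ _ _ _ _ _
  have hsum : ∀ i ∈ T, ∑ u ∈ range (ℓ i), F i u ≤ 2 / (ℓ i : ℝ) := by
    intro i hi
    have h := (mem_filter.1 hi).2
    obtain ⟨s, h1⟩ := Option.ne_none_iff_exists'.1 h
    obtain ⟨s', h2⟩ := Option.ne_none_iff_exists'.1 (mt (hc i).2 h)
    simp only [hF, h1, h2]
    exact sum_thetaMaj_le (hℓ i) (hsh i) p s s'
  have key := abs_sum_prod_periodic_sub_le (fun i => (hℓ i).pos)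
    (fun i j hij => (Nat.coprime_primes (hℓ i) (hℓ j)).2 fun h => hij (hinj h))
    (F := F) (fun i u v h => thetaMaj_periodic _ _ _ _ h) (a := 0) (b := X) (by positivity)
    T hW (fun i _ => hWc i) p0
  have s1 : ∑ p' ∈ P', ∏ i, |theta (ℓ i) sh p p' (t i) (t' i)|
      ≤ ∑ n ∈ Ioc (0 : ℤ) X with n ≡ p0 [ZMOD W], ∏ i ∈ T, F i n := by
    calc _ ≤ ∑ p' ∈ P', ∏ i ∈ T, F i p' := by
          refine sum_le_sum fun p' _ => (prod_le_prod (fun _ _ => abs_nonneg _)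
            fun i _ => abs_theta_le _ _ _ _ _ _).trans_eq ?_
          refine (prod_subset (subset_univ _) fun i _ hi => ?_).symm
          rw [(hout i hi).1, (hout i hi).2]
          rfl
      _ = ∑ n ∈ P'.map Nat.castEmbedding, ∏ i ∈ T, F i n := by
          rw [sum_map]
          rfl
      _ ≤ _ := by
          refine sum_le_sum_of_subset_of_nonneg (fun n hn => ?_) fun n _ _ =>
            prod_nonneg fun i _ => hF0 i n
          obtain ⟨p', hp', rfl⟩ := mem_map.1 hn
          have := hP p' hp'
          rw [mem_filter, mem_Ioc, Nat.castEmbedding_apply]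
          grind
  have s2 : ∏ i ∈ T, avg (ℓ i) (F i) ≤ ∏ i ∈ T, (2 * (1 / (ℓ i : ℝ)) ^ 2) := by
    refine prod_le_prod (fun i _ => div_nonneg (sum_nonneg fun u _ => hF0 i _)
      (hℓ' i).le) fun i hi => ?_
    rw [avg, div_le_iff₀ (hℓ' i)]
    exact (hsum i hi).trans_eq (by field_simp)
  have s3 : ∏ i ∈ T, ∑ u ∈ range (ℓ i), |F i u| ≤ (∏ i ∈ T, (2 * (1 / (ℓ i : ℝ)) ^ 2)) * (X / W) := by
    have b1 : ∏ i ∈ T, ∑ u ∈ range (ℓ i), |F i u| ≤ ∏ i ∈ T, ((2 * (1 / (ℓ i : ℝ)) ^ 2) * ℓ i) := by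
      refine prod_le_prod (fun i _ => sum_nonneg fun u _ => abs_nonneg _) fun i hi => ?_
      simp_rw [abs_of_nonneg (hF0 i _)]
      exact (hsum i hi).trans_eq (by field_simp)
    rw [prod_mul_distrib] at b1
    refine b1.trans (mul_le_mul_of_nonneg_left ?_ (prod_nonneg fun i _ => by positivity))
    have b2 : ∏ i, baseVec (1 / (ℓ i : ℝ)) (t i) = (∏ i ∈ T, (ℓ i : ℝ))⁻¹ := by
      rw [hT, ← prod_inv_distrib, prod_filter]
      exact prod_congr rfl fun i _ => by rcases t i with _ | s <;> simp [baseVec]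
    rw [b2] at ht
    have hpos : 0 < ∏ i ∈ T, (ℓ i : ℝ) := prod_pos fun i _ => hℓ' i
    refine ((inv_le_inv₀ (by positivity) hpos).1 ht).trans ?_
    rw [le_div_iff₀ hW']
    linarith
  have s4 : ∏ i ∈ T, (2 * (1 / (ℓ i : ℝ)) ^ 2)
      = ∏ i, pairVec (2 * (1 / (ℓ i : ℝ)) ^ 2) (t i) (t' i) := by
    rw [hT, prod_filter]
    refine prod_congr rfl fun i _ => ?_
    have := hc i
    rcases h1 : t i with _ | s <;> rcases h2 : t' i with _ | s' <;> simp_all [pairVec]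
  have k2 := (abs_sub_le_iff.1 key).1
  rw [s4] at s2 s3
  have hX : (0 : ℝ) ≤ X / W := by positivity
  have s5 := mul_le_mul_of_nonneg_left s2 hX
  push_cast at k2
  grind

lemma sum_sum_pairVec (c : ι → ℝ) :
    ∑ t : ι → Option J, ∑ t' : ι → Option J, ∏ i, pairVec (c i) (t i) (t' i)
      = ∏ i, (1 + (Fintype.card J : ℝ) ^ 2 * c i) := by
  rw [sum_sum_prod]
  refine prod_congr rfl fun i _ => ?_
  simp [Fintype.sum_option, pairVec]
  ring

/-- The second moment bound for the degrees. -/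
lemma Admissible.second_moment {ℓ : ι → ℕ} {Z : (ι → Option J) → ℝ} {R : ℝ}
    (h : Admissible ℓ Z R) {sh : J → ℤ} (hsh0 : ∀ i s, ¬ (ℓ i : ℤ) ∣ sh s) {P' : Finset ℕ}
    {X W : ℕ} {p0 : ℤ} (hW : 0 < W) (hWc : ∀ i, Nat.Coprime W (ℓ i))
    (hP : ∀ p ∈ P', 0 < p ∧ p ≤ X ∧ (p : ℤ) ≡ p0 [ZMOD W])
    (hsh : ∀ p ∈ P', ∀ i s s', s ≠ s' → ¬ (ℓ i : ℤ) ∣ sh s * p - sh s' * p)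
    (hWR : W * R ^ 2 ≤ X) {a b : ℤ} (hab : a ≤ b) (v : ℤ) :
    ∑ q ∈ Ioc a b with q ≡ v [ZMOD W],
        (∑ p ∈ P', (weight ℓ Z sh p q ^ 2 - meanSq ℓ Z)) ^ 2
      ≤ ((b : ℝ) - a) / W * (P'.card * (2 * ((X : ℝ) / W))) * normSq ℓ Z ^ 2
          * (∏ i, (1 + (Fintype.card J : ℝ) ^ 2 * (648 * (1 / (ℓ i : ℝ)) ^ 2)) - 1)
        + (P'.card * (normSq ℓ Z * errFactor ℓ (Fintype.card J) R)) ^ 2 := by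
  set g := sieveCoef (fun i => 1 / (ℓ i : ℝ)) Z with hg
  set N0 : ι → Option J := fun _ => none with hN0
  set U := (univ : Finset (ι → Option J)).erase N0 with hU
  set B := ((b : ℝ) - a) / W with hB
  set Θ : ℤ → ℤ → (ι → Option J) → (ι → Option J) → ℝ := fun p p' t t' =>
    ∏ i, |theta (ℓ i) sh p p' (t i) (t' i)| with hΘ
  set Ψ : (ι → Option J) → (ι → Option J) → ℝ := fun t t' =>
    ∏ i, pairVec (648 * (1 / (ℓ i : ℝ)) ^ 2) (t i) (t' i) with hΨ
  have hΨ0 : ∀ t t', 0 ≤ Ψ t t' := prod_pairVec_nonneg fun _ => by positivity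
  have hB0 : 0 ≤ B := div_nonneg (sub_nonneg.2 (by exact_mod_cast hab)) (by positivity)
  have expand : ∀ p ∈ P', ∀ q : ℤ, weight ℓ Z sh p q ^ 2 - meanSq ℓ Z
      = ∑ t ∈ U, g t * psi ℓ sh p q t := by
    intro p hp q
    rw [h.weight_sq (hsh p hp), ← add_sum_erase _ _ (mem_univ N0)]
    have : psi ℓ sh p q N0 = 1 := by simp [psi, loc, centred, hN0]
    rw [this, meanSq]; ring
  have e1 : ∀ q : ℤ, (∑ p ∈ P', (weight ℓ Z sh p q ^ 2 - meanSq ℓ Z)) ^ 2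
      = ∑ p ∈ P', ∑ p' ∈ P', ∑ t ∈ U, ∑ t' ∈ U,
        g t * g t' * (psi ℓ sh p q t * psi ℓ sh p' q t') := by
    intro q
    rw [sum_congr rfl fun p hp => expand p hp q, pow_two, sum_mul_sum]
    refine sum_congr rfl fun p _ => sum_congr rfl fun p' _ => ?_
    rw [sum_mul_sum]
    grind
  simp_rw [e1]
  rw [sum_comm, sum_congr rfl fun p _ => sum_comm.trans <| sum_congr rfl fun p' _ =>
    sum_comm.trans <| sum_congr rfl fun t _ => sum_comm]
  simp_rw [← mul_sum]
  have e3 : ∑ p ∈ P', ∑ p' ∈ P', ∑ t ∈ U, ∑ t' ∈ U, g t * g t' *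
          ∑ q ∈ Ioc a b with q ≡ v [ZMOD W], psi ℓ sh p q t * psi ℓ sh p' q t'
      ≤ ∑ p ∈ P', ∑ p' ∈ P', ∑ t ∈ U, ∑ t' ∈ U,
        (B * (|g t| * |g t'| * Θ p p' t t')
          + (|g t| * ∏ i, baseVec 2 (t i)) * (|g t'| * ∏ i, baseVec 2 (t' i))) := by
    refine sum_le_sum fun p _ => sum_le_sum fun p' _ => sum_le_sum fun t _ =>
      sum_le_sum fun t' _ => ?_
    have h1 := abs_sum_psi_mul_psi_sub_le h.prime h.inj sh p p' hab hW hWc v t t'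
    have h2 := (abs_sub_abs_le_abs_sub _ _).trans h1
    rw [abs_mul B, abs_prod, abs_of_nonneg hB0, sub_le_iff_le_add'] at h2
    refine (le_abs_self _).trans ?_
    rw [abs_mul, abs_mul]
    exact (mul_le_mul_of_nonneg_left h2 (by positivity)).trans_eq (by ring)
  refine e3.trans ?_
  simp_rw [sum_add_distrib]
  refine add_le_add ?_ ?_
  · have main : ∀ p ∈ P', ∑ p' ∈ P', ∑ t ∈ U, ∑ t' ∈ U,
        B * (|g t| * |g t'| * Θ p p' t t') ≤ B * (2 * ((X : ℝ) / W)) * normSq ℓ Z ^ 2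
          * (∏ i, (1 + (Fintype.card J : ℝ) ^ 2 * (648 * (1 / (ℓ i : ℝ)) ^ 2)) - 1) := by
      intro p hp
      calc _ = ∑ t ∈ U, ∑ t' ∈ U, B * (|g t| * |g t'| * ∑ p' ∈ P', Θ p p' t t') := by
            simp_rw [mul_sum]
            exact sum_comm.trans <| sum_congr rfl fun t _ => sum_comm
        _ ≤ ∑ t ∈ U, ∑ t' ∈ U, B * (2 * ((X : ℝ) / W)) * normSq ℓ Z ^ 2 * Ψ t t' := by
            refine sum_le_sum fun t _ => sum_le_sum fun t' _ => ?_
            have := hΨ0 t t'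
            by_cases hgt : g t = 0
            · rw [hgt, abs_zero, zero_mul, zero_mul, mul_zero]
              positivity
            · have hsupp := le_prod_of_sieveCoef_ne_zero h.inv_nonneg h.inv_le_one h.R_pos h.supp hgt
              have b1 := sum_prod_abs_theta_le h.prime h.inj hsh0 hW hWc hP h.R_pos hWR p t t' hsupp
              have b2 := abs_sieveCoef_le h.inv_nonneg h.inv_le_one h.card_mul_le h.nonneg h.anti t
              have b3 := abs_sieveCoef_le h.inv_nonneg h.inv_le_one h.card_mul_le h.nonneg h.anti t'
              have n0 : ∀ t : ι → Option J, 0 ≤ ∏ i, baseVec (18 : ℝ) (t i) := fun t =>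
                prod_nonneg fun _ _ => baseVec_nonneg (by norm_num) _
              have n1 := h.normSq_nonneg
              have e : Ψ t t' = (∏ i, baseVec 18 (t i)) * (∏ i, baseVec 18 (t' i)) *
                  ∏ i, pairVec (2 * (1 / (ℓ i : ℝ)) ^ 2) (t i) (t' i) := by
                simp_rw [← prod_mul_distrib]
                refine prod_congr rfl fun i _ => ?_
                rcases t i with _ | s <;> rcases t' i with _ | s' <;> simp [pairVec, baseVec]
                ring
              refine (mul_le_mul_of_nonneg_left (mul_le_mul (mul_le_mul b2 b3 (abs_nonneg _)
                (mul_nonneg (n0 t) n1)) b1 (sum_nonneg fun _ _ => prod_nonneg fun _ _ =>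
                abs_nonneg _) (mul_nonneg (mul_nonneg (n0 t) n1) (mul_nonneg (n0 t') n1)))
                hB0).trans_eq ?_
              rw [e, normSq]
              ring
        _ ≤ _ := by
            simp_rw [← mul_sum]
            refine mul_le_mul_of_nonneg_left ?_ (by positivity)
            rw [← sum_sum_pairVec, ← add_sum_erase _ _ (mem_univ N0),
              le_sub_iff_add_le, add_comm]
            refine add_le_add ?_ (sum_le_sum fun t _ =>
              sum_le_sum_of_subset_of_nonneg (subset_univ _) fun t' _ _ => hΨ0 t t')
            calc (1 : ℝ) = Ψ N0 N0 := by simp [hΨ, hN0, pairVec]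
              _ ≤ _ := single_le_sum (f := Ψ N0) (fun t' _ => hΨ0 N0 t') (mem_univ N0)
    refine (sum_le_sum main).trans (le_of_eq ?_)
    rw [sum_const, nsmul_eq_mul]; ring
  · have b (t : ι → Option J) : 0 ≤ |g t| * ∏ i, baseVec 2 (t i) :=
      mul_nonneg (abs_nonneg _) ((zero_le_one' ℝ).trans (one_le_prod_baseVec_two t))
    have b1 := (sum_le_sum_of_subset_of_nonneg (subset_univ U) fun t _ _ => b t).trans h.sum_abs_le
    have b0 := sum_nonneg fun t (_ : t ∈ U) => b t
    simp_rw [← mul_sum, ← sum_mul]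
    simp only [sum_const, nsmul_eq_mul]
    rw [mul_pow, ← mul_assoc, ← pow_two, mul_assoc]
    refine mul_le_mul_of_nonneg_left ?_ (by positivity)
    nlinarith

/-- The set of indices of a given colour. -/
def fib (C : ι → Option J) (j : J) : Finset ι := univ.filter fun i => C i = some j

lemma mem_fib {C : ι → Option J} {j : J} {i : ι} : i ∈ fib C j ↔ C i = some j := by simp [fib]

lemma fib_eraseAt_subset (t C : ι → Option J) (j : J) : fib (eraseAt t C) j ⊆ fib C j := by
  intro i hi
  rw [mem_fib] at hi ⊢
  unfold eraseAt at hi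
  split_ifs at hi
  exact hi

lemma prod_baseVec_eq_prod_fib (a : ι → ℝ) (C : ι → Option J) :
    ∏ i, baseVec (a i) (C i) = ∏ j, ∏ i ∈ fib C j, a i := by
  simp_rw [fib, prod_filter]
  rw [prod_comm]
  refine prod_congr rfl fun i _ => ?_
  rcases C i with _ | s
  · simp [baseVec]
  · simp [baseVec, Option.some_inj]

lemma sum_fib (F : (J → Finset ι) → ℝ) :
    ∑ C : ι → Option J, F (fib C)
      = ∑ c ∈ univ.filter (fun c : J → Finset ι => ∀ j j', j ≠ j' → Disjoint (c j) (c j')), F c := by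
  refine sum_bij (fun C _ => fib C) (fun C _ => ?_) (fun C _ C' _ h => ?_) (fun c hc => ?_)
    fun _ _ => rfl
  · rw [mem_filter]
    refine ⟨mem_univ _, fun j j' hne => disjoint_left.2 fun i hi hi' => hne ?_⟩
    rw [mem_fib] at hi hi'
    exact Option.some_inj.1 (hi.symm.trans hi')
  · funext i
    have key : ∀ j, C i = some j ↔ C' i = some j := fun j => by
      rw [← mem_fib, ← mem_fib, h]
    rcases hi : C i with _ | j
    · rcases hi' : C' i with _ | j'
      · rfl
      · rw [(key j').2 hi'] at hi; exact hi.symm ▸ rfl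
    · exact ((key j).1 hi).symm
  · rw [mem_filter] at hc
    classical
    refine ⟨fun i => if h : ∃ j, i ∈ c j then some h.choose else none, mem_univ _, ?_⟩
    funext j
    ext i
    rw [mem_fib]
    by_cases h : ∃ j, i ∈ c j
    · rw [dif_pos h, Option.some_inj]
      refine ⟨fun e => e ▸ h.choose_spec, fun hi => ?_⟩
      by_contra hne
      exact disjoint_left.1 (hc.2 _ _ hne) h.choose_spec hi
    · rw [dif_neg h]
      exact ⟨fun e => by simp at e, fun hi => absurd ⟨j, hi⟩ h⟩

lemma sum_prod_tuple (f : J → Finset ι → ℝ) :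
    ∑ c : J → Finset ι, ∏ j, f j (c j) = ∏ j, ∑ b, f j b := by
  rw [prod_univ_sum, Fintype.piFinset_univ]

lemma sum_prod_fib_le {f : Finset ι → ℝ} (hf : ∀ b, 0 ≤ f b) :
    ∑ C : ι → Option J, ∏ j, f (fib C j) ≤ (∑ b, f b) ^ Fintype.card J := by
  rw [sum_fib (fun c => ∏ j, f (c j))]
  refine (sum_le_sum_of_subset_of_nonneg (subset_univ _) fun c _ _ =>
    prod_nonneg fun j _ => hf _).trans (le_of_eq ?_)
  rw [sum_prod_tuple (fun _ => f)]
  simp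

lemma sum_prod_mem_pair_le {f : Finset ι → ℝ} (hf : ∀ b, 0 ≤ f b) {i : ι} {ρ : ℝ}
    (hi : ∑ b, f b * (if i ∈ b then 1 else 0) ≤ ρ * ∑ b, f b) {j₀ j₁ : J} (hne : j₀ ≠ j₁) :
    ∑ c : J → Finset ι, (∏ j, f (c j)) * ((if i ∈ c j₀ then 1 else 0) * if i ∈ c j₁ then 1 else 0)
      ≤ ρ ^ 2 * (∑ b, f b) ^ Fintype.card J := by
  have e : ∀ c : J → Finset ι,
      (∏ j, f (c j)) * (((if i ∈ c j₀ then 1 else 0) * if i ∈ c j₁ then 1 else 0 : ℝ))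
      = ∏ j, (f (c j) * ((if j = j₀ then (if i ∈ c j then 1 else 0) else 1) *
          (if j = j₁ then (if i ∈ c j then 1 else 0) else 1))) := fun c => by
    rw [prod_mul_distrib, prod_mul_distrib, prod_ite_eq',
      prod_ite_eq', if_pos (mem_univ _), if_pos (mem_univ _)]
  simp_rw [e]
  rw [sum_prod_tuple (fun j b => f b * ((if j = j₀ then (if i ∈ b then 1 else 0) else 1) *
          (if j = j₁ then (if i ∈ b then 1 else 0) else 1)))]
  have e2 : ρ ^ 2 * (∑ b, f b) ^ Fintype.card J
      = ∏ j : J, ((∑ b, f b) * ((if j = j₀ then ρ else 1) * if j = j₁ then ρ else 1)) := by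
    rw [prod_mul_distrib, prod_mul_distrib, prod_ite_eq',
      prod_ite_eq', if_pos (mem_univ _), if_pos (mem_univ _)]
    simp [pow_two, mul_comm]
  rw [e2]
  refine prod_le_prod (fun j _ => sum_nonneg fun b _ => mul_nonneg (hf b) ?_)
    fun j _ => ?_
  · split_ifs <;> norm_num
  · by_cases h0 : j = j₀
    · have h1 : j ≠ j₁ := fun h => hne (h0.symm.trans h)
      simp only [if_pos h0, if_neg h1, mul_one]
      linarith
    · by_cases h1 : j = j₁
      · simp only [if_neg h0, if_pos h1, one_mul]
        linarith
      · simp [h0, h1]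

lemma sum_prod_mul_single {f : Finset ι → ℝ} (hf : 0 < ∑ b, f b) (g : Finset ι → ℝ) (j₀ : J) :
    ∑ c : J → Finset ι, (∏ j, f (c j)) * g (c j₀)
      = (∑ b, f b * g b) / (∑ b, f b) * (∑ b, f b) ^ Fintype.card J := by
  have e : ∀ c : J → Finset ι, (∏ j, f (c j)) * g (c j₀)
      = ∏ j, (f (c j) * (if j = j₀ then g (c j) else 1)) := fun c => by
    rw [prod_mul_distrib, prod_ite_eq', if_pos (mem_univ _)]
  simp_rw [e]
  rw [sum_prod_tuple (fun j b => f b * (if j = j₀ then g b else 1))]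
  have e2 : (∑ b, f b * g b) / (∑ b, f b) * (∑ b, f b) ^ Fintype.card J
      = ∏ j : J, ((∑ b, f b) * if j = j₀ then (∑ b, f b * g b) / ∑ b, f b else 1) := by
    rw [prod_mul_distrib, prod_ite_eq', if_pos (mem_univ _)]
    simp [mul_comm]
  rw [e2]
  refine prod_congr rfl fun j _ => ?_
  by_cases h0 : j = j₀
  · simp only [if_pos h0]
    field_simp
  · simp [h0]

/-- Lower bound for a sum over colourings of small total size. -/
lemma le_sum_prod_fib {f : Finset ι → ℝ} (hf : ∀ b, 0 ≤ f b) (hf0 : 0 < ∑ b, f b) {r lam : ι → ℝ}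
    (hr : ∀ i, ∑ b, f b * (if i ∈ b then 1 else 0) ≤ r i * ∑ b, f b) (hl : ∀ i, 0 ≤ lam i)
    {T : ℝ} (hT : 0 < T) :
    (∑ b, f b) ^ Fintype.card J * (1 - Fintype.card J ^ 2 * ∑ i, r i ^ 2
        - Fintype.card J * ((∑ b, f b * ∑ i ∈ b, lam i) / ∑ b, f b) / T)
      ≤ ∑ C : ι → Option J, if ∑ j, ∑ i ∈ fib C j, lam i ≤ T then ∏ j, f (fib C j) else 0 := by
  rw [sum_fib (fun c => if ∑ j, ∑ i ∈ c j, lam i ≤ T then ∏ j, f (c j) else 0), sum_filter]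
  have main : ∀ c : J → Finset ι, (∏ j, f (c j)) * (1 - (∑ p : J × J, if p.1 ≠ p.2 then
      ∑ i, ((if i ∈ c p.1 then 1 else 0) * if i ∈ c p.2 then 1 else 0 : ℝ) else 0)
        - (∑ j, ∑ i ∈ c j, lam i) / T)
      ≤ if ∀ j j', j ≠ j' → Disjoint (c j) (c j') then
        (if ∑ j, ∑ i ∈ c j, lam i ≤ T then ∏ j, f (c j) else 0) else 0 := fun c => by
    have hp : 0 ≤ ∏ j, f (c j) := prod_nonneg fun j _ => hf _
    have n1 : ∀ p ∈ (univ : Finset (J × J)), 0 ≤ (if p.1 ≠ p.2 then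
      ∑ i, ((if i ∈ c p.1 then 1 else 0) * if i ∈ c p.2 then 1 else 0 : ℝ) else 0) := fun p _ => by
      split_ifs
      · exact sum_nonneg fun i _ => by split_ifs <;> norm_num
      · exact le_rfl
    have n2 : 0 ≤ (∑ j, ∑ i ∈ c j, lam i) / T :=
      div_nonneg (sum_nonneg fun j _ => sum_nonneg fun i _ => hl i) hT.le
    have n3 := sum_nonneg n1
    by_cases h1 : ∀ j j', j ≠ j' → Disjoint (c j) (c j')
    · rw [if_pos h1]
      by_cases h2 : ∑ j, ∑ i ∈ c j, lam i ≤ T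
      · rw [if_pos h2]
        exact mul_le_of_le_one_right hp (by linarith)
      · rw [if_neg h2]
        have : 1 ≤ (∑ j, ∑ i ∈ c j, lam i) / T := by
          rw [le_div_iff₀ hT]; linarith
        exact mul_nonpos_of_nonneg_of_nonpos hp (by linarith)
    · rw [if_neg h1]
      push Not at h1
      obtain ⟨j, j', hne, hd⟩ := h1
      rw [not_disjoint_iff] at hd
      obtain ⟨i, hi, hi'⟩ := hd
      have l1 := single_le_sum n1 (mem_univ (j, j'))
      have l2 : (1 : ℝ) ≤ ∑ i, ((if i ∈ c j then 1 else 0) * if i ∈ c j' then 1 else 0 : ℝ) := by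
        refine le_trans ?_ (single_le_sum (f := fun i => ((if i ∈ c j then 1 else 0) *
          if i ∈ c j' then 1 else 0 : ℝ)) (fun i _ => by split_ifs <;> norm_num)
          (mem_univ i))
        simp [hi, hi']
      simp only [ne_eq, hne, not_false_eq_true, if_true] at l1
      exact mul_nonpos_of_nonneg_of_nonpos hp (by linarith)
  refine le_trans ?_ (sum_le_sum fun c _ => main c)
  simp_rw [mul_sub, mul_one]
  rw [sum_sub_distrib, sum_sub_distrib, sum_prod_tuple (fun _ => f)]
  have a0 : ∏ _j : J, ∑ b, f b = (∑ b, f b) ^ Fintype.card J := by simp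
  have a1 : ∑ c : J → Finset ι, (∏ j, f (c j)) * (∑ p : J × J, if p.1 ≠ p.2 then
      ∑ i, ((if i ∈ c p.1 then 1 else 0) * if i ∈ c p.2 then 1 else 0 : ℝ) else 0)
      ≤ (∑ b, f b) ^ Fintype.card J * (Fintype.card J ^ 2 * ∑ i, r i ^ 2) := by
    simp_rw [mul_sum]
    rw [sum_comm]
    have : ∀ p : J × J, ∑ c : J → Finset ι, (∏ j, f (c j)) * (if p.1 ≠ p.2 then
      ∑ i, ((if i ∈ c p.1 then 1 else 0) * if i ∈ c p.2 then 1 else 0 : ℝ) else 0)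
      ≤ (∑ b, f b) ^ Fintype.card J * ∑ i, r i ^ 2 := fun p => by
      by_cases h : p.1 ≠ p.2
      · simp only [if_pos h]
        simp_rw [mul_sum]
        rw [sum_comm]
        refine sum_le_sum fun i _ => ?_
        rw [mul_comm ((∑ b, f b) ^ Fintype.card J)]
        exact sum_prod_mem_pair_le hf (hr i) h
      · simp only [if_neg h, mul_zero, sum_const_zero]
        positivity
    refine (sum_le_sum fun p _ => this p).trans (le_of_eq ?_)
    rw [sum_const, nsmul_eq_mul, card_univ, Fintype.card_prod]
    simp_rw [← mul_sum]
    push_cast; ring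
  have a2 : ∑ c : J → Finset ι, (∏ j, f (c j)) * ((∑ j, ∑ i ∈ c j, lam i) / T)
      = (∑ b, f b) ^ Fintype.card J *
        (Fintype.card J * ((∑ b, f b * ∑ i ∈ b, lam i) / ∑ b, f b) / T) := by
    simp_rw [← mul_div_assoc]
    rw [← sum_div]
    congr 1
    simp_rw [mul_sum (s := (univ : Finset J))]
    rw [sum_comm, sum_congr rfl fun j _ =>
      sum_prod_mul_single hf0 (fun b => ∑ i ∈ b, lam i) j]
    rw [sum_const, nsmul_eq_mul, card_univ]
    ring
  rw [a0, a2]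
  linarith

/-- Coefficients of the sieve weight: a product over the colours, cut off at total size `R`. -/
noncomputable def tupleCoef (r : ι → ℝ) (G : Finset ι → ℝ) (R : ℝ) (C : ι → Option J) : ℝ :=
  if R⁻¹ ≤ ∏ i, baseVec (r i) (C i) then ∏ j, G (fib C j) else 0

/-- The sum over an omitted colour. -/
noncomputable def redSum (r : ι → ℝ) (G : Finset ι → ℝ) (R : ℝ) (C : ι → Option J) : ℝ :=
  ∑ b, if (∀ i ∈ b, C i = none) ∧ R⁻¹ ≤ (∏ i, baseVec (r i) (C i)) * ∏ i ∈ b, r i then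
    G b * ∏ i ∈ b, r i else 0

/-- Coefficients of the sieve weight after summing out one colour. -/
noncomputable def redCoef (r : ι → ℝ) (G : Finset ι → ℝ) (R : ℝ) (C : ι → Option J) : ℝ :=
  (∏ j, G (fib C j)) * redSum r G R C

section Collapse
variable {h : J}

/-- Insert the colour `h` on the set `b`. -/
def extColour (h : J) (C : ι → Option {j : J // j ≠ h}) (b : Finset ι) (i : ι) : Option J :=
  if i ∈ b then some h else (C i).map Subtype.val

/-- Delete the colour `h`. -/
def delColour (h : J) : Option J → Option {j : J // j ≠ h}
  | none => none
  | some j => if hj : j = h then none else some ⟨j, hj⟩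

lemma prod_extColour {C : ι → Option {j : J // j ≠ h}} {b : Finset ι} (hb : ∀ i ∈ b, C i = none)
    {r : ι → ℝ} (φ : ι → Option J → ℝ) (φ' : ι → Option {j : J // j ≠ h} → ℝ)
    (h0 : ∀ i, φ i none = 1) (h0' : ∀ i, φ' i none = 1) (h1 : ∀ i, φ i (some h) = r i)
    (h2 : ∀ i (j : {j : J // j ≠ h}), φ i (some j.1) = φ' i (some j)) :
    ∏ i, φ i (extColour h C b i) = (∏ i, φ' i (C i)) * ∏ i ∈ b, r i := by
  have e : ∏ i ∈ b, r i = ∏ i, if i ∈ b then r i else 1 := by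
    rw [prod_ite_mem, univ_inter]
  rw [e, ← prod_mul_distrib]
  refine prod_congr rfl fun i _ => ?_
  unfold extColour
  by_cases hi : i ∈ b
  · rw [if_pos hi, if_pos hi, h1, hb i hi, h0', one_mul]
  · rw [if_neg hi, if_neg hi, mul_one]
    rcases C i with _ | j
    · rw [Option.map_none, h0, h0']
    · rw [Option.map_some, h2]

lemma fib_extColour_self (C : ι → Option {j : J // j ≠ h}) (b : Finset ι) :
    fib (extColour h C b) h = b := by
  ext i
  rw [mem_fib]
  unfold extColour
  by_cases hi : i ∈ b
  · simp [hi]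
  · rw [if_neg hi]
    simp only [hi, iff_false, Option.map_eq_some_iff, not_exists, not_and]
    exact fun a _ => a.2

lemma fib_extColour_ne {C : ι → Option {j : J // j ≠ h}} {b : Finset ι}
    (hb : ∀ i ∈ b, C i = none) (j : {j : J // j ≠ h}) :
    fib (extColour h C b) j.1 = fib C j := by
  ext i
  rw [mem_fib, mem_fib]
  unfold extColour
  by_cases hi : i ∈ b
  · rw [if_pos hi, hb i hi]
    simp only [Option.some_inj, reduceCtorEq, iff_false]
    exact fun e => j.2 e.symm
  · rw [if_neg hi]
    simp only [Option.map_eq_some_iff]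
    exact ⟨fun ⟨a, ha, hj⟩ => by rw [ha, Subtype.ext hj], fun e => ⟨j, e, rfl⟩⟩

lemma extColour_delColour (C : ι → Option J) :
    extColour h (fun i => delColour h (C i)) (fib C h) = C := by
  funext i
  unfold extColour
  by_cases hi : i ∈ fib C h
  · rw [if_pos hi, mem_fib.1 hi]
  · rw [if_neg hi]
    rw [mem_fib] at hi
    beta_reduce
    generalize C i = o at hi ⊢
    rcases o with _ | j
    · rfl
    · have hj : j ≠ h := fun e => hi (by rw [e])
      simp [delColour, hj]

lemma sum_extColour (F : (ι → Option J) → ℝ) (h : J) :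
    ∑ C : ι → Option J, F C = ∑ C' : ι → Option {j : J // j ≠ h}, ∑ b : Finset ι,
      if ∀ i ∈ b, C' i = none then F (extColour h C' b) else 0 := by
  rw [← sum_product', ← sum_filter]
  refine sum_nbij' (fun C => (fun i => delColour h (C i), fib C h))
    (fun q => extColour h q.1 q.2) ?_ ?_ ?_ ?_ ?_
  · intro C _
    simp only [mem_filter, mem_product, mem_univ, true_and]
    intro i hi
    rw [mem_fib.1 hi]
    simp [delColour]
  · exact fun _ _ => mem_univ _
  · intro C _
    exact extColour_delColour C
  · rintro ⟨C', b⟩ hq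
    simp only [mem_filter, mem_product, mem_univ, true_and] at hq
    refine Prod.ext ?_ (fib_extColour_self C' b)
    funext i
    show delColour h (extColour h C' b i) = C' i
    unfold extColour
    by_cases hi : i ∈ b
    · rw [if_pos hi, hq i hi]; simp [delColour]
    · rw [if_neg hi]
      rcases C' i with _ | j
      · rfl
      · simp [delColour, j.2]
  · intro C _
    rw [extColour_delColour]

lemma sieveSum_tupleCoef (r : ι → ℝ) (G : Finset ι → ℝ) (R : ℝ) {e : ι → J → ℝ} (h : J)
    (he : ∀ i, e i h = 0) :
    sieveSum r (tupleCoef r G R) e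
      = sieveSum r (redCoef r G R) fun i (j : {j : J // j ≠ h}) => e i j.1 := by
  rw [sieveSum, sum_extColour _ h, sieveSum]
  refine sum_congr rfl fun C' _ => ?_
  rw [redCoef, redSum, mul_sum, sum_mul]
  refine sum_congr rfl fun b _ => ?_
  by_cases hb : ∀ i ∈ b, C' i = none
  · rw [if_pos hb, tupleCoef,
      prod_extColour hb (r := r) (fun i => baseVec (r i)) (fun i => baseVec (r i)) (fun _ => rfl)
        (fun _ => rfl) (fun _ => rfl) (fun _ _ => rfl),
      prod_extColour hb (r := r) (fun i => localFactor (r i) (e i))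
        (fun i => localFactor (r i) fun j : {j : J // j ≠ h} => e i j.1) (fun _ => rfl)
        (fun _ => rfl) (fun i => by simp [localFactor, he]) (fun _ _ => rfl),
      Fintype.prod_eq_mul_prod_subtype_ne _ h, fib_extColour_self]
    simp_rw [fib_extColour_ne hb]
    by_cases hR : R⁻¹ ≤ (∏ i, baseVec (r i) (C' i)) * ∏ i ∈ b, r i
    · rw [if_pos hR, if_pos ⟨hb, hR⟩]; ring
    · rw [if_neg hR, if_neg fun h => hR h.2]; ring
  · rw [if_neg hb, if_neg fun h => hb h.1]; ring

end Collapse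

variable {ℓ : ι → ℕ} {G : Finset ι → ℝ} {R : ℝ}

lemma eraseAt_none {t C : ι → Option J} {i : ι} (h : C i = none) : eraseAt t C i = none := by
  unfold eraseAt; split_ifs <;> simp [h]

lemma prod_baseVec_le_eraseAt {r : ι → ℝ} (h0 : ∀ i, 0 ≤ r i) (h1 : ∀ i, r i ≤ 1)
    (t C : ι → Option J) :
    ∏ i, baseVec (r i) (C i) ≤ ∏ i, baseVec (r i) (eraseAt t C i) := by
  refine prod_le_prod (fun i _ => baseVec_nonneg (h0 i) _) fun i _ => ?_
  unfold eraseAt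
  split_ifs
  · exact le_rfl
  · rcases C i with _ | s
    · exact le_rfl
    · exact h1 i

lemma prod_G_le_eraseAt (hG0 : ∀ b, 0 ≤ G b) (hG : ∀ a b, a ⊆ b → G b ≤ G a)
    (t C : ι → Option J) : ∏ j, G (fib C j) ≤ ∏ j, G (fib (eraseAt t C) j) :=
  prod_le_prod (fun j _ => hG0 _) fun j _ => hG _ _ (fib_eraseAt_subset t C j)

lemma admissible_tupleCoef (hℓ : ∀ i, (ℓ i).Prime) (hinj : Function.Injective ℓ)
    (hk : ∀ i, Fintype.card J ≤ ℓ i) (hR : 0 < R) (hG0 : ∀ b, 0 ≤ G b)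
    (hG : ∀ a b, a ⊆ b → G b ≤ G a) :
    Admissible ℓ (tupleCoef (J := J) (fun i => 1 / (ℓ i : ℝ)) G R) R where
  prime := hℓ
  inj := hinj
  card_le := hk
  nonneg C := by
    unfold tupleCoef; split_ifs
    · exact prod_nonneg fun j _ => hG0 _
    · exact le_rfl
  anti t C := by
    have h1 : ∀ i, 1 / (ℓ i : ℝ) ≤ 1 := fun i => by
      have : (1 : ℝ) ≤ ℓ i := by exact_mod_cast (hℓ i).one_lt.le
      rw [div_le_one (by linarith)]; exact this
    unfold tupleCoef
    by_cases hC : R⁻¹ ≤ ∏ i, baseVec (1 / (ℓ i : ℝ)) (C i)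
    · rw [if_pos hC, if_pos (hC.trans (prod_baseVec_le_eraseAt (fun i => by positivity) h1 t C))]
      exact prod_G_le_eraseAt hG0 hG t C
    · rw [if_neg hC]; split_ifs
      · exact prod_nonneg fun j _ => hG0 _
      · exact le_rfl
  R_pos := hR
  supp C h := by
    by_contra hC
    exact h (if_neg hC)

lemma redSum_nonneg {r : ι → ℝ} (h0 : ∀ i, 0 ≤ r i) (hG0 : ∀ b, 0 ≤ G b) (C : ι → Option J) :
    0 ≤ redSum r G R C := by
  refine sum_nonneg fun b _ => ?_
  split_ifs
  · exact mul_nonneg (hG0 b) (prod_nonneg fun i _ => h0 i)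
  · exact le_rfl

lemma redSum_le {r : ι → ℝ} (h0 : ∀ i, 0 ≤ r i) (hG0 : ∀ b, 0 ≤ G b) (C : ι → Option J) :
    redSum r G R C ≤ ∑ b, G b * ∏ i ∈ b, r i := by
  refine sum_le_sum fun b _ => ?_
  split_ifs
  · exact le_rfl
  · exact mul_nonneg (hG0 b) (prod_nonneg fun i _ => h0 i)

lemma admissible_redCoef (hℓ : ∀ i, (ℓ i).Prime) (hinj : Function.Injective ℓ)
    (hk : ∀ i, Fintype.card J ≤ ℓ i) (hR : 0 < R) (hG0 : ∀ b, 0 ≤ G b)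
    (hG : ∀ a b, a ⊆ b → G b ≤ G a) :
    Admissible ℓ (redCoef (J := J) (fun i => 1 / (ℓ i : ℝ)) G R) R where
  prime := hℓ
  inj := hinj
  card_le := hk
  nonneg C := mul_nonneg (prod_nonneg fun j _ => hG0 _)
    (redSum_nonneg (fun i => by positivity) hG0 C)
  anti t C := by
    have h1 : ∀ i, 1 / (ℓ i : ℝ) ≤ 1 := fun i => by
      have : (1 : ℝ) ≤ ℓ i := by exact_mod_cast (hℓ i).one_lt.le
      rw [div_le_one (by linarith)]; exact this
    have h0 : ∀ i, 0 ≤ 1 / (ℓ i : ℝ) := fun i => by positivity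
    refine mul_le_mul (prod_G_le_eraseAt hG0 hG t C) ?_ (redSum_nonneg h0 hG0 C)
      (prod_nonneg fun j _ => hG0 _)
    refine sum_le_sum fun b _ => ?_
    have hb0 : 0 ≤ ∏ i ∈ b, 1 / (ℓ i : ℝ) := prod_nonneg fun i _ => h0 i
    by_cases hC : (∀ i ∈ b, C i = none) ∧
        R⁻¹ ≤ (∏ i, baseVec (1 / (ℓ i : ℝ)) (C i)) * ∏ i ∈ b, 1 / (ℓ i : ℝ)
    · rw [if_pos hC, if_pos ⟨fun i hi => eraseAt_none (hC.1 i hi), hC.2.trans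
        (mul_le_mul_of_nonneg_right (prod_baseVec_le_eraseAt h0 h1 t C) hb0)⟩]
    · rw [if_neg hC]; split_ifs
      · exact mul_nonneg (hG0 b) hb0
      · exact le_rfl
  R_pos := hR
  supp C h := by
    have h2 : redSum (fun i => 1 / (ℓ i : ℝ)) G R C ≠ 0 := fun e => h (by rw [redCoef, e, mul_zero])
    obtain ⟨b, _, hb⟩ := exists_ne_zero_of_sum_ne_zero h2
    have hc : (∀ i ∈ b, C i = none) ∧
        R⁻¹ ≤ (∏ i, baseVec (1 / (ℓ i : ℝ)) (C i)) * ∏ i ∈ b, 1 / (ℓ i : ℝ) := by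
      by_contra hc; exact hb (if_neg hc)
    refine hc.2.trans (mul_le_of_le_one_right (prod_nonneg fun i _ =>
      baseVec_nonneg (by positivity) _) (prod_le_one (fun i _ => by positivity) fun i _ => ?_))
    have : (1 : ℝ) ≤ ℓ i := by exact_mod_cast (hℓ i).one_lt.le
    rw [div_le_one (by linarith)]; exact this

lemma normSq_tupleCoef_le (hG0 : ∀ b, 0 ≤ G b) :
    normSq ℓ (tupleCoef (J := J) (fun i => 1 / (ℓ i : ℝ)) G R)
      ≤ (∑ b, G b ^ 2 * ∏ i ∈ b, 1 / (ℓ i : ℝ)) ^ Fintype.card J := by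
  refine le_trans (sum_le_sum fun C _ => ?_) (sum_prod_fib_le
    (f := fun b => G b ^ 2 * ∏ i ∈ b, 1 / (ℓ i : ℝ)) fun b => by positivity)
  rw [prod_mul_distrib, prod_baseVec_eq_prod_fib, prod_pow]
  refine mul_le_mul_of_nonneg_right ?_ (by positivity)
  unfold tupleCoef
  split_ifs
  · exact le_rfl
  · exact pow_le_pow_left₀ le_rfl (prod_nonneg fun j _ => hG0 _) 2

lemma normSq_redCoef_le (hG0 : ∀ b, 0 ≤ G b) :
    normSq ℓ (redCoef (J := J) (fun i => 1 / (ℓ i : ℝ)) G R)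
      ≤ (∑ b, G b * ∏ i ∈ b, 1 / (ℓ i : ℝ)) ^ 2 *
        (∑ b, G b ^ 2 * ∏ i ∈ b, 1 / (ℓ i : ℝ)) ^ Fintype.card J := by
  refine le_trans ?_ (mul_le_mul_of_nonneg_left (sum_prod_fib_le (J := J)
    (f := fun b => G b ^ 2 * ∏ i ∈ b, 1 / (ℓ i : ℝ)) fun b => by positivity)
    (sq_nonneg (∑ b, G b * ∏ i ∈ b, 1 / (ℓ i : ℝ))))
  rw [mul_sum]
  refine sum_le_sum fun C _ => ?_
  rw [prod_mul_distrib, prod_baseVec_eq_prod_fib, prod_pow, redCoef, mul_pow,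
    mul_comm ((∏ j, G (fib C j)) ^ 2), mul_assoc]
  refine mul_le_mul_of_nonneg_right ?_ (by positivity)
  exact pow_le_pow_left₀ (redSum_nonneg (fun i => by positivity) hG0 C)
    (redSum_le (fun i => by positivity) hG0 C) 2

lemma sum_mem_le_mul {F : Finset ι → ℝ} (hF0 : ∀ b, 0 ≤ F b) (hF : ∀ a b, a ⊆ b → F b ≤ F a)
    {r : ι → ℝ} (hr : ∀ i, 0 ≤ r i) (i : ι) :
    ∑ b, F b * (∏ i ∈ b, r i) * (if i ∈ b then 1 else 0) ≤ r i * ∑ b, F b * ∏ i ∈ b, r i := by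
  simp_rw [mul_ite, mul_one, mul_zero]
  rw [← sum_filter, mul_sum]
  have hp : ∀ b : Finset ι, 0 ≤ ∏ i ∈ b, r i := fun b => prod_nonneg fun i _ => hr i
  have e : ∑ b ∈ univ.filter (fun b : Finset ι => i ∈ b), r i * (F (b.erase i) * ∏ i ∈ b.erase i, r i)
      = ∑ b ∈ (univ.filter fun b : Finset ι => i ∈ b).image fun b => b.erase i,
        r i * (F b * ∏ i ∈ b, r i) := by
    rw [sum_image]
    intro a ha b hb hab
    simp only [coe_filter, mem_univ, true_and, Set.mem_ofPred_eq] at ha hb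
    rw [← insert_erase ha, ← insert_erase hb]
    exact congrArg (insert i) hab
  calc _ ≤ ∑ b ∈ univ.filter (fun b : Finset ι => i ∈ b),
        r i * (F (b.erase i) * ∏ i ∈ b.erase i, r i) := by
        refine sum_le_sum fun b hb => ?_
        rw [mem_filter] at hb
        rw [← mul_prod_erase b r hb.2]
        have := mul_le_mul_of_nonneg_right (hF _ _ (erase_subset i b))
          (mul_nonneg (hr i) (hp (b.erase i)))
        linarith
    _ ≤ _ := by
        rw [e]
        exact sum_le_sum_of_subset_of_nonneg (subset_univ _) fun b _ _ =>
          mul_nonneg (hr i) (mul_nonneg (hF0 b) (hp b))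

lemma sum_sum_fib (a : ι → ℝ) (C : ι → Option J) :
    ∑ j, ∑ i ∈ fib C j, a i = ∑ i, if C i = none then 0 else a i := by
  simp_rw [fib, sum_filter]
  rw [sum_comm]
  refine sum_congr rfl fun i _ => ?_
  rcases C i with _ | s
  · simp
  · simp [Option.some_inj]

lemma one_sub_sum_le_prod {κ : Type*} (s : Finset κ) {a : κ → ℝ} (h0 : ∀ i, 0 ≤ a i) (h1 : ∀ i, a i ≤ 1) :
    1 - ∑ i ∈ s, a i ≤ ∏ i ∈ s, (1 - a i) := by
  classical
  induction s using Finset.induction_on with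
  | empty => simp
  | insert i s hi ih =>
    rw [sum_insert hi, prod_insert hi]
    have p1 : ∏ j ∈ s, (1 - a j) ≤ 1 :=
      prod_le_one (fun j _ => by linarith [h1 j]) fun j _ => by linarith [h0 j]
    nlinarith [h0 i]

lemma prod_one_div_eq_exp {ℓ : ι → ℕ} (hℓ : ∀ i, 0 < ℓ i) (s : Finset ι) :
    ∏ i ∈ s, 1 / (ℓ i : ℝ) = exp (-∑ i ∈ s, log (ℓ i)) := by
  rw [← sum_neg_distrib, exp_sum]
  refine prod_congr rfl fun i _ => ?_
  have : (0 : ℝ) < ℓ i := by exact_mod_cast hℓ i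
  rw [exp_neg, exp_log this, one_div]

variable {ℓ : ι → ℕ} {G : Finset ι → ℝ} {R : ℝ}

lemma le_redSum (hℓ : ∀ i, (ℓ i).Prime) (hR : 0 < R) (hG0 : ∀ b, 0 ≤ G b)
    (hG : ∀ a b, a ⊆ b → G b ≤ G a) {δ T₁ T₂ : ℝ} (hT₂ : 0 < T₂) (hT : T₁ + T₂ ≤ log R)
    (hδ0 : 0 ≤ δ) (hδ : ∀ i, 1 / (ℓ i : ℝ) ≤ δ * log (ℓ i)) {C : ι → Option J}
    (hC : ∑ j, ∑ i ∈ fib C j, log (ℓ i) ≤ T₁) :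
    (∑ b, G b * ∏ i ∈ b, 1 / (ℓ i : ℝ))
      - (∑ b, G b * (∏ i ∈ b, 1 / (ℓ i : ℝ)) * ∑ i ∈ b, log (ℓ i)) / T₂
      - δ * T₁ * ∑ b, G b * ∏ i ∈ b, 1 / (ℓ i : ℝ)
      ≤ redSum (fun i => 1 / (ℓ i : ℝ)) G R C := by
  have hlog : ∀ i, 0 ≤ log (ℓ i) := fun i => log_natCast_nonneg _
  have hr : ∀ i, 0 ≤ 1 / (ℓ i : ℝ) := fun i => by positivity
  set g1 := ∑ b, G b * ∏ i ∈ b, 1 / (ℓ i : ℝ) with hg1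
  have hg10 : 0 ≤ g1 := sum_nonneg fun b _ =>
    mul_nonneg (hG0 b) (prod_nonneg fun i _ => hr i)
  have s1 : ∑ b, G b * (∏ i ∈ b, 1 / (ℓ i : ℝ)) * ∑ i, (if C i = none then 0 else
      (if i ∈ b then 1 else 0 : ℝ)) ≤ δ * T₁ * g1 := by
    simp_rw [mul_sum]
    rw [sum_comm]
    calc _ ≤ ∑ i, (if C i = none then 0 else δ * log (ℓ i)) * g1 := by
          refine sum_le_sum fun i _ => ?_
          by_cases h : C i = none
          · simp [h]
          · simp only [h, if_false]
            exact (sum_mem_le_mul hG0 hG hr i).trans (mul_le_mul_of_nonneg_right (hδ i) hg10)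
      _ = δ * (∑ j, ∑ i ∈ fib C j, log (ℓ i)) * g1 := by
          rw [sum_sum_fib, ← sum_mul, mul_sum (a := δ)]
          simp only [mul_ite, mul_zero]
      _ ≤ _ := mul_le_mul_of_nonneg_right (mul_le_mul_of_nonneg_left hC hδ0) hg10
  have s2 : g1 - redSum (fun i => 1 / (ℓ i : ℝ)) G R C
      ≤ ∑ b, G b * (∏ i ∈ b, 1 / (ℓ i : ℝ)) * (∑ i, (if C i = none then 0 else
      (if i ∈ b then 1 else 0 : ℝ)) + (∑ i ∈ b, log (ℓ i)) / T₂) := by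
    rw [hg1, redSum, ← sum_sub_distrib]
    refine sum_le_sum fun b _ => ?_
    have hp : 0 ≤ G b * ∏ i ∈ b, 1 / (ℓ i : ℝ) :=
      mul_nonneg (hG0 b) (prod_nonneg fun i _ => hr i)
    have n1 : ∀ i ∈ (univ : Finset ι), (0 : ℝ) ≤ if C i = none then 0 else
      (if i ∈ b then 1 else 0 : ℝ) := fun i _ => by split_ifs <;> norm_num
    have n2 : 0 ≤ (∑ i ∈ b, log (ℓ i)) / T₂ :=
      div_nonneg (sum_nonneg fun i _ => hlog i) hT₂.le
    by_cases hc : (∀ i ∈ b, C i = none) ∧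
        R⁻¹ ≤ (∏ i, baseVec (1 / (ℓ i : ℝ)) (C i)) * ∏ i ∈ b, 1 / (ℓ i : ℝ)
    · rw [if_pos hc, sub_self]
      exact mul_nonneg hp (add_nonneg (sum_nonneg n1) n2)
    · rw [if_neg hc, sub_zero]
      refine le_mul_of_one_le_right hp ?_
      by_cases hb : ∀ i ∈ b, C i = none
      · have hRb : ¬ R⁻¹ ≤ (∏ i, baseVec (1 / (ℓ i : ℝ)) (C i)) * ∏ i ∈ b, 1 / (ℓ i : ℝ) :=
          fun h => hc ⟨hb, h⟩
        rw [not_le, prod_baseVec_eq_prod_fib, prod_one_div_eq_exp (fun i => (hℓ i).pos),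
          prod_congr rfl fun j _ => prod_one_div_eq_exp (fun i => (hℓ i).pos) (fib C j),
          ← exp_sum, ← exp_add, ← exp_log hR, ← exp_neg, exp_lt_exp,
          sum_neg_distrib] at hRb
        have : 1 ≤ (∑ i ∈ b, log (ℓ i)) / T₂ := by
          rw [le_div_iff₀ hT₂]; linarith
        linarith [sum_nonneg n1]
      · push Not at hb
        obtain ⟨i, hi, hCi⟩ := hb
        have := single_le_sum n1 (mem_univ i)
        simp only [hCi, if_false, hi, if_true] at this
        linarith
  simp_rw [mul_add] at s2
  rw [sum_add_distrib] at s2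
  have e3 : ∑ b, G b * (∏ i ∈ b, 1 / (ℓ i : ℝ)) * ((∑ i ∈ b, log (ℓ i)) / T₂)
      = (∑ b, G b * (∏ i ∈ b, 1 / (ℓ i : ℝ)) * ∑ i ∈ b, log (ℓ i)) / T₂ := by
    rw [sum_div]
    exact sum_congr rfl fun b _ => (mul_div_assoc _ _ _).symm
  rw [e3] at s2
  linarith

/-- Lower bound for the mean square after summing out one colour. -/
lemma le_meanSq_redCoef (hℓ : ∀ i, (ℓ i).Prime) (hinj : Function.Injective ℓ)
    (hk : ∀ i, Fintype.card J ≤ ℓ i) (hR : 0 < R) (hG0 : ∀ b, 0 ≤ G b)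
    (hG : ∀ a b, a ⊆ b → G b ≤ G a) {δ T₁ T₂ g1 g2 L1 L2 : ℝ} (hT₁ : 0 < T₁) (hT₂ : 0 < T₂)
    (hT : T₁ + T₂ ≤ log R) (hδ0 : 0 ≤ δ) (hδ : ∀ i, 1 / (ℓ i : ℝ) ≤ δ * log (ℓ i))
    (hg1 : ∑ b, G b * ∏ i ∈ b, 1 / (ℓ i : ℝ) = g1)
    (hg2 : ∑ b, G b ^ 2 * ∏ i ∈ b, 1 / (ℓ i : ℝ) = g2) (hg20 : 0 < g2)
    (hL1 : ∑ b, G b * (∏ i ∈ b, 1 / (ℓ i : ℝ)) * ∑ i ∈ b, log (ℓ i) ≤ L1 * g1)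
    (hL2 : ∑ b, G b ^ 2 * (∏ i ∈ b, 1 / (ℓ i : ℝ)) * ∑ i ∈ b, log (ℓ i) ≤ L2 * g2)
    (hη : L1 / T₂ + δ * T₁ ≤ 1) (hη2 : Fintype.card J * δ * T₁ ≤ 1) :
    g1 ^ 2 * g2 ^ Fintype.card J * ((1 - (L1 / T₂ + δ * T₁)) ^ 2 * (1 - Fintype.card J * δ * T₁) *
        (1 - Fintype.card J ^ 2 * ∑ i, (1 / (ℓ i : ℝ)) ^ 2 - Fintype.card J * L2 / T₁))
      ≤ meanSq ℓ (redCoef (J := J) (fun i => 1 / (ℓ i : ℝ)) G R) := by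
  have hadm := admissible_redCoef (J := J) hℓ hinj hk hR hG0 hG
  refine le_trans ?_ hadm.le_meanSq
  have hlog : ∀ i, 0 ≤ log (ℓ i) := fun i => log_natCast_nonneg _
  have hr : ∀ i, 0 ≤ 1 / (ℓ i : ℝ) := fun i => by positivity
  have hg10 : 0 ≤ g1 := by
    rw [← hg1]
    exact sum_nonneg fun b _ => mul_nonneg (hG0 b) (prod_nonneg fun i _ => hr i)
  set k : ℝ := (Fintype.card J : ℝ) with hkdef
  have hk0 : 0 ≤ k := Nat.cast_nonneg _
  set f : Finset ι → ℝ := fun b => G b ^ 2 * ∏ i ∈ b, 1 / (ℓ i : ℝ) with hf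
  have low := le_sum_prod_fib (J := J) (f := f) (fun b => by positivity) (by rw [hg2]; exact hg20)
    (r := fun i => 1 / (ℓ i : ℝ)) (lam := fun i => log (ℓ i))
    (fun i => sum_mem_le_mul (F := fun b => G b ^ 2) (fun b => sq_nonneg _)
      (fun a b hab => pow_le_pow_left₀ (hG0 b) (hG a b hab) 2) hr i) hlog hT₁
  set c1 : ℝ := (g1 * (1 - (L1 / T₂ + δ * T₁))) ^ 2 * (1 - k * δ * T₁) with hc1
  have hc10 : 0 ≤ c1 := mul_nonneg (sq_nonneg _) (by linarith)
  have step : c1 * (∑ C : ι → Option J, if ∑ j, ∑ i ∈ fib C j, log (ℓ i) ≤ T₁ then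
      ∏ j, f (fib C j) else 0) ≤ ∑ C : ι → Option J, redCoef (fun i => 1 / (ℓ i : ℝ)) G R C ^ 2 *
        ∏ i, baseVec (1 / (ℓ i : ℝ) * (1 - k * (1 / (ℓ i : ℝ)))) (C i) := by
    rw [mul_sum]
    refine sum_le_sum fun C _ => ?_
    have hkr : ∀ i, k * (1 / (ℓ i : ℝ)) ≤ 1 := hadm.card_mul_le
    have hprod : ∀ i, 0 ≤ 1 / (ℓ i : ℝ) * (1 - k * (1 / (ℓ i : ℝ))) := fun i =>
      mul_nonneg (hr i) (by linarith [hkr i])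
    by_cases hC : ∑ j, ∑ i ∈ fib C j, log (ℓ i) ≤ T₁
    · rw [if_pos hC]
      have a1 := le_redSum hℓ hR hG0 hG hT₂ hT hδ0 hδ hC
      rw [hg1] at a1
      have a2 : g1 * (1 - (L1 / T₂ + δ * T₁)) ≤ redSum (fun i => 1 / (ℓ i : ℝ)) G R C := by
        have := div_le_div_of_nonneg_right hL1 hT₂.le
        have e : L1 * g1 / T₂ = L1 / T₂ * g1 := by ring
        rw [e] at this
        linarith
      have a3 : 0 ≤ g1 * (1 - (L1 / T₂ + δ * T₁)) := mul_nonneg hg10 (by linarith)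
      have a4 : (∏ j, ∏ i ∈ fib C j, 1 / (ℓ i : ℝ)) * (1 - k * δ * T₁)
          ≤ ∏ i, baseVec (1 / (ℓ i : ℝ) * (1 - k * (1 / (ℓ i : ℝ)))) (C i) := by
        simp_rw [← baseVec_mul]
        rw [prod_mul_distrib, prod_baseVec_eq_prod_fib]
        refine mul_le_mul_of_nonneg_left ?_ (by positivity)
        have e5 : ∀ i, baseVec (1 - k * (1 / (ℓ i : ℝ))) (C i)
            = 1 - (if C i = none then 0 else k * (1 / (ℓ i : ℝ))) := fun i => by
          rcases C i with _ | s <;> simp [baseVec]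
        simp_rw [e5]
        refine le_trans ?_ (one_sub_sum_le_prod _ (fun i => ?_) fun i => ?_)
        · have : ∑ i, (if C i = none then 0 else k * (1 / (ℓ i : ℝ)))
              ≤ k * δ * ∑ j, ∑ i ∈ fib C j, log (ℓ i) := by
            rw [sum_sum_fib, mul_sum]
            refine sum_le_sum fun i _ => ?_
            split_ifs
            · simp
            · rw [mul_assoc]; exact mul_le_mul_of_nonneg_left (hδ i) hk0
          have := this.trans (mul_le_mul_of_nonneg_left hC (mul_nonneg hk0 hδ0))
          linarith
        · split_ifs
          · exact le_rfl
          · exact mul_nonneg hk0 (hr i)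
        · split_ifs
          · exact zero_le_one
          · exact hkr i
      have e6 : ∏ j, f (fib C j) = (∏ j, G (fib C j)) ^ 2 * ∏ j, ∏ i ∈ fib C j, 1 / (ℓ i : ℝ) := by
        rw [hf, prod_mul_distrib, prod_pow]
      rw [e6, redCoef, mul_pow]
      have a5 := pow_le_pow_left₀ a3 a2 2
      calc c1 * ((∏ j, G (fib C j)) ^ 2 * ∏ j, ∏ i ∈ fib C j, 1 / (ℓ i : ℝ))
          = (∏ j, G (fib C j)) ^ 2 * (g1 * (1 - (L1 / T₂ + δ * T₁))) ^ 2 *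
            ((∏ j, ∏ i ∈ fib C j, 1 / (ℓ i : ℝ)) * (1 - k * δ * T₁)) := by rw [hc1]; ring
        _ ≤ _ := mul_le_mul (mul_le_mul_of_nonneg_left a5 (sq_nonneg _)) a4
            (mul_nonneg (by positivity) (by linarith)) (by positivity)
    · rw [if_neg hC, mul_zero]
      exact mul_nonneg (sq_nonneg _) (prod_nonneg fun i _ => baseVec_nonneg (hprod i) _)
  refine le_trans ?_ step
  refine le_trans ?_ (mul_le_mul_of_nonneg_left low hc10)
  rw [hg2, hc1]
  have e7 : (∑ b, f b * ∑ i ∈ b, log (ℓ i)) / g2 ≤ L2 := by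
    rw [div_le_iff₀ hg20]; exact hL2
  have e8 : k * ((∑ b, f b * ∑ i ∈ b, log (ℓ i)) / g2) / T₁ ≤ k * L2 / T₁ :=
    div_le_div_of_nonneg_right (mul_le_mul_of_nonneg_left e7 hk0) hT₁.le
  have e9 : g2 ^ Fintype.card J * (1 - k ^ 2 * ∑ i, (1 / (ℓ i : ℝ)) ^ 2 - k * L2 / T₁)
      ≤ g2 ^ Fintype.card J * (1 - k ^ 2 * ∑ i, (1 / (ℓ i : ℝ)) ^ 2
        - k * ((∑ b, f b * ∑ i ∈ b, log (ℓ i)) / g2) / T₁) :=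
    mul_le_mul_of_nonneg_left (by linarith) (by positivity)
  refine le_trans (le_of_eq ?_) (mul_le_mul_of_nonneg_left e9 hc10)
  ring

end TupleWeights

section Levels
variable {ι : Type*} [Fintype ι] [DecidableEq ι]

/-- A weighted count of the levels containing `b`. -/
noncomputable def levelSum (A : ℕ → Finset ι) (n : ℕ) (b : Finset ι) : ℝ :=
  ∑ i ∈ range n, (1 / 2 : ℝ) ^ i * if b ⊆ A i then 1 else 0

lemma levelSum_nonneg (A : ℕ → Finset ι) (n : ℕ) (b : Finset ι) : 0 ≤ levelSum A n b :=
  sum_nonneg fun i _ => by split_ifs <;> positivity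

lemma levelSum_anti (A : ℕ → Finset ι) (n : ℕ) (a b : Finset ι) (h : a ⊆ b) :
    levelSum A n b ≤ levelSum A n a := by
  refine sum_le_sum fun i _ => mul_le_mul_of_nonneg_left ?_ (by positivity)
  by_cases hb : b ⊆ A i
  · rw [if_pos hb, if_pos (h.trans hb)]
  · rw [if_neg hb]; split_ifs <;> norm_num

lemma sum_subset_prod (r : ι → ℝ) (A : Finset ι) :
    ∑ b, (if b ⊆ A then 1 else 0) * ∏ i ∈ b, r i = ∏ i ∈ A, (1 + r i) := by
  rw [prod_one_add]
  simp_rw [ite_mul, one_mul, zero_mul]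
  rw [← sum_filter]
  refine sum_congr ?_ fun _ _ => rfl
  ext b; simp

lemma sum_subset_prod_mul_le {r lam : ι → ℝ} (hr : ∀ i, 0 ≤ r i) (hl : ∀ i, 0 ≤ lam i)
    (A : Finset ι) :
    ∑ b, (if b ⊆ A then 1 else 0) * (∏ i ∈ b, r i) * ∑ i ∈ b, lam i
      ≤ (∏ i ∈ A, (1 + r i)) * ∑ i ∈ A, r i * lam i := by
  have e : ∀ b : Finset ι, (if b ⊆ A then 1 else 0) * (∏ i ∈ b, r i) * ∑ i ∈ b, lam i
      = ∑ i ∈ A, lam i * ((if b ⊆ A then 1 else 0) * (∏ i ∈ b, r i) * if i ∈ b then 1 else 0) :=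
    fun b => by
    by_cases hb : b ⊆ A
    · simp only [if_pos hb, one_mul]
      rw [← sum_subset hb (f := fun i => lam i * ((∏ i ∈ b, r i) * if i ∈ b then 1 else 0))
        fun i _ hi => by simp [hi], mul_sum]
      exact sum_congr rfl fun i hi => by rw [if_pos hi]; ring
    · simp [hb]
  simp_rw [e]
  rw [sum_comm, mul_sum]
  refine sum_le_sum fun i _ => ?_
  rw [← mul_sum]
  have := sum_mem_le_mul (F := fun b : Finset ι => if b ⊆ A then (1 : ℝ) else 0)
    (fun b => by split_ifs <;> norm_num) (fun a b hab => by
      by_cases hb : b ⊆ A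
      · rw [if_pos hb, if_pos (hab.trans hb)]
      · rw [if_neg hb]; split_ifs <;> norm_num) hr i
  rw [sum_subset_prod] at this
  refine (mul_le_mul_of_nonneg_left this (hl i)).trans (le_of_eq (by ring))

lemma levelSum_sq {A : ℕ → Finset ι} (hA : Monotone A) (n : ℕ) (b : Finset ι) :
    levelSum A n b ^ 2 = ∑ i ∈ range n, ∑ i' ∈ range n, (1 / 2 : ℝ) ^ (i + i') *
      if b ⊆ A (min i i') then 1 else 0 := by
  rw [pow_two, levelSum, sum_mul_sum]
  refine sum_congr rfl fun i _ => sum_congr rfl fun i' _ => ?_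
  have : b ⊆ A (min i i') ↔ b ⊆ A i ∧ b ⊆ A i' :=
    ⟨fun h => ⟨h.trans (hA (min_le_left _ _)), h.trans (hA (min_le_right _ _))⟩, fun h => by
      rcases min_choice i i' with e | e <;> rw [e]
      · exact h.1
      · exact h.2⟩
  by_cases h1 : b ⊆ A i <;> by_cases h2 : b ⊆ A i' <;> simp [this, h1, h2, pow_add]

lemma sum_half_pow_max (n : ℕ) :
    ∑ i ∈ range n, ∑ i' ∈ range n, (1 / 2 : ℝ) ^ max i i' = 6 - (4 * n + 6) / 2 ^ n := by
  induction n with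
  | zero => norm_num
  | succ n ih =>
    have e1 : ∑ i' ∈ range n, (1 / 2 : ℝ) ^ max n i' = n * (1 / 2 : ℝ) ^ n := by
      rw [sum_congr rfl fun i hi => by
        rw [max_eq_left (mem_range.1 hi).le]]
      simp
    have e2 : ∑ i ∈ range n, (1 / 2 : ℝ) ^ max i n = n * (1 / 2 : ℝ) ^ n := by
      rw [← e1]; exact sum_congr rfl fun i _ => by rw [max_comm]
    rw [sum_range_succ]
    simp_rw [sum_range_succ _ n]
    rw [sum_add_distrib, ih, e1, e2, max_self]
    push_cast
    rw [one_div, inv_pow]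
    field_simp
    ring

lemma sum_half_pow_mul_le (n : ℕ) :
    ∑ i ∈ range n, ∑ i' ∈ range n, (1 / 2 : ℝ) ^ max i i' * 2 ^ min i i' ≤ 3 * n := by
  induction n with
  | zero => norm_num
  | succ n ih =>
    have e1 : ∑ i' ∈ range n, (1 / 2 : ℝ) ^ max n i' * 2 ^ min n i' ≤ 1 := by
      rw [sum_congr rfl fun i hi => by
        rw [max_eq_left (mem_range.1 hi).le, min_eq_right (mem_range.1 hi).le],
        ← mul_sum, geom_sum_eq (by norm_num)]
      rw [one_div, inv_pow, inv_mul_le_iff₀ (by positivity)]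
      norm_num
    have e2 : ∑ i ∈ range n, (1 / 2 : ℝ) ^ max i n * 2 ^ min i n ≤ 1 := by
      refine le_trans (le_of_eq ?_) e1
      exact sum_congr rfl fun i _ => by rw [max_comm, min_comm]
    have e3 : (1 / 2 : ℝ) ^ n * 2 ^ n = 1 := by rw [← mul_pow]; norm_num
    rw [sum_range_succ]
    simp_rw [sum_range_succ _ n]
    rw [sum_add_distrib, max_self, min_self, e3]
    push_cast
    linarith

lemma half_pow_add (i i' : ℕ) : (1 / 2 : ℝ) ^ (i + i') * 2 ^ min i i' = (1 / 2 : ℝ) ^ max i i' := by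
  rw [← min_add_max i i', pow_add, mul_comm, ← mul_assoc, ← mul_pow]
  norm_num

section Bounds
variable {A : ℕ → Finset ι} {n : ℕ} {r lam : ι → ℝ} {θ B s : ℝ}

lemma sum_levelSum_eq : ∑ b, levelSum A n b * ∏ i ∈ b, r i
    = ∑ i ∈ range n, (1 / 2 : ℝ) ^ i * ∏ j ∈ A i, (1 + r j) := by
  simp_rw [levelSum, sum_mul]
  rw [sum_comm]
  refine sum_congr rfl fun i _ => ?_
  rw [← sum_subset_prod, mul_sum]
  exact sum_congr rfl fun b _ => by ring

lemma sum_levelSum_sq_eq (hA : Monotone A) : ∑ b, levelSum A n b ^ 2 * ∏ i ∈ b, r i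
    = ∑ i ∈ range n, ∑ i' ∈ range n,
      (1 / 2 : ℝ) ^ (i + i') * ∏ j ∈ A (min i i'), (1 + r j) := by
  simp_rw [levelSum_sq hA, sum_mul]
  rw [sum_comm]
  refine sum_congr rfl fun i _ => ?_
  rw [sum_comm]
  refine sum_congr rfl fun i' _ => ?_
  rw [← sum_subset_prod, mul_sum]
  exact sum_congr rfl fun b _ => by ring

lemma le_sum_levelSum (h : ∀ i < n, (1 - θ) * (2 ^ i * B) ≤ ∏ j ∈ A i, (1 + r j)) :
    (1 - θ) * (n * B) ≤ ∑ b, levelSum A n b * ∏ i ∈ b, r i := by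
  rw [sum_levelSum_eq]
  have : ∀ i ∈ range n, (1 - θ) * B ≤ (1 / 2 : ℝ) ^ i * ∏ j ∈ A i, (1 + r j) := fun i hi => by
    have h2 : (1 / 2 : ℝ) ^ i * 2 ^ i = 1 := by rw [← mul_pow]; norm_num
    have := mul_le_mul_of_nonneg_left (h i (mem_range.1 hi))
      (by positivity : (0 : ℝ) ≤ (1 / 2) ^ i)
    calc (1 - θ) * B = (1 - θ) * B * ((1 / 2 : ℝ) ^ i * 2 ^ i) := by rw [h2, mul_one]
      _ = (1 / 2 : ℝ) ^ i * ((1 - θ) * (2 ^ i * B)) := by ring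
      _ ≤ _ := this
  have := card_nsmul_le_sum _ _ _ this
  rw [card_range, nsmul_eq_mul] at this
  linarith

lemma sum_levelSum_sq_le (hA : Monotone A) (hB : 0 ≤ (1 + θ) * B)
    (h : ∀ i < n, ∏ j ∈ A i, (1 + r j) ≤ (1 + θ) * (2 ^ i * B)) :
    ∑ b, levelSum A n b ^ 2 * ∏ i ∈ b, r i ≤ (1 + θ) * B * 6 := by
  rw [sum_levelSum_sq_eq hA]
  calc _ ≤ ∑ i ∈ range n, ∑ i' ∈ range n, (1 + θ) * B * (1 / 2 : ℝ) ^ max i i' := by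
        refine sum_le_sum fun i hi => sum_le_sum fun i' hi' => ?_
        rw [← half_pow_add]
        have := mul_le_mul_of_nonneg_left (h (min i i') (lt_of_le_of_lt (min_le_left _ _)
          (mem_range.1 hi))) (by positivity : (0 : ℝ) ≤ (1 / 2) ^ (i + i'))
        linarith
    _ = (1 + θ) * B * (6 - (4 * n + 6) / 2 ^ n) := by
        simp_rw [← mul_sum]; rw [sum_half_pow_max]
    _ ≤ _ := mul_le_mul_of_nonneg_left (by
        have : (0 : ℝ) ≤ (4 * n + 6) / 2 ^ n := by positivity
        linarith) hB

lemma le_sum_levelSum_sq (hA : Monotone A)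
    (h : ∀ i < n, (1 - θ) * (2 ^ i * B) ≤ ∏ j ∈ A i, (1 + r j)) :
    (1 - θ) * B * (6 - (4 * n + 6) / 2 ^ n) ≤ ∑ b, levelSum A n b ^ 2 * ∏ i ∈ b, r i := by
  rw [sum_levelSum_sq_eq hA]
  calc _ = ∑ i ∈ range n, ∑ i' ∈ range n, (1 - θ) * B * (1 / 2 : ℝ) ^ max i i' := by
        simp_rw [← mul_sum]; rw [sum_half_pow_max]
    _ ≤ _ := by
        refine sum_le_sum fun i hi => sum_le_sum fun i' hi' => ?_
        rw [← half_pow_add]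
        have := mul_le_mul_of_nonneg_left (h (min i i') (lt_of_le_of_lt (min_le_left _ _)
          (mem_range.1 hi))) (by positivity : (0 : ℝ) ≤ (1 / 2) ^ (i + i'))
        linarith

lemma sum_levelSum_mul_le (hr : ∀ i, 0 ≤ r i) (hl : ∀ i, 0 ≤ lam i)
    (hB : 0 ≤ (1 + θ) * B) (hs : 0 ≤ s)
    (h : ∀ i < n, ∏ j ∈ A i, (1 + r j) ≤ (1 + θ) * (2 ^ i * B))
    (h' : ∀ i < n, ∑ j ∈ A i, r j * lam j ≤ 2 ^ i * s) :
    ∑ b, levelSum A n b * (∏ i ∈ b, r i) * ∑ i ∈ b, lam i ≤ (1 + θ) * B * s * 2 ^ n := by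
  have e : ∑ b, levelSum A n b * (∏ i ∈ b, r i) * ∑ i ∈ b, lam i
      = ∑ i ∈ range n, (1 / 2 : ℝ) ^ i *
        ∑ b, (if b ⊆ A i then 1 else 0) * (∏ i ∈ b, r i) * ∑ i ∈ b, lam i := by
    simp_rw [levelSum, sum_mul]
    rw [sum_comm]
    refine sum_congr rfl fun i _ => ?_
    rw [mul_sum]
    exact sum_congr rfl fun b _ => by ring
  rw [e]
  calc _ ≤ ∑ i ∈ range n, (1 + θ) * B * s * 2 ^ i := by
        refine sum_le_sum fun i hi => ?_
        have hi' := mem_range.1 hi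
        have h2 : (1 / 2 : ℝ) ^ i * 2 ^ i = 1 := by rw [← mul_pow]; norm_num
        have a1 := (sum_subset_prod_mul_le hr hl (A i)).trans
          (mul_le_mul (h i hi') (h' i hi') (sum_nonneg fun j _ => mul_nonneg (hr j) (hl j))
            (by nlinarith [pow_pos (two_pos : (0 : ℝ) < 2) i]))
        have := mul_le_mul_of_nonneg_left a1 (by positivity : (0 : ℝ) ≤ (1 / 2) ^ i)
        calc _ ≤ _ := this
          _ = (1 + θ) * B * s * 2 ^ i * ((1 / 2 : ℝ) ^ i * 2 ^ i) := by ring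
          _ = _ := by rw [h2, mul_one]
    _ = (1 + θ) * B * s * (2 ^ n - 1) := by
        rw [← mul_sum, geom_sum_eq (by norm_num)]; norm_num
    _ ≤ _ := mul_le_mul_of_nonneg_left (by linarith) (mul_nonneg hB hs)

lemma sum_levelSum_sq_mul_le (hA : Monotone A) (hr : ∀ i, 0 ≤ r i) (hl : ∀ i, 0 ≤ lam i)
    (hB : 0 ≤ (1 + θ) * B) (hs : 0 ≤ s)
    (h : ∀ i < n, ∏ j ∈ A i, (1 + r j) ≤ (1 + θ) * (2 ^ i * B))
    (h' : ∀ i < n, ∑ j ∈ A i, r j * lam j ≤ 2 ^ i * s) :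
    ∑ b, levelSum A n b ^ 2 * (∏ i ∈ b, r i) * ∑ i ∈ b, lam i ≤ (1 + θ) * B * s * (3 * n) := by
  have e : ∑ b, levelSum A n b ^ 2 * (∏ i ∈ b, r i) * ∑ i ∈ b, lam i
      = ∑ i ∈ range n, ∑ i' ∈ range n, (1 / 2 : ℝ) ^ (i + i') *
        ∑ b, (if b ⊆ A (min i i') then 1 else 0) * (∏ i ∈ b, r i) * ∑ i ∈ b, lam i := by
    simp_rw [levelSum_sq hA, sum_mul]
    rw [sum_comm]
    refine sum_congr rfl fun i _ => ?_
    rw [sum_comm]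
    refine sum_congr rfl fun i' _ => ?_
    rw [mul_sum]
    exact sum_congr rfl fun b _ => by ring
  rw [e]
  calc _ ≤ ∑ i ∈ range n, ∑ i' ∈ range n,
        (1 + θ) * B * s * ((1 / 2 : ℝ) ^ max i i' * 2 ^ min i i') := by
        refine sum_le_sum fun i hi => sum_le_sum fun i' _ => ?_
        have hi' := lt_of_le_of_lt (min_le_left i i') (mem_range.1 hi)
        rw [← half_pow_add]
        have a1 := (sum_subset_prod_mul_le hr hl (A (min i i'))).trans
          (mul_le_mul (h _ hi') (h' _ hi') (sum_nonneg fun j _ => mul_nonneg (hr j) (hl j))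
            (by nlinarith [pow_pos (two_pos : (0 : ℝ) < 2) (min i i')]))
        have := mul_le_mul_of_nonneg_left a1 (by positivity : (0 : ℝ) ≤ (1 / 2) ^ (i + i'))
        calc _ ≤ _ := this
          _ = _ := by ring
    _ ≤ _ := by
        simp_rw [← mul_sum]
        exact mul_le_mul_of_nonneg_left (sum_half_pow_mul_le n) (mul_nonneg hB hs)

end Bounds

end Levels

section PrimeRange
open Filter

/-- The primes in the interval `(u, v]`. -/
noncomputable def primeRange (u v : ℝ) : Finset ℕ := (Ioc ⌊u⌋₊ ⌊v⌋₊).filter Nat.Prime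

lemma mem_primeRange {u v : ℝ} (hu : 0 ≤ u) {p : ℕ} :
    p ∈ primeRange u v ↔ p.Prime ∧ u < p ∧ (p : ℝ) ≤ v := by
  rw [primeRange, mem_filter, mem_Ioc, Nat.floor_lt hu]
  constructor
  · rintro ⟨⟨h1, h2⟩, h3⟩
    exact ⟨h3, h1, (Nat.le_floor_iff' h3.ne_zero).1 h2⟩
  · rintro ⟨h3, h1, h2⟩
    exact ⟨⟨h1, (Nat.le_floor_iff' h3.ne_zero).2 h2⟩, h3⟩

lemma sum_primeRange_inv_sq_le {u : ℝ} (hu : 2 ≤ u) (v : ℝ) :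
    ∑ p ∈ primeRange u v, (1 / (p : ℝ)) ^ 2 ≤ 2 / u := by
  have hk : ⌊u⌋₊ ≠ 0 := (Nat.floor_pos.2 (by linarith)).ne'
  have hf : u / 2 ≤ (⌊u⌋₊ : ℝ) := by have := Nat.lt_floor_add_one u; linarith
  have h1 : ∑ p ∈ primeRange u v, (1 / (p : ℝ)) ^ 2 ≤ ∑ p ∈ Ioc ⌊u⌋₊ ⌊v⌋₊, ((p : ℝ) ^ 2)⁻¹ := by
    simp only [one_div, inv_pow]
    exact sum_le_sum_of_subset_of_nonneg (filter_subset _ _) fun i _ _ => by positivity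
  have h2 : (⌊u⌋₊ : ℝ)⁻¹ ≤ 2 / u := by
    rw [show 2 / u = (u / 2)⁻¹ by field_simp]
    exact inv_anti₀ (by linarith) hf
  rcases le_total ⌊u⌋₊ ⌊v⌋₊ with h | h
  · have := sum_Ioc_inv_sq_le_sub (α := ℝ) hk h
    have h3 : 0 ≤ (⌊v⌋₊ : ℝ)⁻¹ := by positivity
    linarith
  · rw [Ioc_eq_empty (by omega)] at h1
    exact h1.trans (by rw [sum_empty]; positivity)

lemma exists_sum_primeRange_log_div_le : ∃ C : ℝ, 0 ≤ C ∧ ∀ u v : ℝ, 1 ≤ u → u ≤ v →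
    ∑ p ∈ primeRange u v, 1 / (p : ℝ) * log p ≤ log v - log u + C := by
  obtain ⟨C, hC, h⟩ := exists_sum_log_div_prime
  refine ⟨2 * C, by linarith, fun u v hu huv => ?_⟩
  have h1 := abs_le.1 (h u hu)
  have h2 := abs_le.1 (h v (hu.trans huv))
  have h3 : ∑ p ∈ primeRange u v, 1 / (p : ℝ) * log p
      = ∑ k ∈ Ioc ⌊u⌋₊ ⌊v⌋₊, (if k.Prime then log k / k else 0) := by
    rw [primeRange, sum_filter]
    exact sum_congr rfl fun k _ => by split_ifs <;> ring
  have h4 : ∑ k ∈ Icc 0 ⌊u⌋₊, (if k.Prime then log k / (k : ℝ) else 0)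
      + ∑ k ∈ Ioc ⌊u⌋₊ ⌊v⌋₊, (if k.Prime then log k / (k : ℝ) else 0)
      = ∑ k ∈ Icc 0 ⌊v⌋₊, (if k.Prime then log k / (k : ℝ) else 0) := by
    have hf := Nat.floor_le_floor huv
    rw [← sum_union]
    · congr 1; ext i; simp only [mem_union, mem_Icc, mem_Ioc]; omega
    · rw [disjoint_left]; intro i; simp only [mem_Icc, mem_Ioc]; omega
  linarith

lemma exists_sum_primeRange_inv : ∃ C : ℝ, 0 ≤ C ∧ ∀ u v : ℝ, 2 ≤ u → u ≤ v →
    |∑ p ∈ primeRange u v, 1 / (p : ℝ) - log (log v / log u)|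
      ≤ C / log u := by
  obtain ⟨C, hC, h⟩ := exists_sum_inv_prime
  refine ⟨C, hC, fun u v hu huv => ?_⟩
  rw [primeRange, sum_filter]
  exact h u v hu huv

lemma exp_sub_sq_le {s : ℝ} (hs : 0 ≤ s) : exp (s - s ^ 2) ≤ 1 + s := by
  rw [← le_log_iff_exp_le (by linarith)]
  refine le_trans ?_ (le_log_one_add_of_nonneg hs)
  rw [le_div_iff₀ (by linarith)]
  nlinarith [mul_nonneg hs (mul_nonneg hs hs), mul_nonneg hs hs]

/-- Mertens' product theorem for the products of `1 + 1/p` and `1 - 1/p`. -/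
lemma eventually_prod_primeRange {θ : ℝ} (hθ : 0 < θ) : ∀ᶠ u : ℝ in atTop, ∀ v, u ≤ v →
    (1 - θ) * (log v / log u) ≤ ∏ p ∈ primeRange u v, (1 + 1 / (p : ℝ)) ∧
    ∏ p ∈ primeRange u v, (1 + 1 / (p : ℝ)) ≤ (1 + θ) * (log v / log u) ∧
    (1 - θ) * (log u / log v) ≤ ∏ p ∈ primeRange u v, (1 - 1 / (p : ℝ)) ∧
    ∏ p ∈ primeRange u v, (1 - 1 / (p : ℝ)) ≤ (1 + θ) * (log u / log v) := by
  obtain ⟨C, hC, hM⟩ := exists_sum_primeRange_inv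
  have ht : Tendsto (fun u : ℝ => C / log u + 2 / u) atTop (nhds (0 + 0)) :=
    (tendsto_const_nhds.div_atTop tendsto_log_atTop).add
      (tendsto_const_nhds.div_atTop tendsto_id)
  rw [add_zero] at ht
  have e1 : ∀ᶠ u : ℝ in atTop, exp (C / log u + 2 / u) ≤ 1 + θ := by
    have := (continuous_exp.tendsto 0).comp ht
    rw [exp_zero] at this
    exact this.eventually_le_const (by linarith)
  have e2 : ∀ᶠ u : ℝ in atTop, 1 - θ ≤ exp (-(C / log u + 2 / u)) * (1 - 2 / u) := by
    have := ((continuous_exp.tendsto _).comp ht.neg).mul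
      ((tendsto_const_nhds (x := (1 : ℝ))).sub
        ((tendsto_const_nhds (x := (2 : ℝ))).div_atTop (tendsto_id (α := ℝ) (x := atTop))))
    refine this.eventually_const_le ?_
    norm_num
    exact hθ
  filter_upwards [e1, e2, eventually_ge_atTop 3] with u h1 h2 hu v huv
  have hlu : 0 < log u := log_pos (by linarith)
  have hlv : 0 < log v := log_pos (by linarith)
  obtain ⟨m1, m2⟩ := abs_le.1 (hM u v (by linarith) huv)
  have hsq := sum_primeRange_inv_sq_le (by linarith : (2 : ℝ) ≤ u) v
  have hu2 : 2 / u < 1 := by rw [div_lt_one (by linarith)]; linarith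
  have hu0 : 0 < 2 / u := by positivity
  set S := ∑ p ∈ primeRange u v, 1 / (p : ℝ) with hS
  have hr : 0 < log v / log u := by positivity
  have up : ∏ p ∈ primeRange u v, (1 + 1 / (p : ℝ)) ≤ exp S := by
    rw [hS, exp_sum]
    exact prod_le_prod (fun i _ => by positivity) fun i _ => by
      have := add_one_le_exp (1 / (i : ℝ)); linarith
  have lo : exp (S - 2 / u) ≤ ∏ p ∈ primeRange u v, (1 + 1 / (p : ℝ)) := by
    refine le_trans (exp_le_exp.2 (sub_le_sub_left hsq _)) ?_
    rw [hS, ← sum_sub_distrib, exp_sum]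
    exact prod_le_prod (fun i _ => by positivity) fun i _ => exp_sub_sq_le (by positivity)
  have hpos : 0 < ∏ p ∈ primeRange u v, (1 + 1 / (p : ℝ)) := prod_pos fun i _ => by positivity
  have U : ∏ p ∈ primeRange u v, (1 + 1 / (p : ℝ))
      ≤ exp (C / log u + 2 / u) * (log v / log u) := by
    refine up.trans ?_
    rw [← exp_log hr, ← exp_add, exp_le_exp]
    linarith
  have L : exp (-(C / log u + 2 / u)) * (log v / log u)
      ≤ ∏ p ∈ primeRange u v, (1 + 1 / (p : ℝ)) := by
    refine le_trans ?_ lo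
    rw [← exp_log hr, ← exp_add, exp_le_exp]
    linarith
  have id1 : ∏ p ∈ primeRange u v, (1 - 1 / (p : ℝ))
      = (∏ p ∈ primeRange u v, (1 - (1 / (p : ℝ)) ^ 2))
        * (∏ p ∈ primeRange u v, (1 + 1 / (p : ℝ)))⁻¹ := by
    rw [eq_mul_inv_iff_mul_eq₀ hpos.ne', ← prod_mul_distrib]
    exact prod_congr rfl fun i _ => by ring
  have hle1 : ∀ i : ℕ, 1 / (i : ℝ) ≤ 1 := fun i => by
    rcases Nat.eq_zero_or_pos i with h | h
    · simp [h]
    · rw [div_le_one (by exact_mod_cast h)]; exact_mod_cast h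
  have q1 : 1 - 2 / u ≤ ∏ p ∈ primeRange u v, (1 - (1 / (p : ℝ)) ^ 2) :=
    le_trans (by linarith) (one_sub_sum_le_prod _ (fun i => by positivity)
      fun i => pow_le_one₀ (by positivity) (hle1 i))
  have q2 : ∏ p ∈ primeRange u v, (1 - (1 / (p : ℝ)) ^ 2) ≤ 1 :=
    prod_le_one (fun i _ => by
      have := pow_le_one₀ (n := 2) (by positivity) (hle1 i); linarith)
      fun i _ => by have : (0 : ℝ) ≤ (1 / (i : ℝ)) ^ 2 := by positivity
                    linarith
  have hinv : log u / log v = (log v / log u)⁻¹ := by rw [inv_div]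
  have hE := exp_pos (C / log u + 2 / u)
  refine ⟨?_, U.trans (by gcongr), ?_, ?_⟩
  · refine le_trans ?_ L
    refine mul_le_mul_of_nonneg_right (h2.trans ?_) hr.le
    exact mul_le_of_le_one_right (exp_pos _).le (by linarith)
  · rw [id1, hinv]
    refine le_trans ?_ (mul_le_mul q1 (inv_anti₀ hpos U) (by positivity) (by linarith))
    rw [mul_inv, ← mul_assoc]
    refine mul_le_mul_of_nonneg_right (h2.trans ?_) (by positivity)
    rw [exp_neg, mul_comm]
  · rw [id1, hinv]
    refine le_trans (mul_le_of_le_one_left (by positivity) q2) ?_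
    refine (inv_anti₀ (by positivity) L).trans ?_
    rw [mul_inv, exp_neg, inv_inv]
    gcongr

end PrimeRange

/-- If the fluctuations of `F` around values that are at least `γ` are small in mean square on
residue classes, then few `q` have a small total degree. -/
lemma card_small_degree_mul_le {Q P : Finset ℕ} {W H : ℕ} (hW : 0 < W) {F E : ℕ → ℕ → ℕ → ℝ}
    {γ ε c₁ c₂ : ℝ} (hε : 0 ≤ ε) (hγ : 0 ≤ γ) (hc₂ : 0 ≤ c₂) (hE : ∀ v p h, γ ≤ E v p h)
    (hsec : ∀ v < W, ∀ p₀ < W, ∀ h ∈ Icc 1 H,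
      ∑ q ∈ Q with q % W = v, (∑ p ∈ P with p % W = p₀, (F p q h - E v p₀ h)) ^ 2
        ≤ c₁ * (P.filter fun p => p % W = p₀).card
          + c₂ * ((P.filter fun p => p % W = p₀).card : ℝ) ^ 2) :
    ((Q.filter fun q => ∑ p ∈ P, ∑ h ∈ Icc 1 H, F p q h < (1 - ε) * (γ * H * P.card)).card : ℝ)
      * (ε * (γ * H * P.card)) ^ 2 ≤ W ^ 2 * H ^ 2 * (c₁ * P.card + c₂ * P.card ^ 2) := by
  set N : ℕ → ℝ := fun p₀ => ((P.filter fun p => p % W = p₀).card : ℝ) with hN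
  have hNs : ∑ p₀ ∈ range W, N p₀ = P.card := by
    have := card_eq_sum_card_fiberwise (f := fun p => p % W) (s := P) (t := range W)
      fun p _ => by simpa using Nat.mod_lt p hW
    rw [this]; push_cast; rfl
  set D : ℕ → ℕ → ℕ → ℝ := fun q p₀ h =>
    ∑ p ∈ P with p % W = p₀, (F p q h - E (q % W) p₀ h) with hD
  have key : ∀ q ∈ Q.filter fun q => ∑ p ∈ P, ∑ h ∈ Icc 1 H, F p q h
      < (1 - ε) * (γ * H * P.card), (ε * (γ * H * P.card)) ^ 2
        ≤ W * H * ∑ p₀ ∈ range W, ∑ h ∈ Icc 1 H, D q p₀ h ^ 2 := by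
    intro q hq
    have h1 : ∑ p ∈ P, ∑ h ∈ Icc 1 H, F p q h = ∑ p₀ ∈ range W, ∑ h ∈ Icc 1 H,
        (D q p₀ h + N p₀ * E (q % W) p₀ h) := by
      rw [← sum_fiberwise_of_maps_to (g := fun p => p % W) (t := range W)
        fun p _ => by simpa using Nat.mod_lt p hW]
      refine sum_congr rfl fun p₀ _ => ?_
      rw [sum_comm]
      refine sum_congr rfl fun h _ => ?_
      simp only [hD, hN, sum_sub_distrib, sum_const, nsmul_eq_mul]
      ring
    have h2 : γ * H * P.card ≤ ∑ p₀ ∈ range W, ∑ h ∈ Icc 1 H, N p₀ * E (q % W) p₀ h := by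
      rw [← hNs, mul_sum]
      refine sum_le_sum fun p₀ _ => ?_
      calc γ * H * N p₀ = ∑ h ∈ Icc 1 H, N p₀ * γ := by simp; ring
        _ ≤ _ := sum_le_sum fun h _ => mul_le_mul_of_nonneg_left (hE _ _ _) (by positivity)
    have h3 := (mem_filter.1 hq).2
    rw [h1] at h3
    simp only [sum_add_distrib] at h3
    have h4 : ε * (γ * H * P.card) ≤ -∑ p₀ ∈ range W, ∑ h ∈ Icc 1 H, D q p₀ h := by linarith
    have h5 : (ε * (γ * H * P.card)) ^ 2 ≤ (∑ p₀ ∈ range W, ∑ h ∈ Icc 1 H, D q p₀ h) ^ 2 := by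
      rw [← neg_sq (∑ p₀ ∈ range W, _)]
      exact pow_le_pow_left₀ (by positivity) h4 2
    refine h5.trans ?_
    rw [← sum_product' (f := fun p₀ h => D q p₀ h), ← sum_product' (f := fun p₀ h => D q p₀ h ^ 2)]
    refine sq_sum_le_card_mul_sum_sq.trans_eq ?_
    simp
  have h6 := sum_le_sum key
  rw [sum_const, nsmul_eq_mul] at h6
  refine h6.trans ?_
  have h7 : ∑ q ∈ Q, ∑ p₀ ∈ range W, ∑ h ∈ Icc 1 H, D q p₀ h ^ 2
      ≤ W * (H * (c₁ * P.card + c₂ * P.card ^ 2)) := by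
    rw [← sum_fiberwise_of_maps_to (g := fun p => p % W) (t := range W)
        fun p _ => by simpa using Nat.mod_lt p hW]
    have : ∀ v ∈ range W, ∑ q ∈ Q with q % W = v, ∑ p₀ ∈ range W, ∑ h ∈ Icc 1 H, D q p₀ h ^ 2
        ≤ H * (c₁ * P.card + c₂ * P.card ^ 2) := by
      intro v hv
      rw [sum_comm]
      have h8 : ∀ p₀ ∈ range W, ∑ q ∈ Q with q % W = v, ∑ h ∈ Icc 1 H, D q p₀ h ^ 2
          ≤ H * (c₁ * N p₀ + c₂ * N p₀ ^ 2) := by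
        intro p₀ hp
        rw [sum_comm]
        calc _ ≤ ∑ h ∈ Icc 1 H, (c₁ * N p₀ + c₂ * N p₀ ^ 2) := by
              refine sum_le_sum fun h hh => ?_
              refine le_trans (le_of_eq ?_) (hsec v (mem_range.1 hv) p₀ (mem_range.1 hp) h hh)
              refine sum_congr rfl fun q hq => ?_
              simp only [hD, (mem_filter.1 hq).2]
          _ = _ := by simp; ring
      refine (sum_le_sum h8).trans ?_
      rw [← mul_sum, sum_add_distrib, ← mul_sum, ← mul_sum, hNs]
      have : ∑ i ∈ range W, N i ^ 2 ≤ (P.card : ℝ) ^ 2 := by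
        rw [← hNs]; exact sum_sq_le_sq_sum_of_nonneg fun i _ => by positivity
      gcongr
    refine (sum_le_sum this).trans (by simp)
  calc _ ≤ ∑ q ∈ Q, (W * H * ∑ p₀ ∈ range W, ∑ h ∈ Icc 1 H, D q p₀ h ^ 2) :=
        sum_le_sum_of_subset_of_nonneg (filter_subset _ _) fun i _ _ => by positivity
    _ = W * H * ∑ q ∈ Q, ∑ p₀ ∈ range W, ∑ h ∈ Icc 1 H, D q p₀ h ^ 2 := by rw [mul_sum]
    _ ≤ W * H * (W * (H * (c₁ * P.card + c₂ * P.card ^ 2))) := by gcongr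
    _ = _ := by ring

section SieveWeights
variable {ι : Type*} [Fintype ι] [DecidableEq ι]

/-- The total mass of `G` for the weights `∏ 1/ℓ`. -/
noncomputable def mass (ℓ : ι → ℕ) (G : Finset ι → ℝ) : ℝ := ∑ b, G b * ∏ i ∈ b, 1 / (ℓ i : ℝ)

/-- The total mass of `G ^ 2` for the weights `∏ 1/ℓ`. -/
noncomputable def sqMass (ℓ : ι → ℕ) (G : Finset ι → ℝ) : ℝ :=
  ∑ b, G b ^ 2 * ∏ i ∈ b, 1 / (ℓ i : ℝ)

/-- The shifts `j ≤ H` for which `n + j p` is coprime to `W`. -/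
def coprimeShifts (W H : ℕ) (n p : ℤ) : Finset ℕ :=
  (Icc 1 H).filter fun j => Int.gcd (n + j * p) W = 1

lemma gcd_eq_of_modEq {W : ℕ} {a b : ℤ} (h : a ≡ b [ZMOD W]) : Int.gcd a W = Int.gcd b W := by
  rw [← Int.gcd_emod, h, Int.gcd_emod]

lemma coprimeShifts_congr {W H : ℕ} {n n' p p' : ℤ} (hn : n ≡ n' [ZMOD W])
    (hp : p ≡ p' [ZMOD W]) : coprimeShifts W H n p = coprimeShifts W H n' p' := by
  refine filter_congr fun j _ => ?_
  rw [gcd_eq_of_modEq (hn.add (hp.mul_left _))]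

/-- The multidimensional sieve weight attached to the tuple `(n + j p)_{j ∈ J}`. -/
noncomputable def tupleWeight (ℓ : ι → ℕ) (G : Finset ι → ℝ) (R : ℝ) (J : Finset ℕ) (p n : ℤ) : ℝ :=
  weight ℓ (tupleCoef (fun i => 1 / (ℓ i : ℝ)) G R) (fun j : J => ((j : ℕ) : ℤ)) p n

/-- The standing assumptions on the sieve weights. -/
structure SieveSetup (ℓ : ι → ℕ) (G : Finset ι → ℝ) (R : ℝ) (W H : ℕ) : Prop where
  prime : ∀ i, (ℓ i).Prime
  inj : Function.Injective ℓ
  lt : ∀ i, H < ℓ i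
  nonneg : ∀ b, 0 ≤ G b
  anti : ∀ a b, a ⊆ b → G b ≤ G a
  R_pos : 0 < R
  W_pos : 0 < W
  coprime : ∀ i, W.Coprime (ℓ i)
  sq_pos : 0 < sqMass ℓ G

/-- The normalized square of the sieve weight. -/
noncomputable def normWeight (ℓ : ι → ℕ) (G : Finset ι → ℝ) (R : ℝ) (W H : ℕ) (p n : ℤ) : ℝ :=
  tupleWeight ℓ G R (coprimeShifts W H n p) p n ^ 2 / sqMass ℓ G ^ (coprimeShifts W H n p).card

variable {ℓ : ι → ℕ} {G : Finset ι → ℝ} {R : ℝ} {W H : ℕ}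

lemma errFactor_pos (ℓ : ι → ℕ) (k : ℕ) {R : ℝ} (hR : 0 < R) : 0 < errFactor ℓ k R := by
  unfold errFactor
  positivity

lemma errFactor_mono (ℓ : ι → ℕ) {k k' : ℕ} (h : k ≤ k') (R : ℝ) :
    errFactor ℓ k R ≤ errFactor ℓ k' R := by
  unfold errFactor
  gcongr

lemma card_coprimeShifts_le (W H : ℕ) (n p : ℤ) : (coprimeShifts W H n p).card ≤ H := by
  refine (card_filter_le _ _).trans (by simp)

namespace SieveSetup

variable (h : SieveSetup ℓ G R W H)
include h

lemma normWeight_nonneg (p n : ℤ) : 0 ≤ normWeight ℓ G R W H p n :=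
  div_nonneg (sq_nonneg _) (pow_nonneg h.sq_pos.le _)

lemma admissible {J : Finset ℕ} (hJ : J.card ≤ H) :
    Admissible ℓ (tupleCoef (J := J) (fun i => 1 / (ℓ i : ℝ)) G R) R :=
  admissible_tupleCoef h.prime h.inj (fun i => by simpa using hJ.trans (h.lt i).le) h.R_pos
    h.nonneg h.anti

lemma not_dvd_shift {p : ℤ} (hp : ∀ i, ¬(ℓ i : ℤ) ∣ p) (i : ι) {a b c : ℕ} (ha : a ≤ H) (hb : b ≤ H)
    (hab : a ≠ b) : ¬(ℓ i : ℤ) ∣ ((a : ℤ) - c) * p - ((b : ℤ) - c) * p := by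
  intro hd
  rw [← sub_mul] at hd
  rcases (Nat.prime_iff_prime_int.1 (h.prime i)).dvd_or_dvd hd with h1 | h1
  · have h2 := Int.le_of_dvd (abs_pos.2 (by omega)) ((dvd_abs _ _).2 h1)
    have := h.lt i
    grind
  · exact hp i h1

lemma not_dvd_coe {J : Finset ℕ} (hJ : J ⊆ Icc 1 H) {p : ℤ} (hp : ∀ i, ¬(ℓ i : ℤ) ∣ p) (i : ι)
    (s s' : J) (hs : s ≠ s') : ¬(ℓ i : ℤ) ∣ ((s : ℕ) : ℤ) * p - ((s' : ℕ) : ℤ) * p := by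
  have := h.not_dvd_shift hp i (c := 0) (mem_Icc.1 (hJ s.2)).2 (mem_Icc.1 (hJ s'.2)).2
    fun h => hs (Subtype.ext h)
  simpa using this

lemma normSq_le (J : Finset ℕ) :
    normSq ℓ (tupleCoef (J := J) (fun i => 1 / (ℓ i : ℝ)) G R) ≤ sqMass ℓ G ^ J.card := by
  have := normSq_tupleCoef_le (J := J) (ℓ := ℓ) (R := R) h.nonneg
  rwa [Fintype.card_coe] at this

lemma normWeight_le {p : ℤ} (hp : ∀ i, ¬(ℓ i : ℤ) ∣ p) (n : ℤ) :
    normWeight ℓ G R W H p n ≤ errFactor ℓ H R := by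
  have hc := card_coprimeShifts_le W H n p
  unfold normWeight
  rw [div_le_iff₀ (pow_pos h.sq_pos _), mul_comm]
  refine ((h.admissible hc).weight_sq_le (h.not_dvd_coe (filter_subset _ _) hp) n).trans ?_
  rw [Fintype.card_coe]
  exact mul_le_mul (h.normSq_le _) (errFactor_mono _ hc _) (errFactor_pos _ _ h.R_pos).le
    (pow_nonneg h.sq_pos.le _)

lemma sum_normWeight_le {p : ℤ} (hp : ∀ i, ¬(ℓ i : ℤ) ∣ p) {a b : ℤ} (hab : a ≤ b) :
    ∑ n ∈ Ioc a b, normWeight ℓ G R W H p n ≤ (b - a) + W * errFactor ℓ H R := by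
  have hW : (0 : ℤ) < W := by exact_mod_cast h.W_pos
  rw [← sum_fiberwise_of_maps_to (g := fun n => n % (W : ℤ)) (t := Ico (0 : ℤ) W)
    fun n _ => mem_Ico.2 ⟨Int.emod_nonneg _ hW.ne', Int.emod_lt_of_pos _ hW⟩]
  have key : ∀ v ∈ Ico (0 : ℤ) W, ∑ n ∈ Ioc a b with n % (W : ℤ) = v, normWeight ℓ G R W H p n
      ≤ (b - a) / W + errFactor ℓ H R := by
    intro v hv
    have hv' : ∀ n : ℤ, n % (W : ℤ) = v ↔ n ≡ v [ZMOD W] := fun n => by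
      rw [Int.ModEq, Int.emod_eq_of_lt (mem_Ico.1 hv).1 (mem_Ico.1 hv).2]
    simp only [hv']
    set J := coprimeShifts W H v p with hJ
    have hc : J.card ≤ H := card_coprimeShifts_le W H v p
    have h1 : ∑ n ∈ Ioc a b with n ≡ v [ZMOD W], normWeight ℓ G R W H p n
        = (∑ n ∈ Ioc a b with n ≡ v [ZMOD W], tupleWeight ℓ G R J p n ^ 2)
          / sqMass ℓ G ^ J.card := by
      rw [sum_div]
      refine sum_congr rfl fun n hn => ?_
      rw [normWeight, coprimeShifts_congr (mem_filter.1 hn).2 (Int.ModEq.refl p)]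
    rw [h1, div_le_iff₀ (pow_pos h.sq_pos _)]
    have h2 := (abs_le.1 ((h.admissible hc).abs_sum_weight_sq_sub_le
      (h.not_dvd_coe (filter_subset _ _) hp) hab h.W_pos h.coprime v)).2
    rw [Fintype.card_coe] at h2
    have h3 := (h.admissible hc).meanSq_le.trans (h.normSq_le J)
    have h4 := mul_le_mul (h.normSq_le J) (errFactor_mono ℓ hc R)
      (errFactor_pos ℓ _ h.R_pos).le (pow_nonneg h.sq_pos.le _)
    have h5 : (0 : ℝ) ≤ (b - a) / W := div_nonneg (by simp_all) (Nat.cast_nonneg W)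
    have h6 := mul_le_mul_of_nonneg_left h3 h5
    unfold tupleWeight
    linarith
  refine (sum_le_sum key).trans ?_
  rw [sum_const, nsmul_eq_mul, Int.card_Ico]
  have : (W : ℝ) ≠ 0 := by exact_mod_cast h.W_pos.ne'
  simp
  field_simp
  exact le_rfl

end SieveSetup

variable {ℓ : ι → ℕ} {G : Finset ι → ℝ} {R : ℝ} {W H : ℕ}

lemma tupleWeight_eq {J : Finset ℕ} (j₀ : J) {p q : ℤ} (hq : ∀ i, ¬(ℓ i : ℤ) ∣ q) :
    tupleWeight ℓ G R J p (q - ((j₀ : ℕ) : ℤ) * p)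
      = weight ℓ (redCoef (J := {j : J // j ≠ j₀}) (fun i => 1 / (ℓ i : ℝ)) G R)
        (fun j : {j : J // j ≠ j₀} => ((j.1 : ℕ) : ℤ) - ((j₀ : ℕ) : ℤ)) p q := by
  unfold tupleWeight weight
  rw [sieveSum_tupleCoef _ G R j₀ fun i => by simp [ev, hq i]]
  congr 1
  funext i j
  unfold ev
  rw [show q - ((j₀ : ℕ) : ℤ) * p + ((j.1 : ℕ) : ℤ) * p
    = q + (((j.1 : ℕ) : ℤ) - ((j₀ : ℕ) : ℤ)) * p by ring]

lemma variance_bound_le {y x c N g t e e' r r' : ℝ} (hy : 0 ≤ y) (hx : 0 ≤ x) (hc : 0 ≤ c)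
    (hN : 0 ≤ N) (hNg : N ≤ g * t) (he : 0 ≤ e) (hee : e ≤ e') (hr : 0 ≤ r) (hrr : r ≤ r') :
    y * (c * x) * N ^ 2 * e + (c * (N * r)) ^ 2
      ≤ (y * x * g ^ 2 * e' * c + (g * r') ^ 2 * c ^ 2) * t ^ 2 := by
  have := hN.trans hNg
  calc _ ≤ y * (c * x) * (g * t) ^ 2 * e' + (c * ((g * t) * r')) ^ 2 := by gcongr
    _ = _ := by ring

/-- All but few `q` have a large total degree with respect to the normalized sieve weights. -/
lemma SieveSetup.card_small_degree_mul_le (h : SieveSetup ℓ G R W H) {Q P : Finset ℕ} {a b : ℤ}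
    {X K : ℕ} {γ ε : ℝ} (hab : a ≤ b)
    (hQ : ∀ q ∈ Q, (q : ℤ) ∈ Ioc a b ∧ Int.gcd q W = 1 ∧ ∀ i, ¬(ℓ i : ℤ) ∣ q)
    (hP : ∀ p ∈ P, 0 < p ∧ p ≤ X ∧ Int.gcd p W = 1 ∧ ∀ i, ¬(ℓ i : ℤ) ∣ p)
    (hWR : W * R ^ 2 ≤ X)
    (hK : ∀ n p : ℤ, Int.gcd p W = 1 → (coprimeShifts W H n p).card ≤ K)
    (hmean : ∀ J ⊆ Icc 1 H, J.card ≤ K → ∀ j₀ : J, γ * sqMass ℓ G ^ J.card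
      ≤ meanSq ℓ (redCoef (J := {j : J // j ≠ j₀}) (fun i => 1 / (ℓ i : ℝ)) G R))
    (hγ : 0 ≤ γ) (hε : 0 ≤ ε) :
    ((Q.filter fun q : ℕ => ∑ p ∈ P, ∑ j ∈ Icc 1 H, normWeight ℓ G R W H p (((q : ℕ) : ℤ) - j * p)
        < (1 - ε) * (γ * H * P.card)).card : ℝ) * (ε * (γ * H * P.card)) ^ 2
      ≤ W ^ 2 * H ^ 2 * (((b - a) / W * (2 * (X / W)) * (mass ℓ G ^ 2 / sqMass ℓ G) ^ 2
          * (∏ i, (1 + (H : ℝ) ^ 2 * (648 * (1 / (ℓ i : ℝ)) ^ 2)) - 1)) * P.card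
        + (mass ℓ G ^ 2 / sqMass ℓ G * errFactor ℓ H R) ^ 2 * P.card ^ 2) := by
  classical
  have hsq := h.sq_pos
  have hab' : (0 : ℝ) ≤ b - a := by
    have : (a : ℝ) ≤ b := by exact_mod_cast hab
    linarith
  have hE1 : ∀ k : ℕ, 1 ≤ ∏ i, (1 + (k : ℝ) ^ 2 * (648 * (1 / (ℓ i : ℝ)) ^ 2)) := fun k =>
    calc (1 : ℝ) = ∏ _i : ι, (1 : ℝ) := by simp
      _ ≤ _ := prod_le_prod (fun i _ => zero_le_one) fun i _ =>
        le_add_of_nonneg_right (by positivity)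
  set E : ℕ → ℕ → ℕ → ℝ := fun v p₀ j =>
    if hj : j ∈ coprimeShifts W H ((v : ℤ) - j * p₀) p₀ ∧ Int.gcd p₀ W = 1 then
      meanSq ℓ (redCoef (J := {i : coprimeShifts W H ((v : ℤ) - j * p₀) p₀ // i ≠ ⟨j, hj.1⟩})
        (fun i => 1 / (ℓ i : ℝ)) G R)
        / sqMass ℓ G ^ (coprimeShifts W H ((v : ℤ) - j * p₀) p₀).card
    else γ with hE
  refine RandomSieve.card_small_degree_mul_le (E := E) (c₂ := _) h.W_pos hε hγ (sq_nonneg _)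
    (fun v p₀ j => ?_) fun v hv p₀ hp₀ j hj => ?_
  · simp only [hE]
    split_ifs with hj
    · rw [le_div_iff₀ (pow_pos hsq _)]
      exact hmean _ (filter_subset _ _) (hK _ _ hj.2) _
    · exact le_rfl
  set P' := P.filter fun p => p % W = p₀ with hP'
  have hrhs : 0 ≤ ((b : ℝ) - a) / W * (2 * (X / W)) * (mass ℓ G ^ 2 / sqMass ℓ G) ^ 2
          * (∏ i, (1 + (H : ℝ) ^ 2 * (648 * (1 / (ℓ i : ℝ)) ^ 2)) - 1) * P'.card
        + (mass ℓ G ^ 2 / sqMass ℓ G * errFactor ℓ H R) ^ 2 * (P'.card : ℝ) ^ 2 := by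
    have := sub_nonneg.2 (hE1 H)
    positivity
  rcases (Q.filter fun q => q % W = v).eq_empty_or_nonempty with hQe | ⟨q₁, hq₁⟩
  · rw [hQe, sum_empty]; exact hrhs
  rcases P'.eq_empty_or_nonempty with hPe | ⟨p₁, hp₁⟩
  · rw [hPe] at hrhs ⊢
    simpa using hrhs
  have hqv : ∀ q ∈ Q.filter fun q => q % W = v, (q : ℤ) ≡ v [ZMOD W] := fun q hq => by
    rw [Int.natCast_modEq_iff, ← (mem_filter.1 hq).2]; exact (Nat.mod_modEq _ _).symm
  have hpv : ∀ p ∈ P', (p : ℤ) ≡ p₀ [ZMOD W] := fun p hp => by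
    rw [Int.natCast_modEq_iff, ← (mem_filter.1 hp).2]; exact (Nat.mod_modEq _ _).symm
  set J := coprimeShifts W H ((v : ℤ) - j * p₀) p₀ with hJ
  have hj1 : j ∈ J ∧ Int.gcd p₀ W = 1 := by
    refine ⟨mem_filter.2 ⟨hj, ?_⟩, ?_⟩
    · rw [show (v : ℤ) - j * p₀ + j * p₀ = v by ring, ← gcd_eq_of_modEq (hqv q₁ hq₁)]
      exact (hQ _ (mem_filter.1 hq₁).1).2.1
    · rw [← gcd_eq_of_modEq (hpv p₁ hp₁)]
      exact (hP _ (mem_filter.1 hp₁).1).2.2.1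
  set j₀ : J := ⟨j, hj1.1⟩ with hj₀
  set Z := redCoef (J := {j : J // j ≠ j₀}) (fun i => 1 / (ℓ i : ℝ)) G R with hZ
  set s := sqMass ℓ G with hs
  have hc : J.card ≤ H := card_coprimeShifts_le _ _ _ _
  have hJH : J ⊆ Icc 1 H := filter_subset _ _
  have hEv : E v p₀ j = meanSq ℓ Z / s ^ J.card := by
    simp only [hE]
    rw [dif_pos hj1]
  have hF : ∀ q ∈ Q.filter fun q => q % W = v, ∀ p ∈ P',
      normWeight ℓ G R W H p ((q : ℤ) - j * p) = weight ℓ Z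
        (fun j : {j : J // j ≠ j₀} => ((j.1 : ℕ) : ℤ) - ((j₀ : ℕ) : ℤ)) p q ^ 2 / s ^ J.card := by
    intro q hq p hp
    rw [normWeight, coprimeShifts_congr ((hqv q hq).sub ((hpv p hp).mul_left _)) (hpv p hp), ← hJ,
      ← tupleWeight_eq j₀ (hQ q (mem_filter.1 hq).1).2.2]
  have hcard : Fintype.card {j : J // j ≠ j₀} + 1 = J.card := by
    have h1 := Fintype.card_subtype_compl fun j : J => j = j₀
    have h2 : 0 < J.card := card_pos.2 ⟨j, hj1.1⟩
    simp only [Fintype.card_subtype_eq, Fintype.card_coe] at h1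
    have h3 : Fintype.card {j : J // j ≠ j₀} = Fintype.card {j : J // ¬j = j₀} := rfl
    omega
  have hadm : Admissible ℓ Z R := admissible_redCoef h.prime h.inj
    (fun i => by have := h.lt i; omega) h.R_pos h.nonneg h.anti
  have hN : normSq ℓ Z ≤ mass ℓ G ^ 2 / s * s ^ J.card := by
    refine (normSq_redCoef_le h.nonneg).trans_eq ?_
    rw [← hcard, pow_succ, ← mass, ← sqMass, ← hs]
    field_simp
    ring
  have hN0 : 0 ≤ normSq ℓ Z := hadm.normSq_nonneg
  have hsec := hadm.second_moment (sh := fun j : {j : J // j ≠ j₀} =>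
      ((j.1 : ℕ) : ℤ) - ((j₀ : ℕ) : ℤ)) (P' := P') (X := X) (W := W) (p0 := p₀)
    (fun i j hd => ?_) h.W_pos h.coprime
    (fun p hp => ⟨(hP p (mem_filter.1 hp).1).1, (hP p (mem_filter.1 hp).1).2.1, hpv p hp⟩)
    (fun p hp i j j' hjj => h.not_dvd_shift (hP p (mem_filter.1 hp).1).2.2.2 i
      (mem_Icc.1 (hJH j.1.2)).2 (mem_Icc.1 (hJH j'.1.2)).2
      fun e => hjj (Subtype.ext (Subtype.ext e))) hWR hab v
  · have hcH : Fintype.card {j : J // j ≠ j₀} ≤ H := by omega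
    have e1 : ∑ q ∈ Q with q % W = v, (∑ p ∈ P', (normWeight ℓ G R W H p ((q : ℤ) - j * p)
        - E v p₀ j)) ^ 2 = (∑ q ∈ Q with q % W = v, (∑ p ∈ P', (weight ℓ Z
        (fun j : {j : J // j ≠ j₀} => ((j.1 : ℕ) : ℤ) - ((j₀ : ℕ) : ℤ)) p q ^ 2
          - meanSq ℓ Z)) ^ 2) / (s ^ J.card) ^ 2 := by
      rw [sum_div]
      refine sum_congr rfl fun q hq => ?_
      rw [← div_pow, sum_div]
      congr 1
      refine sum_congr rfl fun p hp => ?_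
      rw [hF q hq p hp, hEv, sub_div]
    rw [e1, div_le_iff₀ (by positivity)]
    have e2 : ∑ q ∈ Q with q % W = v, (∑ p ∈ P', (weight ℓ Z
        (fun j : {j : J // j ≠ j₀} => ((j.1 : ℕ) : ℤ) - ((j₀ : ℕ) : ℤ)) p q ^ 2
          - meanSq ℓ Z)) ^ 2 ≤ ∑ q ∈ Ioc a b with q ≡ v [ZMOD W], (∑ p ∈ P', (weight ℓ Z
        (fun j : {j : J // j ≠ j₀} => ((j.1 : ℕ) : ℤ) - ((j₀ : ℕ) : ℤ)) p q ^ 2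
          - meanSq ℓ Z)) ^ 2 := by
      rw [← sum_image (s := Q.filter fun q => q % W = v) (g := fun q : ℕ => (q : ℤ))
        (f := fun q : ℤ => (∑ p ∈ P', (weight ℓ Z
        (fun j : {j : J // j ≠ j₀} => ((j.1 : ℕ) : ℤ) - ((j₀ : ℕ) : ℤ)) p q ^ 2
          - meanSq ℓ Z)) ^ 2) fun x _ y _ hxy => Nat.cast_injective hxy]
      refine sum_le_sum_of_subset_of_nonneg (fun q hq => ?_) fun _ _ _ => sq_nonneg _
      obtain ⟨q', hq', rfl⟩ := mem_image.1 hq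
      exact mem_filter.2 ⟨(hQ q' (mem_filter.1 hq').1).1, hqv q' hq'⟩
    refine (e2.trans hsec).trans ?_
    have hX := errFactor_mono ℓ hcH R
    have hX0 := errFactor_pos ℓ (Fintype.card {j : J // j ≠ j₀}) h.R_pos
    have hprod : ∏ i, (1 + (Fintype.card {j : J // j ≠ j₀} : ℝ) ^ 2
          * (648 * (1 / (ℓ i : ℝ)) ^ 2))
        ≤ ∏ i, (1 + (H : ℝ) ^ 2 * (648 * (1 / (ℓ i : ℝ)) ^ 2)) :=
      prod_le_prod (fun i _ => by positivity) fun i _ => by gcongr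
    have hp0 := sub_nonneg.2 (hE1 (Fintype.card {j : J // j ≠ j₀}))
    have hm : 0 ≤ mass ℓ G ^ 2 / s := by positivity
    rw [← hs] at *
    exact variance_bound_le (div_nonneg hab' (Nat.cast_nonneg W)) (by positivity)
      (Nat.cast_nonneg _) hN0 hN hp0 (by linarith) hX0.le hX
  · have h1 := h.not_dvd_shift (p := 1) (c := 0) (fun i hd => ?_) i (mem_Icc.1 (hJH j.1.2)).2
      (mem_Icc.1 (hJH j₀.2)).2 fun e => j.2 (Subtype.ext e)
    · simp only [Nat.cast_zero, sub_zero, mul_one] at h1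
      exact h1 hd
    · have := Int.le_of_dvd one_pos hd
      have h2 := (h.prime i).two_le
      omega

end SieveWeights

lemma log_le_mul_sum_tupleCoef {Q : ℕ} (hQ : 1 ≤ Q) :
    log Q ≤ 1.645 * ∑ C : primeRange 1 Q → Option Unit,
      tupleCoef (fun i : primeRange 1 Q => 1 / ((i : ℕ) : ℝ)) (fun _ => 1) Q C
        * ∏ i : primeRange 1 Q, baseVec (1 / ((i : ℕ) : ℝ)) (C i) := by
  classical
  set Z := tupleCoef (J := Unit) (fun i : primeRange 1 Q => 1 / ((i : ℕ) : ℝ)) (fun _ => 1) Q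
    with hZ
  have hQ0 : (0 : ℝ) < Q := by exact_mod_cast hQ
  have hmem : ∀ i : primeRange 1 Q, (i : ℕ).Prime := fun i =>
    ((mem_primeRange zero_le_one).1 i.2).1
  choose a b hab hsq using Nat.sq_mul_squarefree
  set c : ℕ → (primeRange 1 Q → Option Unit) := fun m i => if (i : ℕ) ∣ a m then some () else none
    with hc
  have hc1 : ∀ m ∈ Icc 1 Q, ∏ i : primeRange 1 Q, baseVec (1 / ((i : ℕ) : ℝ)) (c m i) = 1 / (a m : ℝ) := by
    intro m hm
    obtain ⟨hm1, hm2⟩ := mem_Icc.1 hm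
    have hle : a m ≤ m := Nat.le_of_dvd hm1 ⟨b m ^ 2, by rw [mul_comm, hab]⟩
    have h1 : ∀ i : primeRange 1 Q, baseVec (1 / ((i : ℕ) : ℝ)) (c m i)
        = if (i : ℕ) ∣ a m then 1 / ((i : ℕ) : ℝ) else 1 := fun i => by
      simp only [hc]; split_ifs <;> rfl
    simp_rw [h1]
    rw [prod_coe_sort (primeRange 1 Q) fun i : ℕ => if i ∣ a m then 1 / (i : ℝ) else 1,
      ← prod_filter]
    have h2 : (primeRange 1 Q).filter (fun i => i ∣ a m) = (a m).primeFactors := by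
      ext i
      simp only [mem_filter, mem_primeRange zero_le_one, Nat.mem_primeFactors]
      constructor
      · rintro ⟨⟨h1, -, -⟩, h2⟩
        exact ⟨h1, h2, (hsq m).ne_zero⟩
      · rintro ⟨h1, h2, h3⟩
        refine ⟨⟨h1, by exact_mod_cast h1.one_lt, ?_⟩, h2⟩
        exact_mod_cast (Nat.le_of_dvd (Nat.pos_of_ne_zero h3) h2).trans (hle.trans hm2)
    rw [h2]
    conv_rhs => rw [← Nat.prod_primeFactors_of_squarefree (hsq m)]
    simp
  have hb : ∀ m ∈ Icc 1 Q, b m ∈ Icc 1 Q := fun m hm => by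
    obtain ⟨hm1, hm2⟩ := mem_Icc.1 hm
    have h0 : b m ≠ 0 := fun h => by have := hab m; rw [h] at this; simp at this; omega
    have h1 : a m ≠ 0 := (hsq m).ne_zero
    refine mem_Icc.2 ⟨by omega, le_trans ?_ hm2⟩
    calc b m ≤ b m ^ 2 * a m := by
          rw [sq, mul_assoc]
          exact Nat.le_mul_of_pos_right _ (by positivity)
      _ = m := hab m
  have hterm : ∀ m ∈ Icc 1 Q, (1 / (b m : ℝ) ^ 2) * (Z (c m)
      * ∏ i : primeRange 1 Q, baseVec (1 / ((i : ℕ) : ℝ)) (c m i)) = (m : ℝ)⁻¹ := by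
    intro m hm
    obtain ⟨hm1, hm2⟩ := mem_Icc.1 hm
    have h0 : (0 : ℝ) < a m := by exact_mod_cast Nat.pos_of_ne_zero (hsq m).ne_zero
    have hle : a m ≤ m := Nat.le_of_dvd hm1 ⟨b m ^ 2, by rw [mul_comm, hab]⟩
    have h2 : Z (c m) = 1 := by
      simp only [hZ, tupleCoef]
      rw [hc1 m hm, if_pos]
      · simp
      · rw [inv_eq_one_div]
        exact one_div_le_one_div_of_le h0 (by exact_mod_cast hle.trans hm2)
    rw [h2, hc1 m hm]
    conv_rhs => rw [← hab m]
    push_cast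
    field_simp
  have hZ0 : ∀ C, 0 ≤ Z C * ∏ i : primeRange 1 Q, baseVec (1 / ((i : ℕ) : ℝ)) (C i) := fun C => by
    refine mul_nonneg ?_ (prod_nonneg fun i _ => ?_)
    · simp only [hZ, tupleCoef]; split_ifs <;> simp
    · cases C i <;> simp [baseVec]
  have h3 : log Q ≤ ∑ m ∈ Icc 1 Q, (m : ℝ)⁻¹ := by
    have := log_add_one_le_harmonic Q
    rw [harmonic_eq_sum_Icc] at this
    push_cast at this
    exact (log_le_log hQ0 (by linarith)).trans this
  refine h3.trans ?_
  have hinj : Set.InjOn (fun m => (b m, c m)) (Icc 1 Q : Finset ℕ) := by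
    intro m hm m' hm' h
    simp only [Prod.mk.injEq] at h
    have h1 := hc1 m hm
    rw [h.2, hc1 m' hm'] at h1
    have h2 : a m' = a m := by
      have : (a m' : ℝ) = a m := by
        rw [one_div, one_div, inv_inj] at h1; exact h1
      exact_mod_cast this
    rw [← hab m, ← hab m', h.1, h2]
  calc ∑ m ∈ Icc 1 Q, (m : ℝ)⁻¹ = ∑ x ∈ (Icc 1 Q).image fun m => (b m, c m),
        1 / (x.1 : ℝ) ^ 2 * (Z x.2 * ∏ i : primeRange 1 Q, baseVec (1 / ((i : ℕ) : ℝ)) (x.2 i)) := by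
        rw [sum_image hinj]
        exact sum_congr rfl fun m hm => (hterm m hm).symm
    _ ≤ ∑ x ∈ Icc 1 Q ×ˢ (univ : Finset (primeRange 1 Q → Option Unit)),
        1 / (x.1 : ℝ) ^ 2 * (Z x.2 * ∏ i : primeRange 1 Q, baseVec (1 / ((i : ℕ) : ℝ)) (x.2 i)) := by
        refine sum_le_sum_of_subset_of_nonneg (fun x hx => ?_) fun x _ _ =>
          mul_nonneg (by positivity) (hZ0 _)
        obtain ⟨m, hm, rfl⟩ := mem_image.1 hx
        exact mem_product.2 ⟨hb m hm, mem_univ _⟩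
    _ = (∑ d ∈ Icc 1 Q, 1 / (d : ℝ) ^ 2)
        * ∑ C, Z C * ∏ i : primeRange 1 Q, baseVec (1 / ((i : ℕ) : ℝ)) (C i) := by
        rw [sum_product, sum_mul_sum]
    _ ≤ _ := by
        refine mul_le_mul_of_nonneg_right ?_ (sum_nonneg fun C _ => hZ0 C)
        refine (sum_le_hasSum _ (fun i _ => by positivity) hasSum_zeta_two).trans ?_
        nlinarith [pi_lt_d4, pi_pos]

/-- An upper bound sieve for the number of shifts that are coprime to `W`. -/
lemma card_coprimeShifts_mul_log_le {Q W : ℕ} (hQ : 1 ≤ Q) (hW : ∀ l : ℕ, l.Prime → l ≤ Q → l ∣ W)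
    (H : ℕ) (n : ℤ) {p : ℤ} (hp : Int.gcd p W = 1) :
    ((coprimeShifts W H n p).card : ℝ) * log Q
      ≤ 1.645 * (H + Q ^ 2 * ∏ l ∈ primeRange 1 Q, (1 + 36 * (1 / (l : ℝ)))) := by
  classical
  have hmem : ∀ i : primeRange 1 Q, (i : ℕ).Prime ∧ (i : ℕ) ≤ Q := fun i => by
    have := (mem_primeRange zero_le_one).1 i.2
    exact ⟨this.1, by exact_mod_cast this.2.2⟩
  set Z := tupleCoef (J := Unit) (fun i : primeRange 1 Q => 1 / ((i : ℕ) : ℝ)) (fun _ => 1) Q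
    with hZ
  set L := ∑ C, Z C * ∏ i : primeRange 1 Q, baseVec (1 / ((i : ℕ) : ℝ)) (C i) with hL
  have hlog : log Q ≤ 1.645 * L := log_le_mul_sum_tupleCoef hQ
  rcases hQ.eq_or_lt with h1 | h1
  · rw [← h1]
    have : 0 ≤ ∏ l ∈ primeRange 1 ((1 : ℕ) : ℝ), (1 + 36 * (1 / (l : ℝ))) :=
      prod_nonneg fun _ _ => by positivity
    simp only [Nat.cast_one, log_one, mul_zero] at this ⊢
    positivity
  have hL0 : 0 < L := by
    have := log_pos (show (1 : ℝ) < Q by exact_mod_cast h1)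
    linarith
  have hadm : Admissible (fun i : primeRange 1 Q => (i : ℕ)) Z Q :=
    admissible_tupleCoef (fun i => (hmem i).1) Subtype.val_injective
      (fun i => by simpa using (hmem i).1.one_le) (by exact_mod_cast hQ)
      (fun _ => zero_le_one) fun _ _ _ => le_rfl
  have hnorm : normSq (fun i : primeRange 1 Q => (i : ℕ)) Z = L := by
    unfold normSq sqSum
    refine sum_congr rfl fun C _ => ?_
    simp only [hZ, tupleCoef]
    split_ifs <;> simp
  obtain ⟨u, v, huv⟩ : ∃ u v : ℤ, p * u = 1 + W * v := by
    have := Int.gcd_eq_gcd_ab p W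
    rw [hp] at this
    exact ⟨Int.gcdA p W, -Int.gcdB p W, by push_cast at this; linear_combination -this⟩
  have hw : ∀ j ∈ coprimeShifts W H n p,
      weight (fun i : primeRange 1 Q => (i : ℕ)) Z (fun _ => 0) 0 (n * u + j) = L := by
    intro j hj
    unfold weight sieveSum
    refine sum_congr rfl fun C _ => ?_
    congr 1
    refine prod_congr rfl fun i _ => ?_
    cases hC : C i with
    | none => rfl
    | some s =>
      have : ¬((i : ℕ) : ℤ) ∣ n * u + j := by
        intro hd
        have hiW : ((i : ℕ) : ℤ) ∣ W := by exact_mod_cast hW i (hmem i).1 (hmem i).2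
        have h1 : ((i : ℕ) : ℤ) ∣ n + j * p := by
          have : n + j * p = p * (n * u + j) - W * (v * n) := by
            linear_combination -n * huv
          rw [this]
          exact dvd_sub (hd.mul_left _) (hiW.mul_right _)
        have h2 := Int.dvd_coe_gcd h1 hiW
        rw [(mem_filter.1 hj).2] at h2
        have h3 := Int.le_of_dvd one_pos h2
        have := (hmem i).1.two_le
        omega
      simp [localFactor, baseVec, ev, this]
  have hfirst := (abs_le.1 (hadm.abs_sum_weight_sq_sub_le (sh := fun _ => 0) (p := 0)
    (fun i s s' hs => absurd (Subsingleton.elim s s') hs) (a := n * u) (b := n * u + H) (by omega)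
    (W := 1) one_pos (fun i => Nat.coprime_one_left _) 0)).2
  have hms := hadm.meanSq_le
  rw [hnorm] at hfirst hms
  have hsum : ((coprimeShifts W H n p).card : ℝ) * L ^ 2
      ≤ ∑ m ∈ Ioc (n * u) (n * u + H) with m ≡ 0 [ZMOD ((1 : ℕ) : ℤ)],
        weight (fun i : primeRange 1 Q => (i : ℕ)) Z (fun _ => 0) 0 m ^ 2 := by
    rw [← nsmul_eq_mul, ← sum_const, sum_congr rfl fun j hj => congrArg (· ^ 2) (hw j hj).symm,
      ← sum_image (s := coprimeShifts W H n p) (g := fun j : ℕ => n * u + (j : ℤ))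
        (f := fun m => weight (fun i : primeRange 1 Q => (i : ℕ)) Z (fun _ => 0) 0 m ^ 2)
        fun x _ y _ hxy => Nat.cast_injective (add_left_cancel hxy)]
    refine sum_le_sum_of_subset_of_nonneg (fun m hm => ?_) fun _ _ _ => sq_nonneg _
    obtain ⟨j, hj, rfl⟩ := mem_image.1 hm
    have := mem_Icc.1 (mem_filter.1 hj).1
    exact mem_filter.2 ⟨mem_Ioc.2 (by omega), by simpa using Int.modEq_one⟩
  have hErr : errFactor (fun i : primeRange 1 Q => (i : ℕ)) (Fintype.card Unit) Q
      = Q ^ 2 * ∏ l ∈ primeRange 1 Q, (1 + 36 * (1 / (l : ℝ))) := by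
    unfold errFactor
    rw [prod_coe_sort (primeRange 1 Q) fun l : ℕ =>
      (1 + ((Fintype.card Unit : ℕ) : ℝ) * (18 * 2 * (1 / (l : ℝ))))]
    norm_num
  rw [hErr] at hfirst
  push_cast at hfirst
  set E := (Q : ℝ) ^ 2 * ∏ l ∈ primeRange 1 Q, (1 + 36 * (1 / (l : ℝ)))
  have h4 : ((coprimeShifts W H n p).card : ℝ) * L * L ≤ (H + E) * L := by
    have : (H : ℝ) * meanSq (fun i : primeRange 1 Q => (i : ℕ)) Z ≤ H * L := by gcongr
    have e : ((n : ℝ) * u + H - n * u) / 1 = H := by ring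
    rw [e] at hfirst
    push_cast at hsum
    calc _ = ((coprimeShifts W H n p).card : ℝ) * L ^ 2 := by ring
      _ ≤ _ := hsum
      _ ≤ _ := by linarith
  have h5 := le_of_mul_le_mul_right h4 hL0
  calc _ ≤ ((coprimeShifts W H n p).card : ℝ) * (1.645 * L) := by gcongr
    _ ≤ _ := by linarith

section LevelWeights

/-- The members of `(w, z]` up to `exp (2 ^ i * s)`. -/
noncomputable def levelSet (w z s : ℝ) (i : ℕ) : Finset (primeRange w z) :=
  univ.filter fun j => ((j : ℕ) : ℝ) ≤ exp (2 ^ i * s)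

/-- The sieve weights given by the levels `exp (2 ^ i * s)`, `i < n`. -/
noncomputable def levelWeight (w s : ℝ) (n : ℕ) : Finset (primeRange w (exp (2 ^ n * s))) → ℝ :=
  levelSum (levelSet w (exp (2 ^ n * s)) s) n

variable {w s : ℝ}

lemma levelSet_mono (w z : ℝ) (hs : 0 ≤ s) : Monotone (levelSet w z s) := by
  intro i j hij a ha
  refine mem_filter.2 ⟨mem_univ _, (mem_filter.1 ha).2.trans (exp_le_exp.2 ?_)⟩
  exact mul_le_mul_of_nonneg_right (pow_le_pow_right₀ one_le_two hij) hs

lemma map_levelSet (hw : 0 ≤ w) (hs : 0 ≤ s) {n i : ℕ} (hi : i ≤ n) :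
    (levelSet w (exp (2 ^ n * s)) s i).map (Function.Embedding.subtype _)
      = primeRange w (exp (2 ^ i * s)) := by
  have h1 : exp (2 ^ i * s) ≤ exp (2 ^ n * s) :=
    exp_le_exp.2 (mul_le_mul_of_nonneg_right (pow_le_pow_right₀ one_le_two hi) hs)
  ext p
  simp only [mem_map, levelSet, mem_filter, mem_univ, true_and, Function.Embedding.subtype_apply,
    Subtype.exists, exists_and_left, exists_prop, mem_primeRange hw]
  constructor
  · rintro ⟨a, h1, ⟨h2, h3, h4⟩, rfl⟩
    exact ⟨h2, h3, h1⟩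
  · exact fun h => ⟨p, h.2.2, ⟨h.1, h.2.1, h.2.2.trans h1⟩, rfl⟩

lemma mul_div_mul_pow_succ (a m : ℝ) {g : ℝ} (hg : g ≠ 0) (k : ℕ) :
    a * (m / g) * (g ^ k * g) = m * g ^ k * a := by
  field_simp

set_option maxHeartbeats 1000000 in
/-- The numerical properties of the level weights. -/
lemma levelWeight_spec {R T₁ T₂ : ℝ} {n H W K : ℕ} (hw : 2 ≤ w) (hs : 0 < s) (hn : 0 < n)
    (hHw : (H : ℝ) ≤ w) (hR : 0 < R) (hW : 0 < W) (hWc : ∀ l : ℕ, l.Prime → w < l → W.Coprime l)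
    (hlo : ∀ i < n, (1 - 1 / 1000) * (2 ^ i * (s / log w))
      ≤ ∏ p ∈ primeRange w (exp (2 ^ i * s)), (1 + 1 / (p : ℝ)))
    (hup : ∀ i < n, ∏ p ∈ primeRange w (exp (2 ^ i * s)), (1 + 1 / (p : ℝ))
      ≤ (1 + 1 / 1000) * (2 ^ i * (s / log w)))
    (hsum : ∀ i < n, ∑ p ∈ primeRange w (exp (2 ^ i * s)), 1 / (p : ℝ) * log p ≤ 2 ^ i * s)
    (hn2 : (4 * (n : ℝ) + 6) / 2 ^ n ≤ 1 / 100) (hT₁ : 0 < T₁) (hT₂ : 0 < T₂)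
    (hT : T₁ + T₂ ≤ log R)
    (h1 : (1.003 * s * 2 ^ n / n) / T₂ + 1 / (w * log w) * T₁ ≤ 1 / 1000)
    (h2 : K * (1 / (w * log w)) * T₁ ≤ 1 / 1000)
    (h3 : (K : ℝ) ^ 2 * (2 / w) ≤ 1 / 1000)
    (h4 : K * (0.502 * n * s) / T₁ ≤ 0.512) :
    SieveSetup (fun i : primeRange w (exp (2 ^ n * s)) => (i : ℕ)) (levelWeight w s n) R W H ∧
    (∀ J ⊆ Icc 1 H, J.card ≤ K → ∀ j₀ : J,
      0.48 * (mass (fun i : primeRange w (exp (2 ^ n * s)) => (i : ℕ)) (levelWeight w s n) ^ 2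
        / sqMass (fun i : primeRange w (exp (2 ^ n * s)) => (i : ℕ)) (levelWeight w s n))
      * sqMass (fun i : primeRange w (exp (2 ^ n * s)) => (i : ℕ)) (levelWeight w s n) ^ J.card
        ≤ meanSq (fun i : primeRange w (exp (2 ^ n * s)) => (i : ℕ))
        (redCoef (J := {j : J // j ≠ j₀}) (fun i => 1 / ((i : ℕ) : ℝ)) (levelWeight w s n) R)) ∧
    0.165 * n ^ 2 * (s / log w)
      ≤ mass (fun i : primeRange w (exp (2 ^ n * s)) => (i : ℕ)) (levelWeight w s n) ^ 2
        / sqMass (fun i : primeRange w (exp (2 ^ n * s)) => (i : ℕ)) (levelWeight w s n) := by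
  set z := exp (2 ^ n * s) with hz
  set ℓ : primeRange w z → ℕ := fun i => (i : ℕ) with hℓ
  set G := levelWeight w s n with hG
  set A := levelSet w z s with hA
  set B := s / log w with hB
  have hw0 : 0 ≤ w := by linarith
  have hlw : 0 < log w := log_pos (by linarith)
  have hB0 : 0 < B := by positivity
  have hmem : ∀ i : primeRange w z, (ℓ i).Prime ∧ w < ℓ i := fun i =>
    ⟨((mem_primeRange hw0).1 i.2).1, ((mem_primeRange hw0).1 i.2).2.1⟩
  have hprod : ∀ i < n, ∏ j ∈ A i, (1 + 1 / (ℓ j : ℝ))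
      = ∏ p ∈ primeRange w (exp (2 ^ i * s)), (1 + 1 / (p : ℝ)) := fun i hi => by
    rw [← map_levelSet hw0 hs.le hi.le, prod_map]; rfl
  have hlo' : ∀ i < n, (1 - 1 / 1000) * (2 ^ i * B) ≤ ∏ j ∈ A i, (1 + 1 / (ℓ j : ℝ)) :=
    fun i hi => by rw [hprod i hi]; exact hlo i hi
  have hup' : ∀ i < n, ∏ j ∈ A i, (1 + 1 / (ℓ j : ℝ)) ≤ (1 + 1 / 1000) * (2 ^ i * B) :=
    fun i hi => by rw [hprod i hi]; exact hup i hi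
  have hsum' : ∀ i < n, ∑ j ∈ A i, 1 / (ℓ j : ℝ) * log (ℓ j) ≤ 2 ^ i * s := fun i hi => by
    refine le_trans (le_of_eq ?_) (hsum i hi)
    rw [← map_levelSet hw0 hs.le hi.le, sum_map]; rfl
  have hr0 : ∀ i, 0 ≤ 1 / (ℓ i : ℝ) := fun i => by positivity
  have hlog0 : ∀ i, 0 ≤ log (ℓ i) := fun i => log_natCast_nonneg _
  have hmono := levelSet_mono w z hs.le
  have g1lo : (1 - 1 / 1000) * (n * B) ≤ mass ℓ G := le_sum_levelSum hlo'
  have g2up : sqMass ℓ G ≤ (1 + 1 / 1000) * B * 6 := sum_levelSum_sq_le hmono (by positivity) hup'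
  have g2lo : (1 - 1 / 1000) * B * (6 - (4 * (n : ℝ) + 6) / 2 ^ n) ≤ sqMass ℓ G :=
    le_sum_levelSum_sq hmono hlo'
  have l1 := sum_levelSum_mul_le (θ := 1 / 1000) (B := B) (s := s) hr0 hlog0 (by positivity) hs.le
    hup' hsum'
  have l2 := sum_levelSum_sq_mul_le (θ := 1 / 1000) (B := B) (s := s) hmono hr0 hlog0
    (by positivity) hs.le hup' hsum'
  have g2lo' : 0.999 * B * 5.99 ≤ sqMass ℓ G := le_trans (by
    have : 5.99 ≤ 6 - (4 * (n : ℝ) + 6) / 2 ^ n := by linarith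
    norm_num at this ⊢
    gcongr) g2lo
  have hn0 : (0 : ℝ) < n := by exact_mod_cast hn
  have hg1 : 0 < mass ℓ G := lt_of_lt_of_le (by positivity) g1lo
  have hg2 : 0 < sqMass ℓ G := lt_of_lt_of_le (by positivity) g2lo'
  have hG0 : ∀ b, 0 ≤ G b := levelSum_nonneg _ _
  have hGa : ∀ a b, a ⊆ b → G b ≤ G a := levelSum_anti _ _
  have hHl : ∀ i, H < ℓ i := fun i => by exact_mod_cast hHw.trans_lt (hmem i).2
  have hsetup : SieveSetup ℓ G R W H := ⟨fun i => (hmem i).1, Subtype.val_injective, hHl, hG0, hGa,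
    hR, hW, fun i => hWc _ (hmem i).1 (hmem i).2, hg2⟩
  refine ⟨hsetup, fun J hJ hJK j₀ => ?_, ?_⟩
  · have hcard : Fintype.card {j : J // j ≠ j₀} + 1 = J.card := by
      have h1 := Fintype.card_subtype_compl fun j : J => j = j₀
      have h2 : 0 < J.card := card_pos.2 ⟨_, j₀.2⟩
      simp only [Fintype.card_subtype_eq, Fintype.card_coe] at h1
      have h3 : Fintype.card {j : J // j ≠ j₀} = Fintype.card {j : J // ¬j = j₀} := rfl
      omega
    have hJH : J.card ≤ H := (card_le_card hJ).trans (by simp)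
    set k := Fintype.card {j : J // j ≠ j₀} with hk
    have hkK : (k : ℝ) ≤ K := by exact_mod_cast (by omega : k ≤ K)
    set δ := 1 / (w * log w) with hδ
    have hδ0 : 0 < δ := by positivity
    have a1 : (1.003 * s * 2 ^ n / n) / T₂ + δ * T₁ ≤ 1 := by linarith
    have a2 : (k : ℝ) * δ * T₁ ≤ 1 / 1000 := le_trans (by gcongr) h2
    have hms := le_meanSq_redCoef (J := {j : J // j ≠ j₀}) (ℓ := ℓ) (G := G) (R := R)
      (δ := δ) (T₁ := T₁) (T₂ := T₂) (L1 := 1.003 * s * 2 ^ n / n) (L2 := 0.502 * n * s)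
      (g1 := mass ℓ G) (g2 := sqMass ℓ G) (fun i => (hmem i).1) Subtype.val_injective
      (fun i => by have := hHl i; omega) hR hG0 hGa hT₁ hT₂ hT hδ0.le (fun i => ?_) rfl rfl hg2
      ?_ ?_ a1 (by linarith)
    · refine le_trans ?_ hms
      rw [← hk, ← hcard, pow_succ]
      have b1 : (k : ℝ) ^ 2 * ∑ i, (1 / (ℓ i : ℝ)) ^ 2 ≤ 1 / 1000 := by
        have : ∑ i, (1 / (ℓ i : ℝ)) ^ 2 ≤ 2 / w := by
          rw [sum_coe_sort (primeRange w z) fun i : ℕ => (1 / (i : ℝ)) ^ 2]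
          exact sum_primeRange_inv_sq_le hw z
        exact le_trans (by gcongr) h3
      have b2 : k * (0.502 * n * s) / T₁ ≤ 0.512 := le_trans (by gcongr) h4
      have e1 : (0.999 : ℝ) ≤ 1 - ((1.003 * s * 2 ^ n / n) / T₂ + δ * T₁) := by
        norm_num at h1 ⊢; linarith
      have e2 : (0.999 : ℝ) ≤ 1 - k * δ * T₁ := by linarith
      have e3 : (0.487 : ℝ) ≤ 1 - (k : ℝ) ^ 2 * ∑ i, (1 / (ℓ i : ℝ)) ^ 2
        - k * (0.502 * n * s) / T₁ := by linarith
      have e4 : (0.48 : ℝ) ≤ (1 - ((1.003 * s * 2 ^ n / n) / T₂ + δ * T₁)) ^ 2 * (1 - k * δ * T₁)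
          * (1 - (k : ℝ) ^ 2 * ∑ i, (1 / (ℓ i : ℝ)) ^ 2 - k * (0.502 * n * s) / T₁) :=
        calc (0.48 : ℝ) ≤ 0.999 ^ 2 * 0.999 * 0.487 := by norm_num
          _ ≤ _ := by gcongr
      exact (mul_div_mul_pow_succ _ _ hg2.ne' k).trans_le
        (mul_le_mul_of_nonneg_left e4 (by positivity))
    · have c1 := (hmem i).2
      have c2 := log_le_log (by linarith) c1.le
      rw [hδ, div_mul_eq_mul_div, one_mul, div_le_div_iff₀ (by linarith) (by positivity), one_mul,
        mul_comm]
      gcongr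
    · refine l1.trans ?_
      calc (1 + 1 / 1000) * B * s * 2 ^ n
          ≤ (1.003 * (1 - 1 / 1000)) * B * s * 2 ^ n := by gcongr; norm_num
        _ = 1.003 * s * 2 ^ n / n * ((1 - 1 / 1000) * (n * B)) := by field_simp
        _ ≤ _ := by gcongr
    · refine l2.trans ?_
      calc (1 + 1 / 1000) * B * s * (3 * n)
          ≤ (0.502 * (0.999 * 5.99)) * B * s * n := by
            have : 0 ≤ B * s * n := by positivity
            nlinarith
        _ = 0.502 * n * s * (0.999 * B * 5.99) := by ring
        _ ≤ _ := by gcongr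
  · rw [le_div_iff₀ hg2]
    calc 0.165 * (n : ℝ) ^ 2 * B * sqMass ℓ G
        ≤ 0.165 * (n : ℝ) ^ 2 * B * ((1 + 1 / 1000) * B * 6) := by gcongr
      _ ≤ ((1 - 1 / 1000) * (n * B)) ^ 2 := by
          have : 0 ≤ ((n : ℝ) * B) ^ 2 := by positivity
          nlinarith
      _ ≤ _ := by gcongr

end LevelWeights

section Parameters
open Filter

lemma level_numerics {v L s : ℝ} {n K : ℕ} (hv : 10 ^ 6 ≤ v) (hL : 1000 ≤ L)
    (hn : 1.19 * L ≤ n) (h2n : (2 : ℝ) ^ n ≤ v ^ 84) (hs : s = v ^ 10 * L / (21 * n))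
    (hK : K * L ≤ 4.2 * v ^ 90) :
    (1.003 * s * 2 ^ n / n) / (0.002 * v ^ 100) + 1 / (v ^ 500 * (5 * L)) * (0.198 * v ^ 100)
      ≤ 1 / 1000 ∧
    K * (1 / (v ^ 500 * (5 * L))) * (0.198 * v ^ 100) ≤ 1 / 1000 ∧
    (K : ℝ) ^ 2 * (2 / v ^ 500) ≤ 1 / 1000 ∧
    K * (0.502 * n * s) / (0.198 * v ^ 100) ≤ 0.512 := by
  have hv0 : 0 < v := by linarith
  have hL0 : 0 < L := by linarith
  have hn0 : (0 : ℝ) < n := by linarith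
  have hv1 : 1 ≤ v := by linarith
  have hs0 : 0 < s := by rw [hs]; positivity
  have hs1 : s ≤ v ^ 10 := by
    rw [hs, div_le_iff₀ (by positivity)]
    exact mul_le_mul_of_nonneg_left (by linarith) (by positivity)
  have hK1 : (K : ℝ) ≤ v ^ 90 := by
    have : (0 : ℝ) ≤ K := by positivity
    nlinarith [pow_pos hv0 90]
  have hn1 : (1000 : ℝ) ≤ n := by linarith
  have hdiv : ∀ a : ℝ, 0 ≤ a → a ≤ 10 ^ 3 → a / v ≤ 1 / 1000 := fun a _ ha => by
    rw [div_le_iff₀ hv0]; linarith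
  have key : 1 / (v ^ 500 * (5 * L)) * (0.198 * v ^ 100) * v ^ 90 ≤ 1 / v := by
    rw [div_mul_eq_mul_div, div_mul_eq_mul_div, div_le_div_iff₀ (by positivity) hv0]
    calc 1 * (0.198 * v ^ 100) * v ^ 90 * v = 0.198 * v ^ 191 := by ring
      _ ≤ 1 * v ^ 500 := mul_le_mul (by norm_num) (pow_le_pow_right₀ hv1 (by norm_num))
        (by positivity) (by norm_num)
      _ ≤ 1 * (v ^ 500 * (5 * L)) := by
        rw [one_mul, one_mul]; exact le_mul_of_one_le_right (by positivity) (by linarith)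
  have key1 : 1 / (v ^ 500 * (5 * L)) * (0.198 * v ^ 100) ≤ 1 / v := le_trans
    (le_mul_of_one_le_right (by positivity) (one_le_pow₀ hv1)) key
  have hvv : 1 / v ≤ 1 / 10 ^ 6 := by gcongr
  refine ⟨?_, ?_, ?_, ?_⟩
  · have : (1.003 * s * 2 ^ n / n) / (0.002 * v ^ 100) ≤ 502 / v := by
      rw [div_div, div_le_div_iff₀ (by positivity) hv0]
      calc 1.003 * s * 2 ^ n * v ≤ 1.003 * v ^ 10 * v ^ 84 * v := by gcongr
        _ = 1.003 * v ^ 95 := by ring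
        _ ≤ 1.004 * v ^ 100 := by
          gcongr
          · norm_num
          · norm_num
        _ = 502 * (1 * (0.002 * v ^ 100)) := by ring
        _ ≤ 502 * (n * (0.002 * v ^ 100)) := by gcongr; linarith
    have h2 : 502 / v ≤ 502 / 10 ^ 6 := by gcongr
    norm_num at h2 hvv ⊢
    norm_num at this key1
    linarith
  · calc K * (1 / (v ^ 500 * (5 * L))) * (0.198 * v ^ 100)
        = 1 / (v ^ 500 * (5 * L)) * (0.198 * v ^ 100) * K := by ring
      _ ≤ 1 / (v ^ 500 * (5 * L)) * (0.198 * v ^ 100) * v ^ 90 := by gcongr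
      _ ≤ 1 / v := key
      _ ≤ _ := hvv.trans (by norm_num)
  · calc (K : ℝ) ^ 2 * (2 / v ^ 500) ≤ (v ^ 90) ^ 2 * (2 / v ^ 500) := by gcongr
      _ = 2 * v ^ 180 / v ^ 500 := by ring
      _ ≤ 2 / v := by
        rw [div_le_div_iff₀ (by positivity) hv0, mul_assoc, ← pow_succ]
        gcongr
        norm_num
      _ ≤ _ := hdiv 2 (by norm_num) (by norm_num)
  · rw [div_le_iff₀ (by positivity), hs]
    calc K * (0.502 * n * (v ^ 10 * L / (21 * n))) = 0.502 / 21 * v ^ 10 * (K * L) := by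
          field_simp
      _ ≤ 0.502 / 21 * v ^ 10 * (4.2 * v ^ 90) := by gcongr
      _ = (0.502 / 21 * 4.2) * v ^ 100 := by ring
      _ ≤ _ := by
        rw [← mul_assoc]
        exact mul_le_mul_of_nonneg_right (by norm_num) (by positivity)

lemma four_mul_add_le_two_pow {n : ℕ} (hn : 13 ≤ n) :
    (4 * (n : ℝ) + 6) / 2 ^ n ≤ 1 / 100 := by
  rw [div_le_div_iff₀ (by positivity) (by norm_num), one_mul]
  have : (4 * n + 6) * 100 ≤ 2 ^ n := by
    induction n, hn using Nat.le_induction with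
    | base => norm_num
    | succ n hn ih => rw [pow_succ]; omega
  exact_mod_cast this

lemma exists_prod_primeRange_le : ∃ C : ℝ, 0 < C ∧ ∀ v : ℝ, 2 ≤ v →
    ∏ p ∈ primeRange 1 v, (1 + 36 * (1 / (p : ℝ))) ≤ (C * log v) ^ 36 := by
  obtain ⟨C, -, h⟩ := exists_sum_primeRange_inv
  have hl2 : 0 < log 2 := log_pos one_lt_two
  refine ⟨exp (1 / 2 + C / log 2) / log 2, by positivity, fun v hv => ?_⟩
  have hlv : 0 < log v := log_pos (by linarith)
  have hsub : primeRange 1 v ⊆ insert 2 (primeRange 2 v) := fun p hp => by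
    rw [mem_primeRange zero_le_one] at hp
    rw [mem_insert, mem_primeRange zero_le_two]
    rcases hp.1.two_le.eq_or_lt with h2 | h2
    · exact Or.inl h2.symm
    · exact Or.inr ⟨hp.1, by exact_mod_cast h2, hp.2.2⟩
  have hs : ∑ p ∈ primeRange 1 v, 1 / (p : ℝ)
      ≤ 1 / 2 + (log (log v / log 2) + C / log 2) := by
    refine (sum_le_sum_of_subset_of_nonneg hsub fun _ _ _ => by positivity).trans ?_
    rw [sum_insert (by simp [mem_primeRange])]
    have := (abs_le.1 (h 2 v le_rfl hv)).2
    push_cast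
    linarith
  calc ∏ p ∈ primeRange 1 v, (1 + 36 * (1 / (p : ℝ)))
      ≤ ∏ p ∈ primeRange 1 v, exp (36 * (1 / (p : ℝ))) :=
        prod_le_prod (fun _ _ => by positivity) fun p _ => by
          rw [add_comm]; exact add_one_le_exp _
    _ = exp (∑ p ∈ primeRange 1 v, 1 / (p : ℝ)) ^ 36 := by
        rw [← exp_sum, ← mul_sum, ← exp_nat_mul]; norm_num
    _ ≤ exp (1 / 2 + (log (log v / log 2) + C / log 2)) ^ 36 := by
        gcongr
    _ = _ := by
        rw [add_left_comm, exp_add, exp_log (by positivity), div_mul_comm, div_mul_comm]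

lemma eventually_log_pow_le (C : ℝ) (k : ℕ) : ∀ᶠ v : ℝ in atTop, C * log v ^ k ≤ v := by
  have h1 := (isLittleO_pow_log_id_atTop (n := k)).bound (c := 1 / (|C| + 1)) (by positivity)
  filter_upwards [h1, eventually_ge_atTop 1] with v hv h1v
  have h0 : 0 ≤ log v := log_nonneg h1v
  rw [norm_of_nonneg (by positivity), id, norm_of_nonneg (by linarith), one_div,
    inv_mul_eq_div, le_div_iff₀ (by positivity)] at hv
  nlinarith [le_abs_self C, pow_nonneg h0 k]

lemma eventually_card_coprimeShifts_le : ∀ᶠ v : ℝ in atTop, ∀ n p : ℤ,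
    Int.gcd p (primorial ⌊v ^ 40⌋₊) = 1 →
    (coprimeShifts (primorial ⌊v ^ 40⌋₊) ⌊v ^ 90⌋₊ n p).card
      ≤ ⌊4.2 * v ^ 90 / (100 * log v)⌋₊ := by
  obtain ⟨C, hC, h⟩ := exists_prod_primeRange_le
  filter_upwards [eventually_ge_atTop (10 ^ 6), eventually_log_pow_le ((C * 40) ^ 36) 36,
    (tendsto_log_atTop).eventually_ge_atTop 10] with v hv hv1 hlv n p hp
  set W := primorial ⌊v ^ 40⌋₊ with hW
  set Q := ⌊v ^ 40⌋₊ with hQ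
  have hv40 : v ≤ v ^ 40 := le_self_pow₀ (by linarith) (by norm_num)
  have hQ1 : (Q : ℝ) ≤ v ^ 40 := Nat.floor_le (by positivity)
  have hQ2 : v ^ 40 / 2 ≤ Q := by have := Nat.lt_floor_add_one (v ^ 40); rw [← hQ] at this; linarith
  have hQ3 : (2 : ℝ) ≤ Q := by linarith
  have hlQ : 39.9 * log v ≤ log Q := by
    have h1 := log_le_log (by positivity) hQ2
    rw [log_div (by positivity) two_ne_zero, log_pow] at h1
    have := log_two_lt_d9
    push_cast at h1; linarith
  have hlQ' : log Q ≤ 40 * log v := by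
    have h1 := log_le_log (by positivity) hQ1
    rw [log_pow] at h1; exact_mod_cast h1
  have main := card_coprimeShifts_mul_log_le (Q := Q) (W := W)
    (by exact_mod_cast (by linarith : (1 : ℝ) ≤ Q))
    (fun l hl hlQ => dvd_prod_of_mem _ (by simp; exact ⟨by omega, hl⟩)) ⌊v ^ 90⌋₊ n hp
  have hprod : ∏ l ∈ primeRange 1 (Q : ℝ), (1 + 36 * (1 / (l : ℝ))) ≤ v := by
    refine (h Q hQ3).trans (le_trans ?_ hv1)
    rw [← mul_pow]
    have : 0 < log Q := log_pos (by linarith)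
    refine pow_le_pow_left₀ (by positivity) ?_ _
    rw [mul_assoc]
    gcongr
  have hH : (⌊v ^ 90⌋₊ : ℝ) ≤ v ^ 90 := Nat.floor_le (by positivity)
  refine Nat.le_floor ?_
  rw [le_div_iff₀ (by linarith)]
  set c := ((coprimeShifts W ⌊v ^ 90⌋₊ n p).card : ℝ) with hc
  have hc0 : 0 ≤ c := by positivity
  have h2 : (Q : ℝ) ^ 2 * ∏ l ∈ primeRange 1 (Q : ℝ), (1 + 36 * (1 / (l : ℝ))) ≤ v ^ 90 / 1000 := by
    calc (Q : ℝ) ^ 2 * ∏ l ∈ primeRange 1 (Q : ℝ), (1 + 36 * (1 / (l : ℝ)))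
        ≤ (v ^ 40) ^ 2 * v := by gcongr
      _ = v ^ 81 * 1 := by ring
      _ ≤ v ^ 81 * (v ^ 9 / 1000) := by
        gcongr
        have : v ≤ v ^ 9 := le_self_pow₀ (by linarith) (by norm_num)
        linarith
      _ = _ := by ring
  have h3 : c * (39.9 * log v) ≤ c * log Q := by gcongr
  nlinarith

lemma errFactor_le {w z L : ℝ} (hw : 0 ≤ w) (H : ℕ) {R : ℝ}
    (h : ∏ p ∈ primeRange w z, (1 + 1 / (p : ℝ)) ≤ exp L) :
    errFactor (fun i : primeRange w z => (i : ℕ)) H R ≤ R ^ 2 * exp (36 * H * L) := by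
  unfold errFactor
  gcongr
  rw [prod_coe_sort (primeRange w z) fun i : ℕ => 1 + (H : ℝ) * (18 * 2 * (1 / (i : ℝ)))]
  calc ∏ i ∈ primeRange w z, (1 + (H : ℝ) * (18 * 2 * (1 / (i : ℝ))))
      ≤ ∏ i ∈ primeRange w z, (1 + 1 / (i : ℝ)) ^ (36 * H) :=
        prod_le_prod (fun _ _ => by positivity) fun i _ => by
          have := one_add_mul_le_pow (a := 1 / (i : ℝ)) (by
            have : (0 : ℝ) ≤ 1 / (i : ℝ) := by positivity
            linarith) (36 * H)
          push_cast at this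
          linarith
    _ = (∏ i ∈ primeRange w z, (1 + 1 / (i : ℝ))) ^ (36 * H) := by rw [prod_pow]
    _ ≤ exp L ^ (36 * H) :=
        pow_le_pow_left₀ (prod_nonneg fun _ _ => by positivity) h _
    _ = _ := by rw [← exp_nat_mul]; push_cast; ring_nf

lemma prod_one_add_sq_sub_one_le {w z : ℝ} (hw : 2 ≤ w) (H : ℕ)
    (h : 1296 * (H : ℝ) ^ 2 / w ≤ 1) :
    ∏ i : primeRange w z, (1 + (H : ℝ) ^ 2 * (648 * (1 / ((i : ℕ) : ℝ)) ^ 2)) - 1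
      ≤ 2592 * (H : ℝ) ^ 2 / w := by
  have hw0 : 0 < w := by linarith
  have hsum : ∑ i : primeRange w z, (H : ℝ) ^ 2 * (648 * (1 / ((i : ℕ) : ℝ)) ^ 2)
      ≤ 1296 * (H : ℝ) ^ 2 / w := by
    rw [← mul_sum, ← mul_sum, sum_coe_sort (primeRange w z) fun i : ℕ => (1 / (i : ℝ)) ^ 2]
    calc (H : ℝ) ^ 2 * (648 * ∑ i ∈ primeRange w z, (1 / (i : ℝ)) ^ 2)
        ≤ (H : ℝ) ^ 2 * (648 * (2 / w)) := by gcongr; exact sum_primeRange_inv_sq_le hw z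
      _ = _ := by ring
  have h1 : ∏ i : primeRange w z, (1 + (H : ℝ) ^ 2 * (648 * (1 / ((i : ℕ) : ℝ)) ^ 2))
      ≤ exp (1296 * (H : ℝ) ^ 2 / w) :=
    calc _ ≤ ∏ i : primeRange w z, exp ((H : ℝ) ^ 2 * (648 * (1 / ((i : ℕ) : ℝ)) ^ 2)) :=
          prod_le_prod (fun _ _ => by positivity) fun _ _ => by
            rw [add_comm]; exact add_one_le_exp _
      _ ≤ _ := by rw [← exp_sum]; exact exp_le_exp.2 hsum
  have h2 := abs_exp_sub_one_le (x := 1296 * (H : ℝ) ^ 2 / w) (by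
    rwa [abs_of_nonneg (by positivity)])
  rw [abs_of_nonneg (a := 1296 * (H : ℝ) ^ 2 / w) (by positivity)] at h2
  have := (abs_le.1 h2).2
  have e : 2 * (1296 * (H : ℝ) ^ 2 / w) = 2592 * (H : ℝ) ^ 2 / w := by ring
  linarith

set_option maxHeartbeats 800000 in
/-- The sieve weights with all parameters chosen in terms of `v = (log x) ^ (1/100)`. -/
lemma eventually_sieveSetup : ∀ᶠ v : ℝ in atTop,
    ∃ (ι : Type) (_ : Fintype ι) (_ : DecidableEq ι) (ℓ : ι → ℕ) (G : Finset ι → ℝ) (K W : ℕ),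
    SieveSetup ℓ G (exp (v ^ 100 / 5)) W ⌊v ^ 90⌋₊ ∧
    (∀ i, (ℓ i : ℝ) ≤ exp (v ^ 99)) ∧ (W : ℝ) ≤ exp (v ^ 99) ∧
    (∀ n p : ℤ, Int.gcd p W = 1 → (coprimeShifts W ⌊v ^ 90⌋₊ n p).card ≤ K) ∧
    (∀ J ⊆ Icc 1 ⌊v ^ 90⌋₊, J.card ≤ K → ∀ j₀ : J,
      0.48 * (mass ℓ G ^ 2 / sqMass ℓ G) * sqMass ℓ G ^ J.card ≤ meanSq ℓ
        (redCoef (J := {j : J // j ≠ j₀}) (fun i => 1 / (ℓ i : ℝ)) G (exp (v ^ 100 / 5)))) ∧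
    0.00187 * v ^ 10 * (100 * log v) ≤ mass ℓ G ^ 2 / sqMass ℓ G ∧
    errFactor ℓ ⌊v ^ 90⌋₊ (exp (v ^ 100 / 5)) ≤ exp (0.41 * v ^ 100) ∧
    ∏ i, (1 + (⌊v ^ 90⌋₊ : ℝ) ^ 2 * (648 * (1 / (ℓ i : ℝ)) ^ 2)) - 1 ≤ 1 / v ^ 315 := by
  obtain ⟨C, hC, hsum⟩ := exists_sum_primeRange_log_div_le
  have hw1 := (tendsto_pow_atTop (α := ℝ) (n := 500) (by norm_num)).eventually
    (eventually_prod_primeRange (θ := 1 / 1000) (by norm_num))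
  filter_upwards [eventually_ge_atTop (10 ^ 6), eventually_log_pow_le 100 1, hw1,
    (tendsto_log_atTop).eventually_ge_atTop (10 + C), eventually_card_coprimeShifts_le]
    with v hv hLv hprod hlv hcop
  rw [pow_one] at hLv
  set L := 100 * log v with hL
  have hL1 : 1000 ≤ L := by linarith
  set n := ⌊1.2 * L⌋₊ with hn
  set K := ⌊4.2 * v ^ 90 / L⌋₊ with hK
  set s := v ^ 10 * L / (21 * n) with hs
  have hv0 : 0 < v := by linarith
  have hv1 : 1 ≤ v := by linarith
  have hn1 : (n : ℝ) ≤ 1.2 * L := Nat.floor_le (by positivity)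
  have hn2 : 1.19 * L ≤ n := by
    have := Nat.lt_floor_add_one (1.2 * L); rw [← hn] at this; linarith
  have hn0 : (0 : ℝ) < n := by linarith
  have hL0 : 0 < L := by linarith
  have hs0 : 0 < s := by positivity
  have h2n : (2 : ℝ) ^ n ≤ v ^ 84 := by
    rw [← log_le_log_iff (by positivity) (by positivity), log_pow, log_pow]
    have := log_two_lt_d9
    have h3 : (n : ℝ) * log 2 ≤ 1.2 * L * 0.6931471808 := by gcongr
    push_cast; linarith
  have hKL : (K : ℝ) * L ≤ 4.2 * v ^ 90 := by
    rw [← le_div_iff₀ hL0]; exact Nat.floor_le (by positivity)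
  obtain ⟨h1, h2, h3, h4⟩ := level_numerics hv hL1 hn2 h2n hs hKL
  have hlw : log (v ^ 500) = 5 * L := by rw [log_pow, hL]; push_cast; ring
  have hsL : 5 * L ≤ s := by
    rw [hs, le_div_iff₀ (by positivity)]
    have : v ^ 2 ≤ v ^ 10 := pow_le_pow_right₀ hv1 (by norm_num)
    nlinarith
  have hsv : s ≤ v ^ 10 := by
    rw [hs, div_le_iff₀ (by positivity)]
    exact mul_le_mul_of_nonneg_left (by linarith) (by positivity)
  have hwz : ∀ i : ℕ, v ^ 500 ≤ exp (2 ^ i * s) := fun i => by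
    rw [← log_le_iff_le_exp (by positivity), hlw]
    exact hsL.trans (le_mul_of_one_le_left hs0.le (one_le_pow₀ one_le_two))
  have hH : (⌊v ^ 90⌋₊ : ℝ) ≤ v ^ 90 := Nat.floor_le (by positivity)
  have hQ : (⌊v ^ 40⌋₊ : ℝ) ≤ v ^ 40 := Nat.floor_le (by positivity)
  have hw2 : 2 ≤ v ^ 500 := by
    have : v ≤ v ^ 500 := le_self_pow₀ hv1 (by norm_num)
    linarith
  have hpow : ∀ a b : ℕ, a ≤ b → v ^ a ≤ v ^ b := fun a b => pow_le_pow_right₀ hv1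
  obtain ⟨g1, g2, g3⟩ := levelWeight_spec (w := v ^ 500) (s := s) (R := exp (v ^ 100 / 5))
    (T₁ := 0.198 * v ^ 100) (T₂ := 0.002 * v ^ 100) (n := n) (H := ⌊v ^ 90⌋₊)
    (W := primorial ⌊v ^ 40⌋₊) (K := K) hw2 hs0 (by exact_mod_cast hn0)
    (hH.trans (hpow _ _ (by norm_num))) (exp_pos _) (primorial_pos _)
    (fun l hl hwl => by
      refine (Nat.Coprime.symm ((Nat.Prime.coprime_iff_not_dvd hl).2 fun hd => ?_))
      obtain ⟨a, ha, hla⟩ := (Prime.dvd_finsetProd_iff hl.prime _).1 hd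
      simp only [mem_filter, mem_range] at ha
      rw [Nat.prime_dvd_prime_iff_eq hl ha.2] at hla
      have h5 : (a : ℝ) ≤ ⌊v ^ 40⌋₊ := by exact_mod_cast (by omega : a ≤ ⌊v ^ 40⌋₊)
      rw [hla] at hwl
      linarith [hpow 40 500 (by norm_num)])
    (fun i _ => by
      have := (hprod _ (hwz i)).1
      rwa [log_exp, mul_div_assoc] at this)
    (fun i _ => by
      have := (hprod _ (hwz i)).2.1
      rwa [log_exp, mul_div_assoc] at this)
    (fun i _ => by
      have := hsum _ _ (by linarith) (hwz i)
      rw [log_exp, hlw] at this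
      linarith)
    (four_mul_add_le_two_pow (by exact_mod_cast (by linarith : (13 : ℝ) ≤ n)))
    (by positivity) (by positivity) (by rw [log_exp]; linarith)
    (by rwa [hlw]) (by rwa [hlw]) h3 h4
  have htop : 2 ^ n * s ≤ v ^ 94 :=
    (mul_le_mul h2n hsv hs0.le (by positivity)).trans_eq (by ring)
  refine ⟨primeRange (v ^ 500) (exp (2 ^ n * s)), inferInstance, inferInstance,
    fun i => (i : ℕ), levelWeight (v ^ 500) s n, K, primorial ⌊v ^ 40⌋₊, g1, fun i => ?_, ?_, hcop,
    g2, le_trans ?_ g3, ?_, ?_⟩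
  · exact ((mem_primeRange (by positivity)).1 i.2).2.2.trans
      (exp_le_exp.2 (htop.trans (hpow _ _ (by norm_num))))
  · calc ((primorial ⌊v ^ 40⌋₊ : ℕ) : ℝ) ≤ (4 : ℝ) ^ ⌊v ^ 40⌋₊ := by
          exact_mod_cast primorial_le_four_pow _
      _ ≤ exp 2 ^ ⌊v ^ 40⌋₊ := by
          gcongr
          have := add_one_le_exp 1
          rw [show (2 : ℝ) = 1 + 1 by norm_num, exp_add]
          nlinarith
      _ = exp (⌊v ^ 40⌋₊ * 2) := (exp_nat_mul _ _).symm
      _ ≤ _ := exp_le_exp.2 (by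
          calc (⌊v ^ 40⌋₊ : ℝ) * 2 ≤ v ^ 40 * v := by gcongr; linarith
            _ = v ^ 41 := by ring
            _ ≤ _ := hpow _ _ (by norm_num))
  · rw [hlw, hs]
    calc 0.00187 * v ^ 10 * L ≤ 0.165 * v ^ 10 / 105 * (1.19 * L) := by
          have : 0 ≤ v ^ 10 * L := by positivity
          linarith
      _ ≤ 0.165 * v ^ 10 / 105 * n := by gcongr
      _ = _ := by field_simp; norm_num
  · refine (errFactor_le (L := L) (by positivity) _ ?_).trans ?_
    · refine ((hprod _ (hwz n)).2.1).trans ?_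
      have hexp : exp L = v ^ 100 := by
        rw [hL, ← Nat.cast_ofNat (R := ℝ) (n := 100), exp_nat_mul, exp_log hv0]
      rw [log_exp, hlw, hexp]
      have h5 : 2 ^ n * s / (5 * L) ≤ 2 ^ n * s / 5000 := by gcongr; linarith
      have h6 := hpow 94 100 (by norm_num)
      have h7 : 0 < 2 ^ n * s := by positivity
      linarith
    · rw [← exp_nat_mul, ← exp_add]
      refine exp_le_exp.2 ?_
      have : (⌊v ^ 90⌋₊ : ℝ) * L ≤ v ^ 90 * v := by gcongr
      have h5 : v ^ 90 * v * v ≤ v ^ 100 := by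
        rw [← pow_succ, ← pow_succ]; exact hpow _ _ (by norm_num)
      have h6 : 3600 * (v ^ 90 * v) ≤ v ^ 90 * v * v := by
        rw [mul_comm]; gcongr; linarith
      push_cast
      linarith
  · have h5 : (⌊v ^ 90⌋₊ : ℝ) ^ 2 ≤ v ^ 180 := by
      calc (⌊v ^ 90⌋₊ : ℝ) ^ 2 ≤ (v ^ 90) ^ 2 := by gcongr
        _ = _ := by ring
    have h6 : 2592 * (⌊v ^ 90⌋₊ : ℝ) ^ 2 / v ^ 500 ≤ 1 / v ^ 315 := by
      rw [div_le_div_iff₀ (by positivity) (by positivity)]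
      calc 2592 * (⌊v ^ 90⌋₊ : ℝ) ^ 2 * v ^ 315 ≤ v * v ^ 180 * v ^ 315 := by
            gcongr; linarith
        _ = v ^ 496 := by ring
        _ ≤ 1 * v ^ 500 := by rw [one_mul]; exact hpow _ _ (by norm_num)
    refine (prod_one_add_sq_sub_one_le hw2 _ ?_).trans h6
    calc 1296 * (⌊v ^ 90⌋₊ : ℝ) ^ 2 / v ^ 500 ≤ 2592 * (⌊v ^ 90⌋₊ : ℝ) ^ 2 / v ^ 500 := by
          gcongr; norm_num
      _ ≤ 1 / v ^ 315 := h6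
      _ ≤ 1 := (div_le_one (by positivity)).2 (one_le_pow₀ hv1)

lemma bad_card_le {N ms H p X d E0 F W v x : ℝ} (hms : 0 < ms) (hH : 0 < H) (hW : 0 < W)
    (hx : 0 < x) (hv : 10 ^ 6 ≤ v) (hp : x / v ^ 101 ≤ p) (hX : 0 ≤ X) (hXx : X ≤ x) (hN : 0 ≤ N)
    (hd : d ≤ 2 * (v ^ 100 * x)) (hd0 : 0 ≤ d) (hE : E0 ≤ 1 / v ^ 315)
    (hF : W ^ 2 * F ^ 2 ≤ x / v ^ 120)
    (h : N * (0.01 * (0.48 * ms * H * p)) ^ 2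
      ≤ W ^ 2 * H ^ 2 * ((d / W * (2 * (X / W)) * ms ^ 2 * E0) * p + (ms * F) ^ 2 * p ^ 2)) :
    N ≤ x / v ^ 110 := by
  have hv0 : 0 < v := by linarith
  have hp0 : 0 < p := lt_of_lt_of_le (by positivity) hp
  have h1 : N * 0.0048 ^ 2 * p ≤ 2 * d * X * E0 + W ^ 2 * F ^ 2 * p := by
    have e1 : N * (0.01 * (0.48 * ms * H * p)) ^ 2 = (N * 0.0048 ^ 2 * p) * (ms ^ 2 * H ^ 2 * p) := by
      ring
    have e2 : W ^ 2 * H ^ 2 * ((d / W * (2 * (X / W)) * ms ^ 2 * E0) * p + (ms * F) ^ 2 * p ^ 2)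
        = (2 * d * X * E0 + W ^ 2 * F ^ 2 * p) * (ms ^ 2 * H ^ 2 * p) := by
      field_simp
    rw [e1, e2] at h
    exact le_of_mul_le_mul_right h (by positivity)
  have h2 : 2 * d * X * E0 ≤ 4 * x / v ^ 114 * p := by
    calc 2 * d * X * E0 ≤ 2 * d * X * (1 / v ^ 315) := by gcongr
      _ ≤ 2 * (2 * (v ^ 100 * x)) * x * (1 / v ^ 315) := by gcongr
      _ = 4 * x / v ^ 114 * (x / v ^ 101) := by field_simp; ring
      _ ≤ _ := by gcongr
  have h3 : N * 0.0048 ^ 2 ≤ 4 * x / v ^ 114 + x / v ^ 120 := by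
    refine le_of_mul_le_mul_right ?_ hp0
    have := mul_le_mul_of_nonneg_right hF hp0.le
    linarith
  have h4 : x / v ^ 120 ≤ x / v ^ 114 := by
    gcongr
    · linarith
    · norm_num
  have h5 : x / v ^ 114 * v ≤ x / v ^ 110 := by
    rw [div_mul_eq_mul_div, div_le_div_iff₀ (by positivity) (by positivity), mul_assoc, ← pow_succ']
    gcongr
    · linarith
    · norm_num
  have h6 : x / v ^ 114 * 10 ^ 6 ≤ x / v ^ 114 * v := by gcongr
  have h7 : 4 * x / v ^ 114 = 4 * (x / v ^ 114) := by ring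
  have h8 : 0 < x / v ^ 114 := by positivity
  norm_num at h3
  linarith

/-- The hypergraph weights: small, of total mass at most one, and with large degrees. -/
lemma eventually_exists_weights : ∀ᶠ v : ℝ in atTop, ∀ x y : ℝ, x = exp (v ^ 100) →
    v ^ 92 * x ≤ y → y ≤ v ^ 100 * x → ∃ m : ℕ → ℤ → ℝ, (∀ p n, 0 ≤ m p n) ∧
    (∀ p : ℕ, p.Prime → x / 2 < p → ∑ n ∈ Ioc (-(⌊v ^ 90⌋₊ * ⌊x⌋₊ : ℤ)) ⌊y⌋₊, m p n ≤ 1) ∧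
    (∀ p : ℕ, p.Prime → x / 2 < p → ∀ n, m p n ≤ exp (-(0.59 * v ^ 100))) ∧
    ∀ P Q : Finset ℕ, (∀ p ∈ P, p.Prime ∧ x / 2 < p ∧ (p : ℝ) ≤ x) → x / v ^ 101 ≤ P.card →
      (∀ q ∈ Q, q.Prime ∧ x < q ∧ (q : ℝ) ≤ y) →
      ((Q.filter fun q : ℕ => ∑ p ∈ P, ∑ j ∈ Icc 1 ⌊v ^ 90⌋₊, m p ((q : ℤ) - j * p)
        < 8.5 / 10 ^ 4 * (v ^ 100 * (100 * log v)) * P.card / y).card : ℝ) ≤ x / v ^ 110 := by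
  filter_upwards [eventually_sieveSetup, eventually_ge_atTop (10 ^ 6),
    (tendsto_log_atTop).eventually_ge_atTop 10, eventually_log_pow_le 120 1]
    with v ⟨ι, _, _, ℓ, G, K, W, hS, hℓ, hW, hK, hmean, hms, hErr, hE0⟩ hv hlv hlv' x y hx hxy hyx
  rw [pow_one] at hlv'
  have hv0 : 0 < v := by linarith
  have hv1 : 1 ≤ v := by linarith
  have hx0 : 0 < x := hx ▸ exp_pos _
  have hpow : ∀ a b : ℕ, a ≤ b → v ^ a ≤ v ^ b := fun a b => pow_le_pow_right₀ hv1
  have hv99 : v ^ 99 * 10 ^ 6 ≤ v ^ 100 := by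
    rw [pow_succ v 99]; exact mul_le_mul_of_nonneg_left hv (by positivity)
  have hv991 : v ≤ v ^ 99 := le_self_pow₀ hv1 (by norm_num)
  have hx2 : exp (v ^ 99) < x / 2 := by
    rw [hx, lt_div_iff₀ two_pos]
    calc exp (v ^ 99) * 2 ≤ exp (v ^ 99) * exp 1 := by
          gcongr; have := add_one_le_exp 1; linarith
      _ = exp (v ^ 99 + 1) := (exp_add _ _).symm
      _ < _ := exp_lt_exp.2 (by linarith)
  have hvexp : v ^ 120 ≤ exp (v ^ 99) := by
    rw [← log_le_iff_le_exp (by positivity), log_pow]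
    exact hlv'.trans hv991
  have hxbig : v ^ 120 ≤ x := by linarith
  have hx1 : 10 ^ 6 ≤ x := (hv.trans (le_self_pow₀ hv1 (by norm_num))).trans hxbig
  have hgood : ∀ p : ℕ, p.Prime → x / 2 < p → Int.gcd p W = 1 ∧ ∀ i, ¬(ℓ i : ℤ) ∣ p := by
    refine fun p hp hxp => ⟨?_, fun i hd => ?_⟩
    · rw [Int.gcd_natCast_natCast]
      refine (Nat.Prime.coprime_iff_not_dvd hp).2 fun hd => ?_
      have : (p : ℝ) ≤ W := by exact_mod_cast Nat.le_of_dvd hS.W_pos hd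
      linarith
    · rw [Int.natCast_dvd_natCast, Nat.prime_dvd_prime_iff_eq (hS.prime i) hp] at hd
      have := hℓ i
      rw [hd] at this
      linarith
  set R := exp (v ^ 100 / 5) with hR
  set H := ⌊v ^ 90⌋₊ with hH
  set E := errFactor ℓ H R with hE
  set a : ℤ := -(H * ⌊x⌋₊ : ℤ) with ha
  have hab : a ≤ (⌊y⌋₊ : ℤ) := le_trans (neg_nonpos.2 (by positivity)) (by positivity)
  have hEpos : 0 < E := errFactor_pos ℓ H hS.R_pos
  have hWpos : (0 : ℝ) < W := by exact_mod_cast hS.W_pos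
  have hH1 : (H : ℝ) ≤ v ^ 90 := Nat.floor_le (by positivity)
  have hv90 : v ≤ v ^ 90 := le_self_pow₀ hv1 (by norm_num)
  have hH2 : 0.999 * v ^ 90 ≤ H := by
    have := Nat.lt_floor_add_one (v ^ 90); rw [← hH] at this; linarith
  have hXx : (⌊x⌋₊ : ℝ) ≤ x := Nat.floor_le hx0.le
  have hy0 : 0 < y := lt_of_lt_of_le (by positivity) hxy
  have hYy : (⌊y⌋₊ : ℝ) ≤ y := Nat.floor_le hy0.le
  have hv92 : 10 ^ 6 ≤ v ^ 92 := hv.trans (le_self_pow₀ hv1 (by norm_num))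
  have hxy' : 10 ^ 6 * x ≤ y := le_trans (by gcongr) hxy
  have hHx : H * x ≤ y / 10 ^ 4 := by
    rw [le_div_iff₀ (by norm_num)]
    calc H * x * 10 ^ 4 ≤ v ^ 90 * x * (v * v) := by gcongr; nlinarith
      _ = v ^ 92 * x := by ring
      _ ≤ y := hxy
  have hWE : W * E ≤ x := by
    rw [hx]
    calc W * E ≤ exp (v ^ 99) * exp (0.41 * v ^ 100) := by gcongr
      _ = exp (v ^ 99 + 0.41 * v ^ 100) := (exp_add _ _).symm
      _ ≤ _ := exp_le_exp.2 (by linarith)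
  have hdle : ((⌊y⌋₊ : ℤ) : ℝ) - (a : ℝ) ≤ y + y / 10 ^ 4 := by
    have : (H : ℝ) * ⌊x⌋₊ ≤ H * x := by gcongr
    rw [ha]; push_cast; linarith
  have hdge : x ≤ ((⌊y⌋₊ : ℤ) : ℝ) - (a : ℝ) := by
    have : (0 : ℝ) ≤ H * ⌊x⌋₊ := by positivity
    have := Nat.lt_floor_add_one y
    rw [ha]; push_cast; linarith
  set M : ℝ := ((⌊y⌋₊ : ℤ) : ℝ) - (a : ℝ) + W * E with hM
  have hWE0 : 0 < W * E := by positivity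
  have hMx : x ≤ M := by linarith
  have hM0 : 0 < M := by linarith
  refine ⟨fun p n => normWeight ℓ G R W H p n / M,
    fun p n => div_nonneg (hS.normWeight_nonneg _ _) hM0.le, fun p hp hxp => ?_,
    fun p hp hxp n => ?_, fun P Q hP hPc hQ => ?_⟩
  · rw [← sum_div, div_le_one hM0]
    exact hS.sum_normWeight_le (hgood p hp hxp).2 hab
  · rw [div_le_iff₀ hM0]
    refine (hS.normWeight_le (hgood p hp hxp).2 n).trans (hErr.trans ?_)
    calc exp (0.41 * v ^ 100) ≤ exp (-(0.59 * v ^ 100)) * x := by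
          rw [hx, ← exp_add]
          exact exp_le_exp.2 (by linarith)
      _ ≤ _ := by gcongr
  · set ms := mass ℓ G ^ 2 / sqMass ℓ G with hms'
    have hms0 : 0 < ms := lt_of_lt_of_le (by positivity) hms
    have main := hS.card_small_degree_mul_le (Q := Q) (P := P) (a := a) (b := (⌊y⌋₊ : ℤ))
      (X := ⌊x⌋₊) (K := K) (γ := 0.48 * ms) (ε := 0.01) hab
      (fun q hq => by
        obtain ⟨h1, h2, h3⟩ := hQ q hq
        refine ⟨mem_Ioc.2 ⟨lt_of_le_of_lt (neg_nonpos.2 (by positivity))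
          (by exact_mod_cast h1.pos), by exact_mod_cast Nat.le_floor h3⟩,
          hgood q h1 (by linarith)⟩)
      (fun p hp => ⟨(hP p hp).1.pos, Nat.le_floor (hP p hp).2.2, hgood p (hP p hp).1 (hP p hp).2.1⟩)
      (by
        have h1 : W * R ^ 2 ≤ x / 2 := by
          rw [hR, ← exp_nat_mul]
          calc (W : ℝ) * exp ((2 : ℕ) * (v ^ 100 / 5))
              ≤ exp (v ^ 99) * exp ((2 : ℕ) * (v ^ 100 / 5)) := by gcongr
            _ = exp (v ^ 99 + (2 : ℕ) * (v ^ 100 / 5)) := (exp_add _ _).symm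
            _ ≤ exp (v ^ 100 - 1) := exp_le_exp.2 (by push_cast; linarith)
            _ ≤ _ := by
              rw [exp_sub, ← hx]
              gcongr
              have := add_one_le_exp 1; linarith
        have := Nat.lt_floor_add_one x
        linarith)
      hK hmean (by positivity) (by norm_num)
    have hN := bad_card_le hms0 (lt_of_lt_of_le (by positivity) hH2) hWpos hx0 hv hPc
      (Nat.cast_nonneg _) hXx (Nat.cast_nonneg _) (by linarith) (by linarith) hE0 (by
        rw [← mul_pow, le_div_iff₀ (by positivity), hx]
        calc (W * E) ^ 2 * v ^ 120
            ≤ (exp (v ^ 99) * exp (0.41 * v ^ 100)) ^ 2 * exp (v ^ 99) := by gcongr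
          _ = exp (3 * v ^ 99 + 0.82 * v ^ 100) := by
            rw [← exp_add, ← exp_nat_mul, ← exp_add]; congr 1; push_cast; ring
          _ ≤ _ := exp_le_exp.2 (by linarith)) main
    refine le_trans ?_ hN
    refine Nat.cast_le.2 (card_le_card (monotone_filter_right _ fun q _ hq => ?_))
    simp_rw [← sum_div] at hq
    rw [div_lt_iff₀ hM0] at hq
    refine hq.trans_le ?_
    have hMy : M ≤ 1.001 * y := by norm_num; linarith
    have hP0 : (0 : ℝ) ≤ P.card := by positivity
    have hT : 0 ≤ v ^ 100 * (100 * log v) * P.card :=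
      mul_nonneg (mul_nonneg (pow_nonneg hv0.le _) (by linarith)) hP0
    calc 8.5 / 10 ^ 4 * (v ^ 100 * (100 * log v)) * P.card / y * M
        ≤ 8.5 / 10 ^ 4 * (v ^ 100 * (100 * log v)) * P.card / y * (1.001 * y) :=
          mul_le_mul_of_nonneg_left hMy (div_nonneg (by linarith) hy0.le)
      _ = (8.5 / 10 ^ 4 * 1.001) * (v ^ 100 * (100 * log v) * P.card) := by field_simp
      _ ≤ ((1 - 0.01) * 0.48 * 0.00187 * 0.999) * (v ^ 100 * (100 * log v) * P.card) :=
          mul_le_mul_of_nonneg_right (by norm_num) hT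
      _ = (1 - 0.01) * (0.48 * (0.00187 * v ^ 10 * (100 * log v)) * (0.999 * v ^ 90)
          * P.card) := by ring
      _ ≤ _ := by gcongr

end Parameters

/-- If each factor lies in `[0, 1]`, products differ by at most the sum of the differences. -/
lemma abs_prod_sub_prod_le {ι : Type*} (s : Finset ι) (x y : ι → ℝ)
    (hx : ∀ i ∈ s, 0 ≤ x i ∧ x i ≤ 1) (hy : ∀ i ∈ s, 0 ≤ y i ∧ y i ≤ 1) :
    |∏ i ∈ s, x i - ∏ i ∈ s, y i| ≤ ∑ i ∈ s, |x i - y i| := by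
  classical
  induction s using Finset.induction_on with
  | empty => simp
  | insert a s ha ih =>
    rw [prod_insert ha, prod_insert ha, sum_insert ha]
    have ih' := ih (fun i hi => hx i (mem_insert_of_mem hi)) (fun i hi => hy i (mem_insert_of_mem hi))
    have hxa := hx a (mem_insert_self _ _)
    have hya := hy a (mem_insert_self _ _)
    have hX0 : 0 ≤ ∏ i ∈ s, x i := prod_nonneg fun i hi => (hx i (mem_insert_of_mem hi)).1
    have hX1 : ∏ i ∈ s, x i ≤ 1 := prod_le_one (fun i hi => (hx i (mem_insert_of_mem hi)).1)
      fun i hi => (hx i (mem_insert_of_mem hi)).2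
    have e : x a * ∏ i ∈ s, x i - y a * ∏ i ∈ s, y i
        = (x a - y a) * ∏ i ∈ s, x i + y a * (∏ i ∈ s, x i - ∏ i ∈ s, y i) := by ring
    rw [e]
    refine (abs_add_le _ _).trans ?_
    rw [abs_mul, abs_mul, abs_of_nonneg hX0, abs_of_nonneg hya.1]
    have h1 : |x a - y a| * ∏ i ∈ s, x i ≤ |x a - y a| := mul_le_of_le_one_right (abs_nonneg _) hX1
    have h2 : y a * |∏ i ∈ s, x i - ∏ i ∈ s, y i| ≤ |∏ i ∈ s, x i - ∏ i ∈ s, y i| :=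
      mul_le_of_le_one_left (abs_nonneg _) hya.2
    linarith

lemma prod_one_sub_le {ι : Type*} (s : Finset ι) (a : ι → ℝ)
    (ha : ∀ i ∈ s, 0 ≤ a i ∧ a i ≤ 1) :
    ∏ i ∈ s, (1 - a i) ≤ 1 - ∑ i ∈ s, a i + (∑ i ∈ s, a i) ^ 2 := by
  classical
  induction s using Finset.induction_on with
  | empty => simp
  | insert b s hb ih =>
    have ih' := ih fun i hi => ha i (mem_insert_of_mem hi)
    have hab := ha b (mem_insert_self _ _)
    have hS : 0 ≤ ∑ i ∈ s, a i := sum_nonneg fun i hi => (ha i (mem_insert_of_mem hi)).1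
    rw [prod_insert hb, sum_insert hb]
    have := mul_le_mul_of_nonneg_left ih' (show 0 ≤ 1 - a b by linarith [hab.2])
    nlinarith [mul_nonneg hab.1 hS, mul_nonneg hab.1 (mul_nonneg hS hS), hab.1, hab.2,
      mul_nonneg hab.1 hab.1]

/-- Independent random sets `E p c`, with `c` of law `ϖ p`, avoid `T` with almost the
probability with which they would avoid it if the points of `T` behaved independently. -/
lemma abs_prod_avoid_sub_le {ι α : Type*} [Fintype ι] [DecidableEq α] {κ : ι → Type*}
    [∀ p, Fintype (κ p)] (ϖ : ∀ p, κ p → ℝ) (E : ∀ p, κ p → Finset α)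
    (hϖ : ∀ p c, 0 ≤ ϖ p c) (hϖ1 : ∀ p, ∑ c, ϖ p c = 1) (T : Finset α) (k D : ℝ) (hk0 : 0 ≤ k)
    (hk : ∀ p, ∀ q ∈ T, ∑ c, (if q ∈ E p c then ϖ p c else 0) ≤ k)
    (hD : ∀ q ∈ T, ∑ p, ∑ c, (if q ∈ E p c then ϖ p c else 0) ≤ D)
    (hpair : ∀ q ∈ T, ∀ q' ∈ T, q ≠ q' → ∀ p p', (∃ c, q ∈ E p c ∧ q' ∈ E p c) →
      (∃ c, q ∈ E p' c ∧ q' ∈ E p' c) → p = p') :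
    |∏ p, ∑ c, (if Disjoint (E p c) T then ϖ p c else 0)
      - ∏ q ∈ T, ∏ p, (1 - ∑ c, (if q ∈ E p c then ϖ p c else 0))|
      ≤ (T.card : ℝ) ^ 2 * k * (D + T.card) := by
  classical
  rcases T.eq_empty_or_nonempty with rfl | ⟨q0, hq0⟩
  · simp [hϖ1]
  have : Nonempty α := ⟨q0⟩
  set a : ι → α → ℝ := fun p q => ∑ c, (if q ∈ E p c then ϖ p c else 0) with ha
  have ha0 : ∀ p q, 0 ≤ a p q := fun p q => sum_nonneg fun c _ => by split_ifs <;> simp [hϖ]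
  have ha1 : ∀ p q, a p q ≤ 1 := fun p q => by
    rw [← hϖ1 p]; exact sum_le_sum fun c _ => by split_ifs <;> simp [hϖ]
  set s : ι → ℝ := fun p => ∑ q ∈ T, a p q with hs
  have hs0 : ∀ p, 0 ≤ s p := fun p => sum_nonneg fun q _ => ha0 p q
  have hsk : ∀ p, s p ≤ T.card * k := fun p => by
    rw [← nsmul_eq_mul]; exact sum_le_card_nsmul _ _ _ fun q hq => hk p q hq
  set x : ι → ℝ := fun p => ∑ c, (if Disjoint (E p c) T then ϖ p c else 0) with hx
  have hx0 : ∀ p, 0 ≤ x p := fun p => sum_nonneg fun c _ => by split_ifs <;> simp [hϖ]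
  have hx1 : ∀ p, x p ≤ 1 := fun p => by
    rw [← hϖ1 p]; exact sum_le_sum fun c _ => by split_ifs <;> simp [hϖ]
  have hscount : ∀ p, s p = ∑ c, ϖ p c * ((T.filter (· ∈ E p c)).card : ℝ) := fun p => by
    rw [hs]; simp only [ha]; rw [sum_comm]
    refine sum_congr rfl fun c _ => ?_
    rw [← sum_filter, sum_const, nsmul_eq_mul, mul_comm]
  have hxs : ∀ p, 1 - s p ≤ x p := fun p => by
    have : 1 - x p ≤ s p := by
      rw [hscount, ← hϖ1 p, hx, ← sum_sub_distrib]
      refine sum_le_sum fun c _ => ?_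
      split_ifs with h
      · simp only [sub_self]; exact mul_nonneg (hϖ p c) (Nat.cast_nonneg _)
      · rw [sub_zero]
        apply le_mul_of_one_le_right (hϖ p c)
        rw [not_disjoint_iff] at h
        obtain ⟨q, hq, hqT⟩ := h
        exact_mod_cast card_pos.mpr ⟨q, by simp [hq, hqT]⟩
    linarith
  set B : Finset ι := univ.filter fun p => ∃ q ∈ T, ∃ q' ∈ T, q ≠ q' ∧ ∃ c, q ∈ E p c ∧ q' ∈ E p c
    with hB
  have hclean : ∀ p, p ∉ B → x p = 1 - s p := fun p hp => by
    have : 1 - x p = s p := by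
      rw [hscount, ← hϖ1 p, hx, ← sum_sub_distrib]
      refine sum_congr rfl fun c _ => ?_
      split_ifs with h
      · have : T.filter (· ∈ E p c) = ∅ := by
          rw [filter_eq_empty_iff]; intro q hq hqE
          exact disjoint_left.mp h hqE hq
        simp [this]
      · rw [sub_zero]
        rw [not_disjoint_iff] at h
        obtain ⟨q, hq, hqT⟩ := h
        have : T.filter (· ∈ E p c) = {q} := by
          ext q'
          simp only [mem_filter, mem_singleton]
          constructor
          · rintro ⟨h1, h2⟩
            by_contra hne
            exact hp (by rw [hB, mem_filter]; exact ⟨mem_univ _, q', h1, q, hqT, hne, c, h2, hq⟩)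
          · rintro rfl; exact ⟨hqT, hq⟩
        simp [this]
    linarith
  have hBcard : (B.card : ℝ) ≤ (T.card : ℝ) ^ 2 := by
    have : B.card ≤ (T ×ˢ T).card := by
      have hch : ∀ p ∈ B, ∃ z ∈ T ×ˢ T, z.1 ≠ z.2 ∧ ∃ c, z.1 ∈ E p c ∧ z.2 ∈ E p c := by
        intro p hp
        rw [hB, mem_filter] at hp
        obtain ⟨-, q, hq, q', hq', hne, h⟩ := hp
        exact ⟨(q, q'), by simp [hq, hq'], hne, h⟩
      choose! z hz using hch
      refine card_le_card_of_injOn z (fun p hp => (hz p hp).1) ?_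
      intro p hp p' hp' hzz
      have h1 := hz p hp
      have h2 := hz p' hp'
      rw [← hzz] at h2
      rw [mem_product] at h1
      exact hpair _ h1.1.1 _ h1.1.2 h1.2.1 p p' h1.2.2 h2.2.2
    rw [card_product] at this
    calc (B.card : ℝ) ≤ ((T.card * T.card : ℕ) : ℝ) := by exact_mod_cast this
      _ = _ := by push_cast; ring
  have hy : ∀ p, 0 ≤ ∏ q ∈ T, (1 - a p q) ∧ ∏ q ∈ T, (1 - a p q) ≤ 1 := fun p =>
    ⟨prod_nonneg fun q _ => by linarith [ha1 p q],
      prod_le_one (fun q _ => by linarith [ha1 p q]) fun q _ => by linarith [ha0 p q]⟩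
  rw [prod_comm]
  refine (abs_prod_sub_prod_le univ x (fun p => ∏ q ∈ T, (1 - a p q))
    (fun p _ => ⟨hx0 p, hx1 p⟩) (fun p _ => hy p)).trans ?_
  have hlow : ∀ p, 1 - s p ≤ ∏ q ∈ T, (1 - a p q) := fun p =>
    one_sub_sum_le_prod T (ha0 p) (ha1 p)
  have hup : ∀ p, ∏ q ∈ T, (1 - a p q) ≤ 1 - s p + s p ^ 2 := fun p =>
    prod_one_sub_le T (a p) fun q _ => ⟨ha0 p q, ha1 p q⟩
  have hterm : ∀ p, |x p - ∏ q ∈ T, (1 - a p q)| ≤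
      s p * (T.card * k) + (if p ∈ B then T.card * k else 0) := fun p => by
    have hsk' : 0 ≤ (T.card : ℝ) * k := (hs0 p).trans (hsk p)
    by_cases hp : p ∈ B
    · rw [if_pos hp, abs_le]
      have := mul_nonneg (hs0 p) hsk'
      constructor <;> linarith [hxs p, hx1 p, hlow p, (hy p).2, hsk p]
    · rw [if_neg hp, hclean p hp, abs_le]
      have := mul_le_mul_of_nonneg_left (hsk p) (hs0 p)
      constructor
      · have := hup p; nlinarith
      · have := hlow p; nlinarith [mul_nonneg (hs0 p) hsk']
  refine (sum_le_sum fun p _ => hterm p).trans ?_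
  rw [sum_add_distrib, ← sum_mul, ← sum_filter, sum_const, nsmul_eq_mul]
  have hsum : ∑ p, s p ≤ T.card * D := by
    rw [hs, sum_comm, ← nsmul_eq_mul]
    exact sum_le_card_nsmul _ _ _ fun q hq => hD q hq
  have hfB : (univ.filter fun p => p ∈ B) = B := by ext; simp
  rw [hfB]
  have hTk : 0 ≤ (T.card : ℝ) * k := by positivity
  nlinarith [mul_le_mul_of_nonneg_right hsum hTk, mul_le_mul_of_nonneg_right hBcard hTk]

/-- One covering step preserves the weighted moments up to a small relative error. -/
lemma abs_sum_prod_reweight_sub_le {ι α : Type*} [Fintype ι] [DecidableEq ι] [DecidableEq α]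
    {κ : ι → Type*}
    [∀ p, Fintype (κ p)] (ϖ : ∀ p, κ p → ℝ) (E : ∀ p, κ p → Finset α)
    (hϖ : ∀ p c, 0 ≤ ϖ p c) (hϖ1 : ∀ p, ∑ c, ϖ p c = 1) (T : Finset α) (k D : ℝ) (hk0 : 0 ≤ k)
    (hD0 : 0 ≤ D)
    (Rg : α → Prop) [DecidablePred Rg] (W : α → ℝ) (hW : ∀ q, 0 ≤ W q) (ρ : ℝ) (hρ : 0 < ρ)
    (hρ1 : ρ < 1)
    (f : α → ℝ) (hf : ∀ q, f q = ∏ p, (1 - ∑ c, (if q ∈ E p c then ϖ p c else 0)))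
    (hfρ : ∀ q ∈ T, Rg q → f q ≤ ρ)
    (hk : ∀ p, ∀ q ∈ T, ∑ c, (if q ∈ E p c then ϖ p c else 0) ≤ k)
    (hD : ∀ q ∈ T, Rg q → ∑ p, ∑ c, (if q ∈ E p c then ϖ p c else 0) ≤ D)
    (hpair : ∀ q ∈ T, ∀ q' ∈ T, q ≠ q' → ∀ p p', (∃ c, q ∈ E p c ∧ q' ∈ E p c) →
      (∃ c, q ∈ E p' c ∧ q' ∈ E p' c) → p = p') :
    |∑ c : (∀ p, κ p), (∏ p, ϖ p (c p)) * ∏ q ∈ T, (if Rg q then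
        W q * ((ρ - f q) / (1 - f q) + (1 - (ρ - f q) / (1 - f q)) *
          (if ∀ p, q ∉ E p (c p) then 1 else 0)) / ρ else W q) - ∏ q ∈ T, W q|
      ≤ (∏ q ∈ T, W q) * ((T.card : ℝ) ^ 2 * k * (D + T.card) / ρ ^ T.card) := by
  classical
  set β : α → ℝ := fun q => (ρ - f q) / (1 - f q) with hβ
  set unc : α → (∀ p, κ p) → ℝ := fun q c => if ∀ p, q ∉ E p (c p) then 1 else 0 with hunc
  set T1 := T.filter Rg with hT1
  have hf1 : ∀ q ∈ T1, f q < 1 := fun q hq => by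
    rw [hT1, mem_filter] at hq; exact (hfρ q hq.1 hq.2).trans_lt hρ1
  have hβ0 : ∀ q ∈ T1, 0 ≤ β q := fun q hq => by
    have h1 := hf1 q hq
    rw [hT1, mem_filter] at hq
    exact div_nonneg (by linarith [hfρ q hq.1 hq.2]) (by linarith)
  have hβ1 : ∀ q ∈ T1, β q ≤ 1 := fun q hq => by
    have h1 := hf1 q hq
    rw [hβ]; simp only; rw [div_le_one (by linarith)]; linarith
  have hβf : ∀ q ∈ T1, (1 - β q) * f q + β q = ρ := fun q hq => by
    have h1 := hf1 q hq
    have : (1 - f q) ≠ 0 := by linarith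
    rw [hβ]; simp only; field_simp; ring
  have hρT : (0 : ℝ) < ρ ^ T1.card := by positivity
  have hfac : ∀ c : (∀ p, κ p), ∏ q ∈ T, (if Rg q then
        W q * (β q + (1 - β q) * unc q c) / ρ else W q)
        = (∏ q ∈ T, W q) * ((∏ q ∈ T1, ((1 - β q) * unc q c + β q)) / ρ ^ T1.card) := fun c => by
    have : ∀ q ∈ T, (if Rg q then W q * (β q + (1 - β q) * unc q c) / ρ else W q)
        = W q * (if Rg q then ((1 - β q) * unc q c + β q) / ρ else 1) := fun q _ => by
      split_ifs <;> ring
    rw [prod_congr rfl this, prod_mul_distrib]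
    congr 1
    rw [← prod_filter, prod_div_distrib, prod_const]
  have hηdef : ∀ T' ∈ T1.powerset,
      |∑ c : (∀ p, κ p), (∏ p, ϖ p (c p)) * ∏ q ∈ T', unc q c - ∏ q ∈ T', f q|
        ≤ (T.card : ℝ) ^ 2 * k * (D + T.card) := fun T' hT' => by
    rw [mem_powerset] at hT'
    have hTT : T' ⊆ T := hT'.trans (filter_subset _ _)
    have h1 : ∀ c : (∀ p, κ p), (∏ p, ϖ p (c p)) * ∏ q ∈ T', unc q c
        = ∏ p, (if Disjoint (E p (c p)) T' then ϖ p (c p) else 0) := fun c => by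
      by_cases h : ∀ p, Disjoint (E p (c p)) T'
      · rw [prod_eq_one (s := T')]
        · rw [mul_one]; exact prod_congr rfl fun p _ => by rw [if_pos (h p)]
        · intro q hq
          rw [hunc]; simp only
          rw [if_pos]
          intro p hqp
          exact disjoint_left.mp (h p) hqp hq
      · push Not at h
        obtain ⟨p, hp⟩ := h
        have hz : ∏ p, (if Disjoint (E p (c p)) T' then ϖ p (c p) else 0) = 0 :=
          prod_eq_zero (mem_univ p) (if_neg hp)
        rw [hz]
        rw [not_disjoint_iff] at hp
        obtain ⟨q, hq, hqT⟩ := hp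
        have hu : unc q c = 0 := by
          rw [hunc]; simp only
          rw [if_neg]; push Not; exact ⟨p, hq⟩
        rw [prod_eq_zero hqT hu, mul_zero]
    rw [sum_congr rfl fun c _ => h1 c]
    have h2 := Fintype.prod_sum (fun p (c : κ p) => if Disjoint (E p c) T' then ϖ p c else 0)
    rw [← h2, prod_congr rfl fun q _ => hf q]
    refine (abs_prod_avoid_sub_le ϖ E hϖ hϖ1 T' k D hk0 (fun p q hq => hk p q (hTT hq))
      (fun q hq => hD q (hTT hq) (mem_filter.mp (hT' hq)).2)
      (fun q hq q' hq' => hpair q (hTT hq) q' (hTT hq'))).trans ?_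
    have : (T'.card : ℝ) ≤ T.card := by exact_mod_cast card_le_card hTT
    gcongr
  have hmain : ∑ c : (∀ p, κ p), (∏ p, ϖ p (c p)) * ∏ q ∈ T1, ((1 - β q) * unc q c + β q)
      = ∑ T' ∈ T1.powerset, ((∏ q ∈ T', (1 - β q)) * ∏ q ∈ T1 \ T', β q) *
        ∑ c : (∀ p, κ p), (∏ p, ϖ p (c p)) * ∏ q ∈ T', unc q c := by
    simp_rw [prod_add, mul_sum]
    rw [sum_comm]
    refine sum_congr rfl fun T' _ => sum_congr rfl fun c _ => ?_
    rw [prod_mul_distrib]; ring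
  have hideal : ρ ^ T1.card = ∑ T' ∈ T1.powerset, ((∏ q ∈ T', (1 - β q)) * ∏ q ∈ T1 \ T', β q) *
        ∏ q ∈ T', f q := by
    rw [← prod_const, ← prod_congr rfl hβf, prod_add]
    refine sum_congr rfl fun T' _ => ?_
    rw [prod_mul_distrib]; ring
  have htot : ∑ T' ∈ T1.powerset, ((∏ q ∈ T', (1 - β q)) * ∏ q ∈ T1 \ T', β q) = 1 := by
    rw [← prod_add]; exact prod_eq_one fun q _ => by ring
  have hWT : 0 ≤ ∏ q ∈ T, W q := prod_nonneg fun q _ => hW q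
  have hdiff : |∑ c : (∀ p, κ p), (∏ p, ϖ p (c p)) * ∏ q ∈ T1, ((1 - β q) * unc q c + β q)
      - ρ ^ T1.card| ≤ (T.card : ℝ) ^ 2 * k * (D + T.card) := by
    rw [hmain, hideal, ← sum_sub_distrib]
    refine (abs_sum_le_sum_abs _ _).trans ?_
    calc _ ≤ ∑ T' ∈ T1.powerset, ((∏ q ∈ T', (1 - β q)) * ∏ q ∈ T1 \ T', β q) *
          ((T.card : ℝ) ^ 2 * k * (D + T.card)) := by
          refine sum_le_sum fun T' hT' => ?_
          have hT'' := mem_powerset.mp hT'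
          have hnn : 0 ≤ (∏ q ∈ T', (1 - β q)) * ∏ q ∈ T1 \ T', β q :=
            mul_nonneg (prod_nonneg fun q hq => by linarith [hβ1 q (hT'' hq)])
              (prod_nonneg fun q hq => hβ0 q (mem_sdiff.mp hq).1)
          rw [← mul_sub, abs_mul, abs_of_nonneg hnn]
          exact mul_le_mul_of_nonneg_left (hηdef T' hT') hnn
      _ = _ := by rw [← sum_mul, htot, one_mul]
  have hsum : ∑ c : (∀ p, κ p), (∏ p, ϖ p (c p)) * ∏ q ∈ T, (if Rg q then
        W q * (β q + (1 - β q) * unc q c) / ρ else W q) - ∏ q ∈ T, W q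
      = (∏ q ∈ T, W q) * ((∑ c : (∀ p, κ p), (∏ p, ϖ p (c p)) *
        ∏ q ∈ T1, ((1 - β q) * unc q c + β q) - ρ ^ T1.card) / ρ ^ T1.card) := by
    simp_rw [hfac]
    rw [sub_div, div_self hρT.ne', mul_sub, mul_one, sum_div, mul_sum]
    congr 1
    exact sum_congr rfl fun c _ => by ring
  rw [hsum, abs_mul, abs_of_nonneg hWT, abs_div, abs_of_pos hρT]
  refine mul_le_mul_of_nonneg_left ?_ hWT
  have hpow : ρ ^ T.card ≤ ρ ^ T1.card :=
    pow_le_pow_of_le_one hρ.le hρ1.le (card_le_card (filter_subset _ _))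
  have : 0 < ρ ^ T.card := by positivity
  gcongr

/-- Expectation of `f` with respect to the weights `P` on a finite space. -/
def Ex {Ω : Type*} [Fintype Ω] (P : Ω → ℝ) (f : Ω → ℝ) : ℝ := ∑ ω, P ω * f ω

section Ex
variable {Ω : Type*} [Fintype Ω] {P : Ω → ℝ}

lemma Ex_add (f g : Ω → ℝ) : Ex P (fun ω => f ω + g ω) = Ex P f + Ex P g := by
  simp [Ex, mul_add, sum_add_distrib]

lemma Ex_sub (f g : Ω → ℝ) : Ex P (fun ω => f ω - g ω) = Ex P f - Ex P g := by
  simp [Ex, mul_sub, sum_sub_distrib]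

lemma Ex_const_mul (c : ℝ) (f : Ω → ℝ) : Ex P (fun ω => c * f ω) = c * Ex P f := by
  simp only [Ex, mul_sum]; exact sum_congr rfl fun _ _ => by ring

lemma Ex_sum {ι : Type*} (s : Finset ι) (f : ι → Ω → ℝ) :
    Ex P (fun ω => ∑ i ∈ s, f i ω) = ∑ i ∈ s, Ex P (f i) := by
  simp only [Ex, mul_sum]; exact sum_comm

lemma Ex_mono (hP : ∀ ω, 0 ≤ P ω) {f g : Ω → ℝ} (h : ∀ ω, f ω ≤ g ω) : Ex P f ≤ Ex P g :=
  sum_le_sum fun ω _ => mul_le_mul_of_nonneg_left (h ω) (hP ω)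

lemma Ex_nonneg (hP : ∀ ω, 0 ≤ P ω) {f : Ω → ℝ} (h : ∀ ω, 0 ≤ f ω) : 0 ≤ Ex P f :=
  sum_nonneg fun ω _ => mul_nonneg (hP ω) (h ω)

lemma Ex_const (hP1 : ∑ ω, P ω = 1) (c : ℝ) : Ex P (fun _ => c) = c := by
  simp [Ex, ← sum_mul, hP1]

end Ex

section Moments
variable {Ω α : Type*} [Fintype Ω] [DecidableEq α] {P : Ω → ℝ} {W : Ω → α → ℝ} {V : Finset α}
  {H : ℕ} {b ε : ℝ}

/-- Probability weights `P` and weights `W` in `[0, b]` whose products over small subsets of `V`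
have expectation close to one. -/
structure NearIndep (P : Ω → ℝ) (W : Ω → α → ℝ) (V : Finset α) (H : ℕ) (b ε : ℝ) : Prop where
  prob_nonneg : ∀ ω, 0 ≤ P ω
  sum_prob : ∑ ω, P ω = 1
  nonneg : ∀ ω q, 0 ≤ W ω q
  le : ∀ ω q, W ω q ≤ b
  moment : ∀ T ⊆ V, T.card ≤ 3 * H → |Ex P (fun ω => ∏ q ∈ T, W ω q) - 1| ≤ ε

lemma abs_Ex_prod_three_sub_one_le (hI : NearIndep P W V H b ε) (hb : 1 ≤ b) (hε : 0 ≤ ε)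
    {F G K : Finset α} (hF : F ⊆ V) (hG : G ⊆ V) (hK : K ⊆ V)
    (hFc : F.card ≤ H) (hGc : G.card ≤ H) (hKc : K.card ≤ H) :
    |Ex P (fun ω => (∏ q ∈ F, W ω q) * (∏ q ∈ G, W ω q) * ∏ q ∈ K, W ω q) - 1| ≤
      ε + b ^ (3 * H) * ((if Disjoint F G then 0 else 1) + (if Disjoint F K then 0 else 1)
        + (if Disjoint G K then 0 else 1)) := by
  have ⟨hP, hP1, hW, hWb, hM⟩ := hI
  have h0 (F : Finset α) ω : 0 ≤ ∏ q ∈ F, W ω q := prod_nonneg fun q _ => hW ω q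
  have h1 (F : Finset α) (hF : F.card ≤ H) ω : ∏ q ∈ F, W ω q ≤ b ^ H :=
    (prod_le_prod (fun q _ => hW ω q) fun q _ => hWb ω q).trans
      ((prod_const b).trans_le (pow_le_pow_right₀ hb hF))
  by_cases h : Disjoint F G ∧ Disjoint F K ∧ Disjoint G K
  · simp only [h, if_true]
    simpa [← prod_union (disjoint_union_left.2 h.2), ← prod_union h.1] using hM (F ∪ G ∪ K) (union_subset (union_subset hF hG) hK)
      (by grind [card_union_le F G, card_union_le (F ∪ G) K])
  · have h2 : Ex P (fun ω => (∏ q ∈ F, W ω q) * (∏ q ∈ G, W ω q) * ∏ q ∈ K, W ω q) ≤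
        b ^ (3 * H) := by
      refine (Ex_mono hP (g := fun _ => b ^ H * b ^ H * b ^ H) fun ω => ?_).trans_eq
        (by rw [Ex_const hP1]; ring)
      gcongr
      exacts [h0 K ω, h0 G ω, h1 F hFc ω, h1 G hGc ω, h1 K hKc ω]
    have h3 := Ex_nonneg hP fun ω => mul_nonneg (mul_nonneg (h0 F ω) (h0 G ω)) (h0 K ω)
    have h4 : (1 : ℝ) ≤ (if Disjoint F G then 0 else 1) + (if Disjoint F K then 0 else 1)
        + (if Disjoint G K then 0 else 1) := by
      split_ifs <;> first | tauto | norm_num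
    have h5 : 1 ≤ b ^ (3 * H) := one_le_pow₀ hb
    rw [abs_le]
    constructor <;> nlinarith

/-- The random sum `∑ a, m a * ∏ r ∈ g a, W r` has small variance, also with the extra weight
`∏ r ∈ F, W r`. -/
lemma Ex_sq_deviation_le (hI : NearIndep P W V H b ε) (hb : 1 ≤ b) (hε : 0 ≤ ε)
    {ι : Type*} {B : Finset ι} {m : ι → ℝ} (hm : ∀ a ∈ B, 0 ≤ m a) {g : ι → Finset α}
    (hg : ∀ a ∈ B, g a ⊆ V) (hgc : ∀ a ∈ B, (g a).card ≤ H) {F : Finset α} (hF : F ⊆ V)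
    (hFc : F.card ≤ H) {k l : ℝ} (hl : ∑ a ∈ B, (if Disjoint F (g a) then 0 else m a) ≤ l)
    (hk : ∀ a ∈ B, ∑ a' ∈ B, (if Disjoint (g a) (g a') then 0 else m a') ≤ k) :
    Ex P (fun ω => (∏ r ∈ F, W ω r) * (∑ a ∈ B, m a * ∏ r ∈ g a, W ω r - ∑ a ∈ B, m a) ^ 2)
      ≤ 4 * ε * (∑ a ∈ B, m a) ^ 2 + b ^ (3 * H) * (4 * l + k) * ∑ a ∈ B, m a := by
  set M := ∑ a ∈ B, m a
  set S := ∑ a ∈ B, if Disjoint F (g a) then 0 else m a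
  set w : Finset α → Ω → ℝ := fun F ω => ∏ r ∈ F, W ω r
  have hE : Ex P (fun ω => w F ω * (∑ a ∈ B, m a * w (g a) ω - M) ^ 2) =
      ∑ a ∈ B, ∑ a' ∈ B, m a * m a' * (Ex P (fun ω => w F ω * w (g a) ω * w (g a') ω) -
        Ex P (fun ω => w F ω * w (g a) ω * w ∅ ω) - Ex P (fun ω => w F ω * w (g a') ω * w ∅ ω) +
        Ex P (fun ω => w F ω * w ∅ ω * w ∅ ω)) := by
    simp_rw [← Ex_sub, ← Ex_add, ← Ex_const_mul, ← Ex_sum]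
    congr! 2 with ω
    rw [← sum_sub_distrib, sq, sum_mul_sum, mul_sum]
    refine sum_congr rfl fun a _ => (mul_sum _ _ _).trans (sum_congr rfl fun a' _ => ?_)
    simp only [w, prod_empty]
    ring
  have hb3 : (0 : ℝ) ≤ b ^ (3 * H) := by positivity
  have hM : 0 ≤ M := sum_nonneg hm
  calc _ ≤ ∑ a ∈ B, ∑ a' ∈ B, m a * m a' * (4 * ε + b ^ (3 * H) *
          (2 * (if Disjoint F (g a) then 0 else 1) + 2 * (if Disjoint F (g a') then 0 else 1)
            + if Disjoint (g a) (g a') then 0 else 1)) := by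
        rw [hE]
        refine sum_le_sum fun a ha => sum_le_sum fun a' ha' =>
          mul_le_mul_of_nonneg_left ?_ (mul_nonneg (hm a ha) (hm a' ha'))
        have key {G K : Finset α} (hG : G ⊆ V) (hK : K ⊆ V) (hGc : G.card ≤ H)
          (hKc : K.card ≤ H) := abs_le.1 <|
            abs_Ex_prod_three_sub_one_le hI hb hε hF hG hK hFc hGc hKc
        have h1 := (key (hg a ha) (hg a' ha') (hgc a ha) (hgc a' ha')).2
        have h2 := (key (hg a ha) (empty_subset _) (hgc a ha) (Nat.zero_le _)).1
        have h3 := (key (hg a' ha') (empty_subset _) (hgc a' ha') (Nat.zero_le _)).1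
        have h4 := (key (empty_subset _) (empty_subset _) (Nat.zero_le _) (Nat.zero_le _)).2
        simp only [disjoint_empty_right, disjoint_empty_left, if_true] at h2 h3 h4
        linarith
    _ = 4 * ε * M ^ 2 + b ^ (3 * H) *
          (4 * S * M + ∑ a ∈ B, m a * ∑ a' ∈ B, if Disjoint (g a) (g a') then 0 else m a') := by
        have h (a) : (if Disjoint F (g a) then 0 else m a) =
          m a * if Disjoint F (g a) then 0 else 1 := by simp
        have h' (a a') : (if Disjoint (g a) (g a') then 0 else m a') =
          m a' * if Disjoint (g a) (g a') then 0 else 1 := by simp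
        rw [show 4 * S * M = 2 * (S * M) + 2 * (M * S) by ring]
        simp_rw [S, M, h, h', sq, sum_mul_sum, mul_sum, ← sum_add_distrib, mul_sum,
          ← sum_add_distrib]
        refine sum_congr rfl fun a _ => sum_congr rfl fun a' _ => ?_
        ring
    _ ≤ 4 * ε * M ^ 2 + b ^ (3 * H) * (4 * l * M + ∑ a ∈ B, m a * k) := by
        gcongr with a ha
        exacts [hm a ha, hk a ha]
    _ = _ := by rw [← sum_mul]; ring

/-- Weighted variance of the degree of `q`. -/
lemma Ex_degree_variance_le (hI : NearIndep P W V H b ε) (hb : 1 ≤ b) (hε : 0 ≤ ε)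
    {ι : Type*} (A : Finset ι) (m : ι → ℝ) (hm : ∀ a ∈ A, 0 ≤ m a) (g : ι → Finset α) (q : α)
    (hq : ∀ a ∈ A, q ∈ g a) (hg : ∀ a ∈ A, g a ⊆ V) (hgc : ∀ a ∈ A, (g a).card ≤ H)
    (k : ℝ) (hk : ∀ a ∈ A, ∑ a' ∈ A, (if Disjoint (g a) ((g a').erase q) then 0 else m a') ≤ k) :
    Ex P (fun ω => W ω q * (∑ a ∈ A, m a * ∏ r ∈ (g a).erase q, W ω r - ∑ a ∈ A, m a) ^ 2)
      ≤ 4 * ε * (∑ a ∈ A, m a) ^ 2 + b ^ (3 * H) * k * ∑ a ∈ A, m a := by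
  rcases A.eq_empty_or_nonempty with rfl | ⟨a, ha⟩
  · simp [Ex]
  have := Ex_sq_deviation_le hI hb hε hm (g := fun a => (g a).erase q) (F := {q}) (l := 0)
    (fun a ha => (erase_subset _ _).trans (hg a ha))
    (fun a ha => card_erase_le.trans (hgc a ha)) (singleton_subset_iff.2 (hg a ha (hq a ha)))
    ((card_pos.2 ⟨q, hq a ha⟩).trans_le (hgc a ha)) (by simp)
    (fun a ha => by simpa only [← disjoint_erase_comm, erase_idem] using hk a ha)
  simpa using this

/-- Weighted variance of the total mass at a vertex `p`, seen from a fixed edge family `A`. -/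
lemma Ex_mass_variance_le (hI : NearIndep P W V H b ε) (hb : 1 ≤ b) (hε : 0 ≤ ε)
    {ι : Type*} (A B : Finset ι) (hAB : A ⊆ B) (m : ι → ℝ) (hm : ∀ a ∈ B, 0 ≤ m a)
    (hm1 : ∑ a ∈ B, m a ≤ 1)
    (g : ι → Finset α) (hg : ∀ a ∈ B, g a ⊆ V) (hgc : ∀ a ∈ B, (g a).card ≤ H)
    (k : ℝ) (hk0 : 0 ≤ k)
    (hk : ∀ a ∈ B, ∑ a' ∈ B, (if Disjoint (g a) (g a') then 0 else m a') ≤ k) :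
    Ex P (fun ω => (∑ a ∈ A, m a * ∏ r ∈ g a, W ω r) *
        (∑ a ∈ B, m a * ∏ r ∈ g a, W ω r - ∑ a ∈ B, m a) ^ 2)
      ≤ (4 * ε + 5 * b ^ (3 * H) * k) * ∑ a ∈ A, m a := by
  simp_rw [sum_mul, mul_assoc, Ex_sum, Ex_const_mul, mul_sum]
  refine sum_le_sum fun a ha => (mul_le_mul_of_nonneg_left ?_ (hm a (hAB ha))).trans_eq
    (mul_comm _ _)
  have h := Ex_sq_deviation_le hI hb hε hm hg hgc (hg a (hAB ha)) (hgc a (hAB ha))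
    (hk a (hAB ha)) hk
  have hM := sum_nonneg hm
  refine h.trans ((add_le_add (mul_le_of_le_one_right (by positivity) (pow_le_one₀ hM hm1))
    (mul_le_of_le_one_right (by positivity) hm1)).trans_eq (by ring))

end Moments

section Stage
variable {ι ν α : Type} [Fintype ι] [Fintype ν] [DecidableEq α]

/-- The set covered by an optional choice of edge. -/
def stageEdge (e : ι → ν → Finset α) (p : ι) (c : Option ν) : Finset α := c.elim ∅ (e p)

/-- Total reweighted mass at `p`. -/
noncomputable def stageMass (m : ι → ν → ℝ) (e : ι → ν → Finset α) (W : α → ℝ) (p : ι) : ℝ :=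
  ∑ n, m p n * ∏ r ∈ e p n, W r

open Classical in
/-- The reweighted probability of choosing an edge. -/
noncomputable def stageWeight (m : ι → ν → ℝ) (e : ι → ν → Finset α) (η : ℝ) (W : α → ℝ) (p : ι)
    (n : ν) : ℝ :=
  if stageMass m e W p ≤ 1 + η then m p n * (∏ r ∈ e p n, W r) / (1 + η) else 0

/-- The reweighted choice, completed by the empty choice. -/
noncomputable def stageProb (m : ι → ν → ℝ) (e : ι → ν → Finset α) (η : ℝ) (W : α → ℝ) (p : ι)
    (c : Option ν) : ℝ :=
  c.elim (1 - ∑ n, stageWeight m e η W p n) (stageWeight m e η W p)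

/-- Expected number of times `q` is covered. -/
noncomputable def stageDeg (m : ι → ν → ℝ) (e : ι → ν → Finset α) (η : ℝ) (W : α → ℝ) (q : α) : ℝ :=
  ∑ p, ∑ c, (if q ∈ stageEdge e p c then stageProb m e η W p c else 0)

variable {m : ι → ν → ℝ} {e : ι → ν → Finset α} {η : ℝ} {W : α → ℝ} {b : ℝ} {H : ℕ}

lemma stageWeight_nonneg (hm : ∀ p n, 0 ≤ m p n) (hη : 0 ≤ η) (hW : ∀ q, 0 ≤ W q) (p : ι) (n : ν) :
    0 ≤ stageWeight m e η W p n := by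
  unfold stageWeight
  split_ifs
  · exact div_nonneg (mul_nonneg (hm p n) (prod_nonneg fun q _ => hW q)) (by linarith)
  · exact le_rfl

lemma sum_stageWeight_le_one (hη : 0 ≤ η) (p : ι) :
    ∑ n, stageWeight m e η W p n ≤ 1 := by
  unfold stageWeight
  split_ifs with h
  · rw [← sum_div, div_le_one (by linarith)]
    exact h
  · simp

lemma stageProb_nonneg (hm : ∀ p n, 0 ≤ m p n) (hη : 0 ≤ η) (hW : ∀ q, 0 ≤ W q) (p : ι)
    (c : Option ν) : 0 ≤ stageProb m e η W p c := by
  cases c with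
  | none => exact sub_nonneg.mpr (sum_stageWeight_le_one hη p)
  | some n => exact stageWeight_nonneg hm hη hW p n

lemma sum_stageProb (p : ι) : ∑ c, stageProb m e η W p c = 1 := by
  rw [Fintype.sum_option]
  simp [stageProb]

lemma sum_stageProb_edge (p : ι) (q : α) :
    ∑ c, (if q ∈ stageEdge e p c then stageProb m e η W p c else 0)
      = ∑ n, (if q ∈ e p n then stageWeight m e η W p n else 0) := by
  rw [Fintype.sum_option]
  simp only [stageProb, stageEdge, Option.elim_none, notMem_empty, if_false, Option.elim_some,
    zero_add]
  exact sum_congr rfl fun n _ => by congr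

lemma sum_stageProb_edge_le (hm : ∀ p n, 0 ≤ m p n) (hη : 0 ≤ η) (hW : ∀ q, 0 ≤ W q)
    (hWb : ∀ q, W q ≤ b) (hb : 1 ≤ b) (hec : ∀ p n, (e p n).card ≤ H) {κ : ℝ} (p : ι) (q : α)
    (hκ : ∑ n, (if q ∈ e p n then m p n else 0) ≤ κ) :
    ∑ c, (if q ∈ stageEdge e p c then stageProb m e η W p c else 0) ≤ κ * b ^ H := by
  have hbH : (0 : ℝ) ≤ b ^ H := by positivity
  rw [sum_stageProb_edge]
  refine le_trans ?_ (mul_le_mul_of_nonneg_right hκ hbH)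
  rw [sum_mul]
  refine sum_le_sum fun n _ => ?_
  split_ifs with h
  · have h1 : ∏ r ∈ e p n, W r ≤ b ^ H := by
      calc ∏ r ∈ e p n, W r ≤ ∏ r ∈ e p n, b := prod_le_prod (fun q _ => hW q) fun q _ => hWb q
        _ = b ^ (e p n).card := prod_const b
        _ ≤ b ^ H := pow_le_pow_right₀ hb (hec p n)
    have h2 : 0 ≤ m p n * ∏ r ∈ e p n, W r := mul_nonneg (hm p n) (prod_nonneg fun q _ => hW q)
    unfold stageWeight
    split_ifs
    · calc _ ≤ m p n * ∏ r ∈ e p n, W r := div_le_self h2 (by linarith)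
        _ ≤ _ := mul_le_mul_of_nonneg_left h1 (hm p n)
    · exact mul_nonneg (hm p n) hbH
  · simp

open Classical in
/-- If the degree is irregular then one of the two second-moment quantities is large. -/
lemma one_le_of_irregular (hm : ∀ p n, 0 ≤ m p n) (hη : 0 < η) (hη1 : η ≤ 1) (hW : ∀ q, 0 ≤ W q)
    {q : α} (hWq : W q = b) (hb : 0 < b) {d t D1 : ℝ} (hd : 0 < d)
    (ht : t * (1 + η) ≤ b * d * (1 - 2 * η)) (hD1 : 2 * b * d ≤ D1)
    (hreg : ¬(t ≤ stageDeg m e η W q ∧ stageDeg m e η W q ≤ D1)) :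
    1 ≤ (∑ p, ∑ n, (if q ∈ e p n then m p n * ∏ r ∈ (e p n).erase q, W r else 0) - d) ^ 2 / (η * d) ^ 2
      + (∑ p, ∑ n, (if q ∈ e p n ∧ 1 + η < stageMass m e W p then
          m p n * ∏ r ∈ (e p n).erase q, W r else 0)) / (η * d) := by
  set Y := ∑ p, ∑ n, (if q ∈ e p n then m p n * ∏ r ∈ (e p n).erase q, W r else 0) with hY
  set Z := ∑ p, ∑ n, (if q ∈ e p n ∧ 1 + η < stageMass m e W p then
          m p n * ∏ r ∈ (e p n).erase q, W r else 0) with hZ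
  have hZ0 : 0 ≤ Z := sum_nonneg fun p _ => sum_nonneg fun n _ => by
    split_ifs
    · exact mul_nonneg (hm p n) (prod_nonneg fun q _ => hW q)
    · exact le_rfl
  have hdeg : stageDeg m e η W q = b * (Y - Z) / (1 + η) := by
    rw [stageDeg, hY, hZ, ← sum_sub_distrib, mul_sum, sum_div]
    refine sum_congr rfl fun p _ => ?_
    rw [sum_stageProb_edge, ← sum_sub_distrib, mul_sum, sum_div]
    refine sum_congr rfl fun n _ => ?_
    by_cases h : q ∈ e p n
    · rw [if_pos h, if_pos h, stageWeight, ← mul_prod_erase _ _ h, hWq]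
      by_cases h2 : stageMass m e W p ≤ 1 + η
      · rw [if_pos h2, if_neg (fun h' => absurd h'.2 (not_lt.mpr h2))]; ring
      · rw [if_neg h2, if_pos ⟨h, not_le.mp h2⟩]; simp
    · simp [h]
  have hηd : 0 < η * d := mul_pos hη hd
  by_contra! hlt
  have hA : (Y - d) ^ 2 / (η * d) ^ 2 < 1 := by
    have := div_nonneg hZ0 hηd.le; linarith
  have hB : Z / (η * d) < 1 := by
    have := div_nonneg (sq_nonneg (Y - d)) (sq_nonneg (η * d)); linarith
  rw [div_lt_one (by positivity)] at hA hB
  have hA' := abs_lt_of_sq_lt_sq hA hηd.le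
  rw [abs_lt] at hA'
  refine hreg ⟨?_, ?_⟩
  · rw [hdeg, le_div_iff₀ (by linarith)]
    refine ht.trans ?_
    rw [mul_assoc]
    refine mul_le_mul_of_nonneg_left ?_ hb.le
    linarith
  · rw [hdeg, div_le_iff₀ (by linarith)]
    have h1 : Y - Z ≤ 2 * d := by nlinarith
    have h2 := mul_le_mul_of_nonneg_left h1 hb.le
    have h3 : 0 ≤ 2 * b * d := by positivity
    nlinarith

end Stage

/-- A weighted random set `U ⊆ V`, satisfying `R` pointwise, with weights `W` of nearly independent
behaviour, equal to `b` on `U` outside an exceptional set `J` of expected size at most `B`. -/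
def NState {α : Type} [DecidableEq α] (V : Finset α) (H : ℕ) (b ε B : ℝ)
    (R : Finset α → Prop) : Prop :=
  ∃ (Ω : Type) (_ : Fintype Ω) (P : Ω → ℝ) (W : Ω → α → ℝ) (U J : Ω → Finset α),
    NearIndep P W V H b ε ∧ (∀ ω, ∀ q ∈ U ω, q ∉ J ω → W ω q = b) ∧
    Ex P (fun ω => ((J ω).card : ℝ)) ≤ B ∧ ∀ ω, U ω ⊆ V ∧ R (U ω)

section Stage
variable {ι ν α : Type} [Fintype ι] [Fintype ν] [DecidableEq α]
variable {m : ι → ν → ℝ} {e : ι → ν → Finset α} {η b ε κ : ℝ} {H : ℕ} {V : Finset α}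
variable {Ω : Type} [Fintype Ω] {P : Ω → ℝ} {W : Ω → α → ℝ}

/-- Edge weights `m` of total mass at most one and edges `e` in `V` of size at most `H`, such that
all codegrees are at most `κ` and no pair of points is contained in edges of two vertices. -/
structure EdgeSystem (m : ι → ν → ℝ) (e : ι → ν → Finset α) (V : Finset α) (H : ℕ) (κ : ℝ) :
    Prop where
  nonneg : ∀ p n, 0 ≤ m p n
  sum_le : ∀ p, ∑ n, m p n ≤ 1
  subset : ∀ p n, e p n ⊆ V
  card_le : ∀ p n, (e p n).card ≤ H
  one_le : 1 ≤ H
  bound_nonneg : 0 ≤ κ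
  codeg_le : ∀ p, ∀ q ∈ V, ∑ n, (if q ∈ e p n then m p n else 0) ≤ κ
  pair : ∀ q q', q ≠ q' → ∀ p p', (∃ n, q ∈ e p n ∧ q' ∈ e p n) →
    (∃ n, q ∈ e p' n ∧ q' ∈ e p' n) → p = p'

lemma Ex_degree_term_le (hI : NearIndep P W V H b ε) (hb : 1 ≤ b) (hε : 0 ≤ ε)
    (hE : EdgeSystem m e V H κ)
    (q : α) (d : ℝ) (hd : d = ∑ p, ∑ n, (if q ∈ e p n then m p n else 0)) :
    Ex P (fun ω => W ω q *
      (∑ p, ∑ n, (if q ∈ e p n then m p n * ∏ r ∈ (e p n).erase q, W ω r else 0) - d) ^ 2)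
      ≤ 4 * ε * d ^ 2 + b ^ (3 * H) * κ * d := by
  have ⟨hP, hP1, hW, hWb, hM⟩ := hI
  have ⟨hm, hm1, heV, hec, hH, hκ0, hκ, hpair⟩ := hE
  classical
  set A : Finset (ι × ν) := univ.filter (fun a => q ∈ e a.1 a.2) with hA
  have hconv : ∀ F : ι → ν → ℝ, ∑ p, ∑ n, (if q ∈ e p n then F p n else 0)
      = ∑ a ∈ A, F a.1 a.2 := fun F => by
    rw [hA, sum_filter, ← univ_product_univ, sum_product]
  have hqA : ∀ a ∈ A, q ∈ e a.1 a.2 := fun a ha => (mem_filter.mp ha).2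
  have h := Ex_degree_variance_le hI hb hε A (fun a => m a.1 a.2)
    (fun a _ => hm _ _) (fun a => e a.1 a.2) q hqA
    (fun a _ => heV _ _) (fun a _ => hec _ _) κ ?_
  · simp_rw [hconv] at hd ⊢
    rw [hd]; exact h
  · rintro ⟨p, n⟩ ha
    have hqa := hqA _ ha
    refine le_trans ?_ (hκ p q (heV p n hqa))
    rw [hA, sum_filter, ← univ_product_univ, sum_product, sum_eq_single p]
    · refine sum_le_sum fun n' _ => ?_
      split_ifs <;> first | exact le_rfl | exact hm _ _
    · intro p' _ hp'
      refine sum_eq_zero fun n' _ => ?_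
      split_ifs with h1 h2
      · rfl
      · exfalso
        rw [not_disjoint_iff] at h2
        obtain ⟨r, hr1, hr2⟩ := h2
        rw [mem_erase] at hr2
        exact hp' (hpair q r (Ne.symm hr2.1) p' p ⟨n', h1, hr2.2⟩ ⟨n, hqa, hr1⟩)
      · rfl
    · simp

lemma Ex_mass_term_le (hI : NearIndep P W V H b ε) (hb : 1 ≤ b) (hε : 0 ≤ ε)
    (hE : EdgeSystem m e V H κ) (hη : 0 < η)
    (q : α) (d : ℝ) (hd : d = ∑ p, ∑ n, (if q ∈ e p n then m p n else 0)) :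
    Ex P (fun ω => W ω q * ∑ p, ∑ n, (if q ∈ e p n ∧ 1 + η < stageMass m e (W ω) p then
          m p n * ∏ r ∈ (e p n).erase q, W ω r else 0))
      ≤ (4 * ε + 5 * b ^ (3 * H) * (H * κ)) / η ^ 2 * d := by
  have ⟨hP, hP1, hW, hWb, hM⟩ := hI
  have ⟨hm, hm1, heV, hec, hH, hκ0, hκ, hpair⟩ := hE
  classical
  set A : ι → Finset ν := fun p => univ.filter (fun n => q ∈ e p n) with hA
  have hconv : ∀ p, ∀ F : ν → ℝ, ∑ n, (if q ∈ e p n then F n else 0)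
      = ∑ a ∈ A p, F a := fun p F => by
    rw [hA]; exact (sum_filter _ _).symm
  have hp : ∀ p, Ex P (fun ω => (∑ a ∈ A p, m p a * ∏ r ∈ e p a, W ω r) *
        (stageMass m e (W ω) p - ∑ a, m p a) ^ 2)
      ≤ (4 * ε + 5 * b ^ (3 * H) * (H * κ)) * ∑ a ∈ A p, m p a := fun p => by
    refine Ex_mass_variance_le hI hb hε (A p) univ (subset_univ _) (m p)
      (fun a _ => hm _ _) (hm1 p) (e p) (fun a _ => heV _ _) (fun a _ => hec _ _) (H * κ)
      (by positivity) ?_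
    intro n _
    calc ∑ n', (if Disjoint (e p n) (e p n') then 0 else m p n')
        ≤ ∑ n', ∑ r ∈ e p n, (if r ∈ e p n' then m p n' else 0) := by
          refine sum_le_sum fun n' _ => ?_
          have h0 : ∀ r ∈ e p n, 0 ≤ (if r ∈ e p n' then m p n' else 0) := fun r _ => by
            split_ifs <;> first | exact le_rfl | exact hm _ _
          split_ifs with h
          · exact sum_nonneg h0
          · rw [not_disjoint_iff] at h
            obtain ⟨r, hr1, hr2⟩ := h
            refine le_trans ?_ (single_le_sum h0 hr1)
            rw [if_pos hr2]
      _ = ∑ r ∈ e p n, ∑ n', (if r ∈ e p n' then m p n' else 0) := sum_comm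
      _ ≤ ∑ r ∈ e p n, κ := sum_le_sum fun r hr => hκ p r (heV p n hr)
      _ ≤ H * κ := by
          rw [sum_const, nsmul_eq_mul]
          exact mul_le_mul_of_nonneg_right (by exact_mod_cast hec p n) hκ0
  have hη2 : (0 : ℝ) < η ^ 2 := by positivity
  calc _ ≤ Ex P (fun ω => ∑ p, (1 / η ^ 2) * ((∑ a ∈ A p, m p a * ∏ r ∈ e p a, W ω r) *
        (stageMass m e (W ω) p - ∑ a, m p a) ^ 2)) := by
        refine Ex_mono hP fun ω => ?_
        rw [mul_sum]
        refine sum_le_sum fun p _ => ?_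
        have hS0 : 0 ≤ ∑ a ∈ A p, m p a * ∏ r ∈ e p a, W ω r :=
          sum_nonneg fun a _ => mul_nonneg (hm _ _) (prod_nonneg fun r _ => hW ω r)
        by_cases h : 1 + η < stageMass m e (W ω) p
        · have h1 : W ω q * ∑ n, (if q ∈ e p n ∧ 1 + η < stageMass m e (W ω) p then
              m p n * ∏ r ∈ (e p n).erase q, W ω r else 0)
              = ∑ a ∈ A p, m p a * ∏ r ∈ e p a, W ω r := by
            rw [mul_sum, ← hconv p]
            refine sum_congr rfl fun n _ => ?_
            by_cases hq : q ∈ e p n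
            · rw [if_pos ⟨hq, h⟩, if_pos hq, ← mul_prod_erase _ _ hq]; ring
            · rw [if_neg (fun h' => hq h'.1), if_neg hq, mul_zero]
          rw [h1]
          have h2 : η ^ 2 ≤ (stageMass m e (W ω) p - ∑ a, m p a) ^ 2 := by
            refine pow_le_pow_left₀ hη.le ?_ 2
            linarith [hm1 p]
          have h3 : 1 ≤ 1 / η ^ 2 * (stageMass m e (W ω) p - ∑ a, m p a) ^ 2 := by
            rw [one_div_mul_eq_div, one_le_div hη2]; exact h2
          calc _ ≤ _ := le_mul_of_one_le_right hS0 h3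
            _ = _ := by ring
        · have h1 : ∑ n, (if q ∈ e p n ∧ 1 + η < stageMass m e (W ω) p then
              m p n * ∏ r ∈ (e p n).erase q, W ω r else 0) = 0 :=
            sum_eq_zero fun n _ => if_neg fun h' => h h'.2
          rw [h1, mul_zero]; positivity
    _ = ∑ p, (1 / η ^ 2) * Ex P (fun ω => ((∑ a ∈ A p, m p a * ∏ r ∈ e p a, W ω r) *
        (stageMass m e (W ω) p - ∑ a, m p a) ^ 2)) := by
        rw [Ex_sum]; simp_rw [Ex_const_mul]
    _ ≤ ∑ p, (1 / η ^ 2) * ((4 * ε + 5 * b ^ (3 * H) * (H * κ)) * ∑ a ∈ A p, m p a) :=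
        sum_le_sum fun p _ => mul_le_mul_of_nonneg_left (hp p) (by positivity)
    _ = _ := by
        rw [← mul_sum, ← mul_sum, hd]
        simp_rw [hconv]
        ring

open Classical in
/-- An uncovered vertex outside `J` is unlikely to have irregular degree. -/
lemma Ex_irregular_le (hI : NearIndep P W V H b ε) (hb : 1 ≤ b) (hε : 0 ≤ ε)
    (hE : EdgeSystem m e V H κ) (hη : 0 < η) (hη1 : η ≤ 1)
    (q : α) {d t D1 τ : ℝ} (hd : d = ∑ p, ∑ n, (if q ∈ e p n then m p n else 0))
    (hτ : 0 < τ) (hτd : τ ≤ d) (ht : t * (1 + η) ≤ b * τ * (1 - 2 * η)) (hη2 : η ≤ 1 / 2)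
    (hD1 : 2 * b * d ≤ D1) :
    Ex P (fun ω => if W ω q = b ∧ ¬(t ≤ stageDeg m e η (W ω) q ∧ stageDeg m e η (W ω) q ≤ D1)
      then 1 else 0) ≤ 1 / b * ((8 * ε + (1 / τ + 5) * b ^ (3 * H) * (H * κ)) / η ^ 3) := by
  have ⟨hP, hP1, hW, hWb, hM⟩ := hI
  have ⟨hm, hm1, heV, hec, hH, hκ0, hκ, hpair⟩ := hE
  have hd0 : 0 < d := hτ.trans_le hτd
  have hb0 : 0 < b := by linarith
  have hH1 : (1 : ℝ) ≤ H := by exact_mod_cast hH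
  have ht' : t * (1 + η) ≤ b * d * (1 - 2 * η) :=
    ht.trans (mul_le_mul_of_nonneg_right (mul_le_mul_of_nonneg_left hτd hb0.le) (by linarith))
  have h1 := Ex_degree_term_le hI hb hε hE q d hd
  have h2 := Ex_mass_term_le hI hb hε hE hη q d hd
  set F1 : Ω → ℝ := fun ω => W ω q *
      (∑ p, ∑ n, (if q ∈ e p n then m p n * ∏ r ∈ (e p n).erase q, W ω r else 0) - d) ^ 2
  set F2 : Ω → ℝ := fun ω => W ω q * ∑ p, ∑ n, (if q ∈ e p n ∧ 1 + η < stageMass m e (W ω) p then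
          m p n * ∏ r ∈ (e p n).erase q, W ω r else 0)
  have hF2 : ∀ ω, 0 ≤ F2 ω := fun ω => mul_nonneg (hW ω q) <| sum_nonneg fun p _ =>
    sum_nonneg fun n _ => by
      split_ifs
      · exact mul_nonneg (hm p n) (prod_nonneg fun q _ => hW ω q)
      · exact le_rfl
  have hF1 : ∀ ω, 0 ≤ F1 ω := fun ω => mul_nonneg (hW ω q) (sq_nonneg _)
  calc _ ≤ Ex P (fun ω => (1 / b * (1 / (η * d) ^ 2)) * F1 ω + (1 / b * (1 / (η * d))) * F2 ω) := by
        refine Ex_mono hP fun ω => ?_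
        split_ifs with h
        · have := one_le_of_irregular hm hη hη1 (hW ω) h.1 hb0 hd0 ht' hD1 h.2
          calc (1 : ℝ) ≤ _ := this
            _ = _ := by
              simp only [F1, F2, h.1]
              field_simp
        · have := hF1 ω; have := hF2 ω
          positivity
    _ = (1 / b * (1 / (η * d) ^ 2)) * Ex P F1 + (1 / b * (1 / (η * d))) * Ex P F2 := by
        rw [Ex_add, Ex_const_mul, Ex_const_mul]
    _ ≤ (1 / b * (1 / (η * d) ^ 2)) * (4 * ε * d ^ 2 + b ^ (3 * H) * κ * d) +
        (1 / b * (1 / (η * d))) * ((4 * ε + 5 * b ^ (3 * H) * (H * κ)) / η ^ 2 * d) := by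
        gcongr
    _ = 1 / b * ((4 * ε * η + b ^ (3 * H) * (1 * κ) * (1 / d) * η + (4 * ε + 5 * b ^ (3 * H) * (H * κ)))
          / η ^ 3) := by
        field_simp
    _ ≤ 1 / b * ((4 * ε * 1 + b ^ (3 * H) * (H * κ) * (1 / τ) * 1 +
          (4 * ε + 5 * b ^ (3 * H) * (H * κ))) / η ^ 3) := by
        gcongr
    _ = _ := by ring

end Stage

/-- One step of the nibble. -/
lemma NState.step {ι ν α : Type} [Fintype ι] [Fintype ν] [DecidableEq α]
    {m : ι → ν → ℝ} {e : ι → ν → Finset α} {η b ε κ B : ℝ} {H : ℕ} {V : Finset α}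
    {R : Finset α → Prop} (hS : NState V H b ε B R)
    (hb : 1 ≤ b) (hε : 0 ≤ ε) (hε1 : ε ≤ 1)
    (hE : EdgeSystem m e V H κ) (hη : 0 < η)
    (hη2 : η ≤ 1 / 2)
    {t D τ ρ : ℝ} (hτ : 0 < τ) (hτd : ∀ q ∈ V, τ ≤ ∑ p, ∑ n, (if q ∈ e p n then m p n else 0))
    (hdD : ∀ q ∈ V, ∑ p, ∑ n, (if q ∈ e p n then m p n else 0) ≤ D) (hD : 0 ≤ D)
    (ht : t * (1 + η) ≤ b * τ * (1 - 2 * η)) (hρ : 0 < ρ) (hρ1 : ρ < 1) (htρ : exp (-t) ≤ ρ) :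
    NState V H (b / ρ)
      (ε + 2 * ((3 * H) ^ 2 * (κ * b ^ H) * (2 * b * D + 3 * H) / ρ ^ (3 * H)))
      (B + V.card * (1 / b * ((8 * ε + (1 / τ + 5) * b ^ (3 * H) * (H * κ)) / η ^ 3)))
      (fun U' => ∃ U, ∃ c : ι → Option ν, R U ∧ (∀ q ∈ U, (∀ p, q ∉ stageEdge e p (c p)) → q ∈ U')) := by
  classical
  obtain ⟨Ω, _, P, W, U, J, hN, hUJ, hJ, hU⟩ := hS
  have ⟨hP, hP1, hW, hWb, hM⟩ := hN
  have ⟨hm, hm1, heV, hec, hH, hκ0, hκ, hpair⟩ := hE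
  have hη1 : η ≤ 1 := by linarith
  have hb0 : 0 < b := by linarith
  set D1 := 2 * b * D with hD1
  have hD10 : 0 ≤ D1 := by positivity
  set Rg : Ω → α → Prop := fun ω q => t ≤ stageDeg m e η (W ω) q ∧ stageDeg m e η (W ω) q ≤ D1
  set f : Ω → α → ℝ := fun ω q =>
    ∏ p, (1 - ∑ c, (if q ∈ stageEdge e p c then stageProb m e η (W ω) p c else 0)) with hf
  set W' : Ω × (ι → Option ν) → α → ℝ := fun x q => if Rg x.1 q then
        W x.1 q * ((ρ - f x.1 q) / (1 - f x.1 q) + (1 - (ρ - f x.1 q) / (1 - f x.1 q)) *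
          (if ∀ p, q ∉ stageEdge e p (x.2 p) then 1 else 0)) / ρ else W x.1 q with hW'
  set P' : Ω × (ι → Option ν) → ℝ := fun x => P x.1 * ∏ p, stageProb m e η (W x.1) p (x.2 p) with hP'
  set U' : Ω × (ι → Option ν) → Finset α := fun x =>
    (U x.1).filter (fun q => ∀ p, q ∉ stageEdge e p (x.2 p))
  set I : Ω → Finset α := fun ω => V.filter (fun q => W ω q = b ∧ ¬ Rg ω q) with hI
  have hprob : ∀ ω, ∑ c : ι → Option ν, ∏ p, stageProb m e η (W ω) p (c p) = 1 := fun ω => by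
    rw [← Fintype.prod_sum]
    exact prod_eq_one fun p _ => sum_stageProb p
  have hprob0 : ∀ ω, ∀ c : ι → Option ν, 0 ≤ ∏ p, stageProb m e η (W ω) p (c p) := fun ω c =>
    prod_nonneg fun p _ => stageProb_nonneg hm hη.le (hW ω) p (c p)
  have hEx1 : ∀ F : Ω → ℝ, Ex P' (fun x => F x.1) = Ex P F := fun F => by
    rw [Ex, Ex, Fintype.sum_prod_type]
    refine sum_congr rfl fun ω _ => ?_
    have : ∀ c : ι → Option ν, P' (ω, c) * F ω
        = P ω * F ω * ∏ p, stageProb m e η (W ω) p (c p) := fun c => by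
      simp only [hP']; ring
    simp_rw [this]
    rw [← mul_sum, hprob, mul_one]
  have hf1 : ∀ ω q, Rg ω q → f ω q ≤ ρ := fun ω q h => by
    refine le_trans ?_ htρ
    have h1 : ∀ p, ∑ c, (if q ∈ stageEdge e p c then stageProb m e η (W ω) p c else 0) ≤ 1 :=
      fun p => by
        rw [← sum_stageProb (m := m) (e := e) (η := η) (W := W ω) p]
        refine sum_le_sum fun c _ => ?_
        split_ifs
        · exact le_rfl
        · exact stageProb_nonneg hm hη.le (hW ω) p c
    calc f ω q ≤ ∏ p, exp (-∑ c, (if q ∈ stageEdge e p c then stageProb m e η (W ω) p c else 0)) := by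
          refine prod_le_prod (fun p _ => by linarith [h1 p]) fun p _ => ?_
          have := add_one_le_exp (-∑ c, (if q ∈ stageEdge e p c then stageProb m e η (W ω) p c else 0))
          linarith
      _ = exp (- stageDeg m e η (W ω) q) := by
          rw [← exp_sum, sum_neg_distrib, stageDeg]
      _ ≤ _ := exp_le_exp.mpr (by linarith [h.1])
  have hβ : ∀ ω q, Rg ω q → 0 ≤ (ρ - f ω q) / (1 - f ω q) ∧ (ρ - f ω q) / (1 - f ω q) ≤ 1 :=
    fun ω q h => by
      have := hf1 ω q h
      refine ⟨div_nonneg (by linarith) (by linarith), ?_⟩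
      rw [div_le_one (by linarith)]; linarith
  have hW'0 : ∀ x q, 0 ≤ W' x q := fun x q => by
    simp only [hW']
    split_ifs with h1 h2
    · obtain ⟨h3, h4⟩ := hβ _ _ h1
      exact div_nonneg (mul_nonneg (hW _ _) (by linarith)) hρ.le
    · obtain ⟨h3, h4⟩ := hβ _ _ h1
      exact div_nonneg (mul_nonneg (hW _ _) (by linarith)) hρ.le
    · exact hW _ _
  have hW'b : ∀ x q, W' x q ≤ b / ρ := fun x q => by
    simp only [hW']
    split_ifs with h1 h2
    · refine div_le_div_of_nonneg_right ?_ hρ.le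
      rw [mul_one, add_sub_cancel, mul_one]
      exact hWb _ _
    · refine div_le_div_of_nonneg_right ?_ hρ.le
      obtain ⟨h3, h4⟩ := hβ _ _ h1
      rw [mul_zero, add_zero]
      exact (mul_le_of_le_one_right (hW _ _) h4).trans (hWb _ _)
    · exact (hWb _ _).trans ((le_div_iff₀ hρ).mpr (mul_le_of_le_one_right hb0.le hρ1.le))
  have hκ' : 0 ≤ κ * b ^ H := by positivity
  refine ⟨Ω × (ι → Option ν), inferInstance, P', W', U', fun x => J x.1 ∪ I x.1,
    ⟨fun x => mul_nonneg (hP _) (hprob0 _ _), ?_, hW'0, hW'b, ?_⟩, ?_, ?_, ?_⟩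
  · have := hEx1 (fun _ => 1)
    simpa [Ex, hP1] using this
  · intro T hT hTc
    have hTR : (T.card : ℝ) ≤ 3 * H := by exact_mod_cast hTc
    set X := (3 * (H : ℝ)) ^ 2 * (κ * b ^ H) * (D1 + 3 * H) / ρ ^ (3 * H) with hX
    have hX0 : 0 ≤ X := by positivity
    have key : ∀ ω, |∑ c : ι → Option ν, (∏ p, stageProb m e η (W ω) p (c p)) * ∏ q ∈ T, W' (ω, c) q
        - ∏ q ∈ T, W ω q| ≤ (∏ q ∈ T, W ω q) * X := fun ω => by
      refine (abs_sum_prod_reweight_sub_le (fun p c => stageProb m e η (W ω) p c) (stageEdge e)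
        (fun p c => stageProb_nonneg hm hη.le (hW ω) p c) (fun p => sum_stageProb p) T (κ * b ^ H) D1
        hκ' hD10 (Rg ω) (W ω) (hW ω) ρ hρ hρ1 (f ω) (fun q => rfl) (fun q _ => hf1 ω q)
        (fun p q hq => sum_stageProb_edge_le hm hη.le (hW ω) (hWb ω) hb hec p q (hκ p q (hT hq)))
        (fun q _ h => h.2) ?_).trans ?_
      · intro q _ q' _ hne p p' h1 h2
        refine hpair q q' hne p p' ?_ ?_
        · obtain ⟨c, h⟩ := h1
          cases c with
          | none => simp [stageEdge] at h
          | some n => exact ⟨n, h⟩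
        · obtain ⟨c, h⟩ := h2
          cases c with
          | none => simp [stageEdge] at h
          | some n => exact ⟨n, h⟩
      · refine mul_le_mul_of_nonneg_left ?_ (prod_nonneg fun q _ => hW ω q)
        rw [hX]
        have : ρ ^ (3 * H) ≤ ρ ^ T.card := pow_le_pow_of_le_one hρ.le hρ1.le hTc
        gcongr
    have h1 : Ex P' (fun x => ∏ q ∈ T, W' x q)
        = Ex P (fun ω => ∑ c : ι → Option ν, (∏ p, stageProb m e η (W ω) p (c p)) *
            ∏ q ∈ T, W' (ω, c) q) := by
      rw [Ex, Ex, Fintype.sum_prod_type]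
      refine sum_congr rfl fun ω _ => ?_
      rw [mul_sum]
      exact sum_congr rfl fun c _ => by simp only [hP']; ring
    have h2 : |Ex P' (fun x => ∏ q ∈ T, W' x q) - Ex P (fun ω => ∏ q ∈ T, W ω q)| ≤
        Ex P (fun ω => (∏ q ∈ T, W ω q) * X) := by
      rw [h1, ← Ex_sub]
      refine (abs_sum_le_sum_abs _ _).trans (sum_le_sum fun ω _ => ?_)
      rw [abs_mul, abs_of_nonneg (hP ω)]
      exact mul_le_mul_of_nonneg_left (key ω) (hP ω)
    have h3 : Ex P (fun ω => (∏ q ∈ T, W ω q) * X) ≤ 2 * X := by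
      simp_rw [mul_comm _ X]
      rw [Ex_const_mul, mul_comm]
      refine (mul_le_mul_of_nonneg_right ?_ hX0).trans_eq (mul_comm 2 X)
      have := (abs_le.mp (hM T hT hTc)).2
      linarith
    have h4 := hM T hT hTc
    calc _ = |(Ex P' (fun x => ∏ q ∈ T, W' x q) - Ex P (fun ω => ∏ q ∈ T, W ω q)) +
            (Ex P (fun ω => ∏ q ∈ T, W ω q) - 1)| := by congr 1; ring
      _ ≤ _ := abs_add_le _ _
      _ ≤ 2 * X + ε := add_le_add (h2.trans h3) h4
      _ = _ := by rw [add_comm]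
  · intro x q hq hqJ
    rw [notMem_union] at hqJ
    have hq' := mem_filter.mp hq
    have hWq := hUJ x.1 q hq'.1 hqJ.1
    have hR : Rg x.1 q := by
      by_contra hR
      exact hqJ.2 (mem_filter.mpr ⟨(hU x.1).1 hq'.1, hWq, hR⟩)
    simp only [hW']
    rw [if_pos hR, if_pos hq'.2, hWq]
    ring
  · have h1 : ∀ x : Ω × (ι → Option ν), (((J x.1 ∪ I x.1).card : ℕ) : ℝ)
        ≤ ((J x.1).card : ℝ) + ((I x.1).card : ℝ) := fun x => by exact_mod_cast card_union_le _ _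
    refine (Ex_mono (fun x => mul_nonneg (hP _) (hprob0 _ _)) h1).trans ?_
    rw [Ex_add, hEx1 (fun ω => ((J ω).card : ℝ)), hEx1 (fun ω => ((I ω).card : ℝ))]
    refine add_le_add hJ ?_
    have h2 : ∀ ω, ((I ω).card : ℝ) = ∑ q ∈ V, (if W ω q = b ∧ ¬ Rg ω q then 1 else 0) := fun ω => by
      rw [hI, card_filter]; push_cast; rfl
    simp_rw [h2]
    rw [Ex_sum, ← nsmul_eq_mul]
    refine sum_le_card_nsmul _ _ _ fun q hq => ?_
    exact Ex_irregular_le hN hb hε hE hη hη1 q rfl hτ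
      (hτd q hq) ht hη2 (mul_le_mul_of_nonneg_left (hdD q hq) (by positivity))
  · refine fun x => ⟨(filter_subset _ _).trans (hU x.1).1, U x.1, x.2, (hU x.1).2, fun q hq h => ?_⟩
    exact mem_filter.mpr ⟨hq, h⟩

/-- Some realization of the set is small. -/
lemma NState.exists_small {α : Type} [DecidableEq α] {V : Finset α} {H : ℕ} {b ε B : ℝ}
    {R : Finset α → Prop} (hS : NState V H b ε B R) (hH : 1 ≤ H) (hb : 0 < b) :
    ∃ U, R U ∧ (U.card : ℝ) ≤ B + V.card * ((1 + ε) / b) := by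
  classical
  obtain ⟨Ω, _, P, W, U, J, hN, hUJ, hJ, hU⟩ := hS
  have ⟨hP, hP1, hW, hWb, hM⟩ := hN
  have h1 : ∀ ω, ((U ω).card : ℝ) ≤ ((J ω).card : ℝ) + ∑ q ∈ V, 1 / b * W ω q := fun ω => by
    have h2 : ((U ω).card : ℝ) ≤ ((J ω).card : ℝ) + ((U ω \ J ω).card : ℝ) := by
      rw [add_comm]
      exact_mod_cast card_le_card_sdiff_add_card
    have h3 : ((U ω \ J ω).card : ℝ) ≤ ∑ q ∈ V, 1 / b * W ω q := by
      calc ((U ω \ J ω).card : ℝ) = ∑ q ∈ U ω \ J ω, 1 / b * W ω q := by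
            rw [card_eq_sum_ones]; push_cast
            refine sum_congr rfl fun q hq => ?_
            rw [mem_sdiff] at hq
            rw [hUJ ω q hq.1 hq.2]; field_simp
        _ ≤ _ := sum_le_sum_of_subset_of_nonneg (sdiff_subset.trans (hU ω).1) fun q _ _ =>
            mul_nonneg (by positivity) (hW ω q)
    linarith
  have h2 : Ex P (fun ω => ((U ω).card : ℝ)) ≤ B + V.card * ((1 + ε) / b) := by
    refine (Ex_mono hP h1).trans ?_
    rw [Ex_add, Ex_sum, ← nsmul_eq_mul]
    refine add_le_add hJ (sum_le_card_nsmul _ _ _ fun q hq => ?_)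
    rw [Ex_const_mul, one_div_mul_eq_div]
    have := (abs_le.mp (hM {q} (singleton_subset_iff.mpr hq) (by simp; omega))).2
    simp only [prod_singleton] at this
    gcongr; linarith
  by_contra! hcon
  have hlt : ∀ ω, B + V.card * ((1 + ε) / b) < ((U ω).card : ℝ) := fun ω => hcon _ (hU ω).2
  have : Ex P (fun _ => B + V.card * ((1 + ε) / b)) < Ex P (fun ω => ((U ω).card : ℝ)) := by
    obtain ⟨ω0, -, h0⟩ : ∃ ω ∈ univ, (0 : ℝ) < P ω := by
      by_contra! h
      have := sum_nonpos h
      linarith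
    exact sum_lt_sum (fun ω _ => mul_le_mul_of_nonneg_left (hlt ω).le (hP ω))
      ⟨ω0, mem_univ _, mul_lt_mul_of_pos_left (hlt ω0) h0⟩
  rw [Ex_const hP1] at this
  linarith

lemma NState.mono {α : Type} [DecidableEq α] {V : Finset α} {H : ℕ} {b ε ε' B B' : ℝ}
    {R R' : Finset α → Prop} (hS : NState V H b ε B R) (hε : ε ≤ ε') (hB : B ≤ B')
    (hR : ∀ U, R U → R' U) : NState V H b ε' B' R' := by
  obtain ⟨Ω, i, P, W, U, J, hI, hUJ, hJ, hU⟩ := hS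
  exact ⟨Ω, i, P, W, U, J, { hI with moment := fun T h1 h2 => (hI.moment T h1 h2).trans hε }, hUJ, hJ.trans hB,
    fun ω => ⟨(hU ω).1, hR _ (hU ω).2⟩⟩

/-- Iterated nibble: disjoint batches `PP i` of vertices are used one after the other. -/
lemma NState.iterate {V : Finset ℕ} {H : ℕ} {b ε B : ℝ} {R : Finset ℕ → Prop}
    (hS : NState V H b ε B R) (m : ℕ → ℤ → ℝ) (e : ℕ → ℤ → Finset ℕ) (NN : Finset ℤ)
    (PP : ℕ → Finset ℕ) (Jn : ℕ) {η κ t D τ ρ bm εm : ℝ} (τs : ℕ → ℝ)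
    (hdisj : ∀ i j, i < j → j < Jn → Disjoint (PP i) (PP j))
    (hb : 1 ≤ b) (hε : 0 ≤ ε)
    (hm : ∀ i < Jn, ∀ p ∈ PP i, ∀ n ∈ NN, 0 ≤ m p n)
    (hm1 : ∀ i < Jn, ∀ p ∈ PP i, ∑ n ∈ NN, m p n ≤ 1)
    (heV : ∀ p n, e p n ⊆ V) (hec : ∀ i < Jn, ∀ p ∈ PP i, ∀ n, (e p n).card ≤ H) (hH : 1 ≤ H)
    (hκ0 : 0 ≤ κ)
    (hκ : ∀ i < Jn, ∀ p ∈ PP i, ∀ q ∈ V, ∑ n ∈ NN, (if q ∈ e p n then m p n else 0) ≤ κ)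
    (hη : 0 < η) (hη2 : η ≤ 1 / 2)
    (hpair : ∀ q q', q ≠ q' → ∀ i < Jn, ∀ p ∈ PP i, ∀ p' ∈ PP i, (∃ n, q ∈ e p n ∧ q' ∈ e p n) →
      (∃ n, q ∈ e p' n ∧ q' ∈ e p' n) → p = p')
    (hτ : 0 < τ) (hτs : ∀ i < Jn, τ ≤ τs i)
    (hτd : ∀ i < Jn, ∀ q ∈ V, τs i ≤ ∑ p ∈ PP i, ∑ n ∈ NN, (if q ∈ e p n then m p n else 0))
    (hdD : ∀ i < Jn, ∀ q ∈ V, ∑ p ∈ PP i, ∑ n ∈ NN, (if q ∈ e p n then m p n else 0) ≤ D)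
    (hD : 0 ≤ D)
    (ht : ∀ i < Jn, t * (1 + η) ≤ b / ρ ^ i * τs i * (1 - 2 * η)) (hρ : 0 < ρ) (hρ1 : ρ < 1)
    (htρ : exp (-t) ≤ ρ) (hbm : b / ρ ^ Jn ≤ bm)
    (hεm : ε + Jn * (2 * ((3 * H) ^ 2 * (κ * bm ^ H) * (2 * bm * D + 3 * H) / ρ ^ (3 * H))) ≤ εm)
    (hεm1 : εm ≤ 1) :
    ∃ U0, R U0 ∧ ∃ n : ℕ → ℤ,
      (((U0.filter (fun q => ∀ i < Jn, ∀ p ∈ PP i, q ∉ e p (n p))).card : ℕ) : ℝ) ≤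
        B + Jn * (V.card * ((8 * εm + (1 / τ + 5) * bm ^ (3 * H) * (H * κ)) / η ^ 3))
          + V.card * ((1 + εm) * ρ ^ Jn / b) := by
  classical
  set δ := 2 * ((3 * (H : ℝ)) ^ 2 * (κ * bm ^ H) * (2 * bm * D + 3 * H) / ρ ^ (3 * H)) with hδ
  set β := (V.card : ℝ) * ((8 * εm + (1 / τ + 5) * bm ^ (3 * H) * (H * κ)) / η ^ 3) with hβ
  have hb0 : 0 < b := by linarith
  have hbi : ∀ i, 1 ≤ b / ρ ^ i := fun i => by
    rw [le_div_iff₀ (by positivity), one_mul]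
    exact (pow_le_one₀ hρ.le hρ1.le).trans hb
  have hbm1 : 1 ≤ bm := (hbi Jn).trans hbm
  have hbile : ∀ i ≤ Jn, b / ρ ^ i ≤ bm := fun i hi => by
    refine le_trans ?_ hbm
    exact div_le_div_of_nonneg_left hb0.le (by positivity) (pow_le_pow_of_le_one hρ.le hρ1.le hi)
  have hδ0 : 0 ≤ δ := by positivity
  have hεi : ∀ i ≤ Jn, ε + i * δ ≤ εm := fun i hi => by
    refine le_trans ?_ hεm
    have : (i : ℝ) ≤ Jn := by exact_mod_cast hi
    gcongr
  have hεm0 : 0 ≤ εm := hε.trans ((by simpa using hεi 0 (Nat.zero_le _)))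
  have main : ∀ j ≤ Jn, NState V H (b / ρ ^ j) (ε + j * δ) (B + j * β) (fun U' => ∃ U0, R U0 ∧
      ∃ n : ℕ → ℤ, ∀ q ∈ U0, (∀ i < j, ∀ p ∈ PP i, q ∉ e p (n p)) → q ∈ U') := by
    intro j
    induction j with
    | zero =>
      intro _
      simpa using hS.mono le_rfl le_rfl (R' := fun U' => ∃ U0, R U0 ∧ ∀ q ∈ U0, q ∈ U')
          (fun U h => ⟨U, h, fun q hq => hq⟩)
    | succ j ih =>
      intro hj
      have hjJ : j < Jn := hj
      have hcs : ∀ (F : ℕ → ℤ → ℝ), ∑ p : PP j, ∑ n : NN, F p n = ∑ p ∈ PP j, ∑ n ∈ NN, F p n :=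
        fun F => by
          rw [← sum_coe_sort (PP j)]
          exact sum_congr rfl fun p _ => sum_coe_sort NN _
      have hcs1 : ∀ (F : ℤ → ℝ), ∑ n : NN, F n = ∑ n ∈ NN, F n := fun F => sum_coe_sort NN _
      have hε0 : 0 ≤ ε + j * δ := by positivity
      have hstep := (ih hjJ.le).step (ι := PP j) (ν := NN) (m := fun p n => m p n)
        (e := fun p n => e p n) (η := η) (κ := κ) (t := t) (D := D) (τ := τs j) (ρ := ρ) (hbi j)
        hε0 ((hεi j hjJ.le).trans hεm1)
        ⟨fun p n => hm j hjJ p p.2 n n.2,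
          fun p => by rw [hcs1 (fun n => m p n)]; exact hm1 j hjJ p p.2, fun p n => heV _ _,
          fun p n => hec j hjJ p p.2 n, hH, hκ0, fun p q hq => by
            rw [hcs1 (fun n => if q ∈ e p n then m p n else 0)]; exact hκ j hjJ p p.2 q hq,
          fun q q' hne p p' ⟨n, h⟩ ⟨n', h'⟩ =>
            Subtype.ext (hpair q q' hne j hjJ p p.2 p' p'.2 ⟨n, h⟩ ⟨n', h'⟩)⟩ hη hη2
        (hτ.trans_le (hτs j hjJ))
        (fun q hq => by
          rw [hcs (fun p n => if q ∈ e p n then m p n else 0)]; exact hτd j hjJ q hq)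
        (fun q hq => by
          rw [hcs (fun p n => if q ∈ e p n then m p n else 0)]; exact hdD j hjJ q hq) hD
        (ht j hjJ) hρ hρ1 htρ
      have e1 : b / ρ ^ j / ρ = b / ρ ^ (j + 1) := by rw [pow_succ, div_div]
      rw [e1] at hstep
      have hbj0 : 0 ≤ b / ρ ^ j := zero_le_one.trans (hbi j)
      have hbjm := hbile j hjJ.le
      refine hstep.mono ?_ ?_ ?_
      · push_cast
        have : 2 * ((3 * (H : ℝ)) ^ 2 * (κ * (b / ρ ^ j) ^ H) * (2 * (b / ρ ^ j) * D + 3 * H)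
          / ρ ^ (3 * H)) ≤ δ := by rw [hδ]; gcongr
        linarith
      · push_cast
        have : (V.card : ℝ) * (1 / (b / ρ ^ j) * ((8 * (ε + j * δ) + (1 / τs j + 5) *
            (b / ρ ^ j) ^ (3 * H) * (H * κ)) / η ^ 3)) ≤ β := by
          rw [hβ]
          refine mul_le_mul_of_nonneg_left ?_ (Nat.cast_nonneg _)
          have h1 : 1 / (b / ρ ^ j) ≤ 1 := by
            rw [div_le_one (zero_lt_one.trans_le (hbi j))]; exact hbi j
          have h2 : (8 * (ε + j * δ) + (1 / τs j + 5) *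
            (b / ρ ^ j) ^ (3 * H) * (H * κ)) / η ^ 3 ≤
              (8 * εm + (1 / τ + 5) * bm ^ (3 * H) * (H * κ)) / η ^ 3 := by
            have := hεi j hjJ.le
            have := hτs j hjJ
            gcongr
          have h3 : 0 ≤ (8 * εm + (1 / τ + 5) * bm ^ (3 * H) * (H * κ)) / η ^ 3 := by positivity
          have h4 : 0 ≤ 1 / (b / ρ ^ j) := by positivity
          calc _ ≤ 1 / (b / ρ ^ j) * ((8 * εm + (1 / τ + 5) * bm ^ (3 * H) * (H * κ)) / η ^ 3) :=
                mul_le_mul_of_nonneg_left h2 h4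
            _ ≤ _ := mul_le_of_le_one_left h3 h1
        linarith
      · rintro U' ⟨U, c, ⟨U0, hU0, n, hn⟩, hc⟩
        refine ⟨U0, hU0, fun p => if h : p ∈ PP j then ((c ⟨p, h⟩).elim 0 fun k => (k : ℤ)) else n p,
          fun q hq hav => hc q (hn q hq fun i hi p hp => ?_) fun p => ?_⟩
        · have := hav i (by omega) p hp
          beta_reduce at this
          rwa [dif_neg (fun h => disjoint_left.mp (hdisj i j hi hjJ) hp h)] at this
        · have := hav j (by omega) p p.2
          beta_reduce at this
          rw [dif_pos p.2] at this
          cases hcp : c p with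
          | none => simp [stageEdge]
          | some k =>
            have e2 : c ⟨(p : ℕ), p.2⟩ = some k := hcp
            rw [e2] at this
            exact this
  obtain ⟨U, ⟨U0, hU0, n, hn⟩, hU⟩ := (main Jn le_rfl).exists_small hH
    (zero_lt_one.trans_le (hbi Jn))
  refine ⟨U0, hU0, n, ?_⟩
  have h1 : (((U0.filter (fun q => ∀ i < Jn, ∀ p ∈ PP i, q ∉ e p (n p))).card : ℕ) : ℝ) ≤ U.card := by
    exact_mod_cast card_le_card fun q hq => hn q (mem_filter.mp hq).1 (mem_filter.mp hq).2
  have h2 : (1 + (ε + Jn * δ)) / (b / ρ ^ Jn) ≤ (1 + εm) * ρ ^ Jn / b := by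
    rw [div_div_eq_mul_div]
    have := hεi Jn le_rfl
    gcongr
  have h3 := mul_le_mul_of_nonneg_left h2 (Nat.cast_nonneg (α := ℝ) V.card)
  linarith

/-- The normalized probability that a random class mod `s` avoids `T`. -/
noncomputable def avoid (T : Finset ℕ) (s : ℕ) : ℝ :=
  ∑ c : Fin s, 1 / (s : ℝ) * ∏ q ∈ T, if q % s = c then 0 else (1 - 1 / (s : ℝ))⁻¹

lemma avoid_eq (T : Finset ℕ) {s : ℕ} (hs : 0 < s) :
    avoid T s = ((1 - 1 / (s : ℝ))⁻¹) ^ T.card * (1 - (T.image (· % s)).card / s) := by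
  have hs' : (s : ℝ) ≠ 0 := by positivity
  have h1 : ∀ c : Fin s, (1 / (s : ℝ) * ∏ q ∈ T, if q % s = c then 0 else (1 - 1 / (s : ℝ))⁻¹)
      = if (c : ℕ) ∈ T.image (· % s) then 0 else 1 / (s : ℝ) * ((1 - 1 / (s : ℝ))⁻¹) ^ T.card := by
    intro c
    split_ifs with h
    · obtain ⟨q, hq, hqc⟩ := mem_image.1 h
      exact mul_eq_zero_of_right _ (prod_eq_zero hq (if_pos hqc))
    · rw [prod_congr rfl fun q hq => if_neg fun hqc => h (mem_image.2 ⟨q, hq, hqc⟩), prod_const]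
  have h2 : T.image (· % s) ⊆ range s := fun c hc => by
    obtain ⟨q, -, rfl⟩ := mem_image.1 hc
    exact mem_range.2 (Nat.mod_lt _ hs)
  rw [avoid, sum_congr rfl fun c _ => h1 c, Fin.sum_univ_eq_sum_range fun c : ℕ =>
    if c ∈ T.image (· % s) then 0 else 1 / (s : ℝ) * ((1 - 1 / (s : ℝ))⁻¹) ^ T.card,
    sum_ite, sum_const_zero, zero_add, sum_const, ← sdiff_eq_filter, card_sdiff_of_subset h2,
    card_range, nsmul_eq_mul, Nat.cast_sub (by simpa using card_le_card h2)]
  field_simp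

lemma one_sub_sq_le_avoid (T : Finset ℕ) {s : ℕ} (hs : 2 ≤ s) (hT : T.card ≤ s) :
    1 - ((T.card : ℝ) * (1 / s)) ^ 2 ≤ avoid T s := by
  have hs' : (2 : ℝ) ≤ s := by exact_mod_cast hs
  have h1 : ((T.image (· % s)).card : ℝ) ≤ T.card := by exact_mod_cast card_image_le
  have h2 : (1 : ℝ) + 1 / s ≤ (1 - 1 / (s : ℝ))⁻¹ := by
    rw [← one_div, le_div_iff₀ (by rw [sub_pos, div_lt_one] <;> linarith)]
    nlinarith [sq_nonneg (1 / (s : ℝ))]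
  have h3 := one_add_mul_le_pow (a := 1 / (s : ℝ)) (by
    have : (0 : ℝ) ≤ 1 / s := by positivity
    linarith) T.card
  have h4 : (T.card : ℝ) / s ≤ 1 := (div_le_one (by linarith)).2 (by exact_mod_cast hT)
  rw [avoid_eq T (by omega)]
  calc 1 - ((T.card : ℝ) * (1 / s)) ^ 2 = (1 + T.card * (1 / s)) * (1 - T.card / s) := by ring
    _ ≤ ((1 - 1 / (s : ℝ))⁻¹) ^ T.card * (1 - (T.image (· % s)).card / s) := by
      refine mul_le_mul (h3.trans (by gcongr)) (by gcongr) (by linarith)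
        (pow_nonneg (le_trans (by positivity) h2) _)

lemma avoid_le_one {T : Finset ℕ} {s : ℕ} (hs : 2 ≤ s) (hT : Set.InjOn (· % s) (T : Set ℕ)) :
    avoid T s ≤ 1 := by
  have hs' : (2 : ℝ) ≤ s := by exact_mod_cast hs
  have h0 : (0 : ℝ) < 1 - 1 / s := by rw [sub_pos, div_lt_one] <;> linarith
  have h3 := one_add_mul_le_pow (a := -(1 / (s : ℝ))) (by
    linarith) T.card
  rw [← sub_eq_add_neg] at h3
  rw [avoid_eq T (by omega), card_image_of_injOn hT, inv_pow, inv_mul_le_iff₀ (by positivity),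
    mul_one]
  convert h3 using 1
  ring

lemma avoid_le_exp (T : Finset ℕ) {s : ℕ} (hs : 2 ≤ s) :
    avoid T s ≤ exp (2 * T.card / s) := by
  have hs' : (2 : ℝ) ≤ s := by exact_mod_cast hs
  have h0 : (1 : ℝ) / 2 ≤ 1 - 1 / s := by
    have : (1 : ℝ) / s ≤ 1 / 2 := by gcongr
    linarith
  have h1 : (1 - 1 / (s : ℝ))⁻¹ ≤ exp (2 / s) := by
    refine le_trans ?_ (add_one_le_exp _)
    rw [inv_le_iff_one_le_mul₀ (by linarith)]
    have h5 : (2 : ℝ) / s = 2 * (1 / s) := by ring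
    have : (0 : ℝ) ≤ 1 / s := by positivity
    rw [h5]
    nlinarith
  rw [avoid_eq T (by omega)]
  have h2 : (1 - 1 / (s : ℝ))⁻¹ ^ T.card ≤ exp (2 / s) ^ T.card :=
    pow_le_pow_left₀ (inv_nonneg.2 (by linarith)) h1 _
  calc _ ≤ exp (2 / s) ^ T.card * 1 := mul_le_mul h2
        (by have : (0 : ℝ) ≤ (T.image (· % s)).card / s := by positivity
            linarith) (by
          rw [sub_nonneg, div_le_one (by linarith)]
          have h3 : T.image (· % s) ⊆ range s := fun c hc => by
            obtain ⟨q, -, rfl⟩ := mem_image.1 hc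
            exact mem_range.2 (Nat.mod_lt _ (by omega))
          exact_mod_cast (card_le_card h3).trans_eq (card_range s)) (by positivity)
    _ = _ := by rw [mul_one, ← exp_nat_mul]; ring_nf

/-- Few primes fail to separate the elements of `T`. -/
lemma card_not_injOn_mul_le {S T : Finset ℕ} {Y : ℝ} (hS : ∀ s ∈ S, s.Prime) (hY : 1 ≤ Y)
    (hT : ∀ q ∈ T, (q : ℝ) ≤ Y) :
    ((S.filter fun s => ¬Set.InjOn (· % s) (T : Set ℕ)).card : ℝ) * log 2
      ≤ T.card ^ 2 * log Y := by
  set bad := S.filter fun s => ¬Set.InjOn (· % s) (T : Set ℕ) with hbad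
  set D := ∏ i ∈ T.offDiag, ((i.1 : ℤ) - i.2).natAbs with hD
  have hD0 : D ≠ 0 := prod_ne_zero_iff.2 fun i hi => by
    have := (mem_offDiag.1 hi).2.2
    omega
  have hdvd : ∏ s ∈ bad, s ∣ D := by
    refine prod_primes_dvd _ (fun s hs => (hS s (mem_filter.1 hs).1).prime) fun s hs => ?_
    obtain ⟨q, hq, q', hq', h1, h2⟩ : ∃ q ∈ T, ∃ q' ∈ T, q % s = q' % s ∧ q ≠ q' := by
      have := (mem_filter.1 hs).2
      simp only [Set.InjOn, mem_coe] at this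
      push Not at this
      exact this
    have hm : (q', q) ∈ T.offDiag := mem_offDiag.2 ⟨hq', hq, h2.symm⟩
    refine dvd_trans ?_ (dvd_prod_of_mem _ hm)
    exact Int.natCast_dvd.1 (Nat.modEq_iff_dvd.1 h1)
  have h1 : 2 ^ bad.card ≤ D := by
    refine le_trans ?_ (Nat.le_of_dvd (Nat.pos_of_ne_zero hD0) hdvd)
    rw [← prod_const]
    exact prod_le_prod' fun s hs => (hS s (mem_filter.1 hs).1).two_le
  have h2 : (D : ℝ) ≤ Y ^ (T.card ^ 2) := by
    rw [hD, Nat.cast_prod]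
    calc ∏ i ∈ T.offDiag, ((((i.1 : ℤ) - i.2).natAbs : ℕ) : ℝ) ≤ ∏ _i ∈ T.offDiag, Y :=
          prod_le_prod (fun _ _ => by positivity) fun i hi => by
            have h3 := hT _ (mem_offDiag.1 hi).1
            have h4 := hT _ (mem_offDiag.1 hi).2.1
            rcases le_total i.1 i.2 with h | h
            · exact le_trans (Nat.cast_le.2 (by omega)) h4
            · exact le_trans (Nat.cast_le.2 (by omega)) h3
      _ ≤ _ := by
        rw [prod_const, offDiag_card]
        exact pow_le_pow_right₀ hY (by rw [sq]; exact Nat.sub_le _ _)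
  have h3 := log_le_log (by positivity) ((Nat.cast_le (α := ℝ).2 h1).trans h2)
  rw [Nat.cast_pow, log_pow, log_pow] at h3
  exact_mod_cast h3

/-- The random set `V ∩ S(a)` with `a` uniformly distributed. -/
lemma exists_initial_state {S V : Finset ℕ} {H : ℕ} {u Y ε : ℝ} (hS : ∀ s ∈ S, s.Prime ∧ u < s)
    (hsq : ∑ s ∈ S, (1 / (s : ℝ)) ^ 2 ≤ 2 / u) (hY : 1 ≤ Y) (hV : ∀ q ∈ V, (q : ℝ) ≤ Y) (hu : 0 < u)
    (hHu : 3 * H ≤ u) (h1 : 18 * (H : ℝ) ^ 2 / u ≤ ε)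
    (h2 : exp (6 * H / u * (9 * H ^ 2 * log Y / log 2)) ≤ 1 + ε) :
    NState V H (∏ s ∈ S, (1 - 1 / (s : ℝ))⁻¹) ε 0
      (fun U => ∃ a : ℕ → ℕ, U = V.filter fun q => ∀ s ∈ S, q % s ≠ a s) := by
  have hS2 : ∀ s : S, 2 ≤ (s : ℕ) := fun s => (hS s s.2).1.two_le
  have hβ : ∀ s : S, 0 ≤ (1 - 1 / ((s : ℕ) : ℝ))⁻¹ := fun s => by
    have : (1 : ℝ) / (s : ℕ) ≤ 1 := (div_le_one (by have := hS2 s; positivity)).2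
      (by exact_mod_cast (hS2 s).trans' (by norm_num))
    exact inv_nonneg.2 (by linarith)
  have hEx : ∀ T : Finset ℕ, Ex (Ω := ∀ s : S, Fin s) (fun _ => ∏ s : S, 1 / ((s : ℕ) : ℝ))
      (fun ω => ∏ q ∈ T, ∏ s : S, if q % s = ω s then 0 else (1 - 1 / ((s : ℕ) : ℝ))⁻¹)
        = ∏ s ∈ S, avoid T s := fun T => by
    rw [← prod_coe_sort S fun s => avoid T s]
    simp only [avoid, Ex]
    rw [prod_univ_sum, Fintype.piFinset_univ]
    refine sum_congr rfl fun ω _ => ?_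
    rw [prod_comm, ← prod_mul_distrib]
  refine ⟨∀ s : S, Fin s, inferInstance, fun _ => ∏ s : S, 1 / ((s : ℕ) : ℝ),
    fun ω q => ∏ s : S, if q % s = ω s then 0 else (1 - 1 / ((s : ℕ) : ℝ))⁻¹,
    fun ω => V.filter fun q => ∀ s : S, q % s ≠ ω s, fun _ => ∅, ⟨fun ω => by positivity, ?_,
    fun ω q => prod_nonneg fun s _ => ?_, fun ω q => ?_, fun T hT hTH => ?_⟩, fun ω q hq _ => ?_, ?_,
    fun ω => ⟨filter_subset _ _, fun s => if h : s ∈ S then ω ⟨s, h⟩ else 0, ?_⟩⟩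
  · have h := hEx ∅
    have h' : ∏ s ∈ S, avoid ∅ s = 1 := prod_eq_one fun s hs => by
      rw [avoid_eq ∅ (hS s hs).1.pos]; simp
    rw [h'] at h
    simpa [Ex] using h
  · split_ifs
    exacts [le_rfl, hβ s]
  · rw [← prod_coe_sort S fun s => (1 - 1 / (s : ℝ))⁻¹]
    exact prod_le_prod (fun s _ => by split_ifs; exacts [le_rfl, hβ s])
      fun s _ => by split_ifs; exacts [hβ s, le_rfl]
  · rw [hEx]
    have hTc : (T.card : ℝ) ≤ 3 * H := by exact_mod_cast hTH
    have hTs : ∀ s ∈ S, (T.card : ℝ) ≤ s := fun s hs => by linarith [(hS s hs).2]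
    have hav0 : ∀ s ∈ S, 0 ≤ avoid T s := fun s hs => by
      refine le_trans ?_ (one_sub_sq_le_avoid T (hS s hs).1.two_le (by exact_mod_cast hTs s hs))
      have : (T.card : ℝ) * (1 / s) ≤ 1 := by
        rw [mul_one_div, div_le_one (by have := (hS s hs).1.pos; positivity)]; exact hTs s hs
      have h0 : 0 ≤ (T.card : ℝ) * (1 / s) := by positivity
      nlinarith
    rw [abs_sub_le_iff]
    constructor
    · suffices h : ∏ s ∈ S, avoid T s ≤ 1 + ε by linarith
      refine le_trans ?_ h2
      calc ∏ s ∈ S, avoid T s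
          ≤ ∏ s ∈ S, if ¬Set.InjOn (· % s) (T : Set ℕ) then exp (6 * H / u) else 1 := by
            refine prod_le_prod hav0 fun s hs => ?_
            split_ifs with h
            · exact avoid_le_one (hS s hs).1.two_le h
            · refine (avoid_le_exp T (hS s hs).1.two_le).trans (exp_le_exp.2 ?_)
              exact div_le_div₀ (by positivity) (by linarith) hu (hS s hs).2.le
        _ = exp (6 * H / u * (S.filter fun s => ¬Set.InjOn (· % s) (T : Set ℕ)).card) := by
            rw [prod_ite, prod_const, prod_const_one, mul_one, ← exp_nat_mul, mul_comm]
        _ ≤ _ := by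
            refine exp_le_exp.2 (mul_le_mul_of_nonneg_left ?_ (by positivity))
            rw [le_div_iff₀ (log_pos one_lt_two)]
            refine (card_not_injOn_mul_le (fun s hs => (hS s hs).1) hY fun q hq => hV q (hT hq)).trans
              (mul_le_mul_of_nonneg_right ?_ (log_nonneg hY))
            calc (T.card : ℝ) ^ 2 ≤ (3 * H) ^ 2 := by gcongr
              _ = _ := by ring
    · suffices h : 1 - ε ≤ ∏ s ∈ S, avoid T s by linarith
      calc 1 - ε ≤ 1 - ∑ s ∈ S, ((T.card : ℝ) * (1 / s)) ^ 2 := by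
            have : ∑ s ∈ S, ((T.card : ℝ) * (1 / s)) ^ 2 ≤ ε := by
              refine le_trans ?_ h1
              simp_rw [mul_pow]
              rw [← mul_sum]
              calc (T.card : ℝ) ^ 2 * ∑ s ∈ S, (1 / (s : ℝ)) ^ 2 ≤ (3 * H) ^ 2 * (2 / u) := by gcongr
                _ = _ := by ring
            linarith
        _ ≤ ∏ s ∈ S.attach, (1 - ((T.card : ℝ) * (1 / (s : ℕ))) ^ 2) := by
            rw [← sum_attach]
            refine one_sub_sum_le_prod S.attach (fun s => by positivity) fun s => ?_
            rw [mul_one_div]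
            exact pow_le_one₀ (by positivity) ((div_le_one (by have := hS2 s; positivity)).2
              (hTs s s.2))
        _ = ∏ s ∈ S, (1 - ((T.card : ℝ) * (1 / s)) ^ 2) := prod_attach S fun s : ℕ =>
            1 - ((T.card : ℝ) * (1 / s)) ^ 2
        _ ≤ _ := prod_le_prod (fun s hs => by
              rw [sub_nonneg, mul_one_div]
              exact pow_le_one₀ (by positivity)
                ((div_le_one (by have := (hS s hs).1.pos; positivity)).2 (hTs s hs)))
            fun s hs => one_sub_sq_le_avoid T (hS s hs).1.two_le (by exact_mod_cast hTs s hs)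
  · rw [← prod_coe_sort S fun s => (1 - 1 / (s : ℝ))⁻¹]
    exact prod_congr rfl fun s _ => if_neg ((mem_filter.1 hq).2 s)
  · simp [Ex]
  · refine filter_congr fun q _ => ⟨fun h s hs => ?_, fun h s => ?_⟩
    · simpa [hs] using h ⟨s, hs⟩
    · simpa using h s s.2

open Classical in
/-- The elements of `V` covered by the tuple with shift `n` and step `p`. -/
noncomputable def tupleEdge (V : Finset ℕ) (H p : ℕ) (n : ℤ) : Finset ℕ :=
  V.filter fun q => ∃ j ∈ Icc 1 H, (q : ℤ) = n + j * p

lemma mem_tupleEdge {V : Finset ℕ} {H p q : ℕ} {n : ℤ} :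
    q ∈ tupleEdge V H p n ↔ q ∈ V ∧ ∃ j ∈ Icc 1 H, (q : ℤ) = n + j * p := by
  simp [tupleEdge]

lemma card_tupleEdge_le (V : Finset ℕ) (H p : ℕ) (n : ℤ) : (tupleEdge V H p n).card ≤ H := by
  calc (tupleEdge V H p n).card ≤ ((Icc 1 H).image fun j : ℕ => (n + j * p).toNat).card := by
        refine card_le_card fun q hq => ?_
        obtain ⟨j, hj, hqj⟩ := (mem_tupleEdge.1 hq).2
        exact mem_image.2 ⟨j, hj, by rw [← hqj, Int.toNat_natCast]⟩
    _ ≤ _ := card_image_le.trans (by simp)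

lemma sum_tupleEdge {V : Finset ℕ} {H p q X Y : ℕ} (hp : 0 < p) (hpX : p ≤ X) (hq : q ∈ V)
    (hqY : q ≤ Y) (m : ℤ → ℝ) :
    ∑ n ∈ Ioc (-(H * X : ℤ)) Y, (if q ∈ tupleEdge V H p n then m n else 0)
      = ∑ j ∈ Icc 1 H, if -(H * X : ℤ) < (q : ℤ) - j * p then m ((q : ℤ) - j * p) else 0 := by
  rw [← sum_filter, ← sum_filter]
  symm
  refine sum_bij (fun j _ => (q : ℤ) - j * p) (fun j hj => ?_) (fun j _ j' _ h => ?_)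
    (fun n hn => ?_) fun _ _ => rfl
  · obtain ⟨h1, h2⟩ := mem_filter.1 hj
    refine mem_filter.2 ⟨mem_Ioc.2 ⟨h2, ?_⟩, mem_tupleEdge.2 ⟨hq, j, h1, by ring⟩⟩
    have : (0 : ℤ) ≤ j * p := by positivity
    omega
  · have h1 : (j : ℤ) * p = j' * p := by linarith
    exact_mod_cast mul_right_cancel₀ (by exact_mod_cast hp.ne') h1
  · obtain ⟨h1, h2⟩ := mem_filter.1 hn
    obtain ⟨j, hj, hqj⟩ := (mem_tupleEdge.1 h2).2
    have : (q : ℤ) - j * p = n := by linarith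
    exact ⟨j, mem_filter.2 ⟨hj, by rw [this]; exact (mem_Ioc.1 h1).1⟩, this⟩

lemma sum_tupleEdge_eq {V : Finset ℕ} {H p q X Y : ℕ} (hp : 0 < p) (hpX : p ≤ X) (hq : q ∈ V)
    (hqY : q ≤ Y) (hq0 : 0 < q) (m : ℤ → ℝ) :
    ∑ n ∈ Ioc (-(H * X : ℤ)) Y, (if q ∈ tupleEdge V H p n then m n else 0)
      = ∑ j ∈ Icc 1 H, m ((q : ℤ) - j * p) := by
  rw [sum_tupleEdge hp hpX hq hqY]
  refine sum_congr rfl fun j hj => if_pos ?_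
  have : (j : ℤ) * p ≤ H * X := by exact_mod_cast Nat.mul_le_mul (mem_Icc.1 hj).2 hpX
  omega

lemma eq_of_mem_tupleEdge {V : Finset ℕ} {H p p' q q' : ℕ} {n n' : ℤ} (hp : p.Prime)
    (hp' : p'.Prime) (hH : H ≤ p) (hqq : q ≠ q') (h1 : q ∈ tupleEdge V H p n)
    (h2 : q' ∈ tupleEdge V H p n) (h3 : q ∈ tupleEdge V H p' n') (h4 : q' ∈ tupleEdge V H p' n') :
    p = p' := by
  obtain ⟨j1, k1, e1⟩ := (mem_tupleEdge.1 h1).2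
  obtain ⟨j2, k2, e2⟩ := (mem_tupleEdge.1 h2).2
  obtain ⟨j3, k3, e3⟩ := (mem_tupleEdge.1 h3).2
  obtain ⟨j4, k4, e4⟩ := (mem_tupleEdge.1 h4).2
  rw [mem_Icc] at k1 k2 k3 k4
  have e5 : ((j1 : ℤ) - j2) * p = (j3 - j4) * p' := by linarith
  by_contra hpp
  have hd : (p : ℤ) ∣ (j3 - j4) * p' := ⟨_, e5.symm.trans (mul_comm _ _)⟩
  rcases (Nat.prime_iff_prime_int.1 hp).dvd_or_dvd hd with h | h
  · have h0 := Int.eq_zero_of_abs_lt_dvd h (by rw [abs_lt]; omega)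
    refine hqq (by zify; rw [e3, e4, sub_eq_zero.1 h0])
  · exact hpp ((Nat.prime_dvd_prime_iff_eq hp hp').1 (Int.natCast_dvd_natCast.1 h))

/-- Iterated covering of `V` by residue classes to the moduli in `PP`. -/
lemma NState.exists_classes {V : Finset ℕ} {H X Y : ℕ} {b ε : ℝ} {R : Finset ℕ → Prop}
    (hS : NState V H b ε 0 R) (m : ℕ → ℤ → ℝ) (PP : ℕ → Finset ℕ) (Jn : ℕ)
    {η κ t τ ρ bm εm : ℝ} (τs : ℕ → ℝ)
    (hdisj : ∀ i j, i < j → j < Jn → Disjoint (PP i) (PP j)) (hb : 1 ≤ b) (hε : 0 ≤ ε)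
    (hm : ∀ p n, 0 ≤ m p n) (hPP : ∀ i < Jn, ∀ p ∈ PP i, p.Prime ∧ H ≤ p ∧ p ≤ X ∧
      (∀ n, m p n ≤ κ) ∧ ∑ n ∈ Ioc (-(H * X : ℤ)) Y, m p n ≤ 1)
    (hV : ∀ q ∈ V, 0 < q ∧ q ≤ Y) (hH : 1 ≤ H) (hκ0 : 0 ≤ κ) (hη : 0 < η) (hη2 : η ≤ 1 / 2)
    (hτ : 0 < τ) (hτs : ∀ i < Jn, τ ≤ τs i)
    (hτd : ∀ i < Jn, ∀ q ∈ V, τs i ≤ ∑ p ∈ PP i, ∑ j ∈ Icc 1 H, m p ((q : ℤ) - j * p))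
    (ht : ∀ i < Jn, t * (1 + η) ≤ b / ρ ^ i * τs i * (1 - 2 * η)) (hρ : 0 < ρ) (hρ1 : ρ < 1)
    (htρ : exp (-t) ≤ ρ) (hbm : b / ρ ^ Jn ≤ bm)
    (hεm : ε + Jn * (2 * ((3 * H) ^ 2 * ((H * κ) * bm ^ H) * (2 * bm * (X * (H * κ)) + 3 * H)
      / ρ ^ (3 * H))) ≤ εm) (hεm1 : εm ≤ 1) :
    ∃ U0, R U0 ∧ ∃ n : ℕ → ℤ,
      ((U0.filter fun q : ℕ => ∀ i < Jn, ∀ p ∈ PP i, ¬(q : ℤ) ≡ n p [ZMOD p]).card : ℝ) ≤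
        Jn * (V.card * ((8 * εm + (1 / τ + 5) * bm ^ (3 * H) * (H * (H * κ))) / η ^ 3))
          + V.card * ((1 + εm) * ρ ^ Jn / b) := by
  have hsum : ∀ i < Jn, ∀ p ∈ PP i, ∀ q ∈ V, ∑ n ∈ Ioc (-(H * X : ℤ)) Y,
      (if q ∈ tupleEdge V H p n then m p n else 0) = ∑ j ∈ Icc 1 H, m p ((q : ℤ) - j * p) :=
    fun i hi p hp q hq => sum_tupleEdge_eq (hPP i hi p hp).1.pos (hPP i hi p hp).2.2.1 hq
      (hV q hq).2 (hV q hq).1 _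
  have hle : ∀ i < Jn, ∀ p ∈ PP i, ∀ q : ℕ, ∑ j ∈ Icc 1 H, m p ((q : ℤ) - j * p) ≤ H * κ :=
    fun i hi p hp q => by
      refine (sum_le_card_nsmul _ _ κ fun j _ => (hPP i hi p hp).2.2.2.1 _).trans_eq ?_
      simp
  obtain ⟨U0, hU0, n, hn⟩ := hS.iterate m (tupleEdge V H) (Ioc (-(H * X : ℤ)) Y) PP Jn
    (D := X * (H * κ)) (κ := H * κ) τs hdisj hb hε (fun _ _ p _ n _ => hm p n)
    (fun i hi p hp => (hPP i hi p hp).2.2.2.2) (fun p n _ hq => (mem_tupleEdge.1 hq).1)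
    (fun _ _ p _ n => card_tupleEdge_le V H p n) hH (by positivity)
    (fun i hi p hp q hq => by rw [hsum i hi p hp q hq]; exact hle i hi p hp q) hη hη2
    (fun q q' hqq i hi p hp p' hp' ⟨n, h1, h2⟩ ⟨n', h3, h4⟩ =>
      eq_of_mem_tupleEdge (hPP i hi p hp).1 (hPP i hi p' hp').1 (hPP i hi p hp).2.1 hqq h1 h2 h3 h4)
    hτ hτs
    (fun i hi q hq => by
      rw [sum_congr rfl fun p hp => hsum i hi p hp q hq]; exact hτd i hi q hq)
    (fun i hi q hq => by
      rw [sum_congr rfl fun p hp => hsum i hi p hp q hq]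
      refine (sum_le_card_nsmul _ _ _ fun p hp => hle i hi p hp q).trans ?_
      rw [nsmul_eq_mul]
      gcongr
      calc (PP i).card ≤ (Icc 1 X).card := card_le_card fun p hp =>
            mem_Icc.2 ⟨(hPP i hi p hp).1.pos, (hPP i hi p hp).2.2.1⟩
        _ = X := by simp)
    (by positivity) ht hρ hρ1 htρ hbm hεm hεm1
  refine ⟨U0, hU0, n, le_trans ?_ (by simpa using hn)⟩
  refine Nat.cast_le.2 (card_le_card (monotone_filter_right _ fun q _ hq i hi p hp hqp => ?_))
  obtain ⟨j, -, hj⟩ := (mem_tupleEdge.1 hqp).2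
  refine hq i hi p hp ?_
  rw [hj]
  exact (Int.modEq_iff_dvd.2 ⟨-j, by ring⟩)

section Sieving
open Filter

lemma exists_disjoint_subsets {α : Type*} [DecidableEq α] (P : Finset α) (N : ℕ → ℕ) (J : ℕ)
    (h : ∑ i ∈ range J, N i ≤ P.card) : ∃ PP : ℕ → Finset α, (∀ i < J, PP i ⊆ P) ∧
      (∀ i < J, (PP i).card = N i) ∧ ∀ i j, i < j → j < J → Disjoint (PP i) (PP j) := by
  induction J with
  | zero => exact ⟨fun _ => ∅, by simp, by simp, by simp⟩
  | succ J ih =>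
    rw [sum_range_succ] at h
    obtain ⟨PP, h1, h2, h3⟩ := ih (by omega)
    have hU : ((range J).biUnion PP).card ≤ ∑ i ∈ range J, N i :=
      card_biUnion_le.trans_eq (sum_congr rfl fun i hi => h2 i (mem_range.1 hi))
    obtain ⟨T, hT, hTc⟩ := exists_subset_card_eq (s := P \ (range J).biUnion PP) (n := N J)
      (by have := le_card_sdiff ((range J).biUnion PP) P; omega)
    have hupd : ∀ i < J, Function.update PP J T i = PP i := fun i hi =>
      Function.update_of_ne hi.ne _ _
    refine ⟨Function.update PP J T, fun i hi => ?_, fun i hi => ?_, fun i j hij hj => ?_⟩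
    · rcases (Nat.lt_succ_iff.1 hi).lt_or_eq with h | rfl
      · rw [hupd i h]; exact h1 i h
      · rw [Function.update_self]; exact hT.trans sdiff_subset
    · rcases (Nat.lt_succ_iff.1 hi).lt_or_eq with h | rfl
      · rw [hupd i h]; exact h2 i h
      · rw [Function.update_self]; exact hTc
    · rcases (Nat.lt_succ_iff.1 hj).lt_or_eq with h | rfl
      · rw [hupd j h, hupd i (hij.trans h)]; exact h3 i j hij h
      · rw [Function.update_self, hupd i hij]
        refine (disjoint_sdiff.mono_right hT).mono_left fun a ha => ?_
        exact mem_biUnion.2 ⟨i, mem_range.2 hij, ha⟩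

lemma state_error_le {v E κ X bm ρ : ℝ} {H J : ℕ} (hv : 100 ≤ v) (hE : v ^ 2000 ≤ E)
    (hbm : v ^ 101 = bm) (hb : bm ^ H ≤ E) (hρ : 0 < ρ) (hρE : 1 ≤ E * ρ ^ (3 * H))
    (hH : (H : ℝ) ≤ v ^ 90) (hJ : (J : ℝ) ≤ v) (hκ0 : 0 ≤ κ) (hκ : κ * E ^ 59 ≤ 1) (hX0 : 0 ≤ X)
    (hX : X ≤ E ^ 100) :
    J * (2 * ((3 * H) ^ 2 * ((H * κ) * bm ^ H) * (2 * bm * (X * (H * κ)) + 3 * H) / ρ ^ (3 * H)))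
      ≤ 1 / v ^ 1500 := by
  have hv1 : 1 ≤ v := by linarith
  have hv0 : 0 < v := by linarith
  have hE1 : 1 ≤ E := (one_le_pow₀ hv1).trans hE
  have hE0 : 0 < E := by linarith
  have hbm0 : 0 ≤ bm := hbm ▸ by positivity
  have h1 : X * κ ≤ E ^ 41 := by
    calc X * κ ≤ E ^ 100 * κ := by gcongr
      _ = E ^ 41 * (κ * E ^ 59) := by ring
      _ ≤ E ^ 41 * 1 := by gcongr
      _ = _ := mul_one _
  have h2 : 2 * bm * (X * (H * κ)) + 3 * H ≤ v ^ 192 * E ^ 41 := by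
    calc 2 * bm * (X * (H * κ)) + 3 * H = 2 * bm * (H * (X * κ)) + 3 * (H * 1) := by ring
      _ ≤ 2 * v ^ 101 * (v ^ 90 * E ^ 41) + 3 * (v ^ 90 * E ^ 41) := by
          rw [hbm]
          have := one_le_pow₀ hE1 (n := 41)
          gcongr
      _ = (2 * v ^ 191 + 3 * v ^ 90) * E ^ 41 := by ring
      _ ≤ (2 * v ^ 191 + 3 * v ^ 191) * E ^ 41 := by
          have := pow_le_pow_right₀ hv1 (show 90 ≤ 191 by norm_num)
          gcongr
      _ = (5 * v ^ 191) * E ^ 41 := by ring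
      _ ≤ (v * v ^ 191) * E ^ 41 := by gcongr; linarith
      _ = _ := by ring
  have h3 : (ρ ^ (3 * H))⁻¹ ≤ E := (inv_le_iff_one_le_mul₀ (by positivity)).2 hρE
  have h4 : κ ≤ (E ^ 59)⁻¹ := by rw [← one_div, le_div_iff₀ (by positivity)]; exact hκ
  calc _ = J * (18 * H ^ 3 * κ * bm ^ H * (2 * bm * (X * (H * κ)) + 3 * H) * (ρ ^ (3 * H))⁻¹) := by
        rw [div_eq_mul_inv]; ring
    _ ≤ v * (18 * (v ^ 90) ^ 3 * (E ^ 59)⁻¹ * E * (v ^ 192 * E ^ 41) * E) := by gcongr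
    _ = 18 * v ^ 463 * (E ^ 16)⁻¹ := by field_simp
    _ ≤ v * v ^ 463 * (E ^ 16)⁻¹ := by gcongr; linarith
    _ ≤ v ^ 500 * E⁻¹ := by
        rw [← pow_succ']
        gcongr
        · norm_num
        · exact le_self_pow₀ hE1 (by norm_num)
    _ ≤ v ^ 500 * (v ^ 2000)⁻¹ := by gcongr
    _ = _ := by field_simp

lemma covering_error_le {v E κ bm x : ℝ} {H J n : ℕ} (hv : 10 ^ 6 ≤ v) (hE : v ^ 2000 ≤ E)
    (hb : bm ^ (3 * H) ≤ E) (hH : (H : ℝ) ≤ v ^ 90) (hJ : (J : ℝ) ≤ v) (hκ0 : 0 ≤ κ)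
    (hbm0 : 0 ≤ bm) (hκ : κ * E ^ 59 ≤ 1) (hx : 0 ≤ x) (hn : (n : ℝ) ≤ v ^ 100 * x) :
    J * (n * ((8 * (2 / v ^ 1500) + (1 / (1 / v ^ 102) + 5) * bm ^ (3 * H) * (H * (H * κ)))
      / (1 / 100) ^ 3)) ≤ x / v ^ 200 := by
  have hv1 : 1 ≤ v := by linarith
  have hv0 : 0 < v := by linarith
  have hE1 : 1 ≤ E := (one_le_pow₀ hv1).trans hE
  have hE0 : 0 < E := by linarith
  have h4 : κ ≤ (E ^ 59)⁻¹ := by rw [← one_div, le_div_iff₀ (by positivity)]; exact hκ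
  have h1 : (1 / (1 / v ^ 102) + 5) * bm ^ (3 * H) * (H * (H * κ)) ≤ 1 / v ^ 1500 := by
    calc (1 / (1 / v ^ 102) + 5) * bm ^ (3 * H) * (H * (H * κ))
        = (v ^ 102 + 5) * bm ^ (3 * H) * (H ^ 2 * κ) := by rw [one_div_one_div]; ring
      _ ≤ (v ^ 102 + 5 * v ^ 102) * E * ((v ^ 90) ^ 2 * (E ^ 59)⁻¹) := by
          have := one_le_pow₀ hv1 (n := 102)
          gcongr
          linarith
      _ = 6 * v ^ 282 * (E ^ 58)⁻¹ := by field_simp; ring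
      _ ≤ v * v ^ 282 * (E ^ 58)⁻¹ := by gcongr; linarith
      _ ≤ v ^ 500 * E⁻¹ := by
          rw [← pow_succ']
          gcongr
          · norm_num
          · exact le_self_pow₀ hE1 (by norm_num)
      _ ≤ v ^ 500 * (v ^ 2000)⁻¹ := by gcongr
      _ = _ := by field_simp
  have h2 : (8 * (2 / v ^ 1500) + (1 / (1 / v ^ 102) + 5) * bm ^ (3 * H) * (H * (H * κ)))
      / (1 / 100) ^ 3 ≤ 17 * 10 ^ 6 / v ^ 1500 := by
    rw [div_le_iff₀ (by norm_num)]
    refine (add_le_add_right h1 _).trans_eq ?_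
    ring
  refine (mul_le_mul_of_nonneg_left (mul_le_mul_of_nonneg_left h2 n.cast_nonneg)
    J.cast_nonneg).trans ?_
  calc _ ≤ v * ((v ^ 100 * x) * (17 * 10 ^ 6 / v ^ 1500)) := by gcongr
    _ = 17 * 10 ^ 6 * x * v ^ 101 / v ^ 1500 := by ring
    _ ≤ v * v * x * v ^ 101 / v ^ 1500 := by
        gcongr
        linarith
    _ = x / v ^ 1397 := by field_simp
    _ ≤ _ := by
        gcongr
        · norm_num

lemma residue_error_le {v Y : ℝ} {H : ℕ} (hv : 10 ^ 6 ≤ v) (hH : (H : ℝ) ≤ v ^ 90)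
    (hY0 : 0 ≤ log Y) (hY : log Y ≤ 2 * v ^ 100) : 3 * (H : ℝ) ≤ v ^ 2000 ∧
      18 * (H : ℝ) ^ 2 / v ^ 2000 ≤ 1 / v ^ 1500 ∧
      exp (6 * H / v ^ 2000 * (9 * H ^ 2 * log Y / log 2)) ≤ 1 + 1 / v ^ 1500 := by
  have hv1 : 1 ≤ v := by linarith
  have hv0 : 0 < v := by linarith
  have hl : 0.5 ≤ log 2 := by have := log_two_gt_d9; linarith
  refine ⟨?_, ?_, ?_⟩
  · calc 3 * (H : ℝ) ≤ v * v ^ 90 := by gcongr; linarith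
      _ ≤ _ := by rw [← pow_succ']; exact pow_le_pow_right₀ hv1 (by norm_num)
  · rw [div_le_div_iff₀ (by positivity) (by positivity), one_mul]
    calc 18 * (H : ℝ) ^ 2 * v ^ 1500 ≤ v * (v ^ 90) ^ 2 * v ^ 1500 := by gcongr; linarith
      _ = v ^ 1681 := by ring
      _ ≤ _ := pow_le_pow_right₀ hv1 (by norm_num)
  · have h0 : 6 * H / v ^ 2000 * (9 * H ^ 2 * log Y / log 2) ≤ 1 / v ^ 1501 := by
      calc 6 * H / v ^ 2000 * (9 * H ^ 2 * log Y / log 2)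
          ≤ 6 * v ^ 90 / v ^ 2000 * (9 * (v ^ 90) ^ 2 * (2 * v ^ 100) / 0.5) := by gcongr
        _ = 216 * v ^ 370 / v ^ 2000 := by ring
        _ ≤ v * v ^ 370 / v ^ 2000 := by gcongr; linarith
        _ = 1 / v ^ 1629 := by field_simp
        _ ≤ _ := by
          gcongr
          · norm_num
    have h1 : 1 / v ^ 1501 ≤ 1 / 2 * (1 / v ^ 1500) := by
      rw [one_div_mul_one_div, pow_succ v 1500, mul_comm 2]
      refine one_div_le_one_div_of_le (by positivity) (mul_le_mul_of_nonneg_left ?_ (by positivity))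
      linarith
    have h2 : 1 / v ^ 1500 ≤ 1 := by
      rw [div_le_one (by positivity)]; exact one_le_pow₀ hv1
    have h3 : 0 < 1 / v ^ 1501 := by positivity
    generalize 1 / v ^ 1500 = e at *
    generalize 1 / v ^ 1501 = e' at *
    calc _ ≤ exp e' := exp_le_exp.2 h0
      _ ≤ 1 / (1 - e') := exp_bound_div_one_sub_of_interval h3.le (by linarith)
      _ ≤ 1 + e := by rw [div_le_iff₀ (by linarith)]; nlinarith

lemma eventually_residue_product : ∀ᶠ v : ℝ in atTop, ∀ x z L : ℝ, x = exp (v ^ 100) →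
    L = 100 * log v → z = x ^ (log L / (4 * L)) → v ^ 2000 ≤ z ∧ z ≤ x / 2 ∧ ∀ B₀ : ℕ,
      v ^ 100 * log L / (80.5 * L ^ 2)
        ≤ ∏ s ∈ (primeRange (v ^ 2000) z).filter (· ≠ B₀), (1 - 1 / (s : ℝ))⁻¹ ∧
      ∏ s ∈ (primeRange (v ^ 2000) z).filter (· ≠ B₀), (1 - 1 / (s : ℝ))⁻¹ ≤ v ^ 100 := by
  have hpow : Tendsto (fun v : ℝ => v ^ 2000) atTop atTop := tendsto_pow_atTop (by norm_num)
  filter_upwards [hpow.eventually (eventually_prod_primeRange (θ := 0.001) (by norm_num)),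
    eventually_ge_atTop (10 ^ 6), (tendsto_log_atTop).eventually_ge_atTop 10,
    eventually_log_pow_le (10 ^ 6) 2] with v hM hv hlv hlv2 x z L hx hL hz
  have hv0 : 0 < v := by linarith
  have hv1 : 1 ≤ v := by linarith
  have hL0 : 1000 ≤ L := by linarith
  have hl1 : 1 ≤ log L := by
    rw [le_log_iff_exp_le (by linarith)]
    have := exp_one_lt_d9; linarith
  have hlL : log L ≤ L := by have := log_le_sub_one_of_pos (show 0 < L by linarith); linarith
  have hvv : v ≤ v ^ 100 := le_self_pow₀ hv1 (by norm_num)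
  have hL2 : 100 * L ^ 2 ≤ v ^ 100 := by rw [hL]; linarith
  have hx0 : 0 < x := hx ▸ exp_pos _
  have hz' : z = exp (v ^ 100 * (log L / (4 * L))) := by
    rw [hz, hx, ← exp_mul]
  have hlz : log z = v ^ 100 * log L / (4 * L) := by
    rw [hz', log_exp]; ring
  have hlu : log (v ^ 2000) = 20 * L := by rw [log_pow, hL]; push_cast; ring
  have huz : v ^ 2000 ≤ z := by
    rw [← log_le_log_iff (by positivity) (hz' ▸ exp_pos _), hlz, hlu,
      le_div_iff₀ (by linarith)]
    calc 20 * L * (4 * L) = 80 * L ^ 2 * 1 := by ring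
      _ ≤ v ^ 100 * log L := by gcongr; nlinarith
  refine ⟨huz, ?_, fun B₀ => ?_⟩
  · rw [hz', le_div_iff₀ two_pos, hx]
    have hq : log L / (4 * L) ≤ 1 / 4 := by
      rw [div_le_div_iff₀ (by linarith) (by norm_num)]; linarith
    calc exp (v ^ 100 * (log L / (4 * L))) * 2
        ≤ exp (v ^ 100 * (1 / 4)) * exp 1 := by
          gcongr
          · have := add_one_le_exp 1; linarith
      _ = exp (v ^ 100 * (1 / 4) + 1) := (exp_add _ _).symm
      _ ≤ _ := exp_le_exp.2 (by linarith)
  obtain ⟨-, -, h1, h2⟩ := hM z huz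
  have hrat : log (v ^ 2000) / log z = 80 * L ^ 2 / (v ^ 100 * log L) := by
    rw [hlz, hlu]; field_simp; ring
  rw [hrat] at h1 h2
  rw [prod_inv_distrib]
  have hu : 1000 ≤ v ^ 2000 := le_trans (by linarith) (le_self_pow₀ hv1 (by norm_num))
  have hpos : ∀ s ∈ primeRange (v ^ 2000) z, 0 < 1 - 1 / (s : ℝ) ∧ 0.999 ≤ 1 - 1 / (s : ℝ) := by
    intro s hs
    have h3 : 1000 ≤ (s : ℝ) := hu.trans ((mem_primeRange (by positivity)).1 hs).2.1.le
    have : 1 / (s : ℝ) ≤ 1 / 1000 := by gcongr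
    constructor <;> linarith
  set F := ∏ s ∈ (primeRange (v ^ 2000) z).filter (· ≠ B₀), (1 - 1 / (s : ℝ)) with hF
  have hF0 : 0 < F := prod_pos fun s hs => (hpos s (mem_filter.1 hs).1).1
  have hsplit := prod_filter_mul_prod_filter_not (primeRange (v ^ 2000) z) (· ≠ B₀)
    fun s : ℕ => 1 - 1 / (s : ℝ)
  rw [← hF] at hsplit
  have hG : 0.999 ≤ ∏ s ∈ (primeRange (v ^ 2000) z).filter (fun s => ¬s ≠ B₀), (1 - 1 / (s : ℝ)) ∧
      ∏ s ∈ (primeRange (v ^ 2000) z).filter (fun s => ¬s ≠ B₀), (1 - 1 / (s : ℝ)) ≤ 1 := by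
    refine ⟨?_, prod_le_one (fun s hs => (hpos s (mem_filter.1 hs).1).1.le) fun s _ =>
      sub_le_self _ (by positivity)⟩
    simp only [not_not, filter_eq']
    split_ifs with h
    · rw [prod_singleton]; exact (hpos _ h).2
    · norm_num
  have hD : 0 < v ^ 100 * log L := by positivity
  have h3 : F * 0.999 ≤ 80.08 * L ^ 2 / (v ^ 100 * log L) := by
    calc F * 0.999 ≤ F * _ := mul_le_mul_of_nonneg_left hG.1 hF0.le
      _ ≤ _ := hsplit.trans_le h2
      _ = _ := by ring
  have h4 : 79.92 * L ^ 2 / (v ^ 100 * log L) ≤ F := by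
    calc _ = (1 - 0.001) * (80 * L ^ 2 / (v ^ 100 * log L)) := by ring
      _ ≤ _ := h1
      _ = _ := hsplit.symm
      _ ≤ F := mul_le_of_le_one_right hF0.le hG.2
  have hL20 : 0 < L ^ 2 := by positivity
  constructor
  · rw [← one_div, div_le_div_iff₀ (by positivity) hF0]
    rw [le_div_iff₀ hD] at h3
    nlinarith
  · rw [inv_le_comm₀ hF0 (by positivity)]
    refine le_trans ?_ h4
    rw [← one_div, div_le_div_iff₀ (by positivity) hD, one_mul, mul_comm]
    refine mul_le_mul_of_nonneg_right ?_ (by positivity)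
    nlinarith

lemma eventually_exists_stages {θ : ℝ} (hθ : 0 < θ) (hθ1 : θ ≤ 1) : ∀ᶠ v : ℝ in atTop, ∃ J : ℕ,
    100 * log v * (3 / 4) ^ J ≤ θ ∧ 1 / v ≤ 0.116 * (3 / 4) ^ J ∧ (J : ℝ) ≤ v := by
  filter_upwards [eventually_ge_atTop 1, (tendsto_log_atTop).eventually_ge_atTop 1,
    eventually_log_pow_le (1200 / θ) 1] with v hv hlv hlv2
  have hv0 : 0 < v := by linarith
  obtain ⟨n, h1, h2⟩ := exists_nat_pow_near_of_lt_one (x := θ / (100 * log v))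
    (y := (3 / 4 : ℝ)) (by positivity) (by rw [div_le_one (by positivity)]; linarith)
    (by norm_num) (by norm_num)
  rw [lt_div_iff₀ (by positivity)] at h1
  rw [div_le_iff₀ (by positivity)] at h2
  rw [pow_one, div_mul_eq_mul_div, div_le_iff₀ hθ] at hlv2
  have h3 : 1 / v ≤ 0.116 * (3 / 4) ^ (n + 1) := by
    rw [div_le_iff₀ hv0, pow_succ]
    have : log v * 1200 ≤ log v * (v * ((3 / 4) ^ n * 100)) := by nlinarith
    have := le_of_mul_le_mul_left this (by linarith)
    linarith
  refine ⟨n + 1, by linarith, h3, ?_⟩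
  have h4 := one_add_mul_le_pow (a := (1 / 3 : ℝ)) (by norm_num) (n + 1)
  have h5 : (3 / 4 : ℝ) ^ (n + 1) * (1 + 1 / 3) ^ (n + 1) = 1 := by
    rw [← mul_pow]; norm_num
  rw [div_le_iff₀ hv0] at h3
  have h6 : (0 : ℝ) < (3 / 4) ^ (n + 1) := by positivity
  have h7 : (3 / 4 : ℝ) ^ (n + 1) * (1 + 1 / 3) ^ (n + 1)
      ≤ (3 / 4 : ℝ) ^ (n + 1) * (0.116 * v) := by linarith
  have := le_of_mul_le_mul_left h7 h6
  linarith

lemma exp_bounds {v : ℝ} {H : ℕ} (hv : 10 ^ 6 ≤ v) (hH : (H : ℝ) ≤ v ^ 90) :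
    v ^ 2000 ≤ exp (0.01 * v ^ 100) ∧ (v ^ 101) ^ (3 * H) ≤ exp (0.01 * v ^ 100) ∧
      1 ≤ exp (0.01 * v ^ 100) * (3 / 4 : ℝ) ^ (3 * H) := by
  have hv0 : 0 < v := by linarith
  have hv1 : 1 ≤ v := by linarith
  have hlv : log v ≤ v := by have := log_le_sub_one_of_pos hv0; linarith
  have hlv0 : 0 ≤ log v := log_nonneg hv1
  have h91 : v ^ 91 * 10 ^ 6 ≤ v ^ 91 * v := mul_le_mul_of_nonneg_left hv (by positivity)
  have h92 : v ^ 91 * v ≤ v ^ 100 := by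
    rw [← pow_succ]; exact pow_le_pow_right₀ hv1 (by norm_num)
  have h1 : v ≤ v ^ 91 := le_self_pow₀ hv1 (by norm_num)
  refine ⟨?_, ?_, ?_⟩
  · rw [← log_le_iff_le_exp (by positivity), log_pow]
    push_cast
    linarith
  · rw [← log_le_iff_le_exp (by positivity), log_pow, log_pow]
    push_cast
    have : (H : ℝ) * log v ≤ v ^ 91 := by
      rw [pow_succ]
      exact mul_le_mul hH hlv hlv0 (by positivity)
    linarith
  · have h2 : exp (-1) ≤ 3 / 4 := by
      rw [exp_neg, inv_le_comm₀ (exp_pos _) (by norm_num)]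
      have := add_one_le_exp 1
      norm_num
      linarith
    have h90 : v ^ 90 ≤ v ^ 91 := pow_le_pow_right₀ hv1 (by norm_num)
    calc (1 : ℝ) ≤ exp (0.01 * v ^ 100 - (3 * H : ℕ)) := by
          refine one_le_exp ?_
          push_cast
          linarith
      _ = exp (0.01 * v ^ 100) * exp (-1) ^ (3 * H) := by
          rw [← exp_nat_mul, ← exp_add]; ring_nf
      _ ≤ _ := by gcongr

lemma eventually_card_primes : ∀ᶠ x : ℝ in atTop, (∀ B₀ : ℕ, 0.49 * x / log x
      ≤ ((Icc 1 ⌊x⌋₊).filter fun p : ℕ => p.Prime ∧ x / 2 < p ∧ p ≠ B₀).card) ∧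
    ∀ y, x ≤ y → (((Icc 1 ⌊y⌋₊).filter Nat.Prime).card : ℝ) ≤ 1.01 * y / log x := by
  have h1 := (tendsto_primeCount (a := 0) (b := 1) le_rfl zero_le_one).eventually_le_const
    (show (1 : ℝ) - 0 < 1.01 by norm_num)
  have h2 := (tendsto_primeCount (a := 1 / 2) (b := 1) (by norm_num)
    (by norm_num)).eventually_const_le (show (0.499 : ℝ) < 1 - 1 / 2 by norm_num)
  have h3 := eventually_log_pow_le 200 1
  filter_upwards [eventually_ge_atTop 3, h2, h3, eventually_forall_ge_atTop.2 h1]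
    with x hx h2 h3 h1
  have hl : 0 < log x := log_pos (by linarith)
  refine ⟨fun B₀ => ?_, fun y hxy => ?_⟩
  · rw [le_div_iff₀ (by linarith)] at h2
    rw [div_le_iff₀ hl]
    have : primeCount (1 / 2 * x) (1 * x)
        ≤ ((Icc 1 ⌊x⌋₊).filter fun p : ℕ => p.Prime ∧ x / 2 < p ∧ p ≠ B₀).card + 1 := by
      refine le_trans (card_le_card fun p hp => ?_) (card_insert_le B₀ _)
      simp only [one_mul, mem_filter] at hp
      rw [mem_insert, mem_filter]
      by_cases h : p = B₀
      · exact Or.inl h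
      · exact Or.inr ⟨hp.1, hp.2.1, by linarith [hp.2.2], h⟩
    have : (primeCount (1 / 2 * x) (1 * x) : ℝ) ≤ (((Icc 1 ⌊x⌋₊).filter fun p : ℕ =>
      p.Prime ∧ x / 2 < p ∧ p ≠ B₀).card : ℝ) + 1 := by exact_mod_cast this
    rw [pow_one] at h3
    nlinarith
  · have h4 := h1 y hxy
    have hy : 0 < y := by linarith
    have hlxy : log x ≤ log y := log_le_log (by linarith) hxy
    rw [div_le_iff₀ hy] at h4
    rw [le_div_iff₀ hl]
    refine le_trans ?_ h4
    refine mul_le_mul (Nat.cast_le.2 (card_le_card fun p hp => ?_)) hlxy hl.le (by positivity)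
    obtain ⟨h5, h6⟩ := mem_filter.1 hp
    rw [one_mul, zero_mul]
    exact mem_filter.2 ⟨h5, h6, by exact_mod_cast h6.pos⟩

lemma stage_growth {K L l x y b c r N : ℝ} (hK : 0 < K) (hL : 0 < L) (hl : 0 < l) (hx : 0 < x)
    (hc : 0 < c) (hc1 : c ≤ 4.11 / 10 ^ 6) (hr : 0 < r) (hy : y = c * x * K * l / L)
    (hb : K * l / (80.5 * L ^ 2) ≤ b) (hN : 0.116 * r * x / K ≤ N) :
    0.288 * (1 + 1 / 100) ≤ b / r * (8.5 / 10 ^ 4 * (K * L) * N / y) * (1 - 2 * (1 / 100)) := by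
  have hy0 : 0 < y := hy ▸ by positivity
  calc 0.288 * (1 + 1 / 100) ≤ 8.5 / 10 ^ 4 * 0.116 * (1 - 2 * (1 / 100)) / (80.5 * c) := by
        rw [le_div_iff₀ (by positivity)]; linarith
    _ = K * l / (80.5 * L ^ 2) / r * (8.5 / 10 ^ 4 * (K * L) * (0.116 * r * x / K) / y)
        * (1 - 2 * (1 / 100)) := by rw [hy]; field_simp
    _ ≤ _ := by
        have : (0 : ℝ) ≤ 1 - 2 * (1 / 100) := by norm_num
        have : 0 ≤ b := le_trans (by positivity) hb
        gcongr

lemma leftover_le {K L l x y b c r n ε θ : ℝ} (hK : 0 < K) (hL : 0 < L) (hl : 0 < l) (hx : 0 < x)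
    (hc : 0 < c) (hc1 : c ≤ 4.11 / 10 ^ 6) (hr : 0 < r) (hy : y = c * x * K * l / L)
    (hb : K * l / (80.5 * L ^ 2) ≤ b) (hn0 : 0 ≤ n) (hn : n ≤ 1.01 * y / K) (hε0 : 0 ≤ ε)
    (hε : ε ≤ 1) (hθ : L * r ≤ θ) :
    n * ((1 + ε) * r / b) ≤ θ / 2 * (x / K) := by
  have hb0 : 0 < K * l / (80.5 * L ^ 2) := by positivity
  calc n * ((1 + ε) * r / b)
      ≤ 1.01 * y / K * ((1 + 1) * r / (K * l / (80.5 * L ^ 2))) := by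
        have : 0 ≤ y := hy ▸ by positivity
        have : 0 ≤ (1 + ε) * r / b := div_nonneg (by positivity) (hb0.le.trans hb)
        gcongr
    _ = 1.01 * 2 * 80.5 * c * (L * r) * (x / K) := by rw [hy]; field_simp; norm_num
    _ ≤ 1.01 * 2 * 80.5 * (4.11 / 10 ^ 6) * θ * (x / K) := by gcongr
    _ ≤ 1 / 2 * θ * (x / K) := by
        have : 0 ≤ θ := le_trans (by positivity) hθ
        gcongr
        norm_num
    _ = _ := by ring

lemma sum_ceil_le {A : ℝ} (hA : 0 ≤ A) (J : ℕ) :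
    ((∑ i ∈ range J, ⌈A * (3 / 4 : ℝ) ^ i⌉₊ : ℕ) : ℝ) ≤ 4 * A + J := by
  push_cast
  calc ∑ i ∈ range J, (⌈A * (3 / 4 : ℝ) ^ i⌉₊ : ℝ) ≤ ∑ i ∈ range J, (A * (3 / 4 : ℝ) ^ i + 1) :=
        sum_le_sum fun i _ => (Nat.ceil_lt_add_one (by positivity)).le
    _ = A * ∑ i ∈ range J, (3 / 4 : ℝ) ^ i + J := by
        rw [sum_add_distrib, mul_sum]; simp
    _ ≤ A * 4 + J := by
        gcongr
        rw [geom_sum_eq (by norm_num), div_le_iff_of_neg (by norm_num)]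
        have : (0 : ℝ) < (3 / 4) ^ J := by positivity
        linarith
    _ = _ := by ring

lemma sieve_range_bounds {v x y L c : ℝ} (hv : 10 ^ 6 ≤ v) (hx : x = exp (v ^ 100))
    (hL : L = 100 * log v) (hL0 : 1000 ≤ L) (hLv : L ≤ v)
    (hy : y = c * x * v ^ 100 * log L / L) (hc : 1 / 10 ^ 6 ≤ c) (hc1 : c ≤ 4.11 / 10 ^ 6) :
    1 ≤ log L ∧ v ^ 92 * x ≤ y ∧ y ≤ v ^ 100 * x ∧ 0 ≤ log y ∧
      log y ≤ 2 * v ^ 100 := by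
  have hv0 : 0 < v := by linarith
  have hv1 : 1 ≤ v := by linarith
  have hx0 : 0 < x := hx ▸ exp_pos _
  have hx1 : 1 ≤ x := hx ▸ one_le_exp (by positivity)
  have hl1 : 1 ≤ log L := by
    rw [le_log_iff_exp_le (by linarith)]
    have := exp_one_lt_d9; linarith
  have hlL : log L ≤ L := by
    have := log_le_sub_one_of_pos (show 0 < L by linarith); linarith
  have hc0 : 0 < c := by linarith
  have hy1 : v ^ 92 * x ≤ y := by
    rw [hy, le_div_iff₀ (by linarith)]
    calc v ^ 92 * x * L ≤ v ^ 92 * x * v := by gcongr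
      _ = 1 / 10 ^ 6 * x * (v ^ 93 * 10 ^ 6) * 1 := by ring
      _ ≤ c * x * (v ^ 93 * v) * log L := by gcongr
      _ ≤ c * x * v ^ 100 * log L := by
          rw [← pow_succ]
          gcongr
          · norm_num
  have hy2 : y ≤ v ^ 100 * x := by
    rw [hy, div_le_iff₀ (by linarith)]
    calc c * x * v ^ 100 * log L ≤ 1 * x * v ^ 100 * L := by gcongr; linarith
      _ = _ := by ring
  have hxy : x ≤ y := le_trans (le_mul_of_one_le_left hx0.le (one_le_pow₀ hv1)) hy1
  have hy0 : 0 < y := by linarith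
  have hlogy0 : 0 ≤ log y := log_nonneg (hx1.trans hxy)
  have hlogy : log y ≤ 2 * v ^ 100 := by
    calc log y ≤ log (v ^ 100 * x) := log_le_log hy0 hy2
      _ = L + v ^ 100 := by
          rw [log_mul (by positivity) hx0.ne', log_pow, hx, log_exp, hL]; push_cast; rfl
      _ ≤ _ := by have : v ≤ v ^ 100 := le_self_pow₀ hv1 (by norm_num)
                  linarith
  exact ⟨hl1, hy1, hy2, hlogy0, hlogy⟩

set_option maxHeartbeats 4000000 in
/-- Almost all primes in `(x, y]` can be sieved out by residue classes to the primes in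
`(log ^ 20 x, z]` and `(x / 2, x]`. -/
lemma eventually_exists_sieve {θ : ℝ} (hθ : 0 < θ) (hθ1 : θ ≤ 1) : ∀ᶠ v : ℝ in atTop,
    ∀ x y z L c : ℝ, x = exp (v ^ 100) → L = 100 * log v →
      y = c * x * v ^ 100 * log L / L → 1 / 10 ^ 6 ≤ c → c ≤ 4.11 / 10 ^ 6 →
      z = x ^ (log L / (4 * L)) → ∀ B₀ : ℕ, ∃ a : ℕ → ℤ,
      ∀ F : Finset ℕ, (∀ q ∈ F, (q.Prime ∧ x < q ∧ (q : ℝ) ≤ y ∧ q ≠ B₀) ∧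
        ∀ m : ℕ, m.Prime → m ≠ B₀ → (v ^ 2000 < m ∧ (m : ℝ) ≤ z ∨ x / 2 < m ∧ (m : ℝ) ≤ x) →
          ¬(q : ℤ) ≡ a m [ZMOD m]) → (F.card : ℝ) ≤ θ * (x / v ^ 100) := by
  classical
  have hexp : Tendsto (fun v : ℝ => exp (v ^ 100)) atTop atTop :=
    tendsto_exp_atTop.comp (tendsto_pow_atTop (by norm_num))
  filter_upwards [eventually_exists_weights, eventually_residue_product,
    eventually_exists_stages hθ hθ1, hexp.eventually eventually_card_primes,
    eventually_ge_atTop (10 ^ 6), eventually_ge_atTop (4 / θ),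
    (tendsto_log_atTop).eventually_ge_atTop 10, eventually_log_pow_le 100 1]
    with v hW hR ⟨J, hJθ, hJv, hJ⟩ hP hv hvθ hlv hlv2 x y z L c hx hL hy hc hc1 hz B₀
  obtain ⟨huz, hzx, hb⟩ := hR x z L hx hL hz
  obtain ⟨hb1, hb2⟩ := hb B₀
  rw [← hx, hx, log_exp, ← hx] at hP
  obtain ⟨hP1, hP2⟩ := hP
  have hv0 : 0 < v := by linarith
  have hv1 : 1 ≤ v := by linarith
  have hx0 : 0 < x := hx ▸ exp_pos _
  have hL0 : 1000 ≤ L := by linarith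
  have hLv : L ≤ v := by rw [pow_one] at hlv2; linarith
  have hc0 : 0 < c := by linarith
  set H := ⌊v ^ 90⌋₊ with hH
  have hH1 : (H : ℝ) ≤ v ^ 90 := Nat.floor_le (by positivity)
  have hH0 : 1 ≤ H := Nat.le_floor (by exact_mod_cast one_le_pow₀ hv1)
  obtain ⟨hE1, hE2, hE3⟩ := exp_bounds hv hH1
  set E := exp (0.01 * v ^ 100) with hE
  have hEx : x = E ^ 100 := by rw [hE, ← exp_nat_mul, hx]; congr 1; push_cast; ring
  have hEone : 1 ≤ E := (one_le_pow₀ hv1).trans hE1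
  have hxbig : v ^ 2000 ≤ x := hE1.trans (hEx ▸ le_self_pow₀ hEone (by norm_num))
  have hκE : exp (-(0.59 * v ^ 100)) * E ^ 59 ≤ 1 := by
    rw [hE, ← exp_nat_mul, ← exp_add]
    refine exp_le_one_iff.2 ?_
    push_cast; linarith
  obtain ⟨hl1, hy1, hy2, hlogy0, hlogy⟩ := sieve_range_bounds hv hx hL hL0 hLv hy hc hc1
  have hxy : x ≤ y := le_trans (le_mul_of_one_le_left hx0.le (one_le_pow₀ hv1)) hy1
  have hy0 : 0 < y := by linarith
  obtain ⟨hr1, hr2, hr3⟩ := residue_error_le hv hH1 hlogy0 hlogy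
  obtain ⟨m, hm0, hm1, hm2, hm3⟩ := hW x y hx hy1 hy2
  set P := (Icc 1 ⌊x⌋₊).filter fun p : ℕ => p.Prime ∧ x / 2 < p ∧ p ≠ B₀ with hPdef
  set S := (primeRange (v ^ 2000) z).filter (· ≠ B₀) with hSdef
  set b := ∏ s ∈ S, (1 - 1 / (s : ℝ))⁻¹ with hbdef
  set N : ℕ → ℕ := fun i => ⌈0.116 * x / v ^ 100 * (3 / 4 : ℝ) ^ i⌉₊ with hN
  have hsumN : ∑ i ∈ range J, N i ≤ P.card := by
    have h1 := sum_ceil_le (A := 0.116 * x / v ^ 100) (by positivity) J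
    have h2 := hP1 B₀
    have h3 : v ≤ 0.001 * x / v ^ 100 := by
      rw [le_div_iff₀ (by positivity)]
      calc v * v ^ 100 = v ^ 101 := by ring
        _ ≤ 0.001 * (v * v ^ 101) := by nlinarith [one_le_pow₀ hv1 (n := 101)]
        _ ≤ 0.001 * x := by
          rw [← pow_succ']
          gcongr
          exact (pow_le_pow_right₀ hv1 (by norm_num)).trans hxbig
    have h4 : 0 < x / v ^ 100 := by positivity
    have : ((∑ i ∈ range J, N i : ℕ) : ℝ) ≤ P.card := by
      refine h1.trans (le_trans ?_ h2)
      rw [mul_div_assoc] at h3 ⊢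
      rw [mul_div_assoc]
      linarith
    exact_mod_cast this
  obtain ⟨PP, hPP1, hPP2, hPP3⟩ := exists_disjoint_subsets P N J hsumN
  have hNge : ∀ i, 0.116 * (3 / 4) ^ i * x / v ^ 100 ≤ N i := fun i =>
    le_trans (by rw [mul_right_comm, mul_div_right_comm]) (Nat.le_ceil _)
  have hNge' : ∀ i < J, x / v ^ 101 ≤ N i := fun i hi => by
    refine le_trans ?_ (hNge i)
    have : (3 / 4 : ℝ) ^ J ≤ (3 / 4) ^ i := pow_le_pow_of_le_one (by norm_num) (by norm_num) hi.le
    calc x / v ^ 101 = 1 / v * x / v ^ 100 := by field_simp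
      _ ≤ 0.116 * (3 / 4) ^ J * x / v ^ 100 := by gcongr
      _ ≤ _ := by gcongr
  have hPmem : ∀ i < J, ∀ p ∈ PP i, p.Prime ∧ x / 2 < p ∧ (p : ℝ) ≤ x ∧ p ≠ B₀ := fun i hi p hp => by
    obtain ⟨h1, h2, h3, h4⟩ := mem_filter.1 (hPP1 i hi hp)
    exact ⟨h2, h3, ((mem_Icc_floor hx0.le).1 h1).2, h4⟩
  set τs : ℕ → ℝ := fun i => 8.5 / 10 ^ 4 * (v ^ 100 * L) * N i / y with hτs
  have hτ : ∀ i < J, 1 / v ^ 102 ≤ τs i := fun i hi => by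
    have h1 := hNge' i hi
    calc 1 / v ^ 102 = 8.5 / 10 ^ 4 * (v ^ 100 * (10 ^ 4 / 8.5 / v)) * (x / v ^ 101) / (v ^ 100 * x) := by
          field_simp
      _ ≤ 8.5 / 10 ^ 4 * (v ^ 100 * L) * (x / v ^ 101) / (v ^ 100 * x) := by
          gcongr
          rw [div_le_iff₀ hv0]
          nlinarith
      _ ≤ _ := by simp only [hτs]; gcongr
  set Q0 := (Icc 1 ⌊y⌋₊).filter fun q : ℕ => q.Prime ∧ x < q ∧ q ≠ B₀ with hQ0
  have hQmem : ∀ q ∈ Q0, q.Prime ∧ x < q ∧ (q : ℝ) ≤ y := fun q hq => by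
    obtain ⟨h1, h2, h3, -⟩ := mem_filter.1 hq
    exact ⟨h2, h3, ((mem_Icc_floor hy0.le).1 h1).2⟩
  set bad : ℕ → Finset ℕ := fun i => Q0.filter fun q : ℕ =>
    ∑ p ∈ PP i, ∑ j ∈ Icc 1 H, m p ((q : ℤ) - j * p) < τs i with hbad
  have hbadc : ∀ i < J, ((bad i).card : ℝ) ≤ x / v ^ 110 := fun i hi => by
    have := hm3 (PP i) Q0 (fun p hp => ⟨(hPmem i hi p hp).1, (hPmem i hi p hp).2.1,
      (hPmem i hi p hp).2.2.1⟩) (by rw [hPP2 i hi]; exact hNge' i hi) hQmem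
    rwa [hPP2 i hi, ← hL] at this
  set V := Q0.filter fun q : ℕ => ∀ i < J,
    τs i ≤ ∑ p ∈ PP i, ∑ j ∈ Icc 1 H, m p ((q : ℤ) - j * p) with hV
  have hVmem : ∀ q ∈ V, q.Prime ∧ x < q ∧ (q : ℝ) ≤ y := fun q hq => hQmem q (mem_filter.1 hq).1
  have hVc : (V.card : ℝ) ≤ 1.01 * y / v ^ 100 := by
    refine le_trans (Nat.cast_le.2 (card_le_card fun q hq => ?_)) (hP2 y hxy)
    obtain ⟨h1, h2⟩ := mem_filter.1 (mem_filter.1 hq).1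
    exact mem_filter.2 ⟨h1, h2.1⟩
  have hVc2 : (V.card : ℝ) ≤ v ^ 100 * x := by
    refine hVc.trans (le_trans ?_ hy2)
    rw [div_le_iff₀ (by positivity), mul_comm]
    have : v ≤ v ^ 100 := le_self_pow₀ hv1 (by norm_num)
    gcongr
    linarith
  have hSmem : ∀ s ∈ S, s.Prime ∧ v ^ 2000 < (s : ℝ) ∧ (s : ℝ) ≤ z ∧ s ≠ B₀ := fun s hs => by
    obtain ⟨h1, h2⟩ := mem_filter.1 hs
    obtain ⟨h3, h4, h5⟩ := (mem_primeRange (by positivity)).1 h1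
    exact ⟨h3, h4, h5, h2⟩
  have hS2 : ∑ s ∈ S, (1 / (s : ℝ)) ^ 2 ≤ 2 / v ^ 2000 :=
    (sum_le_sum_of_subset_of_nonneg (filter_subset _ _) fun _ _ _ => by positivity).trans
      (sum_primeRange_inv_sq_le (le_trans (by linarith) (le_self_pow₀ hv1 (by norm_num))) z)
  have hb1' : 1 ≤ b := by
    refine le_trans ?_ hb1
    rw [one_le_div (by positivity)]
    have : v ^ 4 ≤ v ^ 100 := pow_le_pow_right₀ hv1 (by norm_num)
    calc 80.5 * L ^ 2 ≤ v * v ^ 2 := by gcongr; linarith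
      _ = v ^ 3 := by ring
      _ ≤ v ^ 100 := pow_le_pow_right₀ hv1 (by norm_num)
      _ ≤ _ := le_mul_of_one_le_right (by positivity) hl1
  have hstate := exists_initial_state (V := V) (S := S) (H := H) (Y := y) (ε := 1 / v ^ 1500)
    (fun s hs => ⟨(hSmem s hs).1, (hSmem s hs).2.1⟩) hS2
    (by linarith [hxbig, one_le_pow₀ hv1 (n := 2000)]) (fun q hq => (hVmem q hq).2.2)
    (by positivity) hr1 hr2 hr3
  have hE59 : (0 : ℝ) ≤ exp (-(0.59 * v ^ 100)) := (exp_pos _).le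
  have hρb : 1 / v ≤ (3 / 4 : ℝ) ^ J := hJv.trans (by
    have : (0 : ℝ) < (3 / 4) ^ J := by positivity
    linarith)
  have hxH : (H : ℝ) ≤ x / 2 := by
    have : v ^ 90 * 2 ≤ v ^ 90 * v := by gcongr; linarith
    have : v ^ 90 * v ≤ v ^ 2000 := by
      rw [← pow_succ]; exact pow_le_pow_right₀ hv1 (by norm_num)
    linarith
  have hXx : (⌊x⌋₊ : ℝ) ≤ x := Nat.floor_le hx0.le
  have hstep := state_error_le (ρ := 3 / 4) (X := (⌊x⌋₊ : ℝ)) (by linarith) hE1 rfl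
    ((pow_le_pow_right₀ (one_le_pow₀ hv1) (by omega)).trans hE2) (by norm_num) hE3 hH1 hJ hE59 hκE
    (Nat.cast_nonneg _) (hXx.trans hEx.le)
  obtain ⟨U0, ⟨a₀, rfl⟩, n, hn⟩ := hstate.exists_classes m PP J (X := ⌊x⌋₊) (Y := ⌊y⌋₊)
    (η := 1 / 100) (κ := exp (-(0.59 * v ^ 100))) (t := 0.288) (τ := 1 / v ^ 102) (ρ := 3 / 4)
    (bm := v ^ 101) (εm := 2 / v ^ 1500) τs hPP3 hb1' (by positivity) hm0
    (fun i hi p hp => by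
      obtain ⟨h1, h2, h3, -⟩ := hPmem i hi p hp
      exact ⟨h1, by exact_mod_cast hxH.trans h2.le, Nat.le_floor h3, hm2 p h1 h2, hm1 p h1 h2⟩)
    (fun q hq => ⟨(hVmem q hq).1.pos, Nat.le_floor (hVmem q hq).2.2⟩) hH0 hE59 (by norm_num)
    (by norm_num) (by positivity) hτ (fun i hi q hq => (mem_filter.1 hq).2 i hi)
    (fun i _ => stage_growth (by positivity) (by linarith) (by linarith) hx0 hc0 hc1 (by positivity)
      hy hb1 (hNge i))
    (by norm_num) (by norm_num)
    (by
      rw [exp_neg, inv_le_comm₀ (exp_pos _) (by norm_num)]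
      refine le_trans ?_ (sum_le_exp_of_nonneg (by norm_num) 4)
      norm_num [sum_range_succ, Nat.factorial])
    (by
      rw [div_le_iff₀ (by positivity)]
      calc b ≤ v ^ 100 := hb2
        _ = v ^ 101 * (1 / v) := by field_simp
        _ ≤ _ := by gcongr)
    (by
      rw [show (2 : ℝ) / v ^ 1500 = 1 / v ^ 1500 + 1 / v ^ 1500 by ring]
      gcongr)
    (by
      rw [div_le_one (by positivity)]
      exact le_trans (by linarith) (le_self_pow₀ hv1 (by norm_num)))
  refine ⟨fun k => if (k : ℝ) ≤ z then a₀ k else n k, fun F hF => ?_⟩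
  have hsub : F ⊆ (range J).biUnion bad ∪
      ((V.filter fun q => ∀ s ∈ S, q % s ≠ a₀ s).filter fun q : ℕ =>
        ∀ i < J, ∀ p ∈ PP i, ¬(q : ℤ) ≡ n p [ZMOD p]) := fun q hq => by
    obtain ⟨⟨h1, h2, h3, h4⟩, h5⟩ := hF q hq
    have hqQ : q ∈ Q0 := mem_filter.2 ⟨(mem_Icc_floor hy0.le).2 ⟨h1.one_le, h3⟩, h1, h2, h4⟩
    by_cases hV' : q ∈ V
    · refine mem_union_right _ (mem_filter.2 ⟨mem_filter.2 ⟨hV', fun s hs h => ?_⟩,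
        fun i hi p hp => ?_⟩)
      · obtain ⟨g1, g2, g3, g4⟩ := hSmem s hs
        refine h5 s g1 g4 (Or.inl ⟨g2, g3⟩) ?_
        simp only [if_pos g3, ← h]
        push_cast
        exact (Int.mod_modEq _ _).symm
      · obtain ⟨g1, g2, g3, g4⟩ := hPmem i hi p hp
        have := h5 p g1 g4 (Or.inr ⟨g2, g3⟩)
        simpa only [if_neg (not_le.2 (hzx.trans_lt g2))] using this
    · have : ∃ i < J, ∑ p ∈ PP i, ∑ j ∈ Icc 1 H, m p ((q : ℤ) - j * p) < τs i := by
        by_contra! hcon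
        exact hV' (mem_filter.2 ⟨hqQ, hcon⟩)
      obtain ⟨i, hi, h⟩ := this
      exact mem_union_left _ (mem_biUnion.2 ⟨i, mem_range.2 hi, mem_filter.2 ⟨hqQ, h⟩⟩)
  have hcover := covering_error_le (x := x) (n := V.card) hv hE1 hE2 hH1 hJ hE59 (by positivity) hκE
    hx0.le hVc2
  have hleft := leftover_le (K := v ^ 100) (L := L) (r := (3 / 4) ^ J) (ε := 2 / v ^ 1500) (θ := θ)
    (by positivity) (by linarith) (by linarith) hx0 hc0 hc1 (by positivity) hy hb1
    (Nat.cast_nonneg _) hVc (by positivity)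
    (by
      rw [div_le_one (by positivity)]
      exact le_trans (by linarith) (le_self_pow₀ hv1 (by norm_num))) (hL ▸ hJθ)
  have hbadsum : (((range J).biUnion bad).card : ℝ) ≤ J * (x / v ^ 110) := by
    calc (((range J).biUnion bad).card : ℝ) ≤ ∑ i ∈ range J, ((bad i).card : ℝ) := by
          exact_mod_cast card_biUnion_le
      _ ≤ ∑ _i ∈ range J, x / v ^ 110 := sum_le_sum fun i hi => hbadc i (mem_range.1 hi)
      _ = _ := by simp
  have hθv : 1 / v ≤ θ / 4 := by
    rw [div_le_iff₀ hv0]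
    rw [div_le_iff₀ hθ] at hvθ
    linarith
  have hsmall : ∀ k : ℕ, 101 ≤ k → x / v ^ k ≤ θ / 4 * (x / v ^ 100) := fun k hk => by
    calc x / v ^ k ≤ x / v ^ 101 := by gcongr
      _ = 1 / v * (x / v ^ 100) := by field_simp
      _ ≤ _ := by gcongr
  have hJx : J * (x / v ^ 110) ≤ x / v ^ 109 := by
    calc J * (x / v ^ 110) ≤ v * (x / v ^ 110) := by gcongr
      _ = _ := by field_simp
  have h109 := hsmall 109 (by norm_num)
  have h200 := hsmall 200 (by norm_num)
  have hF' : (F.card : ℝ) ≤ _ := (Nat.cast_le.2 ((card_le_card hsub).trans (card_union_le _ _))).trans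
    (by push_cast; exact add_le_add hbadsum hn)
  linarith

lemma exists_subset_near {ι : Type*} [DecidableEq ι] (F : Finset ι → ℝ) {k T : ℝ} (hk : 0 ≤ k)
    (N : Finset ι) (hF : ∀ D ⊆ N, ∀ m ∈ N, F D ≤ F (insert m D) + k) (h0 : T ≤ F ∅) (hN : F N ≤ T) :
    ∃ D ⊆ N, T ≤ F D ∧ F D ≤ T + k := by
  induction N using Finset.induction_on with
  | empty => exact ⟨∅, le_rfl, h0, by linarith⟩
  | insert m N _ ih =>
    have hsub := subset_insert m N
    rcases le_total (F N) T with h | h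
    · obtain ⟨D, hD, h⟩ :=
        ih (fun D hD m hm => hF D (hD.trans hsub) m (hsub hm)) h
      exact ⟨D, hD.trans hsub, h⟩
    · exact ⟨N, hsub, h, by linarith [hF N hsub m (mem_insert_self _ _)]⟩

lemma card_filter_modEq_le {Q : Finset ℕ} {y l : ℝ} {m : ℕ} (hl : 0 < l) (hm : l ≤ m) (hy : 0 ≤ y)
    (hQ : ∀ q ∈ Q, 0 < q ∧ (q : ℝ) ≤ y) (a : ℤ) :
    ((Q.filter fun q : ℕ => (q : ℤ) ≡ a [ZMOD m]).card : ℝ) ≤ y / l + 1 := by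
  have hm0 : (0 : ℝ) < m := by linarith
  have h1 : (Q.filter fun q : ℕ => (q : ℤ) ≡ a [ZMOD m]).card
      ≤ ((Ioc (0 : ℤ) ⌊y⌋₊).filter (· ≡ a [ZMOD m])).card := by
    refine card_le_card_of_injOn (fun q => (q : ℤ)) (fun q hq => ?_) (Nat.cast_injective.injOn)
    obtain ⟨h1, h2⟩ := mem_filter.1 hq
    exact mem_coe.2 (mem_filter.2 ⟨mem_Ioc.2 ⟨Nat.cast_pos.2 (hQ q h1).1,
      Nat.cast_le.2 (Nat.le_floor (hQ q h1).2)⟩, h2⟩)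
  have h2 := (abs_le.1 (abs_card_Ioc_modEq_sub_le (W := m) (a := 0) (b := ⌊y⌋₊)
    (by positivity) a (by exact_mod_cast hm0))).2
  have h3 : ((⌊y⌋₊ : ℤ) - (0 : ℤ) : ℝ) / m ≤ y / l := by
    have := Nat.floor_le hy
    push_cast
    rw [sub_zero]
    gcongr
  have : ((Q.filter fun q : ℕ => (q : ℤ) ≡ a [ZMOD m]).card : ℝ) ≤ _ := Nat.cast_le.2 h1
  linarith

/-- Discarding some of the residue classes, one can prescribe the number of survivors. -/
lemma exists_classes_card_near {Q N : Finset ℕ} {x y l T : ℝ} (hl : 0 < l) (hy : 0 ≤ y)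
    (hN : ∀ m ∈ N, m.Prime ∧ l ≤ m ∧ (m : ℝ) ≤ x)
    (hQ : ∀ q ∈ Q, q.Prime ∧ x < q ∧ (q : ℝ) ≤ y) (a : ℕ → ℤ) (h0 : T ≤ Q.card)
    (hT : ((Q.filter fun q : ℕ => ∀ m ∈ N, ¬(q : ℤ) ≡ a m [ZMOD m]).card : ℝ) ≤ T) :
    ∃ c : ∀ m : ℕ, ZMod m, T ≤ (Q.filter fun q : ℕ => ∀ m ∈ N, (q : ZMod m) ≠ c m).card ∧
      ((Q.filter fun q : ℕ => ∀ m ∈ N, (q : ZMod m) ≠ c m).card : ℝ) ≤ T + (y / l + 1) := by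
  obtain ⟨D, hDN, hD⟩ := exists_subset_near
    (fun D : Finset ℕ => ((Q.filter fun q : ℕ => ∀ m ∈ D, ¬(q : ℤ) ≡ a m [ZMOD m]).card : ℝ)) (T := T)
    (show 0 ≤ y / l + 1 by positivity) N (fun D _ m hm => by
      have h1 := card_filter_modEq_le (m := m) hl (hN m hm).2.1 hy
        (fun q hq => ⟨(hQ q hq).1.pos, (hQ q hq).2.2⟩) (a m)
      refine le_trans ?_ (add_le_add_right h1 _)
      norm_cast
      refine le_trans (card_le_card fun q hq => ?_) (card_union_le _ _)
      obtain ⟨h2, h3⟩ := mem_filter.1 hq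
      simp only [mem_union, mem_filter, forall_mem_insert]
      tauto) (by simpa using h0) hT
  refine ⟨fun m => if m ∈ D then (a m : ZMod m) else 0, ?_⟩
  rw [filter_congr (q := fun q : ℕ => ∀ m ∈ D, ¬(q : ℤ) ≡ a m [ZMOD m]) fun q hq => ?_]
  · exact hD
  have key : ∀ m : ℕ, (q : ZMod m) = a m ↔ (q : ℤ) ≡ a m [ZMOD m] := fun m => by
    rw [← ZMod.intCast_eq_intCast_iff, Int.cast_natCast]
  refine ⟨fun h m hm => ?_, fun h m hm => ?_⟩
  · have := h m (hDN hm)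
    simpa only [if_pos hm, Ne, key] using this
  · beta_reduce
    split_ifs with hmD
    · exact fun h' => h m hmD ((key m).1 h')
    · rw [Ne, ZMod.natCast_eq_zero_iff, Nat.prime_dvd_prime_iff_eq (hN m hm).1 (hQ q hq).1]
      rintro rfl
      linarith [(hN m hm).2.2, (hQ m hq).2.1]

/-- Residue classes leaving a prescribed number of primes in `(α * y, β * y]` unsieved. -/
lemma eventually_exists_classes_card_near {A α β δ : ℝ} (hA : 1 ≤ A) (hα : 0 ≤ α) (hαβ : α < β)
    (hβ : β ≤ 1) (hδ : 0 < δ) : ∀ᶠ v : ℝ in atTop, ∀ x y z L c : ℝ,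
      x = exp (v ^ 100) → L = 100 * log v → y = c * x * v ^ 100 * log L / L →
      1 / 10 ^ 6 ≤ c → c ≤ 4.11 / 10 ^ 6 → z = x ^ (log L / (4 * L)) → ∀ B₀ : ℕ,
      ∃ a : ∀ m : ℕ, ZMod m, ∀ F : Finset ℕ,
      (∀ q, q ∈ F ↔ (q.Prime ∧ x < q ∧ (q : ℝ) ≤ y ∧ q ≠ B₀) ∧
        (∀ m : ℕ, m.Prime → m ≠ B₀ → (v ^ 2000 < m ∧ (m : ℝ) ≤ z ∨ x / 2 < m ∧ (m : ℝ) ≤ x) →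
          (q : ZMod m) ≠ a m) ∧ α * y < q ∧ (q : ℝ) ≤ β * y) →
      |(F.card : ℝ) - A * (β - α) * (x / v ^ 100)| ≤ δ * (A * (β - α) * (x / v ^ 100)) := by
  classical
  have hd : 0 < A * (β - α) := mul_pos (by linarith) (by linarith)
  have hexp : Tendsto (fun v : ℝ => exp (v ^ 100)) atTop atTop :=
    tendsto_exp_atTop.comp (tendsto_pow_atTop (by norm_num))
  have hcount := eventually_forall_ge_atTop.2 ((tendsto_primeCount hα hαβ.le).eventually_const_le
    (show (β - α) / 2 < β - α by linarith))
  filter_upwards [eventually_exists_sieve (lt_min one_pos hd) (min_le_left _ _),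
    eventually_residue_product, hexp.eventually eventually_card_primes, hexp.eventually hcount,
    eventually_ge_atTop (10 ^ 6), eventually_ge_atTop (2 / (δ * (A * (β - α)))),
    eventually_ge_atTop ((A * (β - α) + 3) * (4 / (β - α))),
    (tendsto_log_atTop).eventually_ge_atTop 10, eventually_log_pow_le 100 1]
    with v hS hR hP hC hv hvδ hvA hlv hlv2 x y z L c hx hL hy hc hc1 hz B₀
  rw [← hx] at hC
  rw [← hx, hx, log_exp, ← hx] at hP
  obtain ⟨huz, hzx, -⟩ := hR x z L hx hL hz
  obtain ⟨a, ha⟩ := hS x y z L c hx hL hy hc hc1 hz B₀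
  have hv0 : 0 < v := by linarith
  have hv1 : 1 ≤ v := by linarith
  have hx0 : 0 < x := hx ▸ exp_pos _
  obtain ⟨-, hy1, hy2, hlogy0, hlogy⟩ := sieve_range_bounds hv hx hL (by linarith)
    (by rw [pow_one] at hlv2; linarith) hy hc hc1
  have hxy : x ≤ y := le_trans (le_mul_of_one_le_left hx0.le (one_le_pow₀ hv1)) hy1
  have hy0 : 0 < y := by linarith
  have hxv : v ^ 101 ≤ x := (pow_le_pow_right₀ hv1 (by norm_num)).trans
    (show v ^ 2000 ≤ x by linarith)
  set Q := (Icc 1 ⌊y⌋₊).filter fun q : ℕ => (q.Prime ∧ x < q ∧ q ≠ B₀) ∧ α * y < q ∧ (q : ℝ) ≤ β * y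
    with hQ
  set N := (Icc 1 ⌊x⌋₊).filter fun m : ℕ => m.Prime ∧ m ≠ B₀ ∧
    (v ^ 2000 < m ∧ (m : ℝ) ≤ z ∨ x / 2 < m ∧ (m : ℝ) ≤ x) with hN
  have hQmem : ∀ q, q ∈ Q ↔ (q.Prime ∧ x < q ∧ (q : ℝ) ≤ y ∧ q ≠ B₀) ∧ α * y < q ∧ (q : ℝ) ≤ β * y :=
    fun q => by
      rw [hQ, mem_filter, mem_Icc_floor hy0.le]
      have : q.Prime → 1 ≤ q := fun h => h.one_le
      tauto
  have hNmem : ∀ m, m ∈ N ↔ m.Prime ∧ m ≠ B₀ ∧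
      (v ^ 2000 < m ∧ (m : ℝ) ≤ z ∨ x / 2 < m ∧ (m : ℝ) ≤ x) := fun m => by
    rw [hN, mem_filter, mem_Icc_floor hx0.le, and_iff_right_iff_imp]
    rintro ⟨h1, -, h2⟩
    refine ⟨h1.one_le, ?_⟩
    rcases h2 with h2 | h2 <;> linarith
  set T := A * (β - α) * (x / v ^ 100) with hT
  have hxv0 : 0 < x / v ^ 100 := by positivity
  have hQT : T ≤ Q.card := by
    have h1 : primeCount (α * y) (β * y) ≤ Q.card + ((Icc 1 ⌊x⌋₊).filter Nat.Prime).card + 1 := by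
      rw [primeCount]
      refine (card_le_card fun q hq => ?_).trans ((card_insert_le B₀ _).trans
        (Nat.add_le_add_right (card_union_le Q ((Icc 1 ⌊x⌋₊).filter Nat.Prime)) 1))
      obtain ⟨h1, h2, h3⟩ := mem_filter.1 hq
      rw [mem_Icc_floor (mul_nonneg (hα.trans hαβ.le) hy0.le)] at h1
      rw [mem_insert, mem_union, hQmem, mem_filter, mem_Icc_floor hx0.le]
      have : β * y ≤ y := mul_le_of_le_one_left hy0.le hβ
      have h4 : x < q ∨ (q : ℝ) ≤ x := lt_or_ge _ _
      have h5 : (q : ℝ) ≤ y := by linarith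
      tauto
    have h2 : (β - α) / 4 * (v ^ 92 * (x / v ^ 100)) ≤ primeCount (α * y) (β * y) := by
      have := hC y hxy
      rw [le_div_iff₀ hy0] at this
      have h3 : (β - α) / 2 * y ≤ primeCount (α * y) (β * y) * (2 * v ^ 100) :=
        this.trans (by gcongr)
      have h4 : (β - α) / 2 * (v ^ 92 * x) ≤ (β - α) / 2 * y :=
        mul_le_mul_of_nonneg_left hy1 (by linarith)
      calc (β - α) / 4 * (v ^ 92 * (x / v ^ 100)) = (β - α) / 2 * (v ^ 92 * x) / (2 * v ^ 100) := by
            ring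
        _ ≤ _ := by rw [div_le_iff₀ (by positivity)]; linarith
    have h3 := hP.2 x le_rfl
    have h4 : (A * (β - α) + 3) * (x / v ^ 100) ≤ (β - α) / 4 * (v ^ 92 * (x / v ^ 100)) := by
      rw [← mul_assoc]
      refine mul_le_mul_of_nonneg_right ?_ hxv0.le
      have h5 : v ≤ v ^ 92 := le_self_pow₀ hv1 (by norm_num)
      have h6 : 0 < β - α := by linarith
      have h7 := hvA.trans h5
      rw [mul_div_assoc', div_le_iff₀ h6] at h7
      linarith
    have h5 : 1 ≤ x / v ^ 100 := by
      rw [one_le_div (by positivity)]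
      exact (pow_le_pow_right₀ hv1 (by norm_num)).trans hxv
    have h6 : (primeCount (α * y) (β * y) : ℝ)
        ≤ Q.card + ((Icc 1 ⌊x⌋₊).filter Nat.Prime).card + 1 := by exact_mod_cast h1
    rw [mul_div_assoc] at h3
    rw [hT]
    linarith
  obtain ⟨c', hc1', hc2'⟩ := exists_classes_card_near (Q := Q) (N := N) (x := x) (y := y) (T := T)
    (l := v ^ 2000) (by positivity) hy0.le (fun m hm => by
      obtain ⟨h1, -, h2⟩ := (hNmem m).1 hm
      refine ⟨h1, ?_⟩
      rcases h2 with h2 | h2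
      · exact ⟨h2.1.le, by linarith⟩
      · exact ⟨by linarith, h2.2⟩)
    (fun q hq => ((hQmem q).1 hq).1.imp_right fun h => ⟨h.1, h.2.1⟩) a hQT
    ((ha _ fun q hq => by
      obtain ⟨h1, h2⟩ := mem_filter.1 hq
      exact ⟨((hQmem q).1 h1).1, fun m g1 g2 g3 => h2 m ((hNmem m).2 ⟨g1, g2, g3⟩)⟩).trans
      (mul_le_mul_of_nonneg_right (min_le_right _ _) hxv0.le))
  refine ⟨c', fun F hF => ?_⟩
  have hFQ : F = Q.filter fun q : ℕ => ∀ m ∈ N, (q : ZMod m) ≠ c' m := by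
    ext q
    simp only [hF, mem_filter, hQmem, hNmem, and_imp]
    tauto
  have hk : y / v ^ 2000 + 1 ≤ δ * T := by
    calc y / v ^ 2000 + 1 ≤ v ^ 100 * x / v ^ 2000 + x / v ^ 101 := by
          gcongr
          rwa [one_le_div (by positivity)]
      _ ≤ x / v ^ 101 + x / v ^ 101 := by
          gcongr ?_ + _
          rw [div_le_div_iff₀ (by positivity) (by positivity)]
          calc v ^ 100 * x * v ^ 101 = x * v ^ 201 := by ring
            _ ≤ _ := by gcongr; norm_num
      _ = 2 / v * (x / v ^ 100) := by field_simp; norm_num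
      _ ≤ δ * (A * (β - α)) * (x / v ^ 100) := by
          gcongr
          rwa [div_le_comm₀ hv0 (by positivity)]
      _ = _ := by rw [hT]; ring
  rw [hFQ, abs_of_nonneg (by linarith)]
  linarith

end Sieving

end RandomSieve

open Real

lemma RandomSieve.log_five_bounds : 1.586 ≤ log 5 ∧ log 5 ≤ 4 := by
  have h2 := log_two_gt_d9
  have h1 : log 5 = 2 * log 2 + log (5 / 4) := by
    rw [log_div (by norm_num) (by norm_num), show (4 : ℝ) = 2 ^ 2 by norm_num, log_pow]
    push_cast; ring
  have h3 := one_sub_inv_le_log_of_pos (show (0 : ℝ) < 5 / 4 by norm_num)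
  have h4 := log_le_sub_one_of_pos (show (0 : ℝ) < 5 by norm_num)
  norm_num at h3 h4 ⊢
  exact ⟨by linarith, h4⟩

/-- An explicit version of Theorem 3 of Ford–Maynard–Tao: there exist `A′ ≈ c′A` with
`1 ≤ c′ ≤ 5` and a random choice of residue classes `a = (a_s)_{s ∈ 𝒮}`, `n = (n_p)_{p ∈ 𝒫}`
such that, with probability at least `1 − δ`,
`#(𝒬 ∩ S(a) ∩ S(n) ∩ (αy, βy]) = (1 + O(δ))·A′(β−α)·x/log x`. -/
theorem random_sieve_of_primes (A α β δ : ℝ) (hA : 1 ≤ A)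
    (hα : 0 ≤ α) (hαβ : α < β) (hβ : β ≤ 1) (hδ : 0 < δ) :
    ∃ x₀ : ℝ, ∀ x : ℝ, x₀ ≤ x → ∀ B₀ : ℕ, 0 < B₀ →
      let y : ℝ := 1 / (153600 * Real.log 5) * x * Real.log x *
        Real.log (Real.log (Real.log x)) / Real.log (Real.log x)
      let z : ℝ := x ^ (Real.log (Real.log (Real.log x)) / (4 * Real.log (Real.log x)))
      let S : Set ℕ := {s : ℕ | Nat.Prime s ∧ Real.log x ^ (20 : ℕ) < (s : ℝ) ∧
        (s : ℝ) ≤ z ∧ s ≠ B₀}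
      let P : Set ℕ := {p : ℕ | Nat.Prime p ∧ x / 2 < (p : ℝ) ∧ (p : ℝ) ≤ x ∧ p ≠ B₀}
      let Q : Set ℕ := {q : ℕ | Nat.Prime q ∧ x < (q : ℝ) ∧ (q : ℝ) ≤ y ∧ q ≠ B₀}
      ∃ A' c' : ℝ, 1 ≤ c' ∧ c' ≤ 5 ∧ |A' - c' * A| ≤ δ * A ∧
        ∃ μ : PMF ((∀ s : S, ZMod (s : ℕ)) × (∀ p : P, ZMod (p : ℕ))),
          ENNReal.ofReal (1 - δ) ≤
            μ.toOuterMeasure {ω |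
              |(({q : ℕ | q ∈ Q ∧ (∀ s : S, (q : ZMod (s : ℕ)) ≠ ω.1 s) ∧
                    (∀ p : P, (q : ZMod (p : ℕ)) ≠ ω.2 p) ∧
                    α * y < (q : ℝ) ∧ (q : ℝ) ≤ β * y}.ncard : ℝ)) -
                  A' * (β - α) * x / Real.log x|
                ≤ δ * (A' * (β - α) * x / Real.log x)} := by
  have hroot : Filter.Tendsto (fun x : ℝ => log x ^ (1 / 100 : ℝ)) Filter.atTop Filter.atTop :=
    (tendsto_rpow_atTop (by norm_num)).comp tendsto_log_atTop
  obtain ⟨x₀, hx₀⟩ := Filter.eventually_atTop.1 ((hroot.eventually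
    (RandomSieve.eventually_exists_classes_card_near hA hα hαβ hβ hδ)).and
    (Filter.eventually_gt_atTop 1))
  refine ⟨x₀, fun x hx B₀ _ => ?_⟩
  obtain ⟨hx, hx1⟩ := hx₀ x hx
  intro y z S P Q
  set v := log x ^ (1 / 100 : ℝ) with hv
  have hl0 : 0 < log x := log_pos hx1
  have hv100 : v ^ 100 = log x := by
    rw [hv, ← rpow_natCast, ← rpow_mul hl0.le]; norm_num
  have hv2000 : v ^ 2000 = log x ^ 20 := by rw [← hv100, ← pow_mul]
  have hL : log (log x) = 100 * log v := by
    rw [← hv100, log_pow]; push_cast; rfl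
  obtain ⟨hc1, hc2⟩ := RandomSieve.log_five_bounds
  obtain ⟨a, ha⟩ := hx x y z (log (log x)) (1 / (153600 * log 5))
    (by rw [hv100, exp_log (by linarith)]) hL (by rw [hv100])
    (by gcongr; linarith)
    (by rw [div_le_iff₀ (by linarith)]; norm_num; linarith) rfl B₀
  refine ⟨A, 1, le_rfl, by norm_num, by rw [one_mul, sub_self, abs_zero]; positivity,
    PMF.pure (fun s => a s, fun p => a p), ?_⟩
  have hfin : {q : ℕ | q ∈ Q ∧ (∀ s : S, (q : ZMod (s : ℕ)) ≠ a s) ∧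
      (∀ p : P, (q : ZMod (p : ℕ)) ≠ a p) ∧ α * y < (q : ℝ) ∧ (q : ℝ) ≤ β * y}.Finite := by
    refine (Set.finite_Iic ⌊y⌋₊).subset fun q hq => ?_
    exact Nat.le_floor hq.1.2.2.1
  have hF := ha hfin.toFinset fun q => by
    rw [Set.Finite.mem_toFinset]
    constructor
    · rintro ⟨h1, h2, h3, h4⟩
      refine ⟨h1, fun m hm hmB hm' => ?_, h4⟩
      rw [hv2000] at hm'
      rcases hm' with h | h
      · exact h2 ⟨m, hm, h.1, h.2, hmB⟩
      · exact h3 ⟨m, hm, h.1, h.2, hmB⟩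
    · rintro ⟨h1, h2, h3⟩
      rw [hv2000] at h2
      exact ⟨h1, fun s => h2 s s.2.1 s.2.2.2.2 (Or.inl ⟨s.2.2.1, s.2.2.2.1⟩),
        fun p => h2 p p.2.1 p.2.2.2.2 (Or.inr ⟨p.2.2.1, p.2.2.2.1⟩), h3⟩
  rw [(PMF.toOuterMeasure_apply_eq_one_iff _ _).2]
  · exact ENNReal.ofReal_le_one.2 (by linarith)
  rw [PMF.support_pure, Set.singleton_subset_iff]
  rw [← Set.ncard_eq_toFinset_card _ hfin, hv100, ← mul_div_assoc (A * (β - α))] at hF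
  exact hF
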